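/- Let N ⊆ ℝ³ be a nonempty compact connected polyhedron that is a topological 3-manifold with boundary, and assume H₁(N; ℤ/2) = 0 and H₂(N; ℤ/2) = 0. Then N is homeomorphic to the closed unit ball of ℝ³. -/

import Mathlib

open CategoryTheory Set

noncomputable section

/-- Euclidean 3-space. -/
abbrev R3 := EuclideanSpace ℝ (Fin 3)

/-- The singular chain complex functor with `ℤ/2` coefficients: the free `ℤ/2`-module on
the singular simplicial set, turned into a chain complex via alternating face maps. -/
def singularChainComplexZ2 : TopCat ⥤ ChainComplex (ModuleCat (ZMod 2)) ℕ :=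
  TopCat.toSSet ⋙
    ((SimplicialObject.whiskering Type (ModuleCat (ZMod 2))).obj (ModuleCat.free (ZMod 2))) ⋙
    AlgebraicTopology.alternatingFaceMapComplex _

/-- Singular homology `H_n(X; ℤ/2)` of a topological space `X`. -/
def H (n : ℕ) (X : Type) [TopologicalSpace X] : ModuleCat (ZMod 2) :=
  (singularChainComplexZ2.obj (TopCat.of X)).homology n

/-- The rank of `H_n(X; ℤ/2)` as a `ℤ/2`-vector space. -/
def rkH (n : ℕ) (X : Type) [TopologicalSpace X] : Cardinal :=
  Module.rank (ZMod 2) (H n X)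

/-- A simplex in `ℝ³`: the convex hull of a finite affinely independent set of points. -/
def IsSimplexSet (s : Set R3) : Prop :=
  ∃ t : Finset R3, AffineIndependent ℝ (fun x : (t : Set R3) => (x : R3)) ∧
    s = convexHull ℝ (t : Set R3)

/-- A polyhedron in `ℝ³`: a finite union of simplices. -/
def IsPolyhedron (P : Set R3) : Prop :=
  ∃ F : Finset (Set R3), (∀ s ∈ F, IsSimplexSet s) ∧ P = ⋃ s ∈ F, s

/-- Property `(P_r)`: every neighbourhood of `K` contains a polyhedral neighbourhood `N`
of `K` with `rk H₁(N; ℤ/2) ≤ r`. -/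
def HasPropP (K : Set R3) (r : ℕ) : Prop :=
  ∀ U : Set R3, IsOpen U → K ⊆ U →
    ∃ N : Set R3, N ⊆ U ∧ K ⊆ interior N ∧ IsPolyhedron N ∧ rkH 1 ↥N ≤ (r : Cardinal)

/-- `r(K)`: the least nonnegative integer `r` such that `(P_r)` holds, or `∞` if none does. -/
def rInv (K : Set R3) : ℕ∞ :=
  sInf {n : ℕ∞ | ∃ r : ℕ, n = (r : ℕ∞) ∧ HasPropP K r}

/-- The closed half-space `{x ∈ ℝ³ : x₃ ≥ 0}`. -/
def HalfSpace3 : Set R3 := {x | 0 ≤ x 2}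

/-- `M ⊆ ℝ³` is a topological 3-manifold with boundary if every point of `M` has an open
neighbourhood in `M` homeomorphic to an open subset of the closed half-space. -/
def IsManifold3WithBoundary (M : Set R3) : Prop :=
  ∀ p : M, ∃ V : Set M, IsOpen V ∧ p ∈ V ∧
    ∃ W : Set ↥HalfSpace3, IsOpen W ∧ Nonempty (↥V ≃ₜ ↥W)

open Metric Function
open Finset (add_sum_erase card_bij card_eq_one card_eq_sum_ones card_eq_three card_eq_two
  card_eq_zero card_erase_of_mem card_filter card_fin card_pair card_pos card_sdiff_of_subset
  card_union_of_disjoint card_univ erase_subset filter_eq_empty_iff filter_subset insert_erase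
  mem_erase mem_filter mem_insert_self mem_of_mem_erase mem_sigma mem_singleton_self mul_sum
  notMem_erase single_le_sum sum_add_distrib sum_bij sum_comm sum_congr sum_const sum_eq_single
  sum_eq_zero sum_filter sum_image sum_insert sum_le_sum sum_nonneg sum_pair sum_singleton
  sum_smul sum_sub_distrib union_sdiff_of_subset)
open List (append_of_mem cons_append eq_nil_or_concat isChain_cons_cons mem_append mem_cons
  nil_append nodup_append nodup_cons not_mem_nil)
open Finsupp (linearCombination linearCombination_single lmapDomain lsingle_apply mapDomain_single
  mapDomain_support mem_support_iff single single_eq_of_ne)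
open LinearMap (continuous_of_finiteDimensional ext_ring fst ker mem_ker snd)

/-- Faces with vertices in `Fin n`. -/
abbrev Face (n : ℕ) := Finset (Fin n)

/-- Families of faces. -/
abbrev Fam (n : ℕ) := Finset (Face n)

/-- Mod 2 chains on the power set of `Fin n`. -/
abbrev Chn (n : ℕ) := Face n → ZMod 2

/-- The (augmented) mod 2 simplicial boundary. -/
def bd {n : ℕ} : Chn n →ₗ[ZMod 2] Chn n where
  toFun c t := ∑ v ∈ tᶜ, c (insert v t)
  map_add' c d := by ext t; simp [sum_add_distrib]
  map_smul' a c := by ext t; simp [mul_sum]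

theorem bd_apply {n : ℕ} (c : Chn n) (t : Face n) :
    bd c t = ∑ v ∈ tᶜ, c (insert v t) := rfl

theorem zmod2_add_self (a : ZMod 2) : a + a = 0 := CharTwo.add_self_eq_zero a

theorem zmod2_eq_one_of_ne_zero {a : ZMod 2} (h : a ≠ 0) : a = 1 := by
  revert a; decide

theorem zmod2_add_eq_zero {a b : ZMod 2} : a + b = 0 ↔ a = b := by
  revert a b; decide

theorem chn_add_self {n : ℕ} (a : Chn n) : a + a = 0 := by
  ext t; exact zmod2_add_self _

theorem chn_add_eq_zero {n : ℕ} {a b : Chn n} : a + b = 0 ↔ a = b := by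
  constructor
  · intro h; ext t; exact zmod2_add_eq_zero.1 (congrFun h t)
  · rintro rfl; exact chn_add_self _

theorem bd_bd {n : ℕ} (c : Chn n) : bd (bd c) = 0 := by
  ext t
  simp only [bd_apply, Pi.zero_apply]
  rw [Finset.sum_sigma']
  refine Finset.sum_involution (fun p _ => ⟨p.2, p.1⟩) ?_ ?_ ?_ ?_
  · rintro ⟨a, b⟩ _
    simp only [Finset.insert_comm b a]
    exact zmod2_add_self _
  · rintro ⟨a, b⟩ h _ h'
    simp only [mem_sigma, Finset.mem_compl, Finset.mem_insert] at h
    simp only [Sigma.mk.injEq, heq_eq_eq] at h'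
    exact h.2 (Or.inl h'.1)
  · rintro ⟨a, b⟩ h
    simp only [mem_sigma, Finset.mem_compl, Finset.mem_insert] at h ⊢
    grind
  · rintro ⟨a, b⟩ _
    rfl

/-- The elementary chain of a face. -/
def dl {n : ℕ} (s : Face n) : Chn n := Pi.single s 1

theorem dl_apply {n : ℕ} (s t : Face n) : dl s t = if t = s then 1 else 0 := by
  simp [dl, Pi.single_apply]

theorem bd_dl {n : ℕ} (s : Face n) : bd (dl s) = ∑ v ∈ s, dl (s.erase v) := by
  ext t
  simp only [bd_apply, dl_apply, Finset.sum_apply]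
  rw [← sum_filter, ← sum_filter]
  refine sum_congr ?_ fun _ _ => rfl
  ext v
  simp only [mem_filter, Finset.mem_compl]
  constructor
  · rintro ⟨h, rfl⟩; simp [h]
  · rintro ⟨h, rfl⟩; simp [h]

theorem bd_dl_edge {n : ℕ} {a b : Fin n} (h : a ≠ b) : bd (dl {a, b}) = dl {a} + dl {b} := by
  rw [bd_dl, sum_pair h, add_comm]
  congr 2
  · ext x; simp only [mem_erase, Finset.mem_insert, Finset.mem_singleton]; grind
  · ext x; simp only [mem_erase, Finset.mem_insert, Finset.mem_singleton]; grind

theorem dl_singleton_inj {n : ℕ} {a b : Fin n} (h : dl ({a} : Face n) = dl {b}) :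
    a = b := by
  have := congrFun h {a}
  simp only [dl_apply, if_true] at this
  by_contra hne
  simp [hne] at this

/-- The indicator chain of a finite set of faces. -/
def ind {n : ℕ} (F : Fam n) : Chn n := fun s => if s ∈ F then 1 else 0

/-- Chains supported in a finite set of faces. -/
def ChS {n : ℕ} (F : Fam n) : Submodule (ZMod 2) (Chn n) where
  carrier := {c | ∀ s, s ∉ F → c s = 0}
  add_mem' := by intro a b ha hb s hs; simp [ha s hs, hb s hs]
  zero_mem' := by intro s _; rfl
  smul_mem' := by intro a c hc s hs; simp [hc s hs]

theorem ChS_mono {n : ℕ} {F G : Fam n} (h : F ⊆ G) : ChS F ≤ ChS G :=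
  fun _ hc s hs => hc s fun h' => hs (h h')

theorem mem_of_ChS {n : ℕ} {F : Fam n} {c : Chn n} (hc : c ∈ ChS F)
    {s : Face n} (h : c s ≠ 0) : s ∈ F := by
  by_contra h'; exact h (hc s h')

theorem dl_mem_ChS {n : ℕ} {F : Fam n} {s : Face n} (h : s ∈ F) :
    dl s ∈ ChS F := by
  intro t ht
  rw [dl_apply, if_neg]
  rintro rfl; exact ht h

theorem ind_mem_ChS {n : ℕ} {F G : Fam n} (h : F ⊆ G) : ind F ∈ ChS G := by
  intro t ht
  rw [ind, if_neg]
  exact fun h' => ht (h h')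

theorem eq_ind_of_ChS {n : ℕ} {F : Fam n} {c : Chn n} (hc : c ∈ ChS F) :
    c = ind (F.filter fun s => c s ≠ 0) := by
  ext s
  rw [ind]
  split_ifs with h
  · exact zmod2_eq_one_of_ne_zero (mem_filter.1 h).2
  · by_contra h'
    exact h (mem_filter.2 ⟨mem_of_ChS hc h', h'⟩)

/-- The boundary of an indicator counts cofaces. -/
theorem bd_ind_apply {n : ℕ} (F : Fam n) (t : Face n) (k : ℕ)
    (hF : ∀ s ∈ F, s.card = k + 1) (ht : t.card = k) (g : Chn n) :
    bd (fun s => if s ∈ F then g s else 0) t = ∑ s ∈ F.filter fun s => t ⊆ s, g s := by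
  rw [bd_apply]
  rw [← sum_filter]
  refine sum_bij (fun v _ => insert v t) ?_ ?_ ?_ ?_
  · intro v hv
    simp only [mem_filter, Finset.mem_compl] at hv ⊢
    exact ⟨hv.2, Finset.subset_insert _ _⟩
  · intro v hv w hw h
    simp only [mem_filter, Finset.mem_compl] at hv hw
    have : v ∈ insert w t := h ▸ mem_insert_self v t
    simpa [hv.1] using this
  · intro s hs
    simp only [mem_filter] at hs
    have hc : (s \ t).card = 1 := by
      rw [card_sdiff_of_subset hs.2, hF s hs.1, ht]; simp
    obtain ⟨v, hv⟩ := card_eq_one.1 hc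
    have hvs : v ∈ s \ t := by rw [hv]; simp
    have e : insert v t = s := by
      rw [Finset.insert_eq, ← hv, Finset.sdiff_union_of_subset hs.2]
    refine ⟨v, ?_, e⟩
    simp only [mem_filter, Finset.mem_compl, e]
    exact ⟨(Finset.mem_sdiff.1 hvs).2, hs.1⟩
  · intro v _; rfl

theorem bd_apply_of_ChS {n : ℕ} {F : Fam n} {t : Face n} {k : ℕ}
    (hF : ∀ s ∈ F, s.card = k + 1) (ht : t.card = k) {c : Chn n} (hc : c ∈ ChS F) :
    bd c t = ∑ s ∈ F.filter fun s => t ⊆ s, c s := by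
  rw [← bd_ind_apply F t k hF ht c]
  have : c = fun s => if s ∈ F then c s else 0 := by
    funext s
    split_ifs with h
    · rfl
    · exact hc s h
  exact congrFun (congrArg bd this) t

/-- Number of members of `F` containing `t`. -/
def deg {n : ℕ} (F : Fam n) (t : Face n) : ℕ :=
  (F.filter fun s => t ⊆ s).card

theorem bd_ind {n : ℕ} {F : Fam n} {t : Face n} {k : ℕ}
    (hF : ∀ s ∈ F, s.card = k + 1) (ht : t.card = k) : bd (ind F) t = (deg F t : ZMod 2) := by
  have := bd_ind_apply F t k hF ht (fun _ => 1)
  simp only [sum_const, nsmul_eq_mul, mul_one] at this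
  exact this

/-- Boundary of a chain lives on codimension-one faces. -/
theorem bd_mem_ChS {n : ℕ} {F G : Fam n} {c : Chn n} (hc : c ∈ ChS F)
    (h : ∀ s ∈ F, ∀ v ∈ s, s.erase v ∈ G) : bd c ∈ ChS G := by
  intro t ht
  rw [bd_apply]
  refine sum_eq_zero fun v hv => hc _ fun hs => ht ?_
  have := h _ hs v (mem_insert_self _ _)
  rwa [Finset.erase_insert (by simpa using hv)] at this

theorem finrank_ChS {n : ℕ} (F : Fam n) :
    Module.finrank (ZMod 2) (ChS F) = F.card := by
  let e : ChS F ≃ₗ[ZMod 2] (F → ZMod 2) :=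
    { toFun := fun c s => c.1 s.1
      map_add' := fun _ _ => rfl
      map_smul' := fun _ _ => rfl
      invFun := fun f => ⟨fun s => if h : s ∈ F then f ⟨s, h⟩ else 0, fun s hs => by simp [hs]⟩
      left_inv := by
        rintro ⟨c, hc⟩
        ext s
        by_cases h : s ∈ F
        · simp [h]
        · simp [h, hc s h]
      right_inv := by intro f; ext ⟨s, hs⟩; simp [hs] }
  rw [e.finrank_eq]; simp

/-- Faces of cardinality `k`. -/
def fc {n : ℕ} (K : Fam n) (k : ℕ) : Fam n :=
  K.filter fun s => s.card = k

theorem mem_fc {n : ℕ} {K : Fam n} {k : ℕ} {s : Face n} :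
    s ∈ fc K k ↔ s ∈ K ∧ s.card = k := mem_filter

/-- Down-closed families containing the empty face. -/
structure IsCx {n : ℕ} (K : Fam n) : Prop where
  empty_mem : ∅ ∈ K
  down : ∀ s ∈ K, ∀ t ⊆ s, t ∈ K

/-- Vanishing of reduced homology in degree `k - 1`. -/
def Acyc {n : ℕ} (K : Fam n) (k : ℕ) : Prop :=
  ∀ c ∈ ChS (fc K k), bd c = 0 → ∃ d ∈ ChS (fc K (k + 1)), bd d = c

theorem IsCx.bd_mem {n : ℕ} {K : Fam n} (hK : IsCx K) {k : ℕ} {c : Chn n}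
    (hc : c ∈ ChS (fc K (k + 1))) : bd c ∈ ChS (fc K k) := by
  refine bd_mem_ChS hc fun s hs v hv => ?_
  rw [mem_fc] at hs ⊢
  exact ⟨hK.down s hs.1 _ (erase_subset _ _), by rw [card_erase_of_mem hv, hs.2]; rfl⟩

/-- The space of simplicial `k`-cycles (`k` counts vertices). -/
def Zy {n : ℕ} (K : Fam n) (k : ℕ) : Submodule (ZMod 2) (Chn n) :=
  ChS (fc K k) ⊓ ker bd

def By {n : ℕ} (K : Fam n) (k : ℕ) : Submodule (ZMod 2) (Chn n) :=
  (ChS (fc K (k + 1))).map bd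

theorem finrank_Zy_add {n : ℕ} (K : Fam n) (k : ℕ) :
    Module.finrank (ZMod 2) (By K k) + Module.finrank (ZMod 2) (Zy K (k + 1))
      = (fc K (k + 1)).card := by
  rw [← finrank_ChS, ← LinearMap.finrank_range_add_finrank_ker (bd.domRestrict (ChS (fc K (k + 1)))),
    LinearMap.range_domRestrict]
  congr 1
  rw [LinearMap.ker_domRestrict]
  have e : Submodule.comap (ChS (fc K (k + 1))).subtype (ker bd)
      = Submodule.comap (ChS (fc K (k + 1))).subtype (Zy K (k + 1)) := by
    rw [Zy, Submodule.comap_inf]; simp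
  rw [e]
  exact (Submodule.comap_equiv_self_of_inj_of_le (f := (ChS (fc K (k + 1))).subtype)
    (p := Zy K (k + 1)) (Submodule.injective_subtype _)
    (by rw [Submodule.range_subtype]; exact inf_le_left)).symm.finrank_eq

theorem By_le_Zy {n : ℕ} {K : Fam n} (hK : IsCx K) (k : ℕ) :
    By K k ≤ Zy K k := by
  rintro _ ⟨c, hc, rfl⟩
  exact ⟨hK.bd_mem hc, bd_bd c⟩

theorem acyc_iff {n : ℕ} {K : Fam n} {k : ℕ} :
    Acyc K k ↔ Zy K k ≤ By K k :=
  ⟨fun h c hc => h c hc.1 hc.2, fun h _ h1 h2 => h ⟨h1, h2⟩⟩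

/-- With vanishing homology the number of faces is the sum of two cycle ranks. -/
theorem card_fc_succ {n : ℕ} {K : Fam n} (hK : IsCx K) {k : ℕ}
    (h : Acyc K k) :
    (fc K (k + 1)).card
      = Module.finrank (ZMod 2) (Zy K k) + Module.finrank (ZMod 2) (Zy K (k + 1)) := by
  rw [← finrank_Zy_add, le_antisymm (By_le_Zy hK k) (acyc_iff.1 h)]

theorem card_fc_of_acyc {n : ℕ} {K : Fam n} (hK : IsCx K) {k : ℕ}
    (h : Acyc K k) (m : ℕ) (hm : m = k + 1) :
    (fc K m).card
      = Module.finrank (ZMod 2) (Zy K k) + Module.finrank (ZMod 2) (Zy K m) := by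
  subst hm; exact card_fc_succ hK h

theorem fc_zero {n : ℕ} {K : Fam n} (hK : IsCx K) : fc K 0 = {∅} := by
  ext s
  rw [mem_fc, Finset.mem_singleton, card_eq_zero]
  constructor
  · exact fun h => h.2
  · rintro rfl; exact ⟨hK.empty_mem, rfl⟩

theorem finrank_Zy_zero {n : ℕ} {K : Fam n} (hK : IsCx K) :
    Module.finrank (ZMod 2) (Zy K 0) = 1 := by
  have : Zy K 0 = ChS (fc K 0) := by
    refine inf_eq_left.2 fun c hc => ?_
    rw [mem_ker]
    ext t
    rw [bd_apply]
    refine sum_eq_zero fun v _ => hc _ ?_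
    rw [fc_zero hK]; simp
  rw [this, finrank_ChS, fc_zero hK]; rfl

/-- The link of a face. -/
def lk {n : ℕ} (K : Fam n) (s : Face n) : Fam n :=
  K.filter fun t => Disjoint s t ∧ s ∪ t ∈ K

theorem mem_lk {n : ℕ} {K : Fam n} {s t : Face n} :
    t ∈ lk K s ↔ t ∈ K ∧ Disjoint s t ∧ s ∪ t ∈ K := mem_filter

theorem IsCx.mem_lk_iff {n : ℕ} {K : Fam n} (hK : IsCx K)
    {s t : Face n} : t ∈ lk K s ↔ Disjoint s t ∧ s ∪ t ∈ K := by
  rw [mem_lk]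
  exact ⟨fun h => h.2, fun h => ⟨hK.down _ h.2 _ Finset.subset_union_right, h⟩⟩

theorem IsCx.lk {n : ℕ} {K : Fam n} (hK : IsCx K) {s : Face n}
    (hs : s ∈ K) : IsCx (lk K s) where
  empty_mem := by rw [hK.mem_lk_iff]; simpa using hs
  down t ht u hu := by
    rw [hK.mem_lk_iff] at ht ⊢
    exact ⟨ht.1.mono_right hu, hK.down _ ht.2 _ (Finset.union_subset_union_right hu)⟩

theorem lk_empty {n : ℕ} (K : Fam n) : lk K ∅ = K := by
  ext t; simp [mem_lk]

theorem IsCx.sdiff_mem_lk {n : ℕ} {K : Fam n} (hK : IsCx K)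
    {s T : Face n} (hT : T ∈ K) (h : s ⊆ T) : T \ s ∈ _root_.lk K s := by
  rw [hK.mem_lk_iff]
  exact ⟨Finset.disjoint_sdiff, by rwa [union_sdiff_of_subset h]⟩

theorem IsCx.card_fc_lk {n : ℕ} {K : Fam n} (hK : IsCx K)
    (s : Face n) (k : ℕ) :
    (fc (_root_.lk K s) k).card = deg (fc K (k + s.card)) s := by
  refine card_bij (fun t _ => s ∪ t) ?_ ?_ ?_
  · intro t ht
    rw [mem_fc, hK.mem_lk_iff] at ht
    rw [mem_filter, mem_fc]
    exact ⟨⟨ht.1.2, by rw [card_union_of_disjoint ht.1.1, ht.2, add_comm]⟩,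
      Finset.subset_union_left⟩
  · intro t ht u hu h
    rw [mem_fc, hK.mem_lk_iff] at ht hu
    rw [← Finset.union_sdiff_cancel_left ht.1.1, h, Finset.union_sdiff_cancel_left hu.1.1]
  · intro T hT
    rw [mem_filter, mem_fc] at hT
    refine ⟨T \ s, ?_, union_sdiff_of_subset hT.2⟩
    rw [mem_fc]
    refine ⟨hK.sdiff_mem_lk hT.1.1 hT.2, ?_⟩
    rw [card_sdiff_of_subset hT.2, hT.1.2]; omega

/-- Connectedness in dual form. -/
theorem conn_of_acyc {n : ℕ} {L : Fam n} (h : Acyc L 1) (g : Fin n → ZMod 2)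
    (hg : ∀ a b, a ≠ b → {a, b} ∈ L → g a = g b) (a b : Fin n) (ha : {a} ∈ L) (hb : {b} ∈ L) :
    g a = g b := by
  obtain ⟨d, hd, hdc⟩ := h (dl {a} + dl {b})
    (add_mem (dl_mem_ChS (mem_fc.2 ⟨ha, rfl⟩)) (dl_mem_ChS (mem_fc.2 ⟨hb, rfl⟩)))
    (by rw [map_add, bd_dl, bd_dl]; simp [chn_add_self])
  have h1 : ∑ v, g v * bd d {v} = g a + g b := by
    rw [hdc]
    simp [dl_apply, mul_add, sum_add_distrib]
  have h2 : ∑ v, g v * bd d {v} = 0 := by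
    simp only [bd_apply, mul_sum]
    rw [Finset.sum_sigma']
    refine Finset.sum_involution (fun p _ => ⟨p.2, p.1⟩) ?_ ?_ ?_ ?_
    · rintro ⟨x, y⟩ hxy
      simp only [mem_sigma, Finset.mem_compl, Finset.mem_singleton] at hxy
      by_cases h0 : d {y, x} = 0
      · simp only [h0, Finset.pair_comm x y]; simp
      · rw [hg x y (fun h => hxy.2 h.symm) (by
          rw [Finset.pair_comm]; exact (mem_fc.1 (mem_of_ChS hd h0)).1)]
        simp only [Finset.pair_comm x y]
        exact zmod2_add_self _
    · rintro ⟨x, y⟩ hxy _ h'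
      simp only [mem_sigma, Finset.mem_compl, Finset.mem_singleton] at hxy
      simp only [Sigma.mk.injEq, heq_eq_eq] at h'
      exact hxy.2 h'.1
    · rintro ⟨x, y⟩ hxy
      simp only [mem_sigma, Finset.mem_compl, Finset.mem_singleton] at hxy ⊢
      exact ⟨Finset.mem_univ _, fun h => hxy.2 h.symm⟩
    · rintro ⟨x, y⟩ _; rfl
  exact zmod2_add_eq_zero.1 (h1.symm.trans h2)

theorem acyc_one_of_conn {n : ℕ} {L : Fam n}
    (h : ∀ g : Fin n → ZMod 2, (∀ a b, a ≠ b → {a, b} ∈ L → g a = g b) →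
      ∀ a b : Fin n, {a} ∈ L → {b} ∈ L → g a = g b) : Acyc L 1 := by
  classical
  intro c hc hc0
  have key : ∀ a b : Fin n, {a} ∈ L → {b} ∈ L → dl {a} + dl {b} ∈ By L 1 := by
    intro a b ha hb
    have := h (fun x => if dl {a} + dl {x} ∈ By L 1 then 1 else 0) ?_ a b ha hb
    · rw [chn_add_self, if_pos (zero_mem _)] at this
      by_contra h'
      rw [if_neg h'] at this
      exact one_ne_zero this
    · intro x y hxy hL'
      have hm : dl {x} + dl {y} ∈ By L 1 :=
        ⟨dl {x, y}, dl_mem_ChS (mem_fc.2 ⟨hL', card_pair hxy⟩), bd_dl_edge hxy⟩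
      have e : dl {a} + dl {y} = (dl {a} + dl {x}) + (dl {x} + dl {y}) := by
        rw [add_assoc, ← add_assoc (dl {x}), chn_add_self, zero_add]
      have : dl {a} + dl {x} ∈ By L 1 ↔ dl {a} + dl {y} ∈ By L 1 := by
        rw [e]; exact (Submodule.add_mem_iff_left _ hm).symm
      simp only [this]
  by_cases hv : ∃ a : Fin n, {a} ∈ L
  · obtain ⟨a, ha⟩ := hv
    have h1 : c = ∑ x, c {x} • (dl {x} + dl {a}) := by
      have hs : ∑ x, c {x} = 0 := by
        have := congrFun hc0 ∅
        rw [bd_apply] at this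
        simpa using this
      simp only [smul_add, sum_add_distrib]
      rw [← sum_smul, hs, zero_smul, add_zero]
      ext s
      rw [Finset.sum_apply]
      simp only [Pi.smul_apply, dl_apply, smul_eq_mul, mul_ite, mul_one, mul_zero]
      by_cases hs1 : s.card = 1
      · obtain ⟨x, rfl⟩ := card_eq_one.1 hs1
        simp
      · rw [hc s (fun h => hs1 (mem_fc.1 h).2)]
        refine (sum_eq_zero fun x _ => if_neg ?_).symm
        rintro rfl; exact hs1 rfl
    have : c ∈ By L 1 := by
      rw [h1]
      refine Submodule.sum_mem _ fun x _ => ?_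
      by_cases h0 : c {x} = 0
      · rw [h0, zero_smul]; exact zero_mem _
      · exact Submodule.smul_mem _ _ (key x a (mem_fc.1 (mem_of_ChS hc h0)).1 ha)
    exact this
  · refine ⟨0, zero_mem _, ?_⟩
    rw [map_zero]
    ext s
    symm
    refine hc s fun hs => hv ?_
    obtain ⟨x, rfl⟩ := card_eq_one.1 (mem_fc.1 hs).2
    exact ⟨x, (mem_fc.1 hs).1⟩

theorem exists_vertex_of_acyc {n : ℕ} {L : Fam n} (hL : IsCx L)
    (h : Acyc L 0) : ∃ v, {v} ∈ L := by
  obtain ⟨d, hd, e⟩ := h (dl ∅) (dl_mem_ChS (mem_fc.2 ⟨hL.empty_mem, rfl⟩)) (by rw [bd_dl]; simp)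
  by_contra hne
  push Not at hne
  have : d = 0 := by
    ext s
    refine hd s fun hs => ?_
    obtain ⟨x, rfl⟩ := card_eq_one.1 (mem_fc.1 hs).2
    exact hne x (mem_fc.1 hs).1
  have h1 := congrFun e ∅
  rw [this, map_zero, dl_apply] at h1
  simp at h1

theorem acyc_zero_of_vertex {n : ℕ} {L : Fam n} (hL : IsCx L) {v : Fin n}
    (hv : {v} ∈ L) : Acyc L 0 := by
  intro c hc _
  refine ⟨c ∅ • dl {v}, Submodule.smul_mem _ _ (dl_mem_ChS (mem_fc.2 ⟨hv, rfl⟩)), ?_⟩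
  rw [map_smul, bd_dl]
  ext s
  simp only [sum_singleton, Finset.erase_singleton, Pi.smul_apply, dl_apply, smul_eq_mul]
  split_ifs with h
  · rw [h, mul_one]
  · rw [mul_zero]; exact (hc s (by rw [fc_zero hL]; simpa using h)).symm

/-- Counting flags of codimension one. -/
theorem sum_deg_ridges {n : ℕ} {K : Fam n} (hK : IsCx K) (k : ℕ)
    (s : Face n) {F : Fam n} (hF : F ⊆ fc K (k + 1)) :
    ∑ r ∈ (fc K k).filter (fun r => s ⊆ r), deg F r = (k + 1 - s.card) * deg F s := by
  simp only [deg, card_filter]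
  rw [sum_comm, mul_sum]
  refine sum_congr rfl fun T hT => ?_
  rw [← card_filter, Finset.filter_filter]
  have hT' := mem_fc.1 (hF hT)
  split_ifs with h
  · rw [mul_one, ← hT'.2, ← card_sdiff_of_subset h]
    symm
    refine card_bij (fun x _ => T.erase x) ?_ ?_ ?_
    · intro x hx
      rw [Finset.mem_sdiff] at hx
      rw [mem_filter, mem_fc]
      refine ⟨⟨hK.down _ hT'.1 _ (erase_subset _ _), ?_⟩, ?_, erase_subset _ _⟩
      · rw [card_erase_of_mem hx.1, hT'.2]; rfl
      · exact Finset.subset_erase.2 ⟨h, hx.2⟩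
    · intro x hx y hy e
      rw [Finset.mem_sdiff] at hx hy
      by_contra hne
      have : x ∈ T.erase y := mem_erase.2 ⟨hne, hx.1⟩
      rw [← e] at this
      exact notMem_erase _ _ this
    · intro r hr
      rw [mem_filter, mem_fc] at hr
      obtain ⟨x, hx⟩ := card_eq_one.1 (show (T \ r).card = 1 by
        rw [card_sdiff_of_subset hr.2.2, hT'.2, hr.1.2]; simp)
      have hx' : x ∈ T \ r := by rw [hx]; simp
      rw [Finset.mem_sdiff] at hx'
      refine ⟨x, Finset.mem_sdiff.2 ⟨hx'.1, fun h' => hx'.2 (hr.2.1 h')⟩, ?_⟩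
      rw [Finset.erase_eq, ← hx, Finset.sdiff_sdiff_eq_self hr.2.2]
  · rw [mul_zero, card_eq_zero, filter_eq_empty_iff]
    exact fun r _ h' => h (h'.1.trans h'.2)

theorem sum_deg_vertices {n : ℕ} {K : Fam n} (hK : IsCx K) (k : ℕ) :
    ∑ r ∈ fc K 1, deg (fc K k) r = k * (fc K k).card := by
  simp only [deg, card_filter]
  rw [sum_comm, card_eq_sum_ones (fc K k), mul_sum]
  refine sum_congr rfl fun T hT => ?_
  rw [← card_filter, mul_one]
  have hT' := mem_fc.1 hT
  rw [← hT'.2]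
  symm
  refine card_bij (fun x _ => {x}) ?_ ?_ ?_
  · intro x hx
    rw [mem_filter, mem_fc]
    have : {x} ⊆ T := by simpa using hx
    exact ⟨⟨hK.down _ hT'.1 _ this, rfl⟩, this⟩
  · intro x _ y _ e
    simpa using e
  · intro r hr
    rw [mem_filter, mem_fc] at hr
    obtain ⟨x, rfl⟩ := card_eq_one.1 hr.1.2
    exact ⟨x, by simpa using hr.2, rfl⟩

theorem deg_self_empty {n : ℕ} (F : Fam n) : deg F ∅ = F.card := by
  simp [deg]

section

/-- Combinatorial properties of a triangulated homology 3-ball-like manifold. -/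
structure Good {n : ℕ} (K : Fam n) : Prop where
  cx : IsCx K
  dim : ∀ s ∈ K, s.card ≤ 4
  link : ∀ s ∈ K, ∀ j, s.card + j ≤ 3 → Acyc (lk K s) j
  tri : ∀ t ∈ fc K 3, deg (fc K 4) t ≤ 2
  bdry : ∃ t ∈ fc K 3, deg (fc K 4) t = 1

/-- Boundary triangles. -/
def bT {n : ℕ} (K : Fam n) : Fam n :=
  (fc K 3).filter fun t => deg (fc K 4) t = 1

/-- The boundary complex. -/
def dK {n : ℕ} (K : Fam n) : Fam n :=
  (bT K).biUnion Finset.powerset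

theorem mem_bT {n : ℕ} {K : Fam n} {t : Face n} :
    t ∈ bT K ↔ (t ∈ K ∧ t.card = 3) ∧ deg (fc K 4) t = 1 := by
  rw [bT, mem_filter, mem_fc]

theorem mem_dK {n : ℕ} {K : Fam n} {s : Face n} :
    s ∈ dK K ↔ ∃ t ∈ bT K, s ⊆ t := by
  simp [dK]

variable {n : ℕ} {K : Fam n}

theorem mem_fc4 {T : Face n} : T ∈ fc K 4 ↔ T ∈ K ∧ T.card = 4 := mem_fc

theorem Good.acyc (h : Good K) {j : ℕ} (hj : j ≤ 3) : Acyc K j := by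
  have := h.link ∅ h.cx.empty_mem j (by simpa using hj)
  rwa [lk_empty] at this

theorem exists_tet_of_links (hK : IsCx K) (hd : ∀ s ∈ K, s.card ≤ 4)
    (hl : ∀ s ∈ K, ∀ j, s.card + j ≤ 3 → Acyc (lk K s) j) {s : Face n} (hs : s ∈ K) :
    ∃ T ∈ fc K 4, s ⊆ T := by
  obtain ⟨d, hd'⟩ : ∃ d, d = 4 - s.card := ⟨_, rfl⟩
  induction d generalizing s with
  | zero => exact ⟨s, mem_fc.2 ⟨hs, by have := hd s hs; omega⟩, subset_rfl⟩
  | succ d ih =>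
    obtain ⟨v, hv⟩ := exists_vertex_of_acyc (hK.lk hs) (hl s hs 0 (by omega))
    rw [hK.mem_lk_iff] at hv
    obtain ⟨T, hT, hsT⟩ := ih hv.2 (by
      rw [card_union_of_disjoint hv.1]; simp; omega)
    exact ⟨T, hT, Finset.subset_union_left.trans hsT⟩

theorem Good.pure (h : Good K) {s : Face n} (hs : s ∈ K) : ∃ T ∈ fc K 4, s ⊆ T :=
  exists_tet_of_links h.cx h.dim h.link hs

/-- Strong connectivity of the star of each face. -/
theorem Good.sc (h : Good K) {s : Face n} (hs : s ∈ K) (hs3 : s.card ≤ 3) (g : Chn n)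
    (hg : ∀ r ∈ fc K 3, s ⊆ r → ∀ T ∈ fc K 4, ∀ T' ∈ fc K 4, r ⊆ T → r ⊆ T' → g T = g T') :
    ∀ T ∈ fc K 4, ∀ T' ∈ fc K 4, s ⊆ T → s ⊆ T' → g T = g T' := by
  obtain ⟨d, hd⟩ : ∃ d, d = 3 - s.card := ⟨_, rfl⟩
  induction d generalizing s with
  | zero => exact hg s (mem_fc.2 ⟨hs, by omega⟩) subset_rfl
  | succ d ih =>
    have hP : ∀ v, {v} ∈ lk K s → ∃ T ∈ fc K 4, s ∪ {v} ⊆ T := fun v hv =>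
      h.pure (h.cx.mem_lk_iff.1 hv).2
    choose! F hF hFs using hP
    have hF' : ∀ v, {v} ∈ lk K s → ∀ T ∈ fc K 4, s ∪ {v} ⊆ T → g T = g (F v) := by
      intro v hv T hT hsT
      have hv' := h.cx.mem_lk_iff.1 hv
      have hc : (s ∪ {v}).card = s.card + 1 := by
        rw [card_union_of_disjoint hv'.1]; rfl
      exact ih hv'.2 (by omega)
        (fun r hr hsr => hg r hr (Finset.subset_union_left.trans hsr)) (by omega) T hT _
        (hF v hv) hsT (hFs v hv)
    have hcon := conn_of_acyc (h.link s hs 1 (by omega)) (fun v => g (F v)) (by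
      intro a b hab hL
      have hL' := h.cx.mem_lk_iff.1 hL
      have ha : {a} ∈ lk K s := (h.cx.lk hs).down _ hL _ (by simp)
      have hb : {b} ∈ lk K s := (h.cx.lk hs).down _ hL _ (by simp)
      obtain ⟨T, hT, hsT⟩ := h.pure hL'.2
      change g (F a) = g (F b)
      rw [← hF' a ha T hT (subset_trans (Finset.union_subset_union_right (by simp)) hsT),
        ← hF' b hb T hT (subset_trans (Finset.union_subset_union_right (by simp)) hsT)])
    have hv : ∀ T ∈ fc K 4, s ⊆ T → ∃ v, {v} ∈ lk K s ∧ s ∪ {v} ⊆ T := by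
      intro T hT hsT
      have hT' := mem_fc.1 hT
      obtain ⟨v, hv⟩ : (T \ s).Nonempty := by
        rw [← card_pos, card_sdiff_of_subset hsT]; omega
      rw [Finset.mem_sdiff] at hv
      have hsub : s ∪ {v} ⊆ T := Finset.union_subset hsT (by simpa using hv.1)
      exact ⟨v, h.cx.mem_lk_iff.2 ⟨by simpa using hv.2, h.cx.down _ hT'.1 _ hsub⟩, hsub⟩
    intro T hT T' hT' h1 h2
    obtain ⟨v, hv1, hv2⟩ := hv T hT h1
    obtain ⟨w, hw1, hw2⟩ := hv T' hT' h2
    rw [hF' v hv1 T hT hv2, hF' w hw1 T' hT' hw2]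
    exact hcon v w hv1 hw1

theorem Good.deg_tri (h : Good K) {t : Face n} (ht : t ∈ fc K 3) :
    deg (fc K 4) t = if t ∈ bT K then 1 else 2 := by
  have h1 := h.tri t ht
  have h2 : 0 < deg (fc K 4) t := by
    obtain ⟨T, hT, hs⟩ := h.pure (mem_fc.1 ht).1
    exact card_pos.2 ⟨T, mem_filter.2 ⟨hT, hs⟩⟩
  by_cases hb : t ∈ bT K
  · rw [if_pos hb]; exact (mem_bT.1 hb).2
  · rw [if_neg hb]
    have : deg (fc K 4) t ≠ 1 := fun e => hb (mem_filter.2 ⟨ht, e⟩)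
    omega

theorem sum_eq_of_deg_two {F : Fam n} {t : Face n}
    (h : deg F t = 2) (g : Chn n) {T T' : Face n} (hT : T ∈ F) (hT' : T' ∈ F)
    (ht : t ⊆ T) (ht' : t ⊆ T') (hs : ∑ s ∈ F.filter (fun s => t ⊆ s), g s = 0) :
    g T = g T' := by
  obtain ⟨a, b, hab, e⟩ := card_eq_two.1 h
  rw [e, sum_pair hab, zmod2_add_eq_zero] at hs
  have h1 : T ∈ ({a, b} : Finset _) := e ▸ mem_filter.2 ⟨hT, ht⟩
  have h2 : T' ∈ ({a, b} : Finset _) := e ▸ mem_filter.2 ⟨hT', ht'⟩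
  simp only [Finset.mem_insert, Finset.mem_singleton] at h1 h2
  rcases h1 with rfl | rfl <;> rcases h2 with rfl | rfl <;> simp [hs]

theorem eq_of_deg_one {F : Fam n} {t : Face n}
    (h : deg F t = 1) {T T' : Face n} (hT : T ∈ F) (hT' : T' ∈ F)
    (ht : t ⊆ T) (ht' : t ⊆ T') : T = T' := by
  obtain ⟨a, e⟩ := card_eq_one.1 h
  have h1 : T ∈ ({a} : Finset _) := e ▸ mem_filter.2 ⟨hT, ht⟩
  have h2 : T' ∈ ({a} : Finset _) := e ▸ mem_filter.2 ⟨hT', ht'⟩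
  simp only [Finset.mem_singleton] at h1 h2
  rw [h1, h2]

/-- A chain of top faces of a link, with boundary vanishing off the boundary, is constant. -/
theorem Good.link_const (h : Good K) {s : Face n} (hs : s ∈ K) {k : ℕ}
    (hk : s.card + (k + 1) = 4) {c : Chn n} (hc : c ∈ ChS (fc (lk K s) (k + 1)))
    (h0 : ∀ r ∈ fc K 3, s ⊆ r → r ∉ bT K → bd c (r \ s) = 0) :
    c = 0 ∨ c = ind (fc (lk K s) (k + 1)) := by
  have key := h.sc hs (by omega) (fun T => c (T \ s)) (by
    intro r hr hsr T hT T' hT' h1 h2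
    have hr' := mem_fc.1 hr
    by_cases hb : r ∈ bT K
    · have := eq_of_deg_one (mem_bT.1 hb).2 hT hT' h1 h2
      rw [this]
    · have hd := h.deg_tri hr
      rw [if_neg hb] at hd
      refine sum_eq_of_deg_two hd (fun T => c (T \ s)) hT hT' h1 h2 ?_
      rw [← h0 r hr hsr hb, bd_apply_of_ChS (k := k) (F := fc (lk K s) (k + 1))
        (fun _ hx => (mem_fc.1 hx).2) (by rw [card_sdiff_of_subset hsr]; omega) hc]
      refine sum_bij (fun T _ => T \ s) ?_ ?_ ?_ (fun _ _ => rfl)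
      · intro U hU
        rw [mem_filter, mem_fc] at hU
        rw [mem_filter, mem_fc]
        have := hsr.trans hU.2
        refine ⟨⟨h.cx.sdiff_mem_lk hU.1.1 this, ?_⟩, Finset.sdiff_subset_sdiff hU.2 subset_rfl⟩
        rw [card_sdiff_of_subset this]; omega
      · intro U hU U' hU' e
        rw [mem_filter] at hU hU'
        rw [← union_sdiff_of_subset (hsr.trans hU.2), e,
          union_sdiff_of_subset (hsr.trans hU'.2)]
      · intro U hU
        rw [mem_filter, mem_fc, h.cx.mem_lk_iff] at hU
        refine ⟨s ∪ U, ?_, Finset.union_sdiff_cancel_left hU.1.1.1⟩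
        rw [mem_filter, mem_fc]
        refine ⟨⟨hU.1.1.2, by rw [card_union_of_disjoint hU.1.1.1]; omega⟩, ?_⟩
        rw [← union_sdiff_of_subset hsr]
        exact Finset.union_subset_union_right hU.2)
  have key' : ∀ U ∈ fc (lk K s) (k + 1), ∀ U' ∈ fc (lk K s) (k + 1), c U = c U' := by
    intro U hU U' hU'
    rw [mem_fc, h.cx.mem_lk_iff] at hU hU'
    have := key (s ∪ U) (mem_fc.2 ⟨hU.1.2, by rw [card_union_of_disjoint hU.1.1]; omega⟩)
      (s ∪ U') (mem_fc.2 ⟨hU'.1.2, by rw [card_union_of_disjoint hU'.1.1]; omega⟩)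
      Finset.subset_union_left Finset.subset_union_left
    simpa only [Finset.union_sdiff_cancel_left hU.1.1,
      Finset.union_sdiff_cancel_left hU'.1.1] using this
  by_cases h1 : ∃ U ∈ fc (lk K s) (k + 1), c U ≠ 0
  · right
    obtain ⟨U, hU, hU0⟩ := h1
    funext V
    rw [ind]
    split_ifs with hV
    · rw [key' V hV U hU]; exact zmod2_eq_one_of_ne_zero hU0
    · exact hc V hV
  · left
    push Not at h1
    funext V
    by_cases hV : V ∈ fc (lk K s) (k + 1)
    · exact h1 V hV
    · exact hc V hV

theorem Good.link_ridge (h : Good K) {s r : Face n} {k : ℕ}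
    (hk : s.card + (k + 1) = 4) (hr : r ∈ fc (lk K s) k) :
    s ∪ r ∈ fc K 3 ∧ deg (fc (lk K s) (k + 1)) r = deg (fc K 4) (s ∪ r) := by
  rw [mem_fc, h.cx.mem_lk_iff] at hr
  refine ⟨mem_fc.2 ⟨hr.1.2, by rw [card_union_of_disjoint hr.1.1]; omega⟩, ?_⟩
  refine card_bij (fun t _ => s ∪ t) ?_ ?_ ?_
  · intro t ht
    rw [mem_filter, mem_fc, h.cx.mem_lk_iff] at ht
    rw [mem_filter, mem_fc]
    exact ⟨⟨ht.1.1.2, by rw [card_union_of_disjoint ht.1.1.1]; omega⟩,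
      Finset.union_subset_union_right ht.2⟩
  · intro t ht u hu e
    rw [mem_filter, mem_fc, h.cx.mem_lk_iff] at ht hu
    rw [← Finset.union_sdiff_cancel_left ht.1.1.1, e, Finset.union_sdiff_cancel_left hu.1.1.1]
  · intro T hT
    rw [mem_filter, mem_fc] at hT
    have hsT := Finset.subset_union_left.trans hT.2
    refine ⟨T \ s, ?_, union_sdiff_of_subset hsT⟩
    rw [mem_filter, mem_fc]
    refine ⟨⟨h.cx.sdiff_mem_lk hT.1.1 hsT, ?_⟩, ?_⟩
    · rw [card_sdiff_of_subset hsT]; omega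
    · rw [Finset.subset_sdiff]
      exact ⟨Finset.subset_union_right.trans hT.2, hr.1.1.symm⟩

theorem Good.bd_top_link (h : Good K) {s r : Face n} {k : ℕ}
    (hk : s.card + (k + 1) = 4) (hr : r ∈ fc (lk K s) k) :
    bd (ind (fc (lk K s) (k + 1))) r = if s ∪ r ∈ bT K then 1 else 0 := by
  rw [bd_ind (fun _ hx => (mem_fc.1 hx).2) (mem_fc.1 hr).2, (h.link_ridge hk hr).2,
    h.deg_tri (h.link_ridge hk hr).1]
  split_ifs
  · simp
  · rfl

/-- Top cycles of a link. -/
theorem Good.finrank_top (h : Good K) {s : Face n} (hs : s ∈ K) {k : ℕ}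
    (hk : s.card + (k + 1) = 4) :
    Module.finrank (ZMod 2) (Zy (lk K s) (k + 1)) = if s ∈ dK K then 0 else 1 := by
  split_ifs with hd
  · rw [show Zy (lk K s) (k + 1) = ⊥ from ?_, finrank_bot]
    rw [eq_bot_iff]
    intro c hc
    obtain ⟨r, hr, hsr⟩ := mem_dK.1 hd
    have hr' := mem_bT.1 hr
    rcases h.link_const hs hk hc.1 (fun _ _ _ _ => by
      rw [mem_ker.1 hc.2]; rfl) with e | e
    · exact e
    · exfalso
      have := h.bd_top_link hk (r := r \ s) (mem_fc.2 ⟨h.cx.sdiff_mem_lk hr'.1.1 hsr, by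
        rw [card_sdiff_of_subset hsr]; omega⟩)
      rw [← e, mem_ker.1 hc.2, union_sdiff_of_subset hsr, if_pos hr] at this
      exact zero_ne_one this
  · have hne : ind (fc (lk K s) (k + 1)) ≠ 0 := by
      obtain ⟨T, hT, hsT⟩ := h.pure hs
      intro e
      have := congrFun e (T \ s)
      rw [ind, if_pos] at this
      · exact one_ne_zero this
      · rw [mem_fc4] at hT
        exact mem_fc.2 ⟨h.cx.sdiff_mem_lk hT.1 hsT, by
          rw [card_sdiff_of_subset hsT]; omega⟩
    refine Eq.trans ?_ (finrank_span_singleton (K := ZMod 2) hne)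
    rw [show Zy (lk K s) (k + 1) = Submodule.span (ZMod 2) {ind (fc (lk K s) (k + 1))} from ?_]
    apply le_antisymm
    · intro c hc
      rcases h.link_const hs hk hc.1 (fun _ _ _ _ => by
        rw [mem_ker.1 hc.2]; rfl) with e | e
      · rw [e]; exact zero_mem _
      · rw [e]; exact Submodule.mem_span_singleton_self _
    · rw [Submodule.span_singleton_le_iff_mem]
      refine ⟨ind_mem_ChS subset_rfl, mem_ker.2 ?_⟩
      funext r
      by_cases hr : r ∈ fc (lk K s) k
      · rw [h.bd_top_link hk hr, if_neg]
        · rfl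
        · exact fun hb => hd (mem_dK.2 ⟨_, hb, Finset.subset_union_left⟩)
      · exact (h.cx.lk hs).bd_mem (ind_mem_ChS subset_rfl) r hr

end

section

variable {n : ℕ} {K : Fam n}

theorem Good.cx_dK (h : Good K) : IsCx (dK K) where
  empty_mem := by
    obtain ⟨t, ht, hd⟩ := h.bdry
    exact mem_dK.2 ⟨t, mem_filter.2 ⟨ht, hd⟩, Finset.empty_subset _⟩
  down s hs t ht := by
    obtain ⟨u, hu, hsu⟩ := mem_dK.1 hs
    exact mem_dK.2 ⟨u, hu, ht.trans hsu⟩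

theorem Good.dK_subset (h : Good K) : dK K ⊆ K := by
  intro s hs
  obtain ⟨t, ht, hst⟩ := mem_dK.1 hs
  exact h.cx.down _ (mem_bT.1 ht).1.1 _ hst

theorem fc_dK_three : fc (dK K) 3 = bT K := by
  ext s
  rw [mem_fc, mem_dK]
  constructor
  · rintro ⟨⟨t, ht, hst⟩, hs⟩
    have := (mem_bT.1 ht).1.2
    rwa [Finset.eq_of_subset_of_card_le hst (by omega)]
  · intro hs
    exact ⟨⟨s, hs, subset_rfl⟩, (mem_bT.1 hs).1.2⟩

theorem Good.euler_edge (h : Good K) {e : Face n} (he : e ∈ fc K 2) :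
    deg (fc K 3) e = deg (fc K 4) e + if e ∈ dK K then 1 else 0 := by
  have he' := mem_fc.1 he
  have h0 := card_fc_of_acyc (h.cx.lk he'.1) (h.link e he'.1 0 (by omega)) 1 rfl
  have h1 := card_fc_of_acyc (h.cx.lk he'.1) (h.link e he'.1 1 (by omega)) 2 rfl
  have h2 := h.finrank_top he'.1 (k := 1) (by omega)
  rw [finrank_Zy_zero (h.cx.lk he'.1)] at h0
  rw [h.cx.card_fc_lk, he'.2] at h0 h1
  rw [h2] at h1
  simp only [Nat.reduceAdd] at h0 h1
  split_ifs at h1 ⊢ <;> omega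

theorem Good.euler_vertex (h : Good K) {e : Face n} (he : e ∈ fc K 1) :
    deg (fc K 2) e + deg (fc K 4) e = deg (fc K 3) e + 1 + if e ∈ dK K then 0 else 1 := by
  have he' := mem_fc.1 he
  have h0 := card_fc_of_acyc (h.cx.lk he'.1) (h.link e he'.1 0 (by omega)) 1 rfl
  have h1 := card_fc_of_acyc (h.cx.lk he'.1) (h.link e he'.1 1 (by omega)) 2 rfl
  have h2 := card_fc_of_acyc (h.cx.lk he'.1) (h.link e he'.1 2 (by omega)) 3 rfl
  have h3 := h.finrank_top he'.1 (k := 2) (by omega)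
  rw [finrank_Zy_zero (h.cx.lk he'.1)] at h0
  rw [h.cx.card_fc_lk, he'.2] at h0 h1 h2
  rw [h3] at h2
  simp only [Nat.reduceAdd] at h0 h1 h2
  split_ifs at h2 ⊢ <;> omega

theorem Good.euler (h : Good K) :
    (fc K 1).card + (fc K 3).card = (fc K 2).card + (fc K 4).card + 1 := by
  have h0 := card_fc_of_acyc h.cx (h.acyc (j := 0) (by omega)) 1 rfl
  have h1 := card_fc_of_acyc h.cx (h.acyc (j := 1) (by omega)) 2 rfl
  have h2 := card_fc_of_acyc h.cx (h.acyc (j := 2) (by omega)) 3 rfl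
  have h3 := card_fc_of_acyc h.cx (h.acyc (j := 3) (by omega)) 4 rfl
  have h4 : Module.finrank (ZMod 2) (Zy (lk K ∅) 4) = _ :=
    h.finrank_top h.cx.empty_mem (k := 3) rfl
  rw [lk_empty, if_pos h.cx_dK.empty_mem] at h4
  rw [finrank_Zy_zero h.cx] at h0
  omega

theorem sum_ite_mem_one (F B : Fam n) (p : Face n → Prop)
    [DecidablePred p] (h : B ⊆ F) :
    ∑ r ∈ F.filter p, (if r ∈ B then 1 else 0) = (B.filter p).card := by
  rw [← sum_filter, ← card_eq_sum_ones]
  congr 1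
  ext r
  simp only [mem_filter]
  constructor
  · rintro ⟨⟨_, h1⟩, h2⟩; exact ⟨h2, h1⟩
  · rintro ⟨h1, h2⟩; exact ⟨⟨h h1, h2⟩, h1⟩

theorem Good.sum_deg_tri (h : Good K) (s : Face n) :
    ∑ r ∈ (fc K 3).filter (fun r => s ⊆ r), deg (fc K 4) r + deg (bT K) s
      = 2 * deg (fc K 3) s := by
  rw [deg, ← sum_ite_mem_one (fc K 3) (bT K) _ (filter_subset _ _),
    ← sum_add_distrib, deg, card_eq_sum_ones, mul_sum]
  refine sum_congr rfl fun r hr => ?_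
  rw [h.deg_tri (mem_filter.1 hr).1]
  split_ifs <;> rfl

theorem Good.deg_bT_edge (h : Good K) {e : Face n} (he : e ∈ fc K 2) :
    deg (bT K) e = if e ∈ dK K then 2 else 0 := by
  have h1 := h.sum_deg_tri e
  rw [sum_deg_ridges h.cx 3 e subset_rfl, (mem_fc.1 he).2] at h1
  have h2 := h.euler_edge he
  change (4 - 2) * deg (fc K 4) e + _ = _ at h1
  split_ifs at h2 ⊢ <;> omega

theorem Good.deg_bT_of_mem (h : Good K) {e : Face n} (he : e ∈ dK K) (hc : e.card = 2) :
    deg (bT K) e = 2 := by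
  rw [h.deg_bT_edge (mem_fc.2 ⟨h.dK_subset he, hc⟩), if_pos he]

theorem Good.card_bT (h : Good K) : 4 * (fc K 4).card + (bT K).card = 2 * (fc K 3).card := by
  have h1 := h.sum_deg_tri ∅
  rw [sum_deg_ridges h.cx 3 ∅ subset_rfl, deg_self_empty, deg_self_empty, deg_self_empty] at h1
  simpa using h1

theorem Good.card_edges_dK (h : Good K) : 2 * (fc (dK K) 2).card = 3 * (bT K).card := by
  have h1 := sum_deg_ridges h.cx_dK 2 ∅ (F := fc (dK K) 3) subset_rfl
  rw [deg_self_empty, fc_dK_three] at h1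
  rw [sum_congr rfl (g := fun _ => 2) fun r hr => ?_] at h1
  · simp only [Finset.empty_subset, Finset.filter_true, sum_const, smul_eq_mul,
      Finset.card_empty] at h1
    omega
  · have := mem_fc.1 (mem_filter.1 hr).1
    exact h.deg_bT_of_mem this.1 this.2

theorem Good.card_vertices_dK (h : Good K) :
    2 * (fc (dK K) 1).card = 4 + (bT K).card := by
  have h1 : ∑ v ∈ fc K 1, (deg (fc K 2) v + deg (fc K 4) v + if v ∈ dK K then 1 else 0)
      = ∑ v ∈ fc K 1, (deg (fc K 3) v + 2) := by
    refine sum_congr rfl fun v hv => ?_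
    have := h.euler_vertex hv
    split_ifs at this ⊢ <;> omega
  simp only [sum_add_distrib, sum_deg_vertices h.cx, sum_const, smul_eq_mul] at h1
  rw [← sum_filter, ← card_eq_sum_ones] at h1
  have h2 : (fc K 1).filter (fun v => v ∈ dK K) = fc (dK K) 1 := by
    ext v
    rw [mem_filter, mem_fc, mem_fc]
    exact ⟨fun h' => ⟨h'.2, h'.1.2⟩, fun h' => ⟨⟨h.dK_subset h'.1, h'.2⟩, h'.1⟩⟩
  rw [h2] at h1
  have h3 := h.euler
  have h4 := h.card_bT
  omega

theorem Good.bd_tet (h : Good K) : bd (ind (fc K 4)) = ind (bT K) := by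
  funext t
  by_cases ht : t ∈ fc K 3
  · have := h.bd_top_link (s := ∅) (r := t) (k := 3) rfl (by rwa [lk_empty])
    rw [lk_empty, Finset.empty_union] at this
    exact this
  · rw [h.cx.bd_mem (ind_mem_ChS subset_rfl) t ht, ind, if_neg]
    exact fun hb => ht (filter_subset _ _ hb)

/-- The only nonzero 2-cycle on the boundary is the fundamental one. -/
theorem Good.cycle_bT (h : Good K) {c : Chn n} (hc : c ∈ ChS (bT K)) (h0 : bd c = 0) :
    c = 0 ∨ c = ind (bT K) := by
  obtain ⟨w, hw, rfl⟩ := h.acyc (j := 3) le_rfl c (ChS_mono (filter_subset _ _) hc) h0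
  have := h.link_const h.cx.empty_mem (k := 3) rfl (c := w) (by rwa [lk_empty])
    (fun r _ _ hb => by rw [Finset.sdiff_empty]; exact hc r hb)
  rw [lk_empty] at this
  rcases this with rfl | rfl
  · left; exact map_zero _
  · right; exact h.bd_tet

theorem Good.bd_bT (h : Good K) : bd (ind (bT K)) = 0 := by
  rw [← h.bd_tet, bd_bd]

theorem Good.finrank_Z3_dK (h : Good K) : Module.finrank (ZMod 2) (Zy (dK K) 3) = 1 := by
  have hne : ind (bT K) ≠ 0 := by
    obtain ⟨t, ht, hd⟩ := h.bdry
    intro e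
    have := congrFun e t
    rw [ind, if_pos (show t ∈ bT K from mem_filter.2 ⟨ht, hd⟩)] at this
    exact one_ne_zero this
  refine Eq.trans ?_ (finrank_span_singleton (K := ZMod 2) hne)
  rw [show Zy (dK K) 3 = Submodule.span (ZMod 2) {ind (bT K)} from ?_]
  rw [Zy, fc_dK_three]
  apply le_antisymm
  · intro c hc
    rcases h.cycle_bT hc.1 hc.2 with e | e
    · rw [e]; exact zero_mem _
    · rw [e]; exact Submodule.mem_span_singleton_self _
  · rw [Submodule.span_singleton_le_iff_mem]
    exact ⟨ind_mem_ChS subset_rfl, h.bd_bT⟩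

theorem Good.acyc_one_dK (h : Good K) : Acyc (dK K) 1 := by
  refine acyc_one_of_conn fun g hg a b ha hb => ?_
  have hmem : ∀ a : Fin n, {a} ∈ dK K → ∃ t ∈ bT K, a ∈ t := by
    intro a ha
    obtain ⟨t, ht, hat⟩ := mem_dK.1 ha
    exact ⟨t, ht, by simpa using hat⟩
  have hcon : ∀ t ∈ bT K, ∀ x ∈ t, ∀ y ∈ t, g x = g y := by
    intro t ht x hx y hy
    by_cases hxy : x = y
    · rw [hxy]
    · refine hg x y hxy (mem_dK.2 ⟨t, ht, ?_⟩)
      intro z hz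
      simp only [Finset.mem_insert, Finset.mem_singleton] at hz
      rcases hz with rfl | rfl <;> assumption
  let c : Chn n := fun t => if t ∈ bT K then (if ∀ x ∈ t, g x = 1 then 1 else 0) else 0
  have hcv : ∀ t ∈ bT K, ∀ x ∈ t, c t = g x := by
    intro t ht x hx
    simp only [c, if_pos ht]
    split_ifs with h'
    · exact (h' x hx).symm
    · by_contra hne
      exact h' fun y hy => by
        rw [hcon t ht y hy x hx]; exact zmod2_eq_one_of_ne_zero fun h0 => hne h0.symm
  have hc : c ∈ ChS (bT K) := fun t ht => if_neg ht
  have hc0 : bd c = 0 := by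
    funext e
    by_cases he : e ∈ fc (dK K) 2
    · have he' := mem_fc.1 he
      obtain ⟨x, hx⟩ : e.Nonempty := card_pos.1 (by omega)
      rw [bd_apply_of_ChS (k := 2) (fun _ hx => (mem_bT.1 hx).1.2) he'.2 hc,
        sum_congr rfl (g := fun _ => g x) fun t ht => ?_, sum_const]
      · change deg (bT K) e • g x = 0
        rw [h.deg_bT_of_mem he'.1 he'.2, two_nsmul]; exact zmod2_add_self _
      · rw [mem_filter] at ht
        exact hcv t ht.1 x (ht.2 hx)
    · rw [← fc_dK_three] at hc
      exact h.cx_dK.bd_mem hc e he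
  obtain ⟨t, ht, hat⟩ := hmem a ha
  obtain ⟨u, hu, hbu⟩ := hmem b hb
  rw [← hcv t ht a hat, ← hcv u hu b hbu]
  rcases h.cycle_bT hc hc0 with e | e
  · rw [e]; rfl
  · rw [e, ind, ind, if_pos ht, if_pos hu]

theorem Good.acyc_two_dK (h : Good K) : Acyc (dK K) 2 := by
  obtain ⟨t, ht, hd⟩ := h.bdry
  have ht' : t ∈ bT K := mem_filter.2 ⟨ht, hd⟩
  obtain ⟨x, hx⟩ : t.Nonempty := card_pos.1 (by have := (mem_fc.1 ht).2; omega)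
  have h0 := card_fc_of_acyc h.cx_dK (acyc_zero_of_vertex h.cx_dK (v := x)
    (mem_dK.2 ⟨t, ht', by simpa using hx⟩)) 1 rfl
  have h1 := card_fc_of_acyc h.cx_dK h.acyc_one_dK 2 rfl
  have h2 : _ + Module.finrank (ZMod 2) (Zy (dK K) 3) = (fc (dK K) 3).card := finrank_Zy_add (dK K) 2
  rw [finrank_Zy_zero h.cx_dK] at h0
  rw [h.finrank_Z3_dK, fc_dK_three] at h2
  have h3 := h.card_vertices_dK
  have h4 := h.card_edges_dK
  rw [acyc_iff]
  refine (Submodule.eq_of_le_of_finrank_le (By_le_Zy h.cx_dK 2) ?_).ge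
  omega

end

section

variable {n : ℕ}

/-- Edges of a family of triangles. -/
def edg (R : Fam n) : Fam n :=
  fc (R.biUnion Finset.powerset) 2

theorem mem_edg {R : Fam n} {e : Face n} :
    e ∈ edg R ↔ (∃ t ∈ R, e ⊆ t) ∧ e.card = 2 := by
  simp [edg, mem_fc]

/-- Combinatorial data of a triangulated mod 2 acyclic planar surface. -/
structure DData (R : Fam n) : Prop where
  c3 : ∀ t ∈ R, t.card = 3
  e2 : ∀ e, e.card = 2 → deg R e ≤ 2
  inj : ∀ c ∈ ChS R, bd c = 0 → c = 0
  bnd : ∀ z ∈ ChS (edg R), bd z = 0 → ∃ c ∈ ChS R, bd c = z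

/-- The chain of consecutive pairs in a list. -/
def pth : List (Fin n) → Chn n
  | [] => 0
  | [_] => 0
  | x :: y :: l => dl {x, y} + pth (y :: l)

theorem pth_cons_cons (x y : Fin n) (l : List (Fin n)) :
    pth (x :: y :: l) = dl {x, y} + pth (y :: l) := rfl

theorem pth_append (l₁ : List (Fin n)) (b : Fin n) (l₂ : List (Fin n)) :
    pth (l₁ ++ b :: l₂) = pth (l₁ ++ [b]) + pth (b :: l₂) := by
  induction l₁ with
  | nil => simp [pth]
  | cons x l ih =>
    cases l with
    | nil => simp [pth]
    | cons y l =>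
      simp only [cons_append, pth_cons_cons] at ih ⊢
      rw [ih, add_assoc]

theorem pth_edge {l : List (Fin n)} {e : Face n} (h : pth l e ≠ 0) :
    ∀ x ∈ e, x ∈ l := by
  induction l with
  | nil => exact absurd rfl h
  | cons x l ih =>
    cases l with
    | nil => exact absurd rfl h
    | cons y l =>
      rw [pth_cons_cons, Pi.add_apply, dl_apply] at h
      by_cases he : pth (y :: l) e = 0
      · rw [he, add_zero] at h
        have : e = {x, y} := by by_contra h'; exact h (if_neg h')
        subst this
        intro z hz
        simp only [Finset.mem_insert, Finset.mem_singleton] at hz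
        rcases hz with rfl | rfl <;> simp
      · intro z hz
        exact List.mem_cons_of_mem _ (ih he z hz)

theorem pth_card {l : List (Fin n)} (hl : l.IsChain (· ≠ ·)) {e : Face n}
    (h : pth l e ≠ 0) : e.card = 2 := by
  induction l with
  | nil => exact absurd rfl h
  | cons x l ih =>
    cases l with
    | nil => exact absurd rfl h
    | cons y l =>
      rw [pth_cons_cons, Pi.add_apply, dl_apply] at h
      rw [isChain_cons_cons] at hl
      by_cases he : pth (y :: l) e = 0
      · rw [he, add_zero] at h
        have : e = {x, y} := by by_contra h'; exact h (if_neg h')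
        rw [this, card_pair hl.1]
      · exact ih hl.2 he

theorem bd_pth {x : Fin n} {l : List (Fin n)} {y : Fin n} (hl : (x :: (l ++ [y])).IsChain (· ≠ ·)) :
    bd (pth (x :: (l ++ [y]))) = dl {x} + dl {y} := by
  induction l generalizing x with
  | nil =>
    simp only [nil_append, isChain_cons_cons] at hl
    simp only [nil_append, pth, add_zero]
    exact bd_dl_edge hl.1
  | cons z l ih =>
    simp only [cons_append, isChain_cons_cons] at hl
    simp only [cons_append, pth_cons_cons]
    rw [map_add, bd_dl_edge hl.1, ih hl.2, add_assoc, ← add_assoc (dl {z}), chn_add_self, zero_add]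

theorem bd_pth_cycle {x : Fin n} {l : List (Fin n)} (hl : (x :: (l ++ [x])).IsChain (· ≠ ·)) :
    bd (pth (x :: (l ++ [x]))) = 0 := by
  rw [bd_pth hl, chn_add_self]

theorem isChain_ne_of_nodup {l : List (Fin n)} (h : l.Nodup) : l.IsChain (· ≠ ·) :=
  List.Pairwise.isChain h

theorem isChain_cycle {x : Fin n} {l : List (Fin n)} (h : (x :: l).Nodup) (hl : l ≠ []) :
    (x :: (l ++ [x])).IsChain (· ≠ ·) := by
  rw [← cons_append, List.isChain_append]
  refine ⟨isChain_ne_of_nodup h, by simp, ?_⟩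
  intro a ha b hb
  simp only [List.head?_cons, Option.mem_some_iff] at hb
  subst hb
  rintro rfl
  rw [List.getLast?_cons_of_ne_nil hl] at ha
  exact (nodup_cons.1 h).1 (List.mem_of_mem_getLast? ha)

/-- First edge of a path without repetition. -/
theorem pth_first {x y : Fin n} {l : List (Fin n)} (h : x ∉ y :: l) {e : Face n}
    (hx : x ∈ e) : pth (x :: y :: l) e = if e = {x, y} then 1 else 0 := by
  rw [pth_cons_cons, Pi.add_apply, dl_apply]
  have : pth (y :: l) e = 0 := by
    by_contra h'
    exact h (pth_edge h' x hx)
  rw [this, add_zero]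

/-- Rotation of a closed path. -/
theorem pth_rotate (a : Fin n) (p : List (Fin n)) (v : Fin n) (q : List (Fin n)) :
    pth (a :: (p ++ v :: q ++ [a])) = pth (v :: (q ++ a :: p ++ [v])) := by
  have h1 := pth_append (a :: p) v (q ++ [a])
  have h2 := pth_append (v :: q) a (p ++ [v])
  simp only [cons_append, List.append_assoc] at h1 h2 ⊢
  rw [h1, h2, add_comm]

/-- The edge `{a, v}` does not occur in a nodup path from `a` to `v` with interior points. -/
theorem pth_ne_chord {a v : Fin n} {p : List (Fin n)} (hp : p ≠ []) (h : (a :: (p ++ [v])).Nodup) :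
    pth (a :: (p ++ [v])) {a, v} = 0 := by
  obtain ⟨y, p, rfl⟩ := List.exists_cons_of_ne_nil hp
  rw [cons_append, pth_first (by rw [← cons_append]; exact (nodup_cons.1 h).1)
    (by simp), if_neg]
  intro e
  have hv : v ∈ ({a, y} : Face n) := by rw [← e]; simp
  simp only [Finset.mem_insert, Finset.mem_singleton] at hv
  simp only [cons_append, nodup_cons, mem_cons, mem_append] at h
  rcases hv with rfl | rfl <;> simp_all

end

section

variable {n : ℕ}

theorem pth_of_isChain {z : Chn n} {l : List (Fin n)} (hl : l.IsChain fun x y => z {x, y} ≠ 0)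
    {e : Face n} (he : pth l e ≠ 0) : z e ≠ 0 := by
  induction l with
  | nil => exact absurd rfl he
  | cons x l ih =>
    cases l with
    | nil => exact absurd rfl he
    | cons y l =>
      rw [isChain_cons_cons] at hl
      rw [pth_cons_cons, Pi.add_apply, dl_apply] at he
      by_cases h : e = {x, y}
      · rw [h]; exact hl.1
      · rw [if_neg h, zero_add] at he
        exact ih hl.2 he

theorem exists_simple_cycle {z : Chn n} (hz : z ≠ 0) (hz2 : ∀ e, z e ≠ 0 → e.card = 2)
    (hb : bd z = 0) : ∃ a l, (a :: l).Nodup ∧ 2 ≤ l.length ∧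
      ∀ e, pth (a :: (l ++ [a])) e ≠ 0 → z e ≠ 0 := by
  let P : List (Fin n) → Prop := fun l => l.Nodup ∧ l.IsChain fun x y => z {x, y} ≠ 0
  have hbd : ∀ l, P l → l.length ≤ n := fun l hl => by
    simpa using hl.1.length_le_card
  obtain ⟨e, he⟩ : ∃ e, z e ≠ 0 := by
    by_contra h; push Not at h; exact hz (funext h)
  obtain ⟨x, y, hxy, rfl⟩ := card_eq_two.1 (hz2 e he)
  have h2 : P [x, y] := ⟨by simp [hxy], by simp [he]⟩
  classical
  obtain ⟨l, hl, hmax⟩ : ∃ l, P l ∧ ∀ l', P l' → l'.length ≤ l.length := by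
    have hex : ∃ m, ∃ l, P l ∧ l.length = m := ⟨_, _, h2, rfl⟩
    have hs := Nat.findGreatest_spec (P := fun m => ∃ l, P l ∧ l.length = m) (hbd _ h2)
      ⟨_, h2, rfl⟩
    obtain ⟨l, hl, hm⟩ := hs
    refine ⟨l, hl, fun l' hl' => ?_⟩
    rw [hm]
    exact Nat.le_findGreatest (hbd _ hl') ⟨l', hl', rfl⟩
  have hlen := hmax _ h2
  match l, hl, hmax, hlen with
  | x₀ :: x₁ :: p, hl, hmax, _ =>
    have hz01 := (isChain_cons_cons.1 hl.2).1
    have hne : x₀ ≠ x₁ := fun h => (nodup_cons.1 hl.1).1 (by simp [h])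
    obtain ⟨y, hy0, hy1, hyz⟩ : ∃ y, y ≠ x₀ ∧ y ≠ x₁ ∧ z {x₀, y} ≠ 0 := by
      by_contra hno
      push Not at hno
      have := congrFun hb {x₀}
      rw [bd_apply, sum_eq_single x₁] at this
      · rw [Finset.pair_comm] at this; exact hz01 this
      · intro w hw hw1
        rw [Finset.mem_compl, Finset.mem_singleton] at hw
        rw [Finset.pair_comm]; exact hno w hw hw1
      · intro h; simp [hne.symm] at h
    have hmem : y ∈ x₀ :: x₁ :: p := by
      by_contra hmem
      have : P (y :: x₀ :: x₁ :: p) :=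
        ⟨nodup_cons.2 ⟨hmem, hl.1⟩, isChain_cons_cons.2 ⟨by rwa [Finset.pair_comm], hl.2⟩⟩
      have := hmax _ this
      simp at this
    have hyp : y ∈ p := by simpa [hy0, hy1] using hmem
    obtain ⟨q, r, rfl⟩ := append_of_mem hyp
    have hpre : (x₀ :: (x₁ :: q ++ [y])) <+: x₀ :: x₁ :: (q ++ y :: r) := ⟨r, by simp⟩
    refine ⟨x₀, x₁ :: q ++ [y], hl.1.sublist hpre.sublist, by simp, fun e he => ?_⟩
    refine pth_of_isChain (l := x₀ :: (x₁ :: q ++ [y] ++ [x₀])) ?_ he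
    rw [← cons_append, List.isChain_append]
    refine ⟨hl.2.prefix hpre, by simp, ?_⟩
    intro a ha b hb'
    simp only [List.head?_cons, Option.mem_some_iff] at hb'
    subst hb'
    rw [← cons_append, List.getLast?_concat, Option.mem_some_iff] at ha
    subst ha
    rwa [Finset.pair_comm]
  | [_], _, _, h => simp at h
  | [], _, _, h => simp at h

/-- The edge following the first vertex appears in a simple closed path. -/
theorem pth_cycle_ne_zero {a : Fin n} {l : List (Fin n)} (h : (a :: l).Nodup) (hl : 2 ≤ l.length) :
    pth (a :: (l ++ [a])) ≠ 0 := by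
  match l, hl with
  | x :: y :: p, _ =>
    intro e
    have := congrFun e {a, x}
    rw [cons_append, pth_cons_cons, Pi.add_apply, dl_apply, if_pos rfl, cons_append,
      pth_first, if_neg] at this
    · simp at this
    · intro e'
      have ha : a ∈ ({x, y} : Face n) := by rw [← e']; simp
      simp only [Finset.mem_insert, Finset.mem_singleton] at ha
      simp only [nodup_cons, mem_cons] at h
      tauto
    · simp only [nodup_cons, mem_cons, mem_append] at h ⊢
      simp only [not_mem_nil, or_false]
      rintro (rfl | h' | rfl) <;> tauto
    · simp

variable {K : Fam n}

theorem Good.link_boundary_cycle (h : Good K) {v : Fin n} (hv : {v} ∈ dK K) :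
    ∃ a l, (a :: l).Nodup ∧ 2 ≤ l.length ∧
      bd (ind (fc (lk K {v}) 3)) = pth (a :: (l ++ [a])) := by
  have hvK := h.dK_subset hv
  have hL := h.cx.lk hvK
  have hz0 : bd (ind (fc (lk K {v}) 3)) ∈ ChS (fc (lk K {v}) 2) :=
    hL.bd_mem (ind_mem_ChS subset_rfl)
  have hval : ∀ r ∈ fc (lk K {v}) 2, bd (ind (fc (lk K {v}) 3)) r
      = if {v} ∪ r ∈ bT K then 1 else 0 := fun r hr => h.bd_top_link (k := 2) rfl hr
  obtain ⟨a, l, hn, hl, hsup⟩ := exists_simple_cycle (z := bd (ind (fc (lk K {v}) 3))) (by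
      obtain ⟨t, ht, hvt⟩ := mem_dK.1 hv
      intro e
      have ht' := mem_bT.1 ht
      have := hval (t \ {v}) (mem_fc.2 ⟨h.cx.sdiff_mem_lk ht'.1.1 hvt, by
        rw [card_sdiff_of_subset hvt, ht'.1.2]; rfl⟩)
      rw [e, union_sdiff_of_subset hvt, if_pos ht] at this
      exact zero_ne_one this)
    (fun e he => (mem_fc.1 (mem_of_ChS hz0 he)).2) (bd_bd _)
  refine ⟨a, l, hn, hl, ?_⟩
  have hne := pth_cycle_ne_zero hn hl
  have hch : pth (a :: (l ++ [a])) ∈ ChS (fc (lk K {v}) 2) := by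
    intro e he
    by_contra h'
    exact he (mem_of_ChS hz0 (hsup e h'))
  obtain ⟨c, hc, hcb⟩ := h.link {v} hvK 2 (by simp) _ hch
    (bd_pth_cycle (isChain_cycle hn (by rintro rfl; simp at hl)))
  rcases h.link_const hvK (k := 2) rfl hc (fun r hr hvr hb => by
    have hr' := mem_fc.1 hr
    by_contra h'
    rw [hcb] at h'
    have := hsup _ h'
    rw [hval _ (mem_fc.2 ⟨h.cx.sdiff_mem_lk hr'.1 hvr, by
        rw [card_sdiff_of_subset hvr, hr'.2]; rfl⟩),
      union_sdiff_of_subset hvr, if_neg hb] at this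
    exact this rfl) with e | e
  · rw [e, map_zero] at hcb
    exact absurd hcb.symm hne
  · rw [← hcb, e]

theorem Good.dData_link (h : Good K) {v : Fin n} (hv : {v} ∈ dK K) :
    DData (fc (lk K {v}) 3) where
  c3 t ht := (mem_fc.1 ht).2
  e2 e he := by
    by_cases heL : e ∈ lk K {v}
    · have := h.link_ridge (s := {v}) (r := e) (k := 2) rfl (mem_fc.2 ⟨heL, he⟩)
      exact this.2.le.trans (h.tri _ this.1)
    · rw [deg, card_eq_zero.2]
      · omega
      · rw [filter_eq_empty_iff]
        exact fun t ht het => heL ((h.cx.lk (h.dK_subset hv)).down _ (mem_fc.1 ht).1 _ het)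
  inj c hc hb := by
    have := h.finrank_top (h.dK_subset hv) (k := 2) rfl
    rw [if_pos hv, Submodule.finrank_eq_zero] at this
    have hm : c ∈ Zy (lk K {v}) 3 := ⟨hc, hb⟩
    have e : Zy (lk K {v}) 3 = ⊥ := this
    rw [e] at hm
    simpa using hm
  bnd z hz hb := by
    refine h.link {v} (h.dK_subset hv) 2 (by simp) z (ChS_mono ?_ hz) hb
    intro e he
    obtain ⟨⟨t, ht, het⟩, h2⟩ := mem_edg.1 he
    exact mem_fc.2 ⟨(h.cx.lk (h.dK_subset hv)).down _ (mem_fc.1 ht).1 _ het, h2⟩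

theorem ind_erase {R : Fam n} {T : Face n} (hT : T ∈ R) :
    ind (R.erase T) = ind R + dl T := by
  funext s
  rw [Pi.add_apply, ind, ind, dl_apply]
  by_cases h : s = T
  · subst h; simp [hT, zmod2_add_self]
  · simp [h]

theorem deg_mono {R R' : Fam n} (h : R' ⊆ R) (e : Face n) :
    deg R' e ≤ deg R e := Finset.card_le_card (Finset.filter_subset_filter _ h)

theorem Good.dData_sphere (h : Good K) {T : Face n} (hT : T ∈ bT K) :
    DData ((bT K).erase T) where
  c3 t ht := (mem_bT.1 (mem_of_mem_erase ht)).1.2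
  e2 e he := by
    refine (deg_mono (erase_subset _ _) e).trans ?_
    by_cases heK : e ∈ dK K
    · exact (h.deg_bT_of_mem heK he).le
    · rw [deg, card_eq_zero.2]
      · omega
      · rw [filter_eq_empty_iff]
        exact fun t ht het => heK (mem_dK.2 ⟨t, ht, het⟩)
  inj c hc hb := by
    rcases h.cycle_bT (ChS_mono (erase_subset _ _) hc) hb with e | e
    · exact e
    · have := hc T (notMem_erase _ _)
      rw [e, ind, if_pos hT] at this
      exact absurd this one_ne_zero
  bnd z hz hb := by
    obtain ⟨c, hc, hcb⟩ := h.acyc_two_dK z (ChS_mono (by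
      intro e he
      obtain ⟨⟨t, ht, het⟩, h2⟩ := mem_edg.1 he
      exact mem_fc.2 ⟨mem_dK.2 ⟨t, mem_of_mem_erase ht, het⟩, h2⟩) hz) hb
    rw [fc_dK_three] at hc
    have key : ∀ d ∈ ChS (bT K), d T = 0 → d ∈ ChS ((bT K).erase T) := by
      intro d hd h0 s hs
      by_cases hsT : s = T
      · rw [hsT, h0]
      · exact hd s fun h' => hs (mem_erase.2 ⟨hsT, h'⟩)
    by_cases h0 : c T = 0
    · exact ⟨c, key c hc h0, hcb⟩
    · refine ⟨c + ind (bT K), key _ (add_mem hc (ind_mem_ChS subset_rfl)) ?_, ?_⟩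
      · rw [Pi.add_apply, zmod2_eq_one_of_ne_zero h0, ind, if_pos hT]; rfl
      · rw [map_add, hcb, h.bd_bT, add_zero]

theorem bd_dl_triangle {a b c : Fin n} (hab : a ≠ b) (hac : a ≠ c) (hbc : b ≠ c) :
    bd (dl {a, b, c}) = pth [a, b, c, a] := by
  rw [bd_dl, sum_insert (by simp [hab, hac]), sum_pair hbc]
  simp only [pth, add_zero]
  have e1 : ({a, b, c} : Face n).erase a = {b, c} := by
    ext x; simp only [mem_erase, Finset.mem_insert, Finset.mem_singleton]; grind
  have e2 : ({a, b, c} : Face n).erase b = {c, a} := by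
    ext x; simp only [mem_erase, Finset.mem_insert, Finset.mem_singleton]; grind
  have e3 : ({a, b, c} : Face n).erase c = {a, b} := by
    ext x; simp only [mem_erase, Finset.mem_insert, Finset.mem_singleton]; grind
  rw [e1, e2, e3, ← add_assoc, add_comm]

theorem Good.bd_sphere_erase (h : Good K) {T : Face n} (hT : T ∈ bT K) :
    bd (ind ((bT K).erase T)) = bd (dl T) := by
  rw [ind_erase hT, map_add, h.bd_bT, zero_add]

end

section

/-! ### Homeomorphisms of compact sets given by maps -/

/-- A continuous map on a compact set factors through any continuous map to a Hausdorff space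
which identifies no more points. -/
theorem IsCompact.exists_factor {A B C : Type*} [TopologicalSpace A] [TopologicalSpace B]
    [TopologicalSpace C] [T2Space B] [Nonempty C] {K : Set A} (hK : IsCompact K) {q : A → B}
    {f : A → C} (hq : ContinuousOn q K) (hf : ContinuousOn f K)
    (h : ∀ x ∈ K, ∀ y ∈ K, q x = q y → f x = f y) :
    ∃ g : B → C, ContinuousOn g (q '' K) ∧ ∀ x ∈ K, g (q x) = f x := by
  classical
  let g : B → C := fun y => if h : ∃ x ∈ K, q x = y then f h.choose else Classical.arbitrary C
  have hg : ∀ x ∈ K, g (q x) = f x := by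
    intro x hx
    have h1 : ∃ x' ∈ K, q x' = q x := ⟨x, hx, rfl⟩
    simp only [g, dif_pos h1]
    exact h _ h1.choose_spec.1 _ hx h1.choose_spec.2
  refine ⟨g, ?_, hg⟩
  rw [continuousOn_iff_isClosed]
  intro t ht
  obtain ⟨u, hu, hu'⟩ := continuousOn_iff_isClosed.1 hf t ht
  refine ⟨q '' (K ∩ u), ((hK.inter_right hu).image_of_continuousOn
    (hq.mono inter_subset_left)).isClosed, ?_⟩
  ext y
  constructor
  · rintro ⟨hy, x, hx, rfl⟩
    rw [mem_preimage, hg x hx] at hy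
    exact ⟨⟨x, ⟨hx, (hu' ▸ (⟨hy, hx⟩ : x ∈ f ⁻¹' t ∩ K) : x ∈ u ∩ K).1⟩, rfl⟩, x, hx, rfl⟩
  · rintro ⟨⟨x, ⟨hx, hxu⟩, rfl⟩, h2⟩
    refine ⟨?_, h2⟩
    rw [mem_preimage, hg x hx]
    have : x ∈ f ⁻¹' t ∩ K := by rw [hu']; exact ⟨hxu, hx⟩
    exact this.1

/-- `g` restricts to a continuous bijection from `X` to `Y`. -/
structure CHom {A B : Type*} [TopologicalSpace A] [TopologicalSpace B] (g : A → B) (X : Set A)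
    (Y : Set B) : Prop where
  cont : ContinuousOn g X
  inj : InjOn g X
  img : g '' X = Y

namespace CHom

variable {A B C : Type*} [TopologicalSpace A] [TopologicalSpace B] [TopologicalSpace C]
  {g : A → B} {X : Set A} {Y : Set B}

theorem mem (h : CHom g X Y) {x : A} (hx : x ∈ X) : g x ∈ Y := h.img ▸ mem_image_of_mem g hx

theorem mapsTo (h : CHom g X Y) : MapsTo g X Y := fun _ hx => h.mem hx

theorem compact (h : CHom g X Y) (hX : IsCompact X) : IsCompact Y :=
  h.img ▸ hX.image_of_continuousOn h.cont

theorem comp {f : B → C} {Z : Set C} (hf : CHom f Y Z) (hg : CHom g X Y) : CHom (f ∘ g) X Z :=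
  ⟨hf.cont.comp hg.cont hg.mapsTo, hf.inj.comp hg.inj hg.mapsTo, by
    rw [image_comp, hg.img, hf.img]⟩

theorem exists_inv [T2Space B] [Nonempty A] (h : CHom g X Y) (hX : IsCompact X) :
    ∃ f : B → A, CHom f Y X ∧ (∀ x ∈ X, f (g x) = x) ∧ ∀ y ∈ Y, g (f y) = y := by
  obtain ⟨f, hf, hfg⟩ := hX.exists_factor h.cont continuousOn_id
    (fun x hx y hy e => h.inj hx hy e)
  rw [h.img] at hf
  have hgf : ∀ y ∈ Y, g (f y) = y := by
    intro y hy
    rw [← h.img] at hy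
    obtain ⟨x, hx, rfl⟩ := hy
    rw [hfg x hx]
    rfl
  refine ⟨f, ⟨hf, ?_, ?_⟩, hfg, hgf⟩
  · intro y hy y' hy' e
    rw [← hgf y hy, ← hgf y' hy', e]
  · rw [← h.img, image_image]
    ext x
    constructor
    · rintro ⟨x', hx', rfl⟩
      have : f (g x') = x' := hfg x' hx'
      simpa only [this] using hx'
    · exact fun hx => ⟨x, hx, hfg x hx⟩

theorem congr {g' : A → B} (h : CHom g X Y) (e : EqOn g g' X) : CHom g' X Y :=
  ⟨h.cont.congr fun x hx => (e hx).symm, h.inj.congr e, by rw [← h.img]; exact (image_congr e).symm⟩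

/-- Two maps agreeing on the overlap of closed pieces glue. -/
theorem union {g' : A → B} {X' : Set A} {Y' : Set B} (h : CHom g X Y) (h' : CHom g' X' Y')
    (hX : IsClosed X) (hX' : IsClosed X') (e : EqOn g g' (X ∩ X')) (hY : Y ∩ Y' ⊆ g '' (X ∩ X')) :
    ∃ f : A → B, CHom f (X ∪ X') (Y ∪ Y') ∧ EqOn f g X ∧ EqOn f g' X' := by
  classical
  let f : A → B := fun x => if x ∈ X then g x else g' x
  have h1 : EqOn f g X := fun x hx => if_pos hx
  have h2 : EqOn f g' X' := by
    intro x hx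
    by_cases hx2 : x ∈ X
    · rw [h1 hx2]
      exact e ⟨hx2, hx⟩
    · exact if_neg hx2
  have hc : CHom f X Y := h.congr h1.symm
  have hc' : CHom f X' Y' := h'.congr h2.symm
  have key : ∀ x ∈ X, ∀ y ∈ X', f x = f y → x = y := by
    intro x hx y hy exy
    have : f x ∈ Y ∩ Y' := ⟨hc.mem hx, exy ▸ hc'.mem hy⟩
    obtain ⟨z, ⟨hz, hz'⟩, ez⟩ := hY this
    rw [← h1 hz] at ez
    have e1 := hc.inj hz hx ez
    rw [exy] at ez
    rw [← e1, hc'.inj hz' hy ez]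
  refine ⟨f, ⟨hc.cont.union_of_isClosed hc'.cont hX hX', ?_, ?_⟩, h1, h2⟩
  · rintro x (hx | hx) y (hy | hy) exy
    · exact hc.inj hx hy exy
    · exact key x hx y hy exy
    · exact (key y hy x hx exy.symm).symm
    · exact hc'.inj hx hy exy
  · rw [image_union, hc.img, hc'.img]

end CHom

/-! ### Cone structures -/

/-- `X` is a cone on the compact set `C`. -/
def IsDisc {W : Type*} [TopologicalSpace W] (X C : Set W) : Prop :=
  IsCompact C ∧ C.Nonempty ∧ ∃ Θ : ℝ × W → W, ContinuousOn Θ (Icc 0 1 ×ˢ C) ∧ Θ '' (Icc 0 1 ×ˢ C) = X ∧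
    (∀ x ∈ C, Θ (1, x) = x) ∧
    ∀ t ∈ Icc (0 : ℝ) 1, ∀ x ∈ C, ∀ t' ∈ Icc (0 : ℝ) 1, ∀ x' ∈ C,
      Θ (t, x) = Θ (t', x') ↔ t = t' ∧ (t = 0 ∨ x = x')

namespace IsDisc

variable {A W : Type*} [TopologicalSpace A] [TopologicalSpace W] {X C : Set A} {X' C' : Set W}

theorem compact (h : IsDisc X C) : IsCompact X := by
  obtain ⟨hC, -, Θ, h1, h2, -⟩ := h
  exact h2 ▸ (isCompact_Icc.prod hC).image_of_continuousOn h1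

theorem subset (h : IsDisc X C) : C ⊆ X := by
  obtain ⟨hC, -, Θ, h1, h2, h3, -⟩ := h
  intro x hx
  rw [← h2]
  exact ⟨(1, x), ⟨by simp, hx⟩, h3 x hx⟩

/-- Homeomorphisms of bases extend to cones. -/
theorem extend [T2Space A] (h : IsDisc X C) (h' : IsDisc X' C') {ρ : A → W}
    (hρ : CHom ρ C C') : ∃ g : A → W, CHom g X X' ∧ EqOn g ρ C := by
  obtain ⟨hC, hne, Θ, h1, h2, h3, h4⟩ := h
  obtain ⟨hC', hne', Θ', h1', h2', h3', h4'⟩ := h'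
  have : Nonempty W := ⟨hne'.some⟩
  have hmap : MapsTo (fun p : ℝ × A => (p.1, ρ p.2)) (Icc 0 1 ×ˢ C) (Icc 0 1 ×ˢ C') :=
    fun p hp => ⟨hp.1, hρ.mem hp.2⟩
  have hcont : ContinuousOn (fun p : ℝ × A => (p.1, ρ p.2)) (Icc 0 1 ×ˢ C) :=
    continuousOn_fst.prodMk (hρ.cont.comp continuousOn_snd fun p hp => hp.2)
  obtain ⟨g, hg, hgΘ⟩ := (isCompact_Icc.prod hC).exists_factor h1 (h1'.comp hcont hmap) (by
    rintro ⟨t, x⟩ ⟨ht, hx⟩ ⟨t', x'⟩ ⟨ht', hx'⟩ e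
    have := (h4 t ht x hx t' ht' x' hx').1 e
    simp only [Function.comp]
    refine (h4' t ht _ (hρ.mem hx) t' ht' _ (hρ.mem hx')).2 ⟨this.1, this.2.imp_right ?_⟩
    exact fun e => e ▸ rfl)
  rw [h2] at hg
  refine ⟨g, ⟨hg, ?_, ?_⟩, ?_⟩
  · rw [← h2]
    rintro _ ⟨⟨t, x⟩, ⟨ht, hx⟩, rfl⟩ _ ⟨⟨t', x'⟩, ⟨ht', hx'⟩, rfl⟩ e
    rw [hgΘ _ ⟨ht, hx⟩, hgΘ _ ⟨ht', hx'⟩] at e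
    have := (h4' t ht _ (hρ.mem hx) t' ht' _ (hρ.mem hx')).1 e
    exact (h4 t ht x hx t' ht' x' hx').2 ⟨this.1, this.2.imp_right fun e => hρ.inj hx hx' e⟩
  · rw [← h2, image_image, ← h2']
    ext y
    constructor
    · rintro ⟨p, hp, rfl⟩
      exact ⟨(p.1, ρ p.2), hmap hp, (hgΘ p hp).symm⟩
    · rintro ⟨⟨t, y⟩, ⟨ht, hy⟩, rfl⟩
      rw [← hρ.img] at hy
      obtain ⟨x, hx, rfl⟩ := hy
      exact ⟨(t, x), ⟨ht, hx⟩, hgΘ _ ⟨ht, hx⟩⟩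
  · intro x hx
    have : g (Θ (1, x)) = Θ' (1, ρ x) := hgΘ (1, x) ⟨by simp, hx⟩
    rwa [h3 x hx, h3' _ (hρ.mem hx)] at this

/-- Cone structures are transported by homeomorphisms. -/
theorem map [T2Space W] (h : IsDisc X C) {g : A → W} (hg : CHom g X X') : IsDisc X' (g '' C) := by
  have hXc := h.compact
  have hCX := h.subset
  obtain ⟨hC, hne, Θ, h1, h2, h3, h4⟩ := h
  have : Nonempty A := ⟨hne.some⟩
  obtain ⟨f, hf, hfg, hgf⟩ := hg.exists_inv hXc
  have hfC : MapsTo f (g '' C) C := by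
    rintro _ ⟨x, hx, rfl⟩
    rw [hfg x (hCX hx)]
    exact hx
  have hfi : ∀ y ∈ g '' C, g (f y) = y := by
    rintro _ ⟨x, hx, rfl⟩
    rw [hfg x (hCX hx)]
  have hsub : g '' C ⊆ X' := hg.img ▸ image_mono hCX
  have hm : MapsTo (fun p : ℝ × W => (p.1, f p.2)) (Icc 0 1 ×ˢ (g '' C)) (Icc 0 1 ×ˢ C) :=
    fun p hp => ⟨hp.1, hfC hp.2⟩
  have hcont : ContinuousOn (fun p : ℝ × W => (p.1, f p.2)) (Icc 0 1 ×ˢ (g '' C)) :=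
    continuousOn_fst.prodMk ((hf.cont.mono hsub).comp continuousOn_snd fun p hp => hp.2)
  have hmX : MapsTo Θ (Icc 0 1 ×ˢ C) X := fun p hp => h2 ▸ mem_image_of_mem _ hp
  refine ⟨hC.image_of_continuousOn (hg.cont.mono hCX), hne.image g,
    fun p => g (Θ (p.1, f p.2)), ?_, ?_, ?_, ?_⟩
  · exact hg.cont.comp (h1.comp hcont hm) (hmX.comp hm)
  · rw [← hg.img, ← h2, image_image]
    ext y
    constructor
    · rintro ⟨p, hp, rfl⟩
      exact ⟨_, hm hp, rfl⟩
    · rintro ⟨⟨t, x⟩, ⟨ht, hx⟩, rfl⟩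
      exact ⟨(t, g x), ⟨ht, mem_image_of_mem g hx⟩, by simp only [hfg x (hCX hx)]⟩
  · intro y hy
    simp only [h3 _ (hfC hy), hfi y hy]
  · intro t ht y hy t' ht' y' hy'
    simp only
    constructor
    · intro e
      have := hg.inj (hmX ⟨ht, hfC hy⟩) (hmX ⟨ht', hfC hy'⟩) e
      have := (h4 t ht _ (hfC hy) t' ht' _ (hfC hy')).1 this
      refine ⟨this.1, this.2.imp_right fun e => ?_⟩
      rw [← hfi y hy, ← hfi y' hy', e]
    · intro e
      rw [(h4 t ht _ (hfC hy) t' ht' _ (hfC hy')).2 ⟨e.1, e.2.imp_right fun e' => congrArg f e'⟩]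

end IsDisc

/-- Convex bodies are cones on their boundaries. -/
theorem isDisc_convex {E : Type*} [NormedAddCommGroup E] [NormedSpace ℝ E] [Nontrivial E]
    {g : E → ℝ} (hg : ConvexOn ℝ univ g) (hgc : Continuous g) {c : E} (hc : g c < 0)
    (hK : IsCompact {x | g x ≤ 0}) : IsDisc {x | g x ≤ 0} {x | g x = 0} := by
  have ray : ∀ v : E, v ≠ 0 → ∃ T : ℝ, 0 < T ∧ g (c + T • v) = 0 := by
    intro v hv
    obtain ⟨R, hR⟩ := hK.isBounded.subset_closedBall c
    have hbig : ∃ T : ℝ, 0 < T ∧ 0 < g (c + T • v) := by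
      refine ⟨(|R| + 1) / ‖v‖, by positivity, ?_⟩
      by_contra hle
      have := hR (not_lt.1 hle : _ ≤ _)
      rw [mem_closedBall, dist_eq_norm, add_sub_cancel_left, norm_smul, Real.norm_eq_abs,
        abs_of_nonneg (by positivity), div_mul_cancel₀ _ (norm_ne_zero_iff.2 hv)] at this
      linarith [le_abs_self R]
    obtain ⟨T, hT, hgT⟩ := hbig
    have := intermediate_value_Icc hT.le
      (f := fun t : ℝ => g (c + t • v)) (by fun_prop)
    obtain ⟨t, ht, e⟩ := this (show (0 : ℝ) ∈ _ by simp [hc.le, hgT.le])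
    refine ⟨t, lt_of_le_of_ne ht.1 ?_, e⟩
    rintro rfl
    simp at e
    linarith
  have inside : ∀ x, g x ≤ 0 → ∀ t ∈ Ico (0 : ℝ) 1, g (c + t • (x - c)) < 0 := by
    intro x hx t ht
    have := hg.2 (mem_univ c) (mem_univ x) (sub_nonneg.2 ht.2.le) ht.1 (by ring)
    have e : (1 - t) • c + t • x = c + t • (x - c) := by module
    rw [e] at this
    simp only [smul_eq_mul] at this
    nlinarith [ht.1, ht.2]
  have hne0 : ∀ x, g x = 0 → x - c ≠ 0 := by
    intro x hx e
    rw [sub_eq_zero.1 e] at hx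
    linarith
  have hclosed : IsClosed {x | g x = 0} := isClosed_eq hgc continuous_const
  obtain ⟨v, hv⟩ := exists_ne (0 : E)
  refine ⟨hK.of_isClosed_subset hclosed fun x hx => le_of_eq hx, ?_,
    fun p => c + p.1 • (p.2 - c), by fun_prop, ?_, by simp, ?_⟩
  · obtain ⟨T, -, h⟩ := ray v hv
    exact ⟨_, h⟩
  · ext x
    constructor
    · rintro ⟨⟨t, y⟩, ⟨ht, hy⟩, rfl⟩
      simp only [mem_ofPred_eq] at hy ⊢
      rcases eq_or_lt_of_le ht.2 with h | h
      · simp only at h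
        rw [h]
        simp [hy]
      · exact (inside y hy.le t ⟨ht.1, h⟩).le
    · intro hx
      by_cases hxc : x = c
      · obtain ⟨T, -, h⟩ := ray v hv
        exact ⟨(0, _), ⟨by simp, h⟩, by simp [hxc]⟩
      · obtain ⟨T, hT, h⟩ := ray (x - c) (sub_ne_zero.2 hxc)
        have hT1 : 1 ≤ T := by
          by_contra hlt
          have := inside x hx T ⟨hT.le, not_le.1 hlt⟩
          linarith
        refine ⟨(T⁻¹, c + T • (x - c)), ⟨⟨by positivity, inv_le_one_of_one_le₀ hT1⟩, h⟩, ?_⟩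
        simp only [add_sub_cancel_left, smul_smul, inv_mul_cancel₀ hT.ne', one_smul]
        abel
  · have wlog : ∀ t ∈ Icc (0 : ℝ) 1, ∀ x, g x = 0 → ∀ t' ∈ Icc (0 : ℝ) 1, ∀ x', g x' = 0 →
        c + t • (x - c) = c + t' • (x' - c) → t ≤ t' := by
      intro t ht x hx t' ht' x' hx' e
      by_contra hlt
      rw [not_le] at hlt
      have htp : 0 < t := lt_of_le_of_lt ht'.1 hlt
      have e2 : c + (t' / t) • (x' - c) = x := by
        have e3 : t • (x - c) = t' • (x' - c) := add_left_cancel e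
        rw [div_eq_inv_mul, mul_smul, ← e3, smul_smul, inv_mul_cancel₀ htp.ne', one_smul]
        abel
      have := inside x' hx'.le (t' / t) ⟨div_nonneg ht'.1 htp.le, (div_lt_one htp).2 hlt⟩
      rw [e2] at this
      linarith
    intro t ht x hx t' ht' x' hx'
    simp only
    constructor
    · intro e
      have htt := le_antisymm (wlog t ht x hx t' ht' x' hx' e) (wlog t' ht' x' hx' t ht x hx e.symm)
      subst htt
      refine ⟨rfl, ?_⟩
      by_cases h0 : t = 0
      · exact Or.inl h0
      · right
        have := smul_right_injective E h0 (add_left_cancel e)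
        exact sub_left_injective this
    · rintro ⟨rfl, rfl | rfl⟩ <;> simp

end

section

variable {n : ℕ}

theorem pth_split_support {l₁ l₂ : List (Fin n)} {b : Fin n} (h : (l₁ ++ b :: l₂).Nodup)
    (f : Face n) : pth (l₁ ++ [b]) f = 0 ∨ pth (b :: l₂) f = 0 := by
  by_contra! hf
  have h1 := pth_edge hf.1
  have h2 := pth_edge hf.2
  have h3 : (b :: l₂).Nodup := (nodup_append.1 h).2.1
  have hc := pth_card (isChain_ne_of_nodup h3) hf.2
  have : f ⊆ {b} := by
    intro x hx
    rw [Finset.mem_singleton]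
    by_contra hxb
    have hx1 : x ∈ l₁ := by simpa [hxb] using h1 x hx
    exact (nodup_append.1 h).2.2 x hx1 x (h2 x hx) rfl
  have := Finset.card_le_card this
  simp [hc] at this

theorem pth_close (a b : Fin n) (l : List (Fin n)) :
    pth (a :: (l ++ [b] ++ [a])) = pth (a :: (l ++ [b])) + dl {b, a} := by
  have := pth_append (a :: l) b [a]
  simpa [pth] using this

theorem pth_close_support {a b : Fin n} {l : List (Fin n)} (hl : l ≠ [])
    (h : (a :: (l ++ [b])).Nodup) (f : Face n) :
    pth (a :: (l ++ [b])) f = 0 ∨ dl {b, a} f = 0 := by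
  by_cases hf : f = {a, b}
  · left
    rw [hf, pth_ne_chord hl h]
  · right
    rw [dl_apply, if_neg]
    rwa [Finset.pair_comm]

theorem add_ne_zero_of_support {c d : Chn n} (h : ∀ f, c f = 0 ∨ d f = 0) {f : Face n} :
    (c + d) f ≠ 0 ↔ c f ≠ 0 ∨ d f ≠ 0 := by
  rw [Pi.add_apply]
  rcases h f with e | e <;> simp [e]

theorem bd_ind_edge_mem {R : Fam n} (h3 : ∀ t ∈ R, t.card = 3) {c : Chn n}
    (hc : c ∈ ChS R) : bd c ∈ ChS (edg R) := by
  refine bd_mem_ChS hc fun t ht v hv => mem_edg.2 ⟨⟨t, ht, erase_subset _ _⟩, ?_⟩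
  rw [card_erase_of_mem hv, h3 t ht]

theorem edg_mono {R R' : Fam n} (h : R' ⊆ R) : edg R' ⊆ edg R := by
  intro e he
  obtain ⟨⟨t, ht, het⟩, h2⟩ := mem_edg.1 he
  exact mem_edg.2 ⟨⟨t, h ht, het⟩, h2⟩

/-- In an acyclic triangulated piece bounded by a simple cycle all vertices are connected. -/
theorem DData.reach {R : Fam n} (hR : DData R) {a b : Fin n} {l : List (Fin n)}
    (hnd : (a :: (l ++ [b])).Nodup) (hl : l ≠ []) (hb : bd (ind R) = pth (a :: (l ++ [b] ++ [a])))
    {y : Fin n} {t : Face n} (ht : t ∈ R) (hy : y ∈ t) :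
    ∃ p ∈ ChS (edg R), bd p = dl {y} + dl {a} := by
  classical
  let Q : Fin n → Prop := fun y => ∃ p ∈ ChS (edg R), bd p = dl {y} + dl {a}
  have hz : bd (ind R) ∈ ChS (edg R) := bd_ind_edge_mem hR.c3 (ind_mem_ChS subset_rfl)
  have hP : ∀ f, pth (a :: (l ++ [b])) f ≠ 0 → f ∈ edg R := by
    intro f hf
    refine mem_of_ChS hz ?_
    rw [hb, pth_close, add_ne_zero_of_support (pth_close_support hl hnd)]
    exact Or.inl hf
  have hQa : Q a := ⟨0, zero_mem _, by rw [map_zero, chn_add_self]⟩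
  have hlist : ∀ y ∈ a :: (l ++ [b]), Q y := by
    intro y hy
    rcases mem_cons.1 hy with rfl | hy
    · exact hQa
    obtain ⟨l₁, l₂, e⟩ := append_of_mem hy
    rw [e] at hnd hP
    have hs := pth_split_support (l₁ := a :: l₁) hnd
    have e2 : a :: (l₁ ++ y :: l₂) = (a :: l₁) ++ y :: l₂ := rfl
    rw [e2, pth_append] at hP
    have hnd' : (a :: (l₁ ++ [y])).Nodup := by
      refine hnd.sublist ?_
      simp
    refine ⟨pth (a :: (l₁ ++ [y])), fun f hf => ?_, ?_⟩
    · by_contra h'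
      exact hf (hP f ((add_ne_zero_of_support hs).2 (Or.inl h')))
    · rw [bd_pth (isChain_ne_of_nodup hnd'), add_comm]
  have hedge : ∀ e ∈ edg R, ∀ x ∈ e, ∀ y ∈ e, Q x → Q y := by
    intro e he x hx y hy hQ
    by_cases hxy : x = y
    · exact hxy ▸ hQ
    have e1 : e = {x, y} := by
      refine (Finset.eq_of_subset_of_card_le ?_ ?_).symm
      · intro z hz
        simp only [Finset.mem_insert, Finset.mem_singleton] at hz
        rcases hz with rfl | rfl <;> assumption
      · rw [(mem_edg.1 he).2, card_pair hxy]
    obtain ⟨p, hp, hpb⟩ := hQ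
    refine ⟨p + dl e, add_mem hp (dl_mem_ChS he), ?_⟩
    rw [map_add, hpb, e1, bd_dl_edge hxy]
    have := chn_add_self (dl ({x} : Face n))
    linear_combination this
  have htri : ∀ t ∈ R, ∀ x ∈ t, ∀ y ∈ t, Q x → Q y := by
    intro t ht x hx y hy hQ
    by_cases hxy : x = y
    · exact hxy ▸ hQ
    refine hedge {x, y} (mem_edg.2 ⟨⟨t, ht, ?_⟩, card_pair hxy⟩) x (by simp) y (by simp) hQ
    intro z hz
    simp only [Finset.mem_insert, Finset.mem_singleton] at hz
    rcases hz with rfl | rfl <;> assumption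
  let U := R.filter fun t => ∀ x ∈ t, ¬ Q x
  have hU3 : ∀ t ∈ U, t.card = 2 + 1 := fun t ht => hR.c3 t (mem_filter.1 ht).1
  have hU : bd (ind U) = 0 := by
    funext f
    by_cases hf : f ∈ edg R
    · obtain ⟨⟨t, ht, hft⟩, hf2⟩ := mem_edg.1 hf
      have hne : f.Nonempty := by
        rw [← card_pos]
        omega
      obtain ⟨x, hx⟩ := hne
      by_cases hQ : Q x
      · rw [bd_ind hU3 hf2, deg, card_eq_zero.2]
        · rfl
        · rw [filter_eq_empty_iff]
          intro t' ht' hft'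
          exact (mem_filter.1 ht').2 x (hft' hx) hQ
      · have e : bd (ind U) f = bd (ind R) f := by
          rw [bd_ind hU3 hf2, bd_ind hR.c3 hf2, deg, deg, Finset.filter_filter]
          congr 2
          refine Finset.filter_congr fun t' ht' => ?_
          refine ⟨fun h => h.2, fun h => ⟨fun z hz hQz => ?_, h⟩⟩
          exact hQ (htri t' ht' z hz x (h hx) hQz)
        rw [e, hb]
        by_contra h'
        refine hQ (hlist x ?_)
        have := pth_edge h' x hx
        simp only [mem_cons, mem_append] at this ⊢
        tauto
    · exact (bd_ind_edge_mem hR.c3 (ind_mem_ChS (filter_subset _ R))) f hf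
  have hU0 := hR.inj _ (ind_mem_ChS (filter_subset _ R)) hU
  by_contra hQ
  have htU : t ∈ U := mem_filter.2 ⟨ht, fun x hx hQx => hQ (htri t ht x hx y hy hQx)⟩
  have := congrFun hU0 t
  rw [ind, if_pos htU] at this
  exact one_ne_zero this

/-- Splitting a chain along a partition. -/
theorem exists_split_ChS {R R₁ : Fam n} {c : Chn n}
    (hc : c ∈ ChS R) : ∃ c₁ ∈ ChS R₁, ∃ c₂ ∈ ChS (R \ R₁), c = c₁ + c₂ := by
  refine ⟨fun s => if s ∈ R₁ then c s else 0, fun s hs => if_neg hs,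
    fun s => if s ∈ R₁ then 0 else c s, fun s hs => ?_, ?_⟩
  · simp only
    split_ifs with h1
    · rfl
    · exact hc s fun h2 => hs (Finset.mem_sdiff.2 ⟨h2, h1⟩)
  · funext s
    simp only [Pi.add_apply]
    split_ifs <;> simp

theorem eq_of_ChS_singleton {a v : Fin n} {E₁ E₂ : Fam n}
    (h : ∀ f ∈ E₁, f ∈ E₂ → f = {a, v}) {c : Chn n} (h1 : c ∈ ChS E₁) (h2 : c ∈ ChS E₂) :
    c = 0 ∨ c = dl {a, v} := by
  have hs : ∀ f, f ≠ {a, v} → c f = 0 := by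
    intro f hf
    by_contra h'
    exact hf (h f (mem_of_ChS h1 h') (mem_of_ChS h2 h'))
  by_cases h0 : c {a, v} = 0
  · left
    funext f
    by_cases hf : f = {a, v}
    · rw [hf, h0]; rfl
    · exact hs f hf
  · right
    funext f
    rw [dl_apply]
    split_ifs with hf
    · rw [hf, zmod2_eq_one_of_ne_zero h0]
    · exact hs f hf

theorem bd_chord_ne {a v : Fin n} (hav : a ≠ v) : bd (dl {a, v}) ≠ 0 := by
  rw [bd_dl_edge hav]
  intro h
  exact hav (dl_singleton_inj (chn_add_eq_zero.1 h))

theorem DData.split {R R₁ : Fam n} (hR : DData R) (h : R₁ ⊆ R) {a v : Fin n}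
    (hav : a ≠ v) (he : ∀ f ∈ edg R₁, f ∈ edg (R \ R₁) → f = {a, v}) : DData R₁ where
  c3 t ht := hR.c3 t (h ht)
  e2 e he := (deg_mono h e).trans (hR.e2 e he)
  inj c hc := hR.inj c (ChS_mono h hc)
  bnd z hz hb := by
    obtain ⟨c, hc, hcb⟩ := hR.bnd z (ChS_mono (edg_mono h) hz) hb
    obtain ⟨c₁, hc1, c₂, hc2, rfl⟩ := exists_split_ChS hc
    have h3 : ∀ t ∈ R \ R₁, t.card = 3 := fun t ht => hR.c3 t (Finset.mem_sdiff.1 ht).1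
    have e : bd c₂ = z + bd c₁ := by
      rw [← hcb, map_add]
      have := chn_add_self (bd c₁)
      linear_combination - this
    have m2 := bd_ind_edge_mem h3 hc2
    have m1 : bd c₂ ∈ ChS (edg R₁) := by
      rw [e]
      exact add_mem hz (bd_ind_edge_mem (fun t ht => hR.c3 t (h ht)) hc1)
    refine ⟨c₁, hc1, ?_⟩
    rcases eq_of_ChS_singleton he m1 m2 with h0 | h0
    · rw [h0] at e
      exact (chn_add_eq_zero.1 e.symm).symm
    · exact absurd (h0 ▸ bd_bd c₂) (bd_chord_ne hav)

theorem sdiff_sdiff_self' {R R₁ : Fam n} (h : R₁ ⊆ R) : R \ (R \ R₁) = R₁ :=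
  Finset.sdiff_sdiff_eq_self h

theorem ind_sdiff {R R₁ : Fam n} (h : R₁ ⊆ R) : ind (R \ R₁) = ind R + ind R₁ := by
  funext s
  simp only [ind, Pi.add_apply, Finset.mem_sdiff]
  by_cases h1 : s ∈ R₁
  · simp [h1, h h1, zmod2_add_self]
  · simp [h1]

/-- Cutting along a chord. -/
theorem DData.chord {R : Fam n} (hR : DData R) {a v : Fin n}
    {p q : List (Fin n)} (hp : p ≠ []) (hq : q ≠ []) (hnd : (a :: (p ++ v :: q)).Nodup)
    (hb : bd (ind R) = pth (a :: (p ++ v :: q ++ [a]))) (hav : {a, v} ∈ edg R) :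
    ∃ R₁ ⊆ R, R₁.Nonempty ∧ (R \ R₁).Nonempty ∧ DData R₁ ∧ DData (R \ R₁) ∧
      bd (ind R₁) = pth (a :: (p ++ [v] ++ [a])) ∧
      bd (ind (R \ R₁)) = pth (a :: (v :: q ++ [a])) ∧
      ∀ t₁ ∈ R₁, ∀ t₂ ∈ R \ R₁, t₁ ∩ t₂ ⊆ {a, v} := by
  have hnd1 : (a :: (p ++ [v])).Nodup := hnd.sublist (by simp)
  have hnd2 : (a :: v :: q).Nodup := hnd.sublist (by simp)
  have hne : a ≠ v := by
    intro e
    rw [e] at hnd2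
    simp at hnd2
  have hsplit : pth (a :: (p ++ v :: q ++ [a])) = pth (a :: (p ++ [v] ++ [a]))
      + pth (a :: (v :: q ++ [a])) := by
    have e1 := pth_append (a :: p) v (q ++ [a])
    have e2 := pth_append (a :: p) v [a]
    simp only [cons_append, List.append_assoc, nil_append] at e1 e2 ⊢
    rw [e1, e2, pth_cons_cons a v (q ++ [a])]
    simp only [pth, add_zero]
    rw [Finset.pair_comm v a]
    have := chn_add_self (dl ({a, v} : Face n))
    linear_combination - this
  have hz := bd_ind_edge_mem hR.c3 (ind_mem_ChS (subset_refl R))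
  have hnd1r : ∀ f, pth (a :: (p ++ [v])) f ≠ 0 → f ∈ edg R := by
    intro f hf
    refine mem_of_ChS hz ?_
    obtain ⟨q', b, rfl⟩ := eq_nil_or_concat q |>.resolve_left hq
    have e : p ++ v :: (q'.concat b) ++ [a] = (p ++ v :: q') ++ [b] ++ [a] := by simp
    have e' : p ++ v :: (q'.concat b) = (p ++ v :: q') ++ [b] := by simp
    rw [hb, e, pth_close, add_ne_zero_of_support (pth_close_support (by simp) (by rwa [← e']))]
    left
    rw [← e']
    have := pth_append (a :: p) v (q'.concat b)
    rw [cons_append] at this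
    rw [this, add_ne_zero_of_support (pth_split_support (l₁ := a :: p) hnd)]
    exact Or.inl hf
  have hz1 : pth (a :: (p ++ [v] ++ [a])) ∈ ChS (edg R) := by
    rw [pth_close]
    refine add_mem (fun f hf => ?_) (dl_mem_ChS (by rwa [Finset.pair_comm]))
    by_contra h'
    exact hf (hnd1r f h')
  obtain ⟨c, hc, hcb⟩ := hR.bnd _ hz1 (bd_pth_cycle (isChain_cycle hnd1 (by simp)))
  obtain ⟨R₁, hR1, rfl⟩ : ∃ R₁ ⊆ R, c = ind R₁ :=
    ⟨_, filter_subset _ _, eq_ind_of_ChS hc⟩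
  have hb2 : bd (ind (R \ R₁)) = pth (a :: (v :: q ++ [a])) := by
    rw [ind_sdiff hR1, map_add, hb, hcb, hsplit]
    have := chn_add_self (pth (a :: (p ++ [v] ++ [a])))
    linear_combination this
  have hl1 : 2 ≤ (p ++ [v]).length := by
    have := List.length_pos_iff.2 hp
    simp; omega
  have hl2 : 2 ≤ (v :: q).length := by
    have := List.length_pos_iff.2 hq
    simp; omega
  have hne1 : R₁.Nonempty := by
    by_contra h0
    rw [Finset.not_nonempty_iff_eq_empty] at h0
    refine pth_cycle_ne_zero hnd1 hl1 ?_
    rw [← hcb, h0]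
    have : ind (∅ : Fam n) = 0 := by funext s; simp [ind]
    rw [this, map_zero]
  have hne2 : (R \ R₁).Nonempty := by
    by_contra h0
    rw [Finset.not_nonempty_iff_eq_empty] at h0
    refine pth_cycle_ne_zero hnd2 hl2 ?_
    rw [← hb2, h0]
    have : ind (∅ : Fam n) = 0 := by funext s; simp [ind]
    rw [this, map_zero]
  have h31 : ∀ t ∈ R₁, t.card = 2 + 1 := fun t ht => hR.c3 t (hR1 ht)
  have h32 : ∀ t ∈ R \ R₁, t.card = 2 + 1 := fun t ht => hR.c3 t (Finset.mem_sdiff.1 ht).1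
  have hedge : ∀ f ∈ edg R₁, f ∈ edg (R \ R₁) → f = {a, v} := by
    intro f h1 h2
    obtain ⟨⟨t1, ht1, hft1⟩, hf2⟩ := mem_edg.1 h1
    obtain ⟨⟨t2, ht2, hft2⟩, -⟩ := mem_edg.1 h2
    have d1 : 1 ≤ deg R₁ f := card_pos.2 ⟨t1, mem_filter.2 ⟨ht1, hft1⟩⟩
    have d2 : 1 ≤ deg (R \ R₁) f := card_pos.2 ⟨t2, mem_filter.2 ⟨ht2, hft2⟩⟩
    have d3 : deg R₁ f + deg (R \ R₁) f = deg R f := by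
      rw [deg, deg, deg, ← card_union_of_disjoint, ← Finset.filter_union,
        union_sdiff_of_subset hR1]
      exact Finset.disjoint_filter_filter Finset.disjoint_sdiff
    have d4 := hR.e2 f hf2
    have e1 : pth (a :: (p ++ [v] ++ [a])) f ≠ 0 := by
      rw [← hcb, bd_ind h31 hf2, show deg R₁ f = 1 by omega]
      exact one_ne_zero
    have e2 : pth (a :: (v :: q ++ [a])) f ≠ 0 := by
      rw [← hb2, bd_ind h32 hf2, show deg (R \ R₁) f = 1 by omega]
      exact one_ne_zero
    refine Finset.eq_of_subset_of_card_le ?_ (by rw [hf2, card_pair hne])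
    intro x hx
    have m1 := pth_edge e1 x hx
    have m2 := pth_edge e2 x hx
    simp only [mem_cons, mem_append, not_mem_nil, or_false, Finset.mem_insert,
      Finset.mem_singleton] at m1 m2 ⊢
    by_contra! hx'
    have m1' : x ∈ p := by tauto
    have m2' : x ∈ q := by tauto
    have := (nodup_cons.1 hnd).2
    rw [nodup_append] at this
    exact this.2.2 x m1' x (by simp [m2']) rfl
  have hD1 := hR.split hR1 hne hedge
  have hD2 : DData (R \ R₁) := by
    refine hR.split Finset.sdiff_subset hne ?_
    rw [sdiff_sdiff_self' hR1]
    exact fun f h1 h2 => hedge f h2 h1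
  refine ⟨R₁, hR1, hne1, hne2, hD1, hD2, hcb, hb2, ?_⟩
  intro t1 ht1 t2 ht2 y hy
  rw [Finset.mem_inter] at hy
  by_contra hyav
  simp only [Finset.mem_insert, Finset.mem_singleton, not_or] at hyav
  obtain ⟨p1, hp1, hp1b⟩ := hD1.reach hnd1 hp hcb ht1 hy.1
  obtain ⟨p2, hp2, hp2b⟩ : ∃ p ∈ ChS (edg (R \ R₁)), bd p = dl {y} + dl {a} := by
    obtain ⟨q', b, rfl⟩ := eq_nil_or_concat q |>.resolve_left hq
    refine hD2.reach (l := v :: q') (b := b) (by simpa using hnd2) (by simp) ?_ ht2 hy.2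
    simpa using hb2
  obtain ⟨c, hc, hcb'⟩ := hR.bnd (p1 + p2) (add_mem (ChS_mono (edg_mono hR1) hp1)
    (ChS_mono (edg_mono Finset.sdiff_subset) hp2)) (by rw [map_add, hp1b, hp2b, chn_add_self])
  obtain ⟨c1, hc1, c2, hc2, rfl⟩ := exists_split_ChS hc
  have e : p1 + bd c1 = p2 + bd c2 := by
    rw [map_add] at hcb'
    have h1 := chn_add_self (bd c1)
    have h2 := chn_add_self p2
    linear_combination - hcb' + h1 - h2
  have m1 : p1 + bd c1 ∈ ChS (edg R₁) := add_mem hp1 (bd_ind_edge_mem h31 hc1)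
  have m2 : p1 + bd c1 ∈ ChS (edg (R \ R₁)) := e ▸ add_mem hp2 (bd_ind_edge_mem h32 hc2)
  have eb : bd (p1 + bd c1) = dl {y} + dl {a} := by rw [map_add, bd_bd, hp1b, add_zero]
  rcases eq_of_ChS_singleton hedge m1 m2 with h0 | h0
  · rw [h0, map_zero] at eb
    exact hyav.1 (dl_singleton_inj (chn_add_eq_zero.1 eb.symm))
  · rw [h0, bd_dl_edge hne] at eb
    have : dl ({v} : Face n) = dl {y} := by
      linear_combination eb
    exact hyav.2 (dl_singleton_inj this).symm

end

section

/-! ### Lenses -/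

/-- A path of slope `s` from `(-1, 0)` to `(1, 0)`. -/
def roof (s : ℝ) : Set (ℝ × ℝ) := {p | p.2 = s * (1 - |p.1|) ∧ |p.1| ≤ 1}

/-- The region between two roofs. -/
def lens (s s' : ℝ) : Set (ℝ × ℝ) :=
  {p | |p.1| ≤ 1 ∧ s * (1 - |p.1|) ≤ p.2 ∧ p.2 ≤ s' * (1 - |p.1|)}

theorem isClosed_roof (s : ℝ) : IsClosed (roof s) :=
  have h1 : IsClosed {p : ℝ × ℝ | p.2 = s * (1 - |p.1|)} := isClosed_eq (by fun_prop) (by fun_prop)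
  have h2 : IsClosed {p : ℝ × ℝ | |p.1| ≤ 1} := isClosed_le (by fun_prop) (by fun_prop)
  h1.inter h2

theorem isClosed_lens (s s' : ℝ) : IsClosed (lens s s') :=
  have h1 : IsClosed {p : ℝ × ℝ | |p.1| ≤ 1} := isClosed_le (by fun_prop) (by fun_prop)
  have h2 : IsClosed {p : ℝ × ℝ | s * (1 - |p.1|) ≤ p.2} :=
    isClosed_le (by fun_prop) (by fun_prop)
  have h3 : IsClosed {p : ℝ × ℝ | p.2 ≤ s' * (1 - |p.1|)} :=
    isClosed_le (by fun_prop) (by fun_prop)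
  h1.inter (h2.inter h3)

theorem isDisc_lens {s s' : ℝ} (hs : s ≤ 0) (hs' : 0 ≤ s') (hss : s < s') :
    IsDisc (lens s s') (roof s ∪ roof s') := by
  let g : ℝ × ℝ → ℝ := fun p => max (p.2 - s' * (1 - |p.1|)) (s * (1 - |p.1|) - p.2)
  have habs : ConvexOn ℝ univ fun p : ℝ × ℝ => |p.1| := by
    have := (convexOn_univ_norm (E := ℝ)).comp_linearMap (fst ℝ ℝ ℝ)
    simpa [Function.comp_def] using this
  have hsnd : ConvexOn ℝ univ fun p : ℝ × ℝ => p.2 :=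
    (snd ℝ ℝ ℝ).convexOn convex_univ
  have hsnd' : ConvexOn ℝ univ fun p : ℝ × ℝ => - p.2 :=
    (-(snd ℝ ℝ ℝ)).convexOn convex_univ
  have hg : ConvexOn ℝ univ g := by
    refine ConvexOn.sup ?_ ?_
    · have := (hsnd.add (habs.smul hs')).add_const (-s')
      refine this.congr fun p _ => ?_
      simp only [Pi.add_apply, smul_eq_mul]
      ring
    · have := (hsnd'.add (habs.smul (neg_nonneg.2 hs))).add_const s
      refine this.congr fun p _ => ?_
      simp only [Pi.add_apply, smul_eq_mul]
      ring
  have hgc : Continuous g := by fun_prop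
  have hc : g (0, (s + s') / 2) < 0 := by
    simp only [g, abs_zero, sub_zero, mul_one]
    rw [max_lt_iff]
    constructor <;> linarith
  have hbd : ∀ p, g p ≤ 0 → |p.1| ≤ 1 := by
    intro p hp
    rw [max_le_iff] at hp
    nlinarith
  have e1 : {p | g p ≤ 0} = lens s s' := by
    ext p
    constructor
    · intro hp
      have := hbd p hp
      have hp' : g p ≤ 0 := hp
      rw [max_le_iff] at hp'
      exact ⟨this, by linarith, by linarith⟩
    · rintro ⟨_, h1, h2⟩
      exact max_le (sub_nonpos.2 h2) (sub_nonpos.2 h1)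
  have e2 : {p | g p = 0} = roof s ∪ roof s' := by
    ext p
    constructor
    · intro hp
      have hp' : g p = 0 := hp
      have := hbd p hp'.le
      rcases max_choice (p.2 - s' * (1 - |p.1|)) (s * (1 - |p.1|) - p.2) with h | h
      · exact Or.inr ⟨by have : p.2 - s' * (1 - |p.1|) = 0 := h ▸ hp'
                         linarith, this⟩
      · exact Or.inl ⟨by have : s * (1 - |p.1|) - p.2 = 0 := h ▸ hp'
                         linarith, this⟩
    · rintro (⟨h1, h2⟩ | ⟨h1, h2⟩)
      · have : p.2 - s' * (1 - |p.1|) ≤ s * (1 - |p.1|) - p.2 := by rw [h1]; nlinarith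
        change max _ _ = _
        rw [max_eq_right this, h1, sub_self]
      · have : s * (1 - |p.1|) - p.2 ≤ p.2 - s' * (1 - |p.1|) := by rw [h1]; nlinarith
        change max _ _ = _
        rw [max_eq_left this, h1, sub_self]
  have hcomp : IsCompact {p | g p ≤ 0} := by
    refine isCompact_of_isClosed_isBounded (e1 ▸ isClosed_lens s s') ?_
    refine (isBounded_closedBall (x := (0 : ℝ × ℝ)) (r := 1 + s' - s)).subset ?_
    rw [e1]
    rintro ⟨x, y⟩ ⟨h1, h2, h3⟩
    simp only at h1 h2 h3
    have := abs_nonneg x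
    rw [mem_closedBall_zero_iff, Prod.norm_def, Real.norm_eq_abs, Real.norm_eq_abs]
    refine max_le (by linarith) (abs_le.2 ⟨by nlinarith, by nlinarith⟩)
  have := isDisc_convex hg hgc hc hcomp
  rwa [e1, e2] at this

theorem roof_inter {s s' : ℝ} (h : s ≠ s') {p : ℝ × ℝ} (h1 : p ∈ roof s) (h2 : p ∈ roof s') :
    p = (-1, 0) ∨ p = (1, 0) := by
  have : (s - s') * (1 - |p.1|) = 0 := by linarith [h1.1, h2.1]
  have h3 : |p.1| = 1 := by
    rcases mul_eq_zero.1 this with e | e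
    · exact absurd (sub_eq_zero.1 e) h
    · linarith
  have h4 : p.2 = 0 := by rw [h1.1, h3]; ring
  rcases (abs_eq zero_le_one).1 h3 with e | e
  · exact Or.inr (Prod.ext e h4)
  · exact Or.inl (Prod.ext e h4)

theorem chom_roof (s : ℝ) : CHom (fun p : ℝ × ℝ => (p.1 + 1) / 2) (roof s) (Icc 0 1) where
  cont := by fun_prop
  inj := by
    intro p hp q hq e
    have e1 : p.1 = q.1 := by simp only at e; linarith
    exact Prod.ext e1 (by rw [hp.1, hq.1, e1])
  img := by
    ext t
    constructor
    · rintro ⟨p, hp, rfl⟩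
      have := abs_le.1 hp.2
      exact ⟨by linarith, by linarith⟩
    · intro ht
      exact ⟨(2 * t - 1, s * (1 - |2 * t - 1|)), ⟨rfl, abs_le.2 ⟨by linarith [ht.1], by
        linarith [ht.2]⟩⟩, by simp⟩

section

variable {W : Type*} [TopologicalSpace W] {γ δ δ' X X' : Set W} {a b : W}

/-- `γ` is an arc from `a` to `b`. -/
def IsArc (γ : Set W) (a b : W) : Prop :=
  ∃ θ : ℝ → W, CHom θ (Icc 0 1) γ ∧ θ 0 = a ∧ θ 1 = b

theorem IsArc.symm (h : IsArc γ a b) : IsArc γ b a := by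
  obtain ⟨θ, h, h0, h1⟩ := h
  refine ⟨θ ∘ fun t => 1 - t, h.comp ⟨by fun_prop, fun x _ y _ e => by simpa using e, ?_⟩,
    by simp [h1], by simp [h0]⟩
  ext t
  constructor
  · rintro ⟨s, hs, rfl⟩
    exact ⟨by linarith [hs.2], by linarith [hs.1]⟩
  · intro ht
    exact ⟨1 - t, ⟨by linarith [ht.2], by linarith [ht.1]⟩, by simp⟩

theorem IsArc.trans {c : W} (h : IsArc γ a b) (h' : IsArc δ b c) (hi : γ ∩ δ ⊆ {b}) :
    IsArc (γ ∪ δ) a c := by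
  obtain ⟨θ, h, h0, h1⟩ := h
  obtain ⟨θ', h', h0', h1'⟩ := h'
  have c1 : CHom (fun t : ℝ => 2 * t) (Icc 0 (1 / 2)) (Icc 0 1) :=
    ⟨by fun_prop, fun x _ y _ e => by simpa using e, by
      ext t
      constructor
      · rintro ⟨s, hs, rfl⟩
        exact ⟨by linarith [hs.1], by linarith [hs.2]⟩
      · exact fun ht => ⟨t / 2, ⟨by linarith [ht.1], by linarith [ht.2]⟩, by simp; ring⟩⟩
  have c2 : CHom (fun t : ℝ => 2 * t - 1) (Icc (1 / 2) 1) (Icc 0 1) :=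
    ⟨by fun_prop, fun x _ y _ e => by simpa using e, by
      ext t
      constructor
      · rintro ⟨s, hs, rfl⟩
        exact ⟨by linarith [hs.1], by linarith [hs.2]⟩
      · exact fun ht => ⟨(t + 1) / 2, ⟨by linarith [ht.1], by linarith [ht.2]⟩, by simp; ring⟩⟩
  have key : ∀ x ∈ Icc (0 : ℝ) (1 / 2) ∩ Icc (1 / 2) 1, x = 1 / 2 :=
    fun x hx => le_antisymm hx.1.2 hx.2.1
  obtain ⟨f, hf, hf1, hf2⟩ := (h.comp c1).union (h'.comp c2) isClosed_Icc isClosed_Icc (by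
    intro x hx
    rw [key x hx]
    simp [h1, h0']) (by
    intro x hx
    rw [hi hx]
    exact ⟨1 / 2, ⟨by constructor <;> norm_num, by constructor <;> norm_num⟩, by simp [h1]⟩)
  rw [Icc_union_Icc_eq_Icc (by norm_num) (by norm_num)] at hf
  refine ⟨f, hf, ?_, ?_⟩
  · rw [hf1 (by simp)]
    simp [h0]
  · rw [hf2 (by constructor <;> norm_num)]
    simp only [Function.comp]
    norm_num [h1']

/-- Two arcs with common end points form a circle. -/
theorem chom_circle {θ θ' : ℝ → W} (h : CHom θ (Icc 0 1) γ) (h' : CHom θ' (Icc 0 1) δ)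
    (h0 : θ 0 = θ' 0) (h1 : θ 1 = θ' 1) (hi : γ ∩ δ ⊆ {θ 0, θ 1}) {s s' : ℝ} (hs : s ≠ s') :
    ∃ ρ : ℝ × ℝ → W, CHom ρ (roof s ∪ roof s') (γ ∪ δ) ∧
      EqOn ρ (fun p => θ ((p.1 + 1) / 2)) (roof s) ∧
      EqOn ρ (fun p => θ' ((p.1 + 1) / 2)) (roof s') := by
  refine (h.comp (chom_roof s)).union (h'.comp (chom_roof s')) (isClosed_roof s)
    (isClosed_roof s') ?_ ?_
  · intro p hp
    rcases roof_inter hs hp.1 hp.2 with rfl | rfl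
    · simp [h0]
    · simp [h1]
  · intro x hx
    rcases hi hx with rfl | rfl
    · exact ⟨(-1, 0), ⟨by simp [roof], by simp [roof]⟩, by simp⟩
    · exact ⟨(1, 0), ⟨by simp [roof], by simp [roof]⟩, by simp⟩

/-- Two discs meeting in a common boundary arc form a disc. -/
theorem IsDisc.glue [T2Space W] (hγ : IsArc γ a b) (hδ : IsArc δ a b) (hδ' : IsArc δ' a b)
    (h : IsDisc X (γ ∪ δ)) (h' : IsDisc X' (γ ∪ δ')) (hi : γ ∩ δ ⊆ {a, b}) (hi' : γ ∩ δ' ⊆ {a, b})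
    (hX : X ∩ X' ⊆ γ) : IsDisc (X ∪ X') (δ ∪ δ') := by
  obtain ⟨θ, hθ, rfl, rfl⟩ := hγ
  obtain ⟨η, hη, h0, h1⟩ := hδ
  obtain ⟨η', hη', h0', h1'⟩ := hδ'
  obtain ⟨ρ, hρ, hρ1, hρ2⟩ := chom_circle hθ hη h0.symm h1.symm hi (s := 0) (s' := 1) (by norm_num)
  obtain ⟨ρ', hρ', hρ1', hρ2'⟩ := chom_circle hθ hη' h0'.symm h1'.symm hi' (s := 0) (s' := -1)
    (by norm_num)
  have hL := isDisc_lens (s := 0) (s' := 1) le_rfl (by norm_num) (by norm_num)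
  have hL' := isDisc_lens (s := -1) (s' := 0) (by norm_num) le_rfl (by norm_num)
  rw [union_comm] at hL'
  obtain ⟨g, hg, hgρ⟩ := hL.extend h hρ
  obtain ⟨g', hg', hgρ'⟩ := hL'.extend h' hρ'
  have hgr : EqOn g (fun p => θ ((p.1 + 1) / 2)) (roof 0) := fun p hp =>
    (hgρ (Or.inl hp)).trans (hρ1 hp)
  have hgr' : EqOn g' (fun p => θ ((p.1 + 1) / 2)) (roof 0) := fun p hp =>
    (hgρ' (Or.inl hp)).trans (hρ1' hp)
  have hsub : lens 0 1 ∩ lens (-1) 0 = roof 0 := by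
    ext p
    simp only [lens, roof, mem_inter_iff, mem_ofPred_eq]
    constructor
    · rintro ⟨⟨h1, h2, h3⟩, h4, h5, h6⟩
      exact ⟨by linarith, h1⟩
    · rintro ⟨h1, h2⟩
      refine ⟨⟨h2, ?_, ?_⟩, h2, ?_, ?_⟩ <;> linarith
  obtain ⟨f, hf, hf1, hf2⟩ := hg.union hg' (isClosed_lens _ _) (isClosed_lens _ _) (by
    rw [hsub]
    exact fun p hp => (hgr hp).trans (hgr' hp).symm) (by
    rw [hsub, (hgr).image_eq]
    refine hX.trans ?_
    rw [← (hθ.comp (chom_roof 0)).img]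
    rfl)
  have hun : lens 0 1 ∪ lens (-1) 0 = lens (-1) 1 := by
    ext p
    simp only [lens, mem_union, mem_ofPred_eq]
    constructor
    · rintro (⟨h1, h2, h3⟩ | ⟨h4, h5, h6⟩)
      · exact ⟨h1, by linarith, h3⟩
      · exact ⟨h4, h5, by linarith⟩
    · rintro ⟨h1, h2, h3⟩
      rcases le_total 0 p.2 with h | h
      · exact Or.inl ⟨h1, by linarith, h3⟩
      · exact Or.inr ⟨h1, h2, by linarith⟩
  rw [hun] at hf
  have := (isDisc_lens (s := -1) (s' := 1) (by norm_num) (by norm_num) (by norm_num)).map hf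
  have e1 : f '' roof 1 = δ := by
    rw [← (hη.comp (chom_roof 1)).img]
    refine image_congr fun p hp => ?_
    rw [hf1 (hL.subset (Or.inr hp)), hgρ (Or.inr hp), hρ2 hp]
    rfl
  have e2 : f '' roof (-1) = δ' := by
    rw [← (hη'.comp (chom_roof (-1))).img]
    refine image_congr fun p hp => ?_
    rw [hf2 (hL'.subset (Or.inr hp)), hgρ' (Or.inr hp), hρ2' hp]
    rfl
  rwa [image_union, e1, e2, union_comm δ'] at this

/-- Two discs with common boundary form a sphere. -/
theorem IsDisc.sphere (hγ : IsArc γ a b) (hδ : IsArc δ a b) (hi : γ ∩ δ ⊆ {a, b})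
    (h : IsDisc X (γ ∪ δ)) (h' : IsDisc X' (γ ∪ δ)) (hX : X ∩ X' ⊆ γ ∪ δ) :
    ∃ f : R3 → W, CHom f (sphere 0 1) (X ∪ X') := by
  obtain ⟨θ, hθ, rfl, rfl⟩ := hγ
  obtain ⟨η, hη, h0, h1⟩ := hδ
  obtain ⟨ρ, hρ, -, -⟩ := chom_circle hθ hη h0.symm h1.symm hi (s := -1) (s' := 1) (by norm_num)
  have hL := isDisc_lens (s := -1) (s' := 1) (by norm_num) (by norm_num) (by norm_num)
  obtain ⟨g, hg, hgρ⟩ := hL.extend h hρ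
  obtain ⟨g', hg', hgρ'⟩ := hL.extend h' hρ
  let O : ℝ → Set ((ℝ × ℝ) × ℝ) := fun ε => {p | ε * p.2 = 1 - |p.1.1| - |p.1.2| ∧ 0 ≤ ε * p.2}
  have hO : ∀ ε, IsClosed (O ε) := fun ε =>
    have h1 : IsClosed {p : (ℝ × ℝ) × ℝ | ε * p.2 = 1 - |p.1.1| - |p.1.2|} :=
      isClosed_eq (by fun_prop) (by fun_prop)
    have h2 : IsClosed {p : (ℝ × ℝ) × ℝ | 0 ≤ ε * p.2} :=
      isClosed_le (by fun_prop) (by fun_prop)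
    h1.inter h2
  have hfst : ∀ ε : ℝ, ε * ε = 1 → CHom Prod.fst (O ε) (lens (-1) 1) := by
    intro ε hε
    refine ⟨by fun_prop, ?_, ?_⟩
    · intro p hp q hq e
      refine Prod.ext e ?_
      have : ε * p.2 = ε * q.2 := by rw [hp.1, hq.1, e]
      calc p.2 = ε * (ε * p.2) := by rw [← mul_assoc, hε, one_mul]
        _ = q.2 := by rw [this, ← mul_assoc, hε, one_mul]
    · ext q
      constructor
      · rintro ⟨p, ⟨h1, h2⟩, rfl⟩
        have h3 := abs_nonneg p.1.2
        have h5 := neg_abs_le p.1.2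
        have h6 := le_abs_self p.1.2
        exact ⟨by linarith, by linarith, by linarith⟩
      · rintro ⟨h1, h2, h3⟩
        have h4 : |q.2| ≤ 1 - |q.1| := abs_le.2 ⟨by linarith, by linarith⟩
        refine ⟨(q, ε * (1 - |q.1| - |q.2|)), ⟨?_, ?_⟩, rfl⟩
        · simp only
          rw [← mul_assoc, hε, one_mul]
        · simp only
          rw [← mul_assoc, hε]
          linarith
  have hmid : ∀ p ∈ O 1 ∩ O (-1), p.1 ∈ roof (-1) ∪ roof 1 := by
    rintro p ⟨⟨h1, h2⟩, h3, h4⟩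
    have h5 : p.2 = 0 := by linarith
    have h6 : |p.1.2| = 1 - |p.1.1| := by rw [h5] at h1; linarith
    have h7 := abs_nonneg p.1.2
    rcases abs_choice p.1.2 with e | e
    · exact Or.inr ⟨by linarith, by linarith⟩
    · exact Or.inl ⟨by linarith, by linarith⟩
  obtain ⟨f, hf, -, -⟩ := (hg.comp (hfst 1 (by norm_num))).union (hg'.comp (hfst (-1) (by norm_num)))
    (hO 1) (hO (-1)) (by
      intro p hp
      have := hmid p hp
      simp only [Function.comp]
      rw [hgρ this, hgρ' this]) (by
      intro x hx
      have hx' := hX hx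
      rw [← hρ.img] at hx'
      obtain ⟨p, hp, rfl⟩ := hx'
      refine ⟨(p, 0), ?_, hgρ hp⟩
      have : |p.2| = 1 - |p.1| := by
        rcases hp with ⟨h1, h2⟩ | ⟨h1, h2⟩
        · rw [h1, neg_one_mul, abs_neg, abs_of_nonneg (by linarith)]
        · rw [h1, one_mul, abs_of_nonneg (by linarith)]
      refine ⟨⟨?_, ?_⟩, ?_, ?_⟩ <;> simp [this])
  let nm : R3 → ℝ := fun x => |x 0| + |x 1| + |x 2|
  have hnm : ∀ x, x ≠ 0 → 0 < nm x := by
    intro x hx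
    by_contra hle
    apply hx
    have h0 := abs_nonneg (x 0)
    have h1 := abs_nonneg (x 1)
    have h2 := abs_nonneg (x 2)
    simp only [nm, not_lt] at hle
    ext i
    fin_cases i
    · exact abs_eq_zero.1 (le_antisymm (show |x 0| ≤ 0 by linarith) (abs_nonneg _))
    · exact abs_eq_zero.1 (le_antisymm (show |x 1| ≤ 0 by linarith) (abs_nonneg _))
    · exact abs_eq_zero.1 (le_antisymm (show |x 2| ≤ 0 by linarith) (abs_nonneg _))
  have hnmc : Continuous nm := by fun_prop
  have hs0 : ∀ x ∈ sphere (0 : R3) 1, x ≠ 0 := by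
    rintro x hx rfl
    simp at hx
  have hoct : CHom (fun x : R3 => (((x 0 / nm x, x 1 / nm x), x 2 / nm x) : (ℝ × ℝ) × ℝ))
      (sphere 0 1) (O 1 ∪ O (-1)) := by
    have e : ∀ p : (ℝ × ℝ) × ℝ, p ∈ O 1 ∪ O (-1) ↔ |p.1.1| + |p.1.2| + |p.2| = 1 := by
      intro p
      constructor
      · rintro (⟨h1, h2⟩ | ⟨h1, h2⟩)
        · rw [abs_of_nonneg (a := p.2) (by linarith)]
          linarith
        · rw [abs_of_nonpos (a := p.2) (by linarith)]
          linarith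
      · intro h
        rcases le_total 0 p.2 with h' | h'
        · rw [abs_of_nonneg h'] at h
          exact Or.inl ⟨by linarith, by linarith⟩
        · rw [abs_of_nonpos h'] at h
          exact Or.inr ⟨by linarith, by linarith⟩
    refine ⟨?_, ?_, ?_⟩
    · have hd : ∀ i : Fin 3, ContinuousOn (fun x : R3 => x i / nm x) (sphere 0 1) :=
        fun i => ContinuousOn.div (by fun_prop) hnmc.continuousOn
          fun x hx => (hnm x (hs0 x hx)).ne'
      exact ((hd 0).prodMk (hd 1)).prodMk (hd 2)
    · intro x hx y hy e
      simp only [Prod.mk.injEq] at e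
      have hx0 := hnm x (hs0 x hx)
      have hy0 := hnm y (hs0 y hy)
      have key : ∀ i : Fin 3, x i = (nm x / nm y) * y i := by
        have : ∀ i : Fin 3, x i / nm x = y i / nm y := by
          intro i
          fin_cases i
          · exact e.1.1
          · exact e.1.2
          · exact e.2
        intro i
        have h := this i
        field_simp at h ⊢
        linarith
      have hxy : x = (nm x / nm y) • y := by
        ext i
        simpa using key i
      have h3 : ‖x‖ = (nm x / nm y) * ‖y‖ := by
        conv_lhs => rw [hxy]
        rw [norm_smul, Real.norm_eq_abs, abs_of_pos (by positivity)]
      rw [mem_sphere_zero_iff_norm.1 hx, mem_sphere_zero_iff_norm.1 hy, mul_one] at h3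
      rw [hxy, ← h3, one_smul]
    · ext p
      rw [e]
      constructor
      · rintro ⟨x, hx, rfl⟩
        have hx0 := hnm x (hs0 x hx)
        simp only [abs_div, abs_of_pos hx0]
        rw [← add_div, ← add_div]
        exact div_self hx0.ne'
      · intro hp
        let x : R3 := !₂[p.1.1, p.1.2, p.2]
        have hxn : nm x = 1 := by simpa [nm, x] using hp
        have hx0 : x ≠ 0 := by
          intro h
          rw [h] at hxn
          simp [nm] at hxn
        have hx1 : 0 < ‖x‖ := norm_pos_iff.2 hx0
        have hsm : nm (‖x‖⁻¹ • x) = ‖x‖⁻¹ := by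
          have : nm (‖x‖⁻¹ • x) = ‖x‖⁻¹ * nm x := by
            simp only [nm, PiLp.smul_apply, smul_eq_mul, abs_mul, abs_of_pos (inv_pos.2 hx1)]
            ring
          rw [this, hxn, mul_one]
        refine ⟨‖x‖⁻¹ • x, ?_, ?_⟩
        · rw [mem_sphere_zero_iff_norm, norm_smul, norm_inv, norm_norm, inv_mul_cancel₀ hx1.ne']
        · have : ∀ i : Fin 3, (‖x‖⁻¹ • x) i / ‖x‖⁻¹ = x i := by
            intro i
            simp only [PiLp.smul_apply, smul_eq_mul]
            field_simp
          simp only [hsm, this]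
          simp [x]
  exact ⟨_, hf.comp hoct⟩

end

end

section

variable {n : ℕ}

/-! ### Geometric realization -/

/-- The closed face spanned by a finite set of vertices. -/
def fcs (s : Face n) : Set (Fin n → ℝ) :=
  {w | (∀ v, 0 ≤ w v) ∧ ∑ v, w v = 1 ∧ ∀ v ∉ s, w v = 0}

/-- The realization of a family of faces. -/
def rl (F : Fam n) : Set (Fin n → ℝ) := ⋃ s ∈ F, fcs s

/-- The realization of the support of a chain. -/
def BS (c : Chn n) : Set (Fin n → ℝ) := ⋃ e ∈ {e | c e ≠ 0}, fcs e

theorem mem_rl {F : Fam n} {w : Fin n → ℝ} : w ∈ rl F ↔ ∃ s ∈ F, w ∈ fcs s := by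
  simp [rl]

theorem mem_BS {c : Chn n} {w : Fin n → ℝ} : w ∈ BS c ↔ ∃ e, c e ≠ 0 ∧ w ∈ fcs e := by
  simp [BS]

theorem fcs_inter {s t : Face n} : fcs s ∩ fcs t = fcs (s ∩ t) := by
  ext w
  simp only [fcs, mem_inter_iff, mem_ofPred_eq, Finset.mem_inter, not_and_or]
  constructor
  · rintro ⟨⟨h1, h2, h3⟩, -, -, h4⟩
    exact ⟨h1, h2, fun v hv => hv.elim (h3 v) (h4 v)⟩
  · rintro ⟨h1, h2, h3⟩
    exact ⟨⟨h1, h2, fun v hv => h3 v (Or.inl hv)⟩, h1, h2, fun v hv => h3 v (Or.inr hv)⟩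

theorem fcs_mono {s t : Face n} (h : s ⊆ t) : fcs s ⊆ fcs t :=
  fun _ hw => ⟨hw.1, hw.2.1, fun v hv => hw.2.2 v fun h' => hv (h h')⟩

theorem sum_fcs {s : Face n} {w : Fin n → ℝ} (hw : w ∈ fcs s) : ∑ v ∈ s, w v = 1 := by
  rw [← hw.2.1]
  exact Finset.sum_subset (Finset.subset_univ s) fun v _ hv => hw.2.2 v hv

theorem nonempty_of_mem_fcs {s : Face n} {w : Fin n → ℝ} (hw : w ∈ fcs s) : s.Nonempty := by
  rw [Finset.nonempty_iff_ne_empty]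
  rintro rfl
  simpa using sum_fcs hw

theorem fcs_singleton {a : Fin n} {w : Fin n → ℝ} (hw : w ∈ fcs {a}) : w = Pi.single a 1 := by
  have := sum_fcs hw
  rw [sum_singleton] at this
  funext v
  by_cases hv : v = a
  · subst hv; simp [this]
  · rw [hw.2.2 v (by simpa using hv), Pi.single_eq_of_ne hv]

theorem single_mem_fcs {s : Face n} {a : Fin n} (h : a ∈ s) :
    (Pi.single a 1 : Fin n → ℝ) ∈ fcs s := by
  refine ⟨fun v => ?_, by simp, fun v hv => Pi.single_eq_of_ne (fun e => hv (by rw [e]; exact h)) _⟩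
  by_cases hv : v = a
  · subst hv; simp
  · rw [Pi.single_eq_of_ne hv]

theorem isClosed_fcs (s : Face n) : IsClosed (fcs s) := by
  have : fcs s = (⋂ v, {w | 0 ≤ w v}) ∩ ({w | ∑ v, w v = 1} ∩ ⋂ v, ⋂ (_ : v ∉ s), {w | w v = 0}) := by
    ext w
    simp [fcs]
  rw [this]
  exact (isClosed_iInter fun v => isClosed_le continuous_const (continuous_apply v)).inter
    ((isClosed_eq (by fun_prop) continuous_const).inter (isClosed_iInter fun v =>
      isClosed_iInter fun _ => isClosed_eq (continuous_apply v) continuous_const))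

theorem isCompact_fcs (s : Face n) : IsCompact (fcs s) := by
  refine isCompact_of_isClosed_isBounded (isClosed_fcs s)
    ((isBounded_closedBall (x := (0 : Fin n → ℝ)) (r := 1)).subset fun w hw => ?_)
  rw [mem_closedBall_zero_iff, pi_norm_le_iff_of_nonneg zero_le_one]
  intro v
  rw [Real.norm_eq_abs, abs_of_nonneg (hw.1 v), ← hw.2.1]
  exact single_le_sum (fun v _ => hw.1 v) (Finset.mem_univ v)

theorem isCompact_rl (F : Fam n) : IsCompact (rl F) :=
  F.isCompact_biUnion fun s _ => isCompact_fcs s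

theorem mem_fcs_pair {a b : Fin n} (hab : a ≠ b) {w : Fin n → ℝ} (hw : w ∈ fcs {a, b}) :
    w = (1 - w b) • Pi.single a 1 + w b • Pi.single b 1 := by
  have := sum_fcs hw
  rw [sum_pair hab] at this
  funext v
  by_cases hva : v = a
  · subst hva
    simp [hab]
    linarith
  · by_cases hvb : v = b
    · subst hvb
      simp [hva]
    · rw [hw.2.2 v (by simp [hva, hvb])]
      simp [hva, hvb]

theorem isArc_fcs {a b : Fin n} (hab : a ≠ b) :
    IsArc (fcs {a, b}) (Pi.single a 1) (Pi.single b 1) := by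
  refine ⟨fun t => (1 - t) • Pi.single a 1 + t • Pi.single b 1, ⟨by fun_prop, ?_, ?_⟩, by simp,
    by simp⟩
  · intro t _ t' _ e
    have := congrFun e b
    simpa [hab.symm] using this
  · ext w
    constructor
    · rintro ⟨t, ht, rfl⟩
      refine ⟨fun v => ?_, ?_, ?_⟩
      · have h1 := (single_mem_fcs (s := {a}) (a := a) (by simp)).1 v
        have h2 := (single_mem_fcs (s := {b}) (a := b) (by simp)).1 v
        have h3 := sub_nonneg.2 ht.2
        have h4 := ht.1
        simp only [Pi.add_apply, Pi.smul_apply, smul_eq_mul]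
        positivity
      · simp [sum_add_distrib, ← mul_sum]
      · intro v hv
        simp only [Finset.mem_insert, Finset.mem_singleton, not_or] at hv
        simp [hv.1, hv.2]
    · intro hw
      have h1 := sum_fcs hw
      rw [sum_pair hab] at h1
      exact ⟨w b, ⟨hw.1 b, by linarith [hw.1 a]⟩, (mem_fcs_pair hab hw).symm⟩

theorem fcs_inter_edges {a b : Fin n} {f : Face n} (hab : a ≠ b) (hf : f.card = 2)
    (hne : f ≠ {a, b}) {w : Fin n → ℝ} (h1 : w ∈ fcs {a, b}) (h2 : w ∈ fcs f) :
    w = Pi.single a 1 ∨ w = Pi.single b 1 := by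
  have h : w ∈ fcs ({a, b} ∩ f) := fcs_inter ▸ ⟨h1, h2⟩
  by_cases ha : a ∈ f
  · have hb : b ∉ f := by
      intro hb
      refine hne (Finset.eq_of_subset_of_card_le ?_ ?_).symm
      · intro x hx
        simp only [Finset.mem_insert, Finset.mem_singleton] at hx
        rcases hx with rfl | rfl <;> assumption
      · rw [hf, card_pair hab]
    left
    refine fcs_singleton (fcs_mono ?_ h)
    intro x hx
    simp only [Finset.mem_inter, Finset.mem_insert, Finset.mem_singleton] at hx ⊢
    rcases hx with ⟨rfl | rfl, hx⟩
    · rfl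
    · exact absurd hx hb
  · right
    refine fcs_singleton (fcs_mono ?_ h)
    intro x hx
    simp only [Finset.mem_inter, Finset.mem_insert, Finset.mem_singleton] at hx ⊢
    rcases hx with ⟨rfl | rfl, hx⟩
    · exact absurd hx ha
    · rfl

theorem BS_add {c d : Chn n} (h : ∀ f, c f = 0 ∨ d f = 0) : BS (c + d) = BS c ∪ BS d := by
  ext w
  simp only [mem_union, mem_BS, add_ne_zero_of_support h]
  constructor
  · rintro ⟨e, h1 | h1, h2⟩
    exacts [Or.inl ⟨e, h1, h2⟩, Or.inr ⟨e, h1, h2⟩]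
  · rintro (⟨e, h1, h2⟩ | ⟨e, h1, h2⟩)
    exacts [⟨e, Or.inl h1, h2⟩, ⟨e, Or.inr h1, h2⟩]

theorem BS_dl (s : Face n) : BS (dl s) = fcs s := by
  ext w
  simp [mem_BS, dl_apply]

theorem isArc_pth {a b : Fin n} {l : List (Fin n)} (h : (a :: (l ++ [b])).Nodup) :
    IsArc (BS (pth (a :: (l ++ [b])))) (Pi.single a 1) (Pi.single b 1) := by
  induction l generalizing a with
  | nil =>
    have hab : a ≠ b := by simpa using h
    simp only [nil_append, pth, add_zero, BS_dl]
    exact isArc_fcs hab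
  | cons x l ih =>
    have hx := (nodup_cons.1 h).2
    have hax : a ≠ x := by
      rintro rfl
      simp at h
    have hs : ∀ f, dl {a, x} f = 0 ∨ pth (x :: (l ++ [b])) f = 0 := by
      intro f
      by_contra! hf
      rw [dl_apply] at hf
      have : f = {a, x} := by
        by_contra h'
        exact hf.1 (if_neg h')
      exact (nodup_cons.1 h).1 (pth_edge hf.2 a (by rw [this]; simp))
    rw [cons_append, pth_cons_cons, BS_add hs, BS_dl]
    refine (isArc_fcs hax).trans (ih hx) ?_
    rintro w ⟨h1, h2⟩
    obtain ⟨f, hf, hwf⟩ := mem_BS.1 h2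
    have h3 : w ∈ fcs ({a, x} ∩ f) := fcs_inter ▸ ⟨h1, hwf⟩
    refine fcs_singleton (fcs_mono ?_ h3)
    intro y hy
    simp only [Finset.mem_inter, Finset.mem_insert, Finset.mem_singleton] at hy ⊢
    rcases hy with ⟨rfl | rfl, hy⟩
    · exact absurd (pth_edge hf y hy) (nodup_cons.1 h).1
    · rfl

theorem BS_close {a b : Fin n} {l : List (Fin n)} (hl : l ≠ []) (h : (a :: (l ++ [b])).Nodup) :
    BS (pth (a :: (l ++ [b] ++ [a]))) = fcs {a, b} ∪ BS (pth (a :: (l ++ [b]))) := by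
  rw [pth_close, BS_add (pth_close_support hl h), BS_dl, union_comm, Finset.pair_comm]

theorem isDisc_triangle {a b c : Fin n} (h : [a, b, c].Nodup) :
    IsDisc (fcs {a, b, c}) (BS (pth [a, b, c, a])) := by
  have hab : a ≠ b := by rintro rfl; simp at h
  have hac : a ≠ c := by rintro rfl; simp at h
  have hbc : b ≠ c := by rintro rfl; simp at h
  let g : ℝ × ℝ → ℝ := fun p => max (max (-p.1) (-p.2)) (p.1 + p.2 - 1)
  have hfst : ConvexOn ℝ univ fun p : ℝ × ℝ => - p.1 :=
    (-(fst ℝ ℝ ℝ)).convexOn convex_univ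
  have hsnd : ConvexOn ℝ univ fun p : ℝ × ℝ => - p.2 :=
    (-(snd ℝ ℝ ℝ)).convexOn convex_univ
  have hadd : ConvexOn ℝ univ fun p : ℝ × ℝ => p.1 + p.2 :=
    (fst ℝ ℝ ℝ + snd ℝ ℝ ℝ).convexOn convex_univ
  have hg : ConvexOn ℝ univ g := (hfst.sup hsnd).sup (hadd.add_const (-1))
  have hgc : Continuous g := by fun_prop
  have hle : ∀ p, g p ≤ 0 ↔ 0 ≤ p.1 ∧ 0 ≤ p.2 ∧ p.1 + p.2 ≤ 1 := by
    intro p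
    simp only [g, max_le_iff]
    grind
  have heq : ∀ p, g p = 0 ↔ g p ≤ 0 ∧ (p.1 = 0 ∨ p.2 = 0 ∨ p.1 + p.2 = 1) := by
    intro p
    simp only [g]
    grind
  have hcomp : IsCompact {p | g p ≤ 0} := by
    refine isCompact_of_isClosed_isBounded (isClosed_le hgc continuous_const)
      ((isBounded_closedBall (x := (0 : ℝ × ℝ)) (r := 1)).subset ?_)
    intro p hp
    obtain ⟨h1, h2, h3⟩ := (hle p).1 hp
    rw [mem_closedBall_zero_iff, Prod.norm_def, Real.norm_eq_abs, Real.norm_eq_abs,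
      abs_of_nonneg h1, abs_of_nonneg h2]
    exact max_le (by linarith) (by linarith)
  have hd := isDisc_convex hg hgc (c := (1 / 4, 1 / 4)) (by simp only [g]; norm_num) hcomp
  let f : ℝ × ℝ → (Fin n → ℝ) := fun p =>
    (1 - p.1 - p.2) • Pi.single a 1 + p.1 • Pi.single b 1 + p.2 • Pi.single c 1
  have fa : ∀ p, f p a = 1 - p.1 - p.2 := fun p => by simp [f, hab, hac]
  have fb : ∀ p, f p b = p.1 := fun p => by simp [f, hab.symm, hbc]
  have fc' : ∀ p, f p c = p.2 := fun p => by simp [f, hac.symm, hbc.symm]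
  have fo : ∀ p, ∀ v ∉ ({a, b, c} : Face n), f p v = 0 := by
    intro p v hv
    simp only [Finset.mem_insert, Finset.mem_singleton, not_or] at hv
    simp [f, hv.1, hv.2.1, hv.2.2]
  have hmem : ∀ p, g p ≤ 0 → f p ∈ fcs {a, b, c} := by
    intro p hp
    obtain ⟨h1, h2, h3⟩ := (hle p).1 hp
    refine ⟨fun v => ?_, ?_, fo p⟩
    · by_cases hv : v ∈ ({a, b, c} : Face n)
      · simp only [Finset.mem_insert, Finset.mem_singleton] at hv
        rcases hv with rfl | rfl | rfl
        · rw [fa]; linarith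
        · rw [fb]; exact h1
        · rw [fc']; exact h2
      · rw [fo p v hv]
    · simp [f, sum_add_distrib, ← mul_sum]; ring
  have hinv : ∀ w ∈ fcs {a, b, c}, g (w b, w c) ≤ 0 ∧ f (w b, w c) = w := by
    intro w hw
    have h1 := sum_fcs hw
    rw [sum_insert (by simp [hab, hac]), sum_pair hbc] at h1
    refine ⟨(hle _).2 ⟨hw.1 b, hw.1 c, by simp only; linarith [hw.1 a]⟩, ?_⟩
    funext v
    by_cases hv : v ∈ ({a, b, c} : Face n)
    · simp only [Finset.mem_insert, Finset.mem_singleton] at hv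
      rcases hv with rfl | rfl | rfl
      · rw [fa]; simp only; linarith
      · rw [fb]
      · rw [fc']
    · rw [fo _ v hv, hw.2.2 v hv]
  have hf : CHom f {p | g p ≤ 0} (fcs {a, b, c}) := by
    refine ⟨by fun_prop, ?_, ?_⟩
    · intro p _ q _ e
      exact Prod.ext (by rw [← fb p, ← fb q, e]) (by rw [← fc' p, ← fc' q, e])
    · ext w
      constructor
      · rintro ⟨p, hp, rfl⟩
        exact hmem p hp
      · exact fun hw => ⟨_, (hinv w hw).1, (hinv w hw).2⟩
  have hBS : BS (pth [a, b, c, a]) = fcs {a, c} ∪ (fcs {a, b} ∪ fcs {b, c}) := by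
    have := BS_close (a := a) (b := c) (l := [b]) (by simp) h
    simp only [cons_append, nil_append] at this
    rw [this, pth_cons_cons, BS_add, BS_dl]
    · simp only [pth, add_zero, BS_dl]
    · intro e
      simp only [pth, add_zero, dl_apply]
      by_contra! he
      have h1 : e = {a, b} := by by_contra h'; exact he.1 (if_neg h')
      have h2 : e = {b, c} := by by_contra h'; exact he.2 (if_neg h')
      have : a ∈ ({b, c} : Face n) := by rw [← h2, h1]; simp
      simp [hab, hac] at this
  have himg : f '' {p | g p = 0} = BS (pth [a, b, c, a]) := by
    rw [hBS]
    have hsub : ∀ s ⊆ ({a, b, c} : Face n), ∀ w ∈ fcs {a, b, c},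
        (w ∈ fcs s ↔ ∀ v ∈ ({a, b, c} : Face n) \ s, w v = 0) := by
      intro s hs w hw
      constructor
      · exact fun h v hv => h.2.2 v (Finset.mem_sdiff.1 hv).2
      · intro h
        refine ⟨hw.1, hw.2.1, fun v hv => ?_⟩
        by_cases hv' : v ∈ ({a, b, c} : Face n)
        · exact h v (Finset.mem_sdiff.2 ⟨hv', hv⟩)
        · exact hw.2.2 v hv'
    have hs1 : ({a, c} : Face n) ⊆ {a, b, c} := by grind
    have hs2 : ({a, b} : Face n) ⊆ {a, b, c} := by grind
    have hs3 : ({b, c} : Face n) ⊆ {a, b, c} := by grind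
    have key : ∀ p, g p ≤ 0 → (g p = 0 ↔ f p ∈ fcs {a, c} ∪ (fcs {a, b} ∪ fcs {b, c})) := by
      intro p hp
      rw [heq, mem_union, mem_union, hsub _ hs1 _ (hmem p hp), hsub _ hs2 _ (hmem p hp),
        hsub _ hs3 _ (hmem p hp)]
      have s1 : ({a, b, c} : Face n) \ {a, c} = {b} := by grind
      have s2 : ({a, b, c} : Face n) \ {a, b} = {c} := by grind
      have s3 : ({a, b, c} : Face n) \ {b, c} = {a} := by grind
      have : 1 - p.1 - p.2 = 0 ↔ p.1 + p.2 = 1 := by grind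
      simp [s1, s2, s3, fa, fb, fc', hp, this]
    ext w
    constructor
    · rintro ⟨p, hp, rfl⟩
      exact (key p (le_of_eq hp)).1 hp
    · intro hw
      have hw' : w ∈ fcs {a, b, c} := by
        rcases hw with hw | hw | hw
        exacts [fcs_mono hs1 hw, fcs_mono hs2 hw, fcs_mono hs3 hw]
      obtain ⟨h1, h2⟩ := hinv w hw'
      exact ⟨_, (key _ h1).2 (h2.symm ▸ hw), h2⟩
  rw [← himg]
  exact hd.map hf

theorem rl_union (F G : Fam n) : rl (F ∪ G) = rl F ∪ rl G := by
  ext w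
  simp only [mem_union, mem_rl, Finset.mem_union]
  constructor
  · rintro ⟨s, h | h, hw⟩
    exacts [Or.inl ⟨s, h, hw⟩, Or.inr ⟨s, h, hw⟩]
  · rintro (⟨s, h, hw⟩ | ⟨s, h, hw⟩)
    exacts [⟨s, Or.inl h, hw⟩, ⟨s, Or.inr h, hw⟩]

theorem isDisc_of_chord {R : Fam n} (hR : DData R)
    (ih : ∀ R' ⊂ R, DData R' → ∀ a b l, (a :: (l ++ [b])).Nodup → l ≠ [] →
      bd (ind R') = pth (a :: (l ++ [b] ++ [a])) → IsDisc (rl R') (BS (bd (ind R'))))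
    {a v : Fin n} {p q : List (Fin n)} (hp : p ≠ []) (hq : q ≠ []) (hnd : (a :: (p ++ v :: q)).Nodup)
    (hb : bd (ind R) = pth (a :: (p ++ v :: q ++ [a]))) (hav : {a, v} ∈ edg R) :
    IsDisc (rl R) (BS (bd (ind R))) := by
  obtain ⟨R₁, hR1, hne1, hne2, hD1, hD2, hb1, hb2, hint⟩ := hR.chord hp hq hnd hb hav
  have hnd1 : (a :: (p ++ [v])).Nodup := hnd.sublist (by simp)
  have hnd2 : (a :: v :: q).Nodup := hnd.sublist (by simp)
  have hnd3 : (v :: (q ++ [a])).Nodup := by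
    have : List.Perm (v :: (q ++ [a])) (a :: v :: q) := by
      rw [← cons_append]
      exact List.perm_append_singleton _ _
    exact this.nodup_iff.2 hnd2
  have hne : a ≠ v := by
    intro e
    rw [e] at hnd2
    simp at hnd2
  have s1 : R₁ ⊂ R := by
    refine Finset.ssubset_iff_subset_ne.2 ⟨hR1, ?_⟩
    rintro rfl
    simp at hne2
  have s2 : R \ R₁ ⊂ R := Finset.sdiff_ssubset hR1 hne1
  have d1 := ih R₁ s1 hD1 a v p hnd1 hp hb1
  have d2 : IsDisc (rl (R \ R₁)) (BS (bd (ind (R \ R₁)))) := by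
    obtain ⟨q', b, rfl⟩ := eq_nil_or_concat q |>.resolve_left hq
    exact ih (R \ R₁) s2 hD2 a b (v :: q') (by simpa using hnd2) (by simp) (by simpa using hb2)
  rw [hb1, BS_close hp hnd1] at d1
  have e2 : BS (bd (ind (R \ R₁))) = fcs {a, v} ∪ BS (pth (v :: (q ++ [a]))) := by
    rw [hb2, cons_append, pth_cons_cons, BS_add, BS_dl]
    intro f
    by_contra! hf
    have : f = {a, v} := by by_contra h'; exact hf.1 (by rw [dl_apply, if_neg h'])
    refine hf.2 ?_
    rw [this, Finset.pair_comm]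
    exact pth_ne_chord hq hnd3
  rw [e2] at d2
  have e0 : BS (bd (ind R)) = BS (pth (a :: (p ++ [v]))) ∪ BS (pth (v :: (q ++ [a]))) := by
    have : a :: (p ++ v :: q ++ [a]) = (a :: p) ++ v :: (q ++ [a]) := by simp
    rw [hb, this, pth_append, BS_add]
    · rfl
    intro f
    by_contra! hf
    have h2 := pth_card (isChain_ne_of_nodup hnd3) hf.2
    have hfav : f = {a, v} := by
      refine Finset.eq_of_subset_of_card_le ?_ (by rw [h2, card_pair hne])
      intro x hx
      have m1 := pth_edge hf.1 x hx
      have m2 := pth_edge hf.2 x hx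
      simp only [mem_cons, mem_append, not_mem_nil, or_false, Finset.mem_insert,
        Finset.mem_singleton, cons_append] at m1 m2 ⊢
      by_contra! hx'
      have m1' : x ∈ p := by tauto
      have m2' : x ∈ q := by tauto
      have := (nodup_cons.1 hnd).2
      rw [nodup_append] at this
      exact this.2.2 x m1' x (by simp [m2']) rfl
    refine hf.1 ?_
    rw [hfav]
    exact pth_ne_chord hp hnd1
  have hUn : rl R = rl R₁ ∪ rl (R \ R₁) := by
    rw [← rl_union, union_sdiff_of_subset hR1]
  have hi : ∀ {x y : Fin n} {l : List (Fin n)}, l ≠ [] → (x :: (l ++ [y])).Nodup → ∀ w ∈ fcs {x, y},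
      w ∈ BS (pth (x :: (l ++ [y]))) → w = Pi.single x 1 ∨ w = Pi.single y 1 := by
    intro x y l hl hnd w h1 h2
    obtain ⟨f, hf, hwf⟩ := mem_BS.1 h2
    have hxy : x ≠ y := by rintro rfl; simp at hnd
    refine fcs_inter_edges hxy (pth_card (isChain_ne_of_nodup hnd) hf) ?_ h1 hwf
    rintro rfl
    exact hf (pth_ne_chord hl hnd)
  rw [hUn, e0]
  refine IsDisc.glue (isArc_fcs hne) (isArc_pth hnd1) (isArc_pth hnd3).symm d1 d2 ?_ ?_ ?_
  · rintro w ⟨h1, h2⟩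
    exact hi hp hnd1 w h1 h2
  · rintro w ⟨h1, h2⟩
    rw [Finset.pair_comm] at h1
    exact (hi hq hnd3 w h1 h2).symm
  · rintro w ⟨h1, h2⟩
    obtain ⟨t1, ht1, hw1⟩ := mem_rl.1 h1
    obtain ⟨t2, ht2, hw2⟩ := mem_rl.1 h2
    exact fcs_mono (hint t1 ht1 t2 ht2) (fcs_inter ▸ ⟨hw1, hw2⟩)

/-- Acyclic triangulated surfaces bounded by a simple cycle are discs. -/
theorem isDisc_of_dData (R : Fam n) : DData R → ∀ a b l,
    (a :: (l ++ [b])).Nodup → l ≠ [] → bd (ind R) = pth (a :: (l ++ [b] ++ [a])) →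
      IsDisc (rl R) (BS (bd (ind R))) := by
  induction R using Finset.strongInduction with
  | H R ih =>
  intro hR a b l hnd hl hb
  have hab : a ≠ b := by rintro rfl; simp at hnd
  have h3 : ∀ t ∈ R, t.card = 2 + 1 := hR.c3
  have hval : bd (ind R) {a, b} = 1 := by
    rw [hb, pth_close, Pi.add_apply, pth_ne_chord hl hnd, dl_apply, if_pos (Finset.pair_comm a b),
      zero_add]
  have hdeg : deg R {a, b} = 1 := by
    have h2 := hR.e2 {a, b} (card_pair hab)
    rw [bd_ind h3 (card_pair hab)] at hval
    interval_cases h : deg R {a, b}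
    · simp at hval
    · rfl
    · exact absurd hval (by decide)
  obtain ⟨T, hT⟩ := card_eq_one.1 hdeg
  have hTm : T ∈ R ∧ {a, b} ⊆ T := by
    have : T ∈ R.filter fun s => {a, b} ⊆ s := by rw [hT]; simp
    simpa using this
  have hTu : ∀ t ∈ R, {a, b} ⊆ t → t = T := by
    intro t ht hab
    have : t ∈ R.filter fun s => {a, b} ⊆ s := mem_filter.2 ⟨ht, hab⟩
    rwa [hT, Finset.mem_singleton] at this
  obtain ⟨v, hv⟩ : ∃ v, T \ {a, b} = {v} := by
    rw [← card_eq_one, card_sdiff_of_subset hTm.2, hR.c3 T hTm.1,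
      card_pair hab]
  have hvT : v ∈ T ∧ v ≠ a ∧ v ≠ b := by
    have : v ∈ T \ {a, b} := by rw [hv]; simp
    simpa [not_or] using this
  have hTe : T = {a, v, b} := by
    rw [← Finset.sdiff_union_of_subset hTm.2, hv]
    ext x
    simp only [Finset.mem_union, Finset.mem_insert, Finset.mem_singleton]
    tauto
  have hndT : [a, v, b].Nodup := by simp [hvT.2.1.symm, hvT.2.2, hab]
  have hedge : ∀ x ∈ T, ∀ y ∈ T, x ≠ y → {x, y} ∈ edg R := by
    intro x hx y hy hxy
    refine mem_edg.2 ⟨⟨T, hTm.1, ?_⟩, card_pair hxy⟩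
    intro z hz
    simp only [Finset.mem_insert, Finset.mem_singleton] at hz
    rcases hz with rfl | rfl <;> assumption
  have htri := isDisc_triangle hndT
  by_cases hvl : v ∈ l
  · obtain ⟨p, q, rfl⟩ := append_of_mem hvl
    by_cases hp : p = []
    · subst hp
      by_cases hq : q = []
      · subst hq
        have h1 : bd (ind R) = bd (dl T) := by
          rw [hb, hTe, bd_dl_triangle hvT.2.1.symm hab hvT.2.2]
          rfl
        have h2 : ind R + dl T = 0 := by
          refine hR.inj _ (add_mem (ind_mem_ChS subset_rfl) (dl_mem_ChS hTm.1)) ?_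
          rw [map_add, h1, chn_add_self]
        have h3 : R = {T} := by
          ext t
          have := congrFun (chn_add_eq_zero.1 h2) t
          rw [ind, dl_apply] at this
          rw [Finset.mem_singleton]
          by_cases htT : t = T
          · simp [htT, hTm.1]
          · simpa [htT] using this
        have h4 : rl R = fcs {a, v, b} := by rw [h3, ← hTe]; simp [rl]
        rw [h4, hb]
        exact htri
      · have hb' : bd (ind R) = pth (b :: ([a] ++ v :: q ++ [b])) := by
          rw [hb]
          have := pth_rotate a (v :: q) b []
          simpa using this
        refine isDisc_of_chord hR ih (by simp) hq ?_ hb' (hedge b (hTm.2 (by simp)) v hvT.1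
          hvT.2.2.symm)
        have : List.Perm (a :: ([] ++ v :: q ++ [b])) (b :: ([a] ++ v :: q)) := by
          have := List.perm_append_singleton b (a :: v :: q)
          simpa using this
        exact this.nodup_iff.1 hnd
    · refine isDisc_of_chord hR ih (q := q ++ [b]) hp (by simp) (by simpa using hnd)
        (by simpa using hb) (hedge a (hTm.2 (by simp)) v hvT.1 hvT.2.1.symm)
  · have hvn : v ∉ a :: (l ++ [b]) := by
      simp [hvT.2.1, hvT.2.2, hvl]
    have hbR : bd (ind (R.erase T)) = pth [a, v, b] + pth (a :: (l ++ [b])) := by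
      rw [ind_erase hTm.1, map_add, hb, hTe, bd_dl_triangle hvT.2.1.symm hab hvT.2.2, pth_close]
      have e := pth_close a b [v]
      simp only [cons_append, nil_append] at e
      rw [e]
      have := chn_add_self (dl ({b, a} : Face n))
      linear_combination this
    have hcyc : pth [a, v, b] + pth (a :: (l ++ [b])) = pth (v :: ((a :: l) ++ [b] ++ [v])) := by
      rw [pth_close, cons_append, pth_cons_cons v a]
      simp only [pth, add_zero]
      rw [Finset.pair_comm v a, Finset.pair_comm v b]
      ring
    have hDR : DData (R.erase T) := by
      have hsub := erase_subset T R
      refine ⟨fun t ht => hR.c3 t (hsub ht), fun e he => (deg_mono hsub e).trans (hR.e2 e he),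
        fun c hc => hR.inj c (ChS_mono hsub hc), fun z hz hzb => ?_⟩
      obtain ⟨c, hc, hcb⟩ := hR.bnd z (ChS_mono (edg_mono hsub) hz) hzb
      refine ⟨c, fun s hs => ?_, hcb⟩
      by_cases hsT : s = T
      · have h1 := bd_apply_of_ChS h3 (card_pair hab) hc
        rw [hT, sum_singleton, hcb] at h1
        rw [hsT, ← h1]
        refine hz _ fun hm => ?_
        obtain ⟨⟨t, ht, het⟩, -⟩ := mem_edg.1 hm
        exact Finset.ne_of_mem_erase ht (hTu t (mem_of_mem_erase ht) het)
      · exact hc s fun h' => hs (mem_erase.2 ⟨hsT, h'⟩)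
    have hnd' : (v :: ((a :: l) ++ [b])).Nodup := nodup_cons.2 ⟨hvn, hnd⟩
    have d2 := ih _ (Finset.erase_ssubset hTm.1) hDR v b (a :: l) hnd' (by simp)
      (by rw [hbR, hcyc])
    have hpe : ∀ f, pth [a, v, b] f ≠ 0 → v ∈ f ∧ f.card = 2 := by
      intro f hf
      refine ⟨?_, pth_card (isChain_ne_of_nodup hndT) hf⟩
      simp only [pth, add_zero, Pi.add_apply, dl_apply] at hf
      by_contra hvf
      refine hf ?_
      rw [if_neg, if_neg, add_zero]
      · rintro rfl; simp at hvf
      · rintro rfl; simp at hvf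
    have hds : ∀ f, pth [a, v, b] f = 0 ∨ pth (a :: (l ++ [b])) f = 0 := by
      intro f
      by_contra! hf
      exact hvn (pth_edge hf.2 v (hpe f hf.1).1)
    rw [hbR, BS_add hds] at d2
    have e1 : BS (pth [a, v, b, a]) = fcs {a, b} ∪ BS (pth [a, v, b]) :=
      BS_close (l := [v]) (by simp) hndT
    rw [e1, union_comm] at htri
    rw [hb, BS_close hl hnd]
    have hUn : rl R = fcs {a, v, b} ∪ rl (R.erase T) := by
      conv_lhs => rw [← insert_erase hTm.1]
      rw [Finset.insert_eq, rl_union, ← hTe]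
      simp [rl]
    have harc : IsArc (BS (pth [a, v, b])) (Pi.single a 1) (Pi.single b 1) := isArc_pth (l := [v]) hndT
    rw [hUn]
    refine IsDisc.glue harc (isArc_fcs hab) (isArc_pth hnd) htri d2 ?_ ?_ ?_
    · rintro w ⟨h1, h2⟩
      obtain ⟨f, hf, hwf⟩ := mem_BS.1 h1
      refine fcs_inter_edges hab (hpe f hf).2 ?_ h2 hwf
      rintro rfl
      have := (hpe _ hf).1
      simp [hvT.2.1, hvT.2.2] at this
    · rintro w ⟨h1, h2⟩
      obtain ⟨f, hf, hwf⟩ := mem_BS.1 h1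
      obtain ⟨f', hf', hwf'⟩ := mem_BS.1 h2
      have hw : w ∈ fcs (f ∩ f') := fcs_inter ▸ ⟨hwf, hwf'⟩
      have hvf' : v ∉ f' := fun h' => hvn (pth_edge hf' v h')
      have hsub : f ∩ f' ⊆ {a} ∨ f ∩ f' ⊆ {b} := by
        simp only [pth, add_zero, Pi.add_apply, dl_apply] at hf
        have : f = {a, v} ∨ f = {v, b} := by
          by_contra! h'
          exact hf (by rw [if_neg h'.1, if_neg h'.2, add_zero])
        rcases this with rfl | rfl
        · exact Or.inl (by grind)
        · exact Or.inr (by grind)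
      rcases hsub with h' | h'
      · exact Or.inl (fcs_singleton (fcs_mono h' hw))
      · exact Or.inr (fcs_singleton (fcs_mono h' hw))
    · rintro w ⟨h1, h2⟩
      obtain ⟨t, ht, hwt⟩ := mem_rl.1 h2
      have hw : w ∈ fcs ({a, v, b} ∩ t) := fcs_inter ▸ ⟨h1, hwt⟩
      have hnab : ¬ ({a, b} ⊆ t) := fun h' =>
        Finset.ne_of_mem_erase ht (hTu t (mem_of_mem_erase ht) h')
      have hpv : ∀ f, f = {a, v} ∨ f = {v, b} → pth [a, v, b] f ≠ 0 := by
        intro f hf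
        have hne : ({a, v} : Face n) ≠ {v, b} := by
          intro h'
          have : a ∈ ({v, b} : Face n) := by rw [← h']; simp
          simp [hvT.2.1.symm, hab] at this
        simp only [pth, add_zero, Pi.add_apply, dl_apply]
        rcases hf with rfl | rfl
        · rw [if_pos rfl, if_neg hne]; decide
        · rw [if_neg hne.symm, if_pos rfl]; decide
      by_cases hat : a ∈ t
      · refine mem_BS.2 ⟨{a, v}, hpv _ (Or.inl rfl), fcs_mono ?_ hw⟩
        grind
      · refine mem_BS.2 ⟨{v, b}, hpv _ (Or.inr rfl), fcs_mono ?_ hw⟩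
        grind

end

section

variable {n : ℕ} {K : Fam n}

/-- The boundary complex of a good complex is realized by a 2-sphere. -/
theorem Good.sphere (h : Good K) :
    ∃ f : R3 → (Fin n → ℝ), CHom f (sphere 0 1) (rl (bT K)) := by
  obtain ⟨T, hT3, hT1⟩ := h.bdry
  have hT : T ∈ bT K := mem_bT.2 ⟨mem_fc.1 hT3, hT1⟩
  obtain ⟨a, b, c, hab, hac, hbc, rfl⟩ := card_eq_three.1 (mem_fc.1 hT3).2
  have hnd : [a, b, c].Nodup := by simp [hab, hac, hbc]
  have hbd : bd (ind ((bT K).erase {a, b, c})) = pth (a :: ([b] ++ [c] ++ [a])) := by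
    rw [h.bd_sphere_erase hT, bd_dl_triangle hab hac hbc]
    rfl
  have hd := isDisc_of_dData _ (h.dData_sphere hT) a c [b] hnd (by simp) hbd
  have ht := isDisc_triangle hnd
  have hBS : BS (pth [a, b, c, a]) = fcs {a, c} ∪ BS (pth [a, b, c]) :=
    BS_close (a := a) (b := c) (l := [b]) (by simp) hnd
  rw [hbd] at hd
  simp only [cons_append, nil_append] at hd
  have hsub : ∀ e : Face n, e ⊆ {a, b, c} → e.card = 2 →
      e = {a, c} ∨ e = {a, b} ∨ e = {b, c} := by
    intro e he h2
    obtain ⟨x, y, hxy, rfl⟩ := card_eq_two.1 h2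
    have hx := he (mem_insert_self x _)
    have hy := he (Finset.mem_insert_of_mem (mem_singleton_self y))
    simp only [Finset.mem_insert, Finset.mem_singleton] at hx hy
    rcases hx with rfl | rfl | rfl <;> rcases hy with rfl | rfl | rfl <;>
      simp_all [Finset.pair_comm]
  have hpt : ∀ e : Face n, e ⊂ {a, b, c} → fcs e ⊆ BS (pth [a, b, c, a]) := by
    intro e he w hw
    have hcard : e.card ≤ 2 := by
      have := Finset.card_lt_card he
      rw [card_eq_three.2 ⟨a, b, c, hab, hac, hbc, rfl⟩] at this
      omega
    obtain ⟨f, hef, hf, hf2⟩ := Finset.exists_subsuperset_card_eq he.1 hcard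
      (by rw [card_eq_three.2 ⟨a, b, c, hab, hac, hbc, rfl⟩]; omega)
    have hwf := fcs_mono hef hw
    have ec := hBS
    have ep : BS (pth [a, b, c]) = fcs {a, b} ∪ fcs {b, c} := by
      rw [pth_cons_cons, BS_add, BS_dl]
      · simp only [pth, add_zero, BS_dl]
      · intro e
        simp only [pth, add_zero, dl_apply]
        by_contra! he
        have h1 : e = {a, b} := by by_contra h'; exact he.1 (if_neg h')
        have h2 : e = {b, c} := by by_contra h'; exact he.2 (if_neg h')
        have : a ∈ ({b, c} : Face n) := by rw [← h2, h1]; simp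
        simp [hab, hac] at this
    rw [hBS, ep]
    rcases hsub f hf hf2 with rfl | rfl | rfl
    exacts [Or.inl hwf, Or.inr (Or.inl hwf), Or.inr (Or.inr hwf)]
  have hX : rl ((bT K).erase {a, b, c}) ∩ fcs {a, b, c} ⊆ BS (pth [a, b, c, a]) := by
    rintro w ⟨hw, hw'⟩
    obtain ⟨s, hs, hws⟩ := mem_rl.1 hw
    obtain ⟨hne, hs⟩ := mem_erase.1 hs
    have hwi : w ∈ fcs (s ∩ {a, b, c}) := by rw [← fcs_inter]; exact ⟨hws, hw'⟩
    refine hpt _ ⟨Finset.inter_subset_right, fun hc => hne ?_⟩ hwi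
    have hs3 := (mem_bT.1 hs).1.2
    exact (Finset.eq_of_subset_of_card_le (fun x hx => (Finset.mem_inter.1 (hc hx)).1)
      (by rw [hs3, (mem_fc.1 hT3).2])).symm
  have hi : fcs {a, c} ∩ BS (pth [a, b, c]) ⊆ {Pi.single a 1, Pi.single c 1} := by
    rintro w ⟨hw, hw'⟩
    obtain ⟨e, he, hwe⟩ := mem_BS.1 hw'
    have hnd' : (a :: ([b] ++ [c])).Nodup := hnd
    refine fcs_inter_edges hac (pth_card (isChain_ne_of_nodup hnd') he) ?_ hw hwe
    rintro rfl
    exact he (pth_ne_chord (p := [b]) (by simp) hnd')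
  rw [hBS] at hd ht hX
  obtain ⟨f, hf⟩ := IsDisc.sphere (isArc_fcs hac) (isArc_pth (a := a) (b := c) (l := [b]) hnd) hi
    hd ht hX
  refine ⟨f, ?_⟩
  have : rl (bT K) = rl ((bT K).erase {a, b, c}) ∪ fcs {a, b, c} := by
    conv_lhs => rw [← insert_erase hT]
    ext w
    simp only [mem_union, mem_rl, Finset.mem_insert]
    constructor
    · rintro ⟨s, rfl | h, hw⟩
      exacts [Or.inr hw, Or.inl ⟨s, h, hw⟩]
    · rintro (⟨s, h, hw⟩ | hw)
      exacts [⟨s, Or.inr h, hw⟩, ⟨_, Or.inl rfl, hw⟩]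
  rwa [this]

/-- The link of a boundary vertex is realized by a disc. -/
theorem Good.disc_link (h : Good K) {v : Fin n} (hv : {v} ∈ dK K) :
    IsDisc (rl (fc (lk K {v}) 3)) (BS (bd (ind (fc (lk K {v}) 3)))) := by
  obtain ⟨a, l, hnd, hl, hb⟩ := h.link_boundary_cycle hv
  obtain ⟨l', b, rfl⟩ : ∃ l' b, l = l' ++ [b] := by
    rcases eq_nil_or_concat l with rfl | ⟨l', b, rfl⟩
    · simp at hl
    · exact ⟨l', b, by simp⟩
  refine isDisc_of_dData _ (h.dData_link hv) a b l' hnd ?_ hb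
  rintro rfl
  simp at hl

end

section

variable {E V : Type*} [TopologicalSpace E] [NormedAddCommGroup V] [NormedSpace ℝ V]
  [FiniteDimensional ℝ V]

/-- The model of a half-ball neighbourhood of a boundary point. -/
def halfCone (V : Type*) [NormedAddCommGroup V] : Set (V × ℝ) := {q | 0 ≤ q.2 ∧ ‖q.1‖ + q.2 ≤ 1}

/-- A boundary chart of the pair `(P, S)` on the positivity set of `ω`. -/
structure BdChart (P S : Set E) (ω : E → ℝ) (Ψ : V × ℝ → E) : Prop where
  cont : ContinuousOn Ψ (halfCone V)
  inj : InjOn Ψ (halfCone V)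
  maps : MapsTo Ψ (halfCone V) P
  ωcont : Continuous ω
  nonneg : ∀ x ∈ P, 0 ≤ ω x
  surj : ∀ x ∈ P, 0 < ω x → ∃ q ∈ halfCone V, Ψ q = x
  ωΨ : ∀ q ∈ halfCone V, ω (Ψ q) = 1 - ‖q.1‖ - q.2
  bdry : ∀ q ∈ halfCone V, 0 < ω (Ψ q) → (Ψ q ∈ S ↔ q.2 = 0)

/-- The space `P` with a collar of variable height `f` attached along `S`. -/
def collared (P S : Set E) (f : E → ℝ) : Set (E × ℝ) :=
  {p | p.1 ∈ P ∧ 0 ≤ p.2 ∧ (p.2 = 0 ∨ p.1 ∈ S ∧ p.2 ≤ f p.1)}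

theorem isCompact_collared {P S : Set E} {f : E → ℝ} (hP : IsCompact P) (hS : IsCompact S)
    (hSP : S ⊆ P) (hf : Continuous f) (hf0 : ∀ x, 0 ≤ f x) : IsCompact (collared P S f) := by
  have : collared P S f = (P ×ˢ {0}) ∪ (fun p : E × ℝ => (p.1, p.2 * f p.1)) '' (S ×ˢ Icc 0 1) := by
    ext ⟨x, t⟩
    constructor
    · rintro ⟨hx, ht, h | ⟨h, h'⟩⟩
      · exact Or.inl ⟨hx, h⟩
      · simp only at hx ht h h'
        by_cases h0 : f x = 0
        · refine Or.inl ⟨hx, ?_⟩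
          simp only [mem_singleton_iff]
          linarith
        · have := lt_of_le_of_ne (hf0 x) (Ne.symm h0)
          exact Or.inr ⟨(x, t / f x), ⟨h, div_nonneg ht this.le, (div_le_one this).2 h'⟩, by
            simp [h0]⟩
    · rintro (⟨hx, h⟩ | ⟨⟨y, s⟩, ⟨hy, h1, h2⟩, h⟩)
      · exact ⟨hx, (le_of_eq h.symm), Or.inl h⟩
      · simp only [Prod.mk.injEq] at h
        obtain ⟨rfl, rfl⟩ := h
        exact ⟨hSP hy, mul_nonneg h1 (hf0 _), Or.inr ⟨hy, mul_le_of_le_one_left (hf0 _) h2⟩⟩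
  rw [this]
  exact (hP.prod isCompact_singleton).union
    ((hS.prod isCompact_Icc).image (by fun_prop))

theorem BdChart.step [T2Space E] {P S : Set E} {ω : E → ℝ} {Ψ : V × ℝ → E} (h : BdChart P S ω Ψ)
    (hP : IsCompact P) (hS : IsCompact S) (hSP : S ⊆ P) {f : E → ℝ} (hf : Continuous f)
    (hf0 : ∀ x, 0 ≤ f x) :
    ∃ k, CHom k (collared P S fun x => f x + max 0 (ω x - 1 / 4)) (collared P S f) ∧
      ∀ x ∈ S, k (x, f x + max 0 (ω x - 1 / 4)) = (x, f x) := by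
  have : ProperSpace V := FiniteDimensional.proper ℝ V
  set φ : E → ℝ := fun x => max 0 (ω x - 1 / 4) with hφ
  have hφc : Continuous φ := by have := h.ωcont; fun_prop
  have hφ0 : ∀ x, 0 ≤ φ x := fun x => le_max_left _ _
  let D : (E → ℝ) → Set (V × ℝ) := fun g =>
    {q | ‖q.1‖ ≤ 3 / 4 ∧ -g (Ψ (q.1, 0)) ≤ q.2 ∧ q.2 ≤ 3 / 4 - ‖q.1‖}
  let Wm : V × ℝ → E × ℝ := fun q => (Ψ (q.1, max q.2 0), max (-q.2) 0)
  have hdom : ∀ u : V, ‖u‖ ≤ 3 / 4 → (u, (0 : ℝ)) ∈ halfCone V := fun u hu =>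
    ⟨le_rfl, by simp only; linarith⟩
  have hdom' : ∀ g, ∀ q ∈ D g, (q.1, max q.2 0) ∈ halfCone V := fun g q hq =>
    ⟨le_max_right _ _, by
      have h1 : max q.2 0 ≤ 3 / 4 - ‖q.1‖ := max_le hq.2.2 (by linarith [hq.1])
      simp only; linarith⟩
  have hS0 : ∀ u : V, ‖u‖ ≤ 3 / 4 → Ψ (u, 0) ∈ S := fun u hu =>
    (h.bdry _ (hdom u hu) (by rw [h.ωΨ _ (hdom u hu)]; simp only; linarith)).2 rfl
  have hφu : ∀ u : V, ‖u‖ ≤ 3 / 4 → φ (Ψ (u, 0)) = 3 / 4 - ‖u‖ := fun u hu => by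
    simp only [hφ]
    rw [h.ωΨ _ (hdom u hu), max_eq_right] <;> simp only <;> linarith
  have hDc : ∀ g, Continuous g → (∀ x, 0 ≤ g x) → IsCompact (D g) := by
    intro g hg hg0
    have hK : IsCompact (closedBall (0 : V) (3 / 4)) := isCompact_closedBall _ _
    have hc : ContinuousOn (fun u : V => g (Ψ (u, 0))) (closedBall 0 (3 / 4)) := by
      refine hg.comp_continuousOn (h.cont.comp (by fun_prop) fun u hu => hdom u ?_)
      simpa using hu
    have himg : D g = (fun p : V × ℝ => (p.1, -g (Ψ (p.1, 0)) + p.2 *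
        (g (Ψ (p.1, 0)) + (3 / 4 - ‖p.1‖)))) '' (closedBall 0 (3 / 4) ×ˢ Icc 0 1) := by
      ext ⟨u, t⟩
      constructor
      · rintro ⟨h1, h2, h3⟩
        simp only at h1 h2 h3
        by_cases h0 : g (Ψ (u, 0)) + (3 / 4 - ‖u‖) = 0
        · refine ⟨(u, 0), ⟨by simpa using h1, by simp⟩, ?_⟩
          simp only [Prod.mk.injEq, true_and]
          linarith [hg0 (Ψ (u, 0))]
        · have hp : 0 < g (Ψ (u, 0)) + (3 / 4 - ‖u‖) :=
            lt_of_le_of_ne (by linarith [hg0 (Ψ (u, 0))]) (Ne.symm h0)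
          refine ⟨(u, (t + g (Ψ (u, 0))) / (g (Ψ (u, 0)) + (3 / 4 - ‖u‖))),
            ⟨by simpa using h1, div_nonneg (by linarith) hp.le, (div_le_one hp).2 (by linarith)⟩, ?_⟩
          simp only [Prod.mk.injEq, true_and]
          rw [div_mul_cancel₀ _ hp.ne']
          ring
      · rintro ⟨⟨y, s⟩, ⟨hy, hs1, hs2⟩, he⟩
        simp only [Prod.mk.injEq] at he
        obtain ⟨rfl, rfl⟩ := he
        have hy' : ‖y‖ ≤ 3 / 4 := by simpa using hy
        have := hg0 (Ψ (y, 0))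
        simp only at hs1 hs2
        refine ⟨hy', ?_, ?_⟩ <;> simp only <;> nlinarith
    rw [himg]
    refine (hK.prod isCompact_Icc).image_of_continuousOn ?_
    have hc' : ContinuousOn (fun p : V × ℝ => g (Ψ (p.1, 0)))
        (closedBall (0 : V) (3 / 4) ×ˢ Icc (0 : ℝ) 1) :=
      hc.comp (g := fun u : V => g (Ψ (u, 0))) continuousOn_fst fun p hp => hp.1
    exact continuousOn_fst.prodMk (hc'.neg.add (continuousOn_snd.mul
      (hc'.add (by fun_prop))))
  have hW : ∀ g, CHom Wm (D g) (Wm '' D g) := by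
    intro g
    refine ⟨?_, ?_, rfl⟩
    · refine ContinuousOn.prodMk (h.cont.comp (by fun_prop) (hdom' g)) (by fun_prop)
    · intro p hp q hq e
      simp only [Wm, Prod.mk.injEq] at e
      have h1 := h.inj (hdom' g p hp) (hdom' g q hq) e.1
      simp only [Prod.mk.injEq] at h1
      refine Prod.ext h1.1 ?_
      grind
  let m : V × ℝ → V × ℝ := fun q =>
    (q.1, min (q.2 + (3 / 4 - ‖q.1‖)) ((q.2 + (3 / 4 - ‖q.1‖)) / 2))
  have hm : CHom m (D fun x => f x + φ x) (D f) := by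
    refine ⟨by fun_prop, ?_, ?_⟩
    · intro p _ q _ e
      simp only [m, Prod.mk.injEq] at e
      obtain ⟨e1, e2⟩ := e
      rw [e1] at e2
      refine Prod.ext e1 ?_
      grind
    · ext ⟨u, t⟩
      constructor
      · rintro ⟨⟨y, s⟩, ⟨h1, h2, h3⟩, he⟩
        simp only [m, Prod.mk.injEq] at he
        obtain ⟨rfl, rfl⟩ := he
        simp only at h1 h2 h3
        rw [hφu y h1] at h2
        have := hf0 (Ψ (y, 0))
        refine ⟨h1, ?_, ?_⟩
        · exact le_min (by simp only; linarith) (by simp only; linarith)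
        · exact (min_le_right _ _).trans (by simp only; linarith)
      · rintro ⟨h1, h2, h3⟩
        simp only at h1 h2 h3
        have := hf0 (Ψ (u, 0))
        refine ⟨(u, max t (2 * t) - (3 / 4 - ‖u‖)), ⟨h1, ?_, ?_⟩, ?_⟩
        · simp only
          rw [hφu u h1]
          linarith [le_max_left t (2 * t)]
        · simp only
          linarith [max_le (show t ≤ 2 * (3 / 4 - ‖u‖) by linarith)
            (show 2 * t ≤ 2 * (3 / 4 - ‖u‖) by linarith)]
        · simp only [m, Prod.mk.injEq, true_and, sub_add_cancel]
          rcases le_total t 0 with a | a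
          · rw [max_eq_left (by linarith), min_eq_left (by linarith)]
          · rw [max_eq_right (by linarith), min_eq_right (by linarith)]
            ring
  have hg0 : ∀ x, 0 ≤ f x + φ x := fun x => add_nonneg (hf0 x) (hφ0 x)
  have hne : Nonempty (V × ℝ) := inferInstance
  obtain ⟨Wi, hWi, hWi1, hWi2⟩ := (hW fun x => f x + φ x).exists_inv
    (hDc _ (hf.add hφc) hg0)
  have hk1 := (hW f).comp (hm.comp hWi)
  let B : Set (E × ℝ) := ((P ∩ {x | ω x = 0}) ×ˢ {0}) ∪
    (((Ψ '' (halfCone V ∩ {q | 3 / 4 - ‖q.1‖ ≤ q.2})) ×ˢ {0}) ∪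
    (collared P S f ∩ ((S ∩ {x | ω x ≤ 1 / 4}) ×ˢ univ)))
  have hhc : IsCompact (halfCone V) := by
    have hcl : IsClosed (halfCone V) := by
      have h1 : IsClosed {q : V × ℝ | 0 ≤ q.2} := isClosed_le (by fun_prop) (by fun_prop)
      have h2 : IsClosed {q : V × ℝ | ‖q.1‖ + q.2 ≤ 1} := isClosed_le (by fun_prop) (by fun_prop)
      exact h1.inter h2
    refine ((isCompact_closedBall (0 : V) 1).prod (isCompact_Icc (a := (0 : ℝ)) (b := 1))).of_isClosed_subset hcl ?_
    rintro ⟨u, t⟩ ⟨h1, h2⟩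
    simp only at h1 h2
    exact ⟨by simp only [mem_closedBall_zero_iff]; linarith, h1, by linarith [norm_nonneg u]⟩
  have hBc : IsCompact B := by
    have h1 : IsClosed {x | ω x = 0} := isClosed_eq h.ωcont continuous_const
    have h2 : IsClosed {q : V × ℝ | 3 / 4 - ‖q.1‖ ≤ q.2} := isClosed_le (by fun_prop) (by fun_prop)
    have h3 : IsClosed {x | ω x ≤ 1 / 4} := isClosed_le h.ωcont continuous_const
    refine ((hP.inter_right h1).prod isCompact_singleton).union
      ((((hhc.inter_right h2).image_of_continuousOn (h.cont.mono inter_subset_left)).prod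
        isCompact_singleton).union ?_)
    exact (isCompact_collared hP hS hSP hf hf0).inter_right
      (((hS.inter_right h3).isClosed).prod isClosed_univ)
  have hcov : ∀ g, (∀ x, 0 ≤ g x) → (∀ x, ω x ≤ 1 / 4 → g x = f x) →
      collared P S g = Wm '' D g ∪ B := by
    intro g hg hgf
    apply Subset.antisymm
    · rintro ⟨x, t⟩ ⟨hx, ht, h0⟩
      simp only at hx ht h0
      rcases lt_or_ge 0 (ω x) with hpos | hz
      swap
      · have hz := le_antisymm hz (h.nonneg x hx)
        rcases h0 with rfl | ⟨hxS, htf⟩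
        · exact Or.inr (Or.inl ⟨⟨hx, hz⟩, rfl⟩)
        · rw [hgf x (by linarith)] at htf
          exact Or.inr (Or.inr (Or.inr ⟨⟨hx, ht, Or.inr ⟨hxS, htf⟩⟩,
            ⟨hxS, by simp only [mem_ofPred_eq]; linarith⟩, trivial⟩))
      obtain ⟨q, hq, rfl⟩ := h.surj x hx hpos
      rcases h0 with rfl | ⟨hxS, htf⟩
      · rcases le_or_gt (3 / 4 - ‖q.1‖) q.2 with h1 | h1
        · exact Or.inr (Or.inr (Or.inl ⟨⟨q, ⟨hq, h1⟩, rfl⟩, rfl⟩))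
        · refine Or.inl ⟨q, ⟨by linarith [hq.1], ?_, h1.le⟩, ?_⟩
          · linarith [hq.1, hg (Ψ (q.1, 0))]
          · simp only [Wm, Prod.mk.injEq, max_eq_left hq.1]
            exact ⟨trivial, max_eq_right (by linarith [hq.1])⟩
      · have hq2 := (h.bdry q hq hpos).1 hxS
        rcases le_or_gt (ω (Ψ q)) (1 / 4) with h1 | h1
        · rw [hgf _ h1] at htf
          exact Or.inr (Or.inr (Or.inr ⟨⟨hx, ht, Or.inr ⟨hxS, htf⟩⟩, ⟨hxS, h1⟩, trivial⟩))
        · rw [h.ωΨ q hq] at h1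
          have hqe : q = (q.1, 0) := Prod.ext rfl hq2
          rw [hqe] at htf
          refine Or.inl ⟨(q.1, -t), ⟨by simp only; linarith, by simp only; linarith,
            by simp only; linarith⟩, ?_⟩
          simp only [Wm, neg_neg, Prod.mk.injEq]
          rw [max_eq_right (by linarith), ← hqe]
          exact ⟨rfl, max_eq_left ht⟩
    · rintro p (⟨q, hq, rfl⟩ | ⟨⟨hx, -⟩, h0⟩ | ⟨⟨q, hq, h1⟩, h0⟩ | ⟨hp, ⟨hS', hω⟩, -⟩)
      · refine ⟨h.maps (hdom' g q hq), le_max_right _ _, ?_⟩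
        simp only [Wm]
        rcases le_total 0 q.2 with a | a
        · left; exact max_eq_right (by linarith)
        · right
          rw [max_eq_right a, max_eq_left (by linarith)]
          exact ⟨hS0 _ hq.1, by linarith [hq.2.1]⟩
      · exact ⟨hx, le_of_eq (Eq.symm h0), Or.inl h0⟩
      · exact ⟨h1 ▸ h.maps hq.1, le_of_eq (Eq.symm h0), Or.inl h0⟩
      · refine ⟨hp.1, hp.2.1, hp.2.2.imp id fun h' => ⟨h'.1, ?_⟩⟩
        rw [hgf _ hω]
        exact h'.2
  have hAB : ∀ g, ∀ q ∈ D g, Wm q ∈ B → q.2 = 3 / 4 - ‖q.1‖ ∨ ‖q.1‖ = 3 / 4 := by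
    intro g q hq hB
    by_contra! hcon
    have h1 : ‖q.1‖ < 3 / 4 := lt_of_le_of_ne hq.1 hcon.2
    have h2 : q.2 < 3 / 4 - ‖q.1‖ := lt_of_le_of_ne hq.2.2 hcon.1
    have h3 := h.ωΨ _ (hdom' g q hq)
    have h4 : max q.2 0 < 3 / 4 - ‖q.1‖ := max_lt h2 (by linarith)
    simp only at h3
    rcases hB with ⟨⟨-, h0⟩, -⟩ | ⟨⟨q', ⟨hq', h5⟩, h6⟩, h7⟩ | ⟨-, ⟨-, h0⟩, -⟩
    · simp only [Wm, mem_ofPred_eq] at h0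
      linarith
    · have := h.inj hq' (hdom' g q hq) h6
      subst this
      simp only [mem_ofPred_eq] at h5
      linarith
    · simp only [Wm, mem_ofPred_eq] at h0
      linarith
  have hmfix : ∀ g, ∀ q ∈ D g, Wm q ∈ B → m q = q := by
    intro g q hq hB
    have h0 := hq.1
    have h1 := hq.2.2
    refine Prod.ext rfl ?_
    simp only [m]
    rcases hAB g q hq hB with e | e
    · rw [min_eq_right (by linarith)]; linarith
    · rw [min_eq_left (by linarith)]; linarith
  have hφz : ∀ x, ω x ≤ 1 / 4 → φ x = 0 := fun x hx => max_eq_left (by linarith)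
  have hid : ∀ p ∈ Wm '' (D fun x => f x + φ x) ∩ B, (Wm ∘ m ∘ Wi) p = p := by
    rintro _ ⟨⟨q, hq, rfl⟩, hB⟩
    simp only [Function.comp]
    rw [hWi1 q hq, hmfix (fun x => f x + φ x) q hq hB]
  obtain ⟨k, hk, hkA, hkB⟩ := hk1.union (g' := id) (X' := B) (Y' := B)
    ⟨continuousOn_id, injOn_id _, by simp⟩
    (((hW _).compact (hDc _ (hf.add hφc) hg0)).isClosed) hBc.isClosed
    (fun p hp => hid p hp) (by
      rintro p ⟨⟨q, hq, rfl⟩, hB⟩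
      have : Wm q ∈ Wm '' (D fun x => f x + φ x) ∩ B :=
        ⟨⟨q, ⟨hq.1, by linarith [hq.2.1, hφ0 (Ψ (q.1, 0))], hq.2.2⟩, rfl⟩, hB⟩
      exact ⟨_, this, hid _ this⟩)
  rw [← hcov f hf0 (fun _ _ => rfl), ← hcov (fun x => f x + φ x) hg0
    (fun x hx => by simp only [hφz x hx, add_zero])] at hk
  refine ⟨k, hk, fun x hx => ?_⟩
  rcases le_or_gt (ω x) (1 / 4) with h1 | h1
  · have h2 := hφz x h1
    have h3 : (x, f x) ∈ B := Or.inr (Or.inr ⟨⟨hSP hx, hf0 x, Or.inr ⟨hx, le_rfl⟩⟩,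
      ⟨hx, h1⟩, trivial⟩)
    change k (x, f x + φ x) = _
    rw [h2, add_zero]
    exact hkB h3
  · obtain ⟨q, hq, rfl⟩ := h.surj x (hSP hx) (by linarith)
    have hq2 := (h.bdry q hq (by linarith)).1 hx
    rw [h.ωΨ q hq] at h1
    have hqe : (q.1, (0 : ℝ)) = q := Prod.ext rfl hq2.symm
    have hu : ‖q.1‖ ≤ 3 / 4 := by linarith
    have hf' := hf0 (Ψ q)
    have hg' := hg0 (Ψ q)
    have hDq : (q.1, -(f (Ψ q) + φ (Ψ q))) ∈ D fun x => f x + φ x :=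
      ⟨hu, by simp only [hqe]; exact le_rfl, by simp only; linarith⟩
    have hWq : ∀ t, 0 ≤ t → Wm (q.1, -t) = (Ψ q, t) := by
      intro t ht
      simp only [Wm, neg_neg]
      rw [max_eq_right (by linarith), max_eq_left ht, hqe]
    change k (Ψ q, f (Ψ q) + φ (Ψ q)) = _
    rw [← hWq _ hg', hkA ⟨_, hDq, rfl⟩]
    simp only [Function.comp]
    rw [hWi1 _ hDq, ← hWq _ hf']
    congr 1
    refine Prod.ext rfl ?_
    simp only [m]
    have hφq := hφu q.1 hu
    rw [hqe] at hφq
    rw [hφq, min_eq_left] <;> linarith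

/-- A pair covered by boundary charts has a collar. -/
theorem exists_collar [T2Space E] {P S : Set E} (hP : IsCompact P) (hS : IsCompact S) (hSP : S ⊆ P)
    {ι : Type*} (s : Finset ι) (ω : ι → E → ℝ) (Ψ : ι → V × ℝ → E)
    (h : ∀ i ∈ s, BdChart P S (ω i) (Ψ i)) :
    ∃ G, CHom G (collared P S fun x => ∑ i ∈ s, max 0 (ω i x - 1 / 4)) P ∧
      ∀ x ∈ S, G (x, ∑ i ∈ s, max 0 (ω i x - 1 / 4)) = x := by
  classical
  induction s using Finset.induction_on with
  | empty =>
    refine ⟨Prod.fst, ⟨continuousOn_fst, ?_, ?_⟩, fun x _ => rfl⟩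
    · rintro ⟨x, t⟩ ⟨-, h1, h2⟩ ⟨y, t'⟩ ⟨-, h1', h2'⟩ e
      simp only [Finset.sum_empty] at h1 h2 h1' h2' e
      refine Prod.ext e ?_
      simp only
      rcases h2 with h2 | ⟨-, h2⟩ <;> rcases h2' with h2' | ⟨-, h2'⟩ <;> linarith
    · ext x
      constructor
      · rintro ⟨p, hp, rfl⟩
        exact hp.1
      · exact fun hx => ⟨(x, 0), ⟨hx, le_rfl, Or.inl rfl⟩, rfl⟩
  | insert i s hi ih =>
    obtain ⟨G, hG, hG'⟩ := ih fun j hj => h j (Finset.mem_insert_of_mem hj)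
    obtain ⟨k, hk, hk'⟩ := (h i (mem_insert_self i s)).step hP hS hSP
      (f := fun x => ∑ i ∈ s, max 0 (ω i x - 1 / 4))
      (continuous_finsetSum _ fun j hj => by
        have := (h j (Finset.mem_insert_of_mem hj)).ωcont
        fun_prop)
      (fun x => sum_nonneg fun j _ => le_max_left _ _)
    have e : ∀ x, ∑ i ∈ insert i s, max 0 (ω i x - 1 / 4) =
        ∑ i ∈ s, max 0 (ω i x - 1 / 4) + max 0 (ω i x - 1 / 4) := by
      intro x
      rw [sum_insert hi, add_comm]
    simp only [e]
    refine ⟨G ∘ k, hG.comp hk, fun x hx => ?_⟩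
    simp only [Function.comp]
    rw [hk' x hx, hG' x hx]

end

section

variable {n : ℕ} {K : Fam n}

theorem chom_rotate : CHom (fun u : ℝ × ℝ => ((u.1 + u.2) / 2, (u.1 - u.2) / 2)) {u | ‖u‖ ≤ 1}
      (lens (-1) 1) ∧
    ∀ u : ℝ × ℝ, ((u.1 + u.2) / 2, (u.1 - u.2) / 2) ∈ roof (-1) ∪ roof 1 ↔ ‖u‖ = 1 := by
  have key : ∀ u : ℝ × ℝ, |(u.1 + u.2) / 2| + |(u.1 - u.2) / 2| = ‖u‖ := by
    intro u
    rw [Prod.norm_def, Real.norm_eq_abs, Real.norm_eq_abs]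
    rcases abs_cases ((u.1 + u.2) / 2) with ⟨h1, _⟩ | ⟨h1, _⟩ <;>
      rcases abs_cases ((u.1 - u.2) / 2) with ⟨h2, _⟩ | ⟨h2, _⟩ <;>
      rcases abs_cases u.1 with ⟨h3, _⟩ | ⟨h3, _⟩ <;>
      rcases abs_cases u.2 with ⟨h4, _⟩ | ⟨h4, _⟩ <;>
      rcases max_cases |u.1| |u.2| with ⟨h5, _⟩ | ⟨h5, _⟩ <;> linarith
  have hl : ∀ p : ℝ × ℝ, p ∈ lens (-1) 1 ↔ |p.1| + |p.2| ≤ 1 := by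
    intro p
    simp only [lens, mem_ofPred_eq]
    constructor
    · rintro ⟨_, h2, h3⟩
      linarith [abs_le.2 (show -(1 - |p.1|) ≤ p.2 ∧ p.2 ≤ 1 - |p.1| from ⟨by linarith, by linarith⟩)]
    · intro h
      have := abs_le.1 (show |p.2| ≤ 1 - |p.1| by linarith)
      exact ⟨by linarith [abs_nonneg p.2], by linarith, by linarith⟩
  have hr : ∀ p : ℝ × ℝ, p ∈ roof (-1) ∪ roof 1 ↔ |p.1| + |p.2| = 1 := by
    intro p
    simp only [roof, mem_union, mem_ofPred_eq]
    constructor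
    · rintro (⟨h1, h2⟩ | ⟨h1, h2⟩)
      · rw [abs_of_nonpos (by linarith : p.2 ≤ 0)]; linarith
      · rw [abs_of_nonneg (by linarith : 0 ≤ p.2)]; linarith
    · intro h
      have := abs_nonneg p.2
      rcases abs_cases p.2 with ⟨h1, _⟩ | ⟨h1, _⟩
      · right; constructor <;> linarith
      · left; constructor <;> linarith
  refine ⟨⟨by fun_prop, ?_, ?_⟩, fun u => by rw [hr]; simp only [key]⟩
  · intro p _ q _ e
    simp only [Prod.mk.injEq] at e
    exact Prod.ext (by linarith) (by linarith)
  · ext p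
    constructor
    · rintro ⟨u, hu, rfl⟩
      rw [hl]
      simp only [key]
      exact hu
    · intro hp
      have e : ((p.1 + p.2 + (p.1 - p.2)) / 2, (p.1 + p.2 - (p.1 - p.2)) / 2) = p :=
        Prod.ext (by simp only; ring) (by simp only; ring)
      refine ⟨(p.1 + p.2, p.1 - p.2), ?_, e⟩
      have := key (p.1 + p.2, p.1 - p.2)
      simp only at this
      rw [mem_ofPred_eq, ← this]
      have := (hl p).1 hp
      rw [← e] at this
      exact this

/-- The link of a boundary vertex is parametrized by the unit ball. -/
theorem Good.link_param (h : Good K) {v : Fin n} (hv : {v} ∈ dK K) :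
    ∃ g : ℝ × ℝ → (Fin n → ℝ), CHom g {u | ‖u‖ ≤ 1} (rl (fc (lk K {v}) 3)) ∧
      ∀ u : ℝ × ℝ, ‖u‖ ≤ 1 → (g u ∈ BS (bd (ind (fc (lk K {v}) 3))) ↔ ‖u‖ = 1) := by
  obtain ⟨a, l, hnd, hl, hb⟩ := h.link_boundary_cycle hv
  obtain ⟨l', b, rfl⟩ : ∃ l' b, l = l' ++ [b] := by
    rcases eq_nil_or_concat l with rfl | ⟨l', b, rfl⟩
    · simp at hl
    · exact ⟨l', b, by simp⟩
  have hl' : l' ≠ [] := by rintro rfl; simp at hl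
  have hdl := h.disc_link hv
  rw [hb] at hdl ⊢
  have hab : a ≠ b := by
    rintro rfl
    simp at hnd
  have hBS := BS_close hl' hnd
  rw [hBS] at hdl ⊢
  obtain ⟨θ, hθ, hθ0, hθ1⟩ := isArc_fcs hab
  obtain ⟨θ', hθ', hθ'0, hθ'1⟩ := isArc_pth hnd
  have hi : fcs {a, b} ∩ BS (pth (a :: (l' ++ [b]))) ⊆ {θ 0, θ 1} := by
    rintro w ⟨hw, hw'⟩
    obtain ⟨e, he, hwe⟩ := mem_BS.1 hw'
    rw [hθ0, hθ1]
    refine fcs_inter_edges hab (pth_card (isChain_ne_of_nodup hnd) he) ?_ hw hwe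
    rintro rfl
    exact he (pth_ne_chord hl' hnd)
  obtain ⟨ρ, hρ, -, -⟩ := chom_circle hθ hθ' (hθ0.trans hθ'0.symm) (hθ1.trans hθ'1.symm) hi
    (s := -1) (s' := 1) (by norm_num)
  have hlens := isDisc_lens (s := -1) (s' := 1) (by norm_num) (by norm_num) (by norm_num)
  obtain ⟨g, hg, hgρ⟩ := hlens.extend hdl hρ
  refine ⟨_, hg.comp chom_rotate.1, fun u hu => ?_⟩
  rw [← chom_rotate.2 u]
  constructor
  · intro hc
    rw [← hρ.img] at hc
    obtain ⟨p, hp, hpe⟩ := hc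
    rw [← hgρ hp] at hpe
    have := hg.inj (hlens.subset hp) (chom_rotate.1.mem hu) hpe
    exact this ▸ hp
  · intro hp
    simp only [Function.comp]
    rw [hgρ hp]
    exact hρ.mem hp

theorem Good.bd_link_ne_zero (h : Good K) {v : Fin n} (hv : {v} ∈ dK K) {e : Face n} :
    bd (ind (fc (lk K {v}) 3)) e ≠ 0 ↔ v ∉ e ∧ insert v e ∈ bT K := by
  have hvK := h.dK_subset hv
  have hk : ({v} : Face n).card + (2 + 1) = 4 := rfl
  constructor
  · intro he
    have h1 : e ∈ fc (lk K {v}) 2 := mem_of_ChS (bd_mem_ChS (ind_mem_ChS (Finset.Subset.refl _))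
      fun s hs x hx => by
        rw [mem_fc] at hs ⊢
        exact ⟨(h.cx.lk hvK).down s hs.1 _ (erase_subset _ _), by
          rw [card_erase_of_mem hx, hs.2]⟩) he
    rw [h.bd_top_link hk h1] at he
    have h2 : {v} ∪ e ∈ bT K := by by_contra hc; exact he (if_neg hc)
    refine ⟨?_, h2⟩
    have := (h.cx.mem_lk_iff.1 (mem_fc.1 h1).1).1
    simpa using this
  · rintro ⟨h1, h2⟩
    have h3 := (mem_bT.1 h2).1
    have h4 : e ∈ fc (lk K {v}) 2 := by
      rw [mem_fc, h.cx.mem_lk_iff]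
      refine ⟨⟨by simpa using h1, h3.1⟩, ?_⟩
      have := h3.2
      rw [Finset.card_insert_of_notMem h1] at this
      omega
    rw [h.bd_top_link hk h4, if_pos (show {v} ∪ e ∈ bT K from h2)]
    exact one_ne_zero

theorem fcs_cone {v : Fin n} {e : Face n} {y : Fin n → ℝ} (hy : y ∈ fcs e) {s : ℝ}
    (hs : s ∈ Icc (0 : ℝ) 1) : (1 - s) • Pi.single v 1 + s • y ∈ fcs (insert v e) := by
  have hy0 := fcs_mono (Finset.subset_insert v e) hy
  have hv := single_mem_fcs (mem_insert_self v e)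
  refine ⟨fun x => ?_, ?_, fun x hx => ?_⟩
  · have := hv.1 x
    have := hy0.1 x
    have := hs.1
    have := hs.2
    simp only [Pi.add_apply, Pi.smul_apply, smul_eq_mul]
    exact add_nonneg (mul_nonneg (by linarith) (by assumption)) (mul_nonneg (by linarith) (by assumption))
  · simp only [Pi.add_apply, Pi.smul_apply, smul_eq_mul, sum_add_distrib, ← mul_sum,
      hv.2.1, hy0.2.1]
    ring
  · simp only [Pi.add_apply, Pi.smul_apply, smul_eq_mul, hv.2.2 x hx, hy0.2.2 x hx]
    ring

theorem fcs_of_cone {v : Fin n} {t : Face n} {y : Fin n → ℝ} (hy0 : ∀ x, 0 ≤ y x)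
    (hy1 : ∑ x, y x = 1) (hyv : y v = 0) {s : ℝ} (hs : 0 < s)
    (h : (1 - s) • Pi.single v 1 + s • y ∈ fcs t) : y ∈ fcs (t.erase v) := by
  refine ⟨hy0, hy1, fun x hx => ?_⟩
  by_cases hxv : x = v
  · rw [hxv, hyv]
  · have := h.2.2 x fun hc => hx (mem_erase.2 ⟨hxv, hc⟩)
    simp only [Pi.add_apply, Pi.smul_apply, smul_eq_mul, Pi.single_eq_of_ne hxv, mul_zero,
      zero_add] at this
    exact (mul_eq_zero.1 this).resolve_left hs.ne'

theorem Good.bdChart (h : Good K) {v : Fin n} (hv : {v} ∈ dK K) :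
    ∃ Ψ : (ℝ × ℝ) × ℝ → (Fin n → ℝ), BdChart (rl K) (rl (bT K)) (fun w => w v) Ψ := by
  obtain ⟨g, hg, hgb⟩ := h.link_param hv
  have hvK := h.dK_subset hv
  have hL : ∀ y ∈ rl (fc (lk K {v}) 3), (∀ x, 0 ≤ y x) ∧ ∑ x, y x = 1 ∧ y v = 0 := by
    intro y hy
    obtain ⟨t, ht, hyt⟩ := mem_rl.1 hy
    refine ⟨hyt.1, hyt.2.1, hyt.2.2 v ?_⟩
    have := (h.cx.mem_lk_iff.1 (mem_fc.1 ht).1).1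
    simpa using this
  let M : Set ((ℝ × ℝ) × ℝ) := {u | ‖u‖ ≤ 1} ×ˢ Icc 0 1
  let q : (ℝ × ℝ) × ℝ → (ℝ × ℝ) × ℝ := fun p => (p.2 • p.1, p.2 * (1 - ‖p.1‖))
  let f : (ℝ × ℝ) × ℝ → (Fin n → ℝ) := fun p => (1 - p.2) • Pi.single v 1 + p.2 • g p.1
  have hMc : IsCompact M := by
    have : {u : ℝ × ℝ | ‖u‖ ≤ 1} = closedBall 0 1 := by ext; simp
    simp only [M, this]
    exact (isCompact_closedBall _ _).prod isCompact_Icc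
  have hfv : ∀ p ∈ M, f p v = 1 - p.2 := by
    intro p hp
    simp [f, (hL _ (hg.mem hp.1)).2.2]
  have hqs : ∀ p ∈ M, ‖(q p).1‖ + (q p).2 = p.2 := by
    intro p hp
    simp only [q, norm_smul, Real.norm_eq_abs, abs_of_nonneg hp.2.1]
    ring
  have hq : q '' M = halfCone (ℝ × ℝ) := by
    ext ⟨u, η⟩
    constructor
    · rintro ⟨p, hp, hpe⟩
      rw [← hpe]
      refine ⟨mul_nonneg hp.2.1 (sub_nonneg.2 hp.1), ?_⟩
      rw [hqs p hp]
      exact hp.2.2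
    · rintro ⟨h1, h2⟩
      simp only at h1 h2
      by_cases h0 : ‖u‖ + η = 0
      · have hu : ‖u‖ = 0 := by linarith [norm_nonneg u]
        have hη : η = 0 := by linarith
        refine ⟨(0, 0), ⟨by simp, by simp⟩, ?_⟩
        simp [q, hη, norm_eq_zero.1 hu]
      · have hpos : 0 < ‖u‖ + η := lt_of_le_of_ne (by positivity) (Ne.symm h0)
        have hn : ‖(‖u‖ + η)⁻¹ • u‖ = ‖u‖ / (‖u‖ + η) := by
          rw [norm_smul, norm_inv, Real.norm_of_nonneg hpos.le, inv_mul_eq_div]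
        refine ⟨((‖u‖ + η)⁻¹ • u, ‖u‖ + η), ⟨?_, hpos.le, h2⟩, ?_⟩
        · rw [mem_ofPred_eq, hn, div_le_one hpos]
          linarith
        · simp only [q, Prod.mk.injEq]
          refine ⟨smul_inv_smul₀ h0 u, ?_⟩
          rw [hn, mul_sub, mul_div_cancel₀ _ h0]
          ring
  have hqc : ContinuousOn q M := by fun_prop
  have hfc : ContinuousOn f M := by
    have : ContinuousOn (fun p : (ℝ × ℝ) × ℝ => g p.1) M :=
      hg.cont.comp continuousOn_fst fun p hp => hp.1
    exact ContinuousOn.add (by fun_prop) (continuousOn_snd.smul this)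
  obtain ⟨Ψ, hΨc, hΨ⟩ := hMc.exists_factor hqc hfc (by
    intro p hp p' hp' e
    have hs : p.2 = p'.2 := by rw [← hqs p hp, ← hqs p' hp', e]
    simp only [q, Prod.mk.injEq, hs] at e
    simp only [f, hs]
    by_cases h0 : p'.2 = 0
    · simp [h0]
    · rw [smul_right_injective _ h0 e.1])
  rw [hq] at hΨc
  refine ⟨Ψ, hΨc, ?_, ?_, by fun_prop, ?_, ?_, ?_, ?_⟩
  · rw [← hq]
    rintro _ ⟨p, hp, rfl⟩ _ ⟨p', hp', rfl⟩ e
    rw [hΨ p hp, hΨ p' hp'] at e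
    have hs : p.2 = p'.2 := by
      have := congrFun e v
      rw [hfv p hp, hfv p' hp'] at this
      linarith
    simp only [f, hs, add_right_inj] at e
    by_cases h0 : p'.2 = 0
    · simp [q, hs, h0]
    · rw [show p = p' from Prod.ext (hg.inj hp.1 hp'.1 (smul_right_injective _ h0 e)) hs]
  · rw [← hq]
    rintro _ ⟨p, hp, rfl⟩
    rw [hΨ p hp]
    obtain ⟨t, ht, hgt⟩ := mem_rl.1 (hg.mem hp.1)
    refine mem_rl.2 ⟨insert v t, ?_, fcs_cone hgt hp.2⟩
    exact (h.cx.mem_lk_iff.1 (mem_fc.1 ht).1).2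
  · intro x hx
    obtain ⟨t, -, hxt⟩ := mem_rl.1 hx
    exact hxt.1 v
  · intro x hx hxv
    obtain ⟨t, ht, hxt⟩ := mem_rl.1 hx
    suffices hs : ∃ p ∈ M, f p = x by
      obtain ⟨p, hp, rfl⟩ := hs
      exact ⟨q p, hq ▸ mem_image_of_mem q hp, hΨ p hp⟩
    have hvt : v ∈ t := by
      by_contra hc
      exact hxv.ne' (hxt.2.2 v hc)
    by_cases hx1 : x v = 1
    · refine ⟨(0, 0), ⟨by simp, by simp⟩, ?_⟩
      have hz : ∀ y, y ≠ v → x y = 0 := by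
        intro y hy
        have h1 := Finset.add_le_sum (f := x) (fun i _ => hxt.1 i) (Finset.mem_univ v)
          (Finset.mem_univ y) hy.symm
        rw [hxt.2.1] at h1
        exact le_antisymm (by linarith) (hxt.1 y)
      funext y
      by_cases hy : y = v
      · subst hy; simp [f, hx1]
      · simp [f, hy, hz y hy]
    · have hle : x v ≤ 1 := by
        rw [← hxt.2.1]
        exact single_le_sum (fun i _ => hxt.1 i) (Finset.mem_univ v)
      have hlt : 0 < 1 - x v := sub_pos.2 (lt_of_le_of_ne hle hx1)
      obtain ⟨T, hT, htT⟩ := h.pure ht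
      have hTm := (mem_fc.1 hT)
      set y : Fin n → ℝ := fun z => (1 - x v)⁻¹ * (x z - x v * Pi.single (M := fun _ => ℝ) v 1 z) with hy
      have hyT : y ∈ fcs (T \ {v}) := by
        have hxT := fcs_mono htT hxt
        refine ⟨fun z => ?_, ?_, fun z hz => ?_⟩
        · refine mul_nonneg (inv_nonneg.2 hlt.le) ?_
          by_cases hz : z = v
          · subst hz; simp
          · simp [hz, hxt.1 z]
        · simp only [hy, ← mul_sum, sum_sub_distrib, hxt.2.1]
          simp [hlt.ne']
        · by_cases hzv : z = v
          · subst hzv; simp [hy]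
          · have : z ∉ T := fun hc => hz (by simp [hc, hzv])
            simp [hy, hzv, hxT.2.2 z this]
      have hyL : y ∈ rl (fc (lk K {v}) 3) := by
        refine mem_rl.2 ⟨_, mem_fc.2 ⟨h.cx.sdiff_mem_lk hTm.1 (by simpa using htT hvt), ?_⟩, hyT⟩
        rw [card_sdiff_of_subset (by simpa using htT hvt), hTm.2]
        rfl
      rw [← hg.img] at hyL
      obtain ⟨u, hu, huy⟩ := hyL
      refine ⟨(u, 1 - x v), ⟨hu, hlt.le, by simp only; linarith⟩, ?_⟩
      funext z
      simp only [f, huy, hy, Pi.add_apply, Pi.smul_apply, smul_eq_mul]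
      rw [mul_inv_cancel_left₀ hlt.ne']
      ring
  · rw [← hq]
    rintro _ ⟨p, hp, rfl⟩
    rw [hΨ p hp, hfv p hp, ← hqs p hp]
    ring
  · rw [← hq]
    rintro _ ⟨p, hp, rfl⟩ hpos
    rw [hΨ p hp] at hpos ⊢
    rw [hfv p hp] at hpos
    have hLp := hL _ (hg.mem hp.1)
    simp only [q, mul_eq_zero, sub_eq_zero]
    by_cases h0 : p.2 = 0
    · simp only [h0, true_or, iff_true]
      obtain ⟨t, ht, hvt⟩ := mem_dK.1 hv
      refine mem_rl.2 ⟨t, ht, ?_⟩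
      simp only [f, h0, sub_zero, one_smul, zero_smul, add_zero]
      exact single_mem_fcs (hvt (mem_singleton_self v))
    · have hp0 : 0 < p.2 := lt_of_le_of_ne hp.2.1 (Ne.symm h0)
      simp only [h0, false_or]
      rw [eq_comm, ← hgb p.1 hp.1]
      constructor
      · intro hf
        obtain ⟨t, ht, hft⟩ := mem_rl.1 hf
        have hvt : v ∈ t := by
          by_contra hc
          have := hft.2.2 v hc
          rw [hfv p hp] at this
          linarith
        refine mem_BS.2 ⟨t.erase v, (h.bd_link_ne_zero hv).2 ⟨notMem_erase v t, ?_⟩,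
          fcs_of_cone hLp.1 hLp.2.1 hLp.2.2 hp0 hft⟩
        rwa [insert_erase hvt]
      · intro hf
        obtain ⟨e, he, hge⟩ := mem_BS.1 hf
        exact mem_rl.2 ⟨_, ((h.bd_link_ne_zero hv).1 he).2, fcs_cone hge hp.2⟩

/-- The realization of a good complex is collared along its boundary. -/
theorem Good.collar (h : Good K) : ∃ F : (Fin n → ℝ) → ℝ, Continuous F ∧ (∀ x, 0 ≤ F x) ∧
    (∀ x ∈ rl (bT K), 0 < F x) ∧ ∃ G, CHom G (collared (rl K) (rl (bT K)) F) (rl K) ∧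
      ∀ x ∈ rl (bT K), G (x, F x) = x := by
  classical
  choose! Ψ hΨ using fun v (hv : {v} ∈ dK K) => h.bdChart hv
  let s : Face n := Finset.univ.filter fun v => {v} ∈ dK K
  have hsub : rl (bT K) ⊆ rl K := by
    intro w hw
    obtain ⟨t, ht, hwt⟩ := mem_rl.1 hw
    exact mem_rl.2 ⟨t, (mem_bT.1 ht).1.1, hwt⟩
  obtain ⟨G, hG, hG'⟩ := exists_collar (isCompact_rl K) (isCompact_rl (bT K)) hsub s
    (fun v w => w v) Ψ fun v hv => hΨ v (mem_filter.1 hv).2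
  refine ⟨_, ?_, fun x => sum_nonneg fun v _ => le_max_left _ _, ?_, G, hG, hG'⟩
  · fun_prop
  · intro x hx
    obtain ⟨t, ht, hxt⟩ := mem_rl.1 hx
    have h1 := sum_fcs hxt
    obtain ⟨v, hv, hxv⟩ : ∃ v ∈ t, 1 / 4 < x v := by
      by_contra! hc
      have h2 := Finset.sum_le_card_nsmul t x _ hc
      rw [(mem_bT.1 ht).1.2, h1] at h2
      norm_num at h2
    refine Finset.sum_pos' (fun v _ => le_max_left _ _) ⟨v, mem_filter.2
      ⟨Finset.mem_univ v, mem_dK.2 ⟨t, ht, by simpa using hv⟩⟩, ?_⟩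
    exact lt_max_of_lt_right (by linarith)

end

section

variable {E : Type*} [NormedAddCommGroup E] [NormedSpace ℝ E]

/-- A radial embedding of the whole space into a ball, fixing the concentric ball of half the
radius. -/
def rad (ε : ℝ) (b w : E) : E :=
  b + (ε / max ‖w - b‖ (ε / 2) - ε ^ 2 / (4 * max ‖w - b‖ (ε / 2) ^ 2)) • (w - b)

/-- The inverse of `rad`. -/
def irad (ε : ℝ) (b w : E) : E :=
  b + (ε ^ 2 / (4 * max ‖w - b‖ (ε / 2) * (ε - max ‖w - b‖ (ε / 2)))) • (w - b)

variable {ε : ℝ} {b : E}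

theorem continuous_rad (hε : 0 < ε) : Continuous (rad ε b) := by
  have h : ∀ w : E, max ‖w - b‖ (ε / 2) ≠ 0 := fun w =>
    (lt_of_lt_of_le (half_pos hε) (le_max_right _ _)).ne'
  unfold rad
  refine continuous_const.add (Continuous.smul (Continuous.sub ?_ ?_) (by fun_prop))
  · exact Continuous.div (by fun_prop) (by fun_prop) h
  · exact Continuous.div (by fun_prop) (by fun_prop) fun w => by simp [h w]

theorem rad_of_le (hε : 0 < ε) {w : E} (h : ‖w - b‖ ≤ ε / 2) : rad ε b w = w := by
  rw [rad, max_eq_right h]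
  have : ε / (ε / 2) - ε ^ 2 / (4 * (ε / 2) ^ 2) = 1 := by field_simp; norm_num
  rw [this, one_smul, add_sub_cancel]

theorem rad_self (hε : 0 < ε) : rad ε b b = b := rad_of_le hε (by simp; positivity)

theorem norm_rad (hε : 0 < ε) {w : E} (h : ε / 2 ≤ ‖w - b‖) :
    ‖rad ε b w - b‖ = ε - ε ^ 2 / (4 * ‖w - b‖) := by
  have hp : 0 < ‖w - b‖ := lt_of_lt_of_le (half_pos hε) h
  rw [rad, max_eq_left h, add_sub_cancel_left, norm_smul, Real.norm_eq_abs, abs_of_nonneg]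
  · field_simp
  · have : ε / ‖w - b‖ - ε ^ 2 / (4 * ‖w - b‖ ^ 2) = ε * (4 * ‖w - b‖ - ε) / (4 * ‖w - b‖ ^ 2) := by
      field_simp
    rw [this]
    exact div_nonneg (mul_nonneg hε.le (by linarith)) (by positivity)

theorem half_le_norm_rad (hε : 0 < ε) {w : E} (h : ε / 2 ≤ ‖w - b‖) : ε / 2 ≤ ‖rad ε b w - b‖ := by
  have hp : 0 < ‖w - b‖ := lt_of_lt_of_le (half_pos hε) h
  rw [norm_rad hε h]
  have : ε ^ 2 / (4 * ‖w - b‖) ≤ ε / 2 := by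
    rw [div_le_iff₀ (by positivity)]
    nlinarith
  linarith

theorem norm_rad_lt (hε : 0 < ε) (w : E) : ‖rad ε b w - b‖ < ε := by
  rcases le_total ‖w - b‖ (ε / 2) with h | h
  · rw [rad_of_le hε h]
    linarith
  · have hp : 0 < ‖w - b‖ := lt_of_lt_of_le (half_pos hε) h
    rw [norm_rad hε h]
    have : 0 < ε ^ 2 / (4 * ‖w - b‖) := by positivity
    linarith

theorem irad_rad (hε : 0 < ε) (w : E) : irad ε b (rad ε b w) = w := by
  rcases le_total ‖w - b‖ (ε / 2) with h | h
  · rw [rad_of_le hε h, irad, max_eq_right h]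
    have : ε ^ 2 / (4 * (ε / 2) * (ε - ε / 2)) = 1 := by
      have h0 : ε - ε / 2 = ε / 2 := by ring
      rw [h0]
      field_simp
      norm_num
    rw [this, one_smul, add_sub_cancel]
  · have hp : 0 < ‖w - b‖ := lt_of_lt_of_le (half_pos hε) h
    have h2 := half_le_norm_rad hε h
    have h3 := norm_rad hε h
    rw [irad, max_eq_left h2, h3]
    nth_rewrite 1 [rad]
    rw [max_eq_left h, add_sub_cancel_left, smul_smul]
    have h4 : 0 < 4 * ‖w - b‖ - ε := by linarith
    have : ε ^ 2 / (4 * (ε - ε ^ 2 / (4 * ‖w - b‖)) * (ε - (ε - ε ^ 2 / (4 * ‖w - b‖)))) *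
        (ε / ‖w - b‖ - ε ^ 2 / (4 * ‖w - b‖ ^ 2)) = 1 := by
      have e1 : ε - ε ^ 2 / (4 * ‖w - b‖) = ε * (4 * ‖w - b‖ - ε) / (4 * ‖w - b‖) := by field_simp
      have e2 : ε / ‖w - b‖ - ε ^ 2 / (4 * ‖w - b‖ ^ 2) = ε * (4 * ‖w - b‖ - ε) / (4 * ‖w - b‖ ^ 2) := by
        field_simp
      rw [sub_sub_cancel, e1, e2]
      field_simp
    rw [this, one_smul, add_sub_cancel]

theorem rad_irad (hε : 0 < ε) {w : E} (hw : ‖w - b‖ < ε) : rad ε b (irad ε b w) = w := by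
  rcases le_total ‖w - b‖ (ε / 2) with h | h
  · have : irad ε b w = w := by
      rw [irad, max_eq_right h]
      have : ε ^ 2 / (4 * (ε / 2) * (ε - ε / 2)) = 1 := by
        have h0 : ε - ε / 2 = ε / 2 := by ring
        rw [h0]
        field_simp
        norm_num
      rw [this, one_smul, add_sub_cancel]
    rw [this, rad_of_le hε h]
  · have hp : 0 < ‖w - b‖ := lt_of_lt_of_le (half_pos hε) h
    have h1 : 0 < ε - ‖w - b‖ := by linarith
    have hn : ‖irad ε b w - b‖ = ε ^ 2 / (4 * (ε - ‖w - b‖)) := by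
      rw [irad, max_eq_left h, add_sub_cancel_left, norm_smul, Real.norm_eq_abs,
        abs_of_nonneg (by positivity)]
      field_simp
    have hn2 : ε / 2 ≤ ‖irad ε b w - b‖ := by
      rw [hn, le_div_iff₀ (by positivity)]
      nlinarith
    rw [rad, max_eq_left hn2, hn]
    nth_rewrite 1 [irad]
    rw [max_eq_left h, add_sub_cancel_left, smul_smul]
    have : (ε / (ε ^ 2 / (4 * (ε - ‖w - b‖))) -
        ε ^ 2 / (4 * (ε ^ 2 / (4 * (ε - ‖w - b‖))) ^ 2)) *
        (ε ^ 2 / (4 * ‖w - b‖ * (ε - ‖w - b‖))) = 1 := by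
      field_simp
      ring
    rw [this, one_smul, add_sub_cancel]

theorem rad_injective (hε : 0 < ε) : Function.Injective (rad ε b) :=
  LeftInverse.injective (irad_rad hε)

theorem continuousOn_irad (hε : 0 < ε) : ContinuousOn (irad ε b) (ball b ε) := by
  unfold irad
  refine continuousOn_const.add (ContinuousOn.smul (ContinuousOn.div (by fun_prop) (by fun_prop) ?_)
    (by fun_prop))
  intro w hw
  rw [mem_ball_iff_norm] at hw
  have h1 : 0 < max ‖w - b‖ (ε / 2) := lt_of_lt_of_le (half_pos hε) (le_max_right _ _)
  have h2 : max ‖w - b‖ (ε / 2) < ε := max_lt hw (by linarith)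
  have : 0 < ε - max ‖w - b‖ (ε / 2) := by linarith
  positivity

theorem isOpen_image_rad (hε : 0 < ε) {V : Set E} (hV : IsOpen V) : IsOpen (rad ε b '' V) := by
  have : rad ε b '' V = ball b ε ∩ irad ε b ⁻¹' V := by
    ext w
    constructor
    · rintro ⟨v, hv, rfl⟩
      refine ⟨by rw [mem_ball_iff_norm]; exact norm_rad_lt hε v, ?_⟩
      rwa [mem_preimage, irad_rad hε]
    · rintro ⟨h1, h2⟩
      rw [mem_ball_iff_norm] at h1
      exact ⟨_, h2, rad_irad hε h1⟩
  rw [this]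
  exact (continuousOn_irad hε).isOpen_inter_preimage isOpen_ball hV

/-- Pulling back a radial contraction along a map that is injective away from one fibre. -/
theorem exists_pullback_rad {X : Type*} [TopologicalSpace X] [T2Space X] {Q U : Set X}
    (hQ : IsCompact Q) (hU : IsOpen U) (hUQ : U ⊆ Q) {F : X → E} (hF : ContinuousOn F Q)
    (hε : 0 < ε) (hFU : IsOpen (F '' U)) (hb : closedBall b ε ⊆ F '' U)
    (hin : ∀ z ∈ Q, F z ∈ closedBall b ε → z ∈ U)
    (hinj : ∀ z ∈ Q, ∀ z' ∈ Q, F z = F z' → F z ∈ closedBall b ε → F z ≠ b → z = z') :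
    ∃ ψ : X → X, ContinuousOn ψ Q ∧ (∀ z ∈ Q, ψ z ∈ U ∧ F (ψ z) = rad ε b (F z)) ∧
      (∀ z ∈ Q, F z = b → ψ z = z) ∧
      (∀ z ∈ Q, ∀ z' ∈ Q, ψ z = ψ z' ↔ z = z' ∨ (F z = F z' ∧ F z ≠ b)) ∧ IsOpen (ψ '' U) := by
  have hbm : b ∈ closedBall b ε := mem_closedBall_self hε.le
  obtain ⟨x0, -, -⟩ := hb hbm
  have : Nonempty X := ⟨x0⟩
  let R : Set X := Q ∩ F ⁻¹' (closedBall b ε ∩ {w | ε / 2 ≤ ‖w - b‖})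
  have hcl : IsClosed (closedBall b ε ∩ {w | ε / 2 ≤ ‖w - b‖}) := by
    have : IsClosed {w : E | ε / 2 ≤ ‖w - b‖} := isClosed_le (by fun_prop) (by fun_prop)
    exact isClosed_closedBall.inter this
  have hR : IsCompact R := by
    have := hF.preimage_isClosed_of_isClosed hQ.isClosed hcl
    exact hQ.of_isClosed_subset this inter_subset_left
  have hne : ∀ w : E, ε / 2 ≤ ‖w - b‖ → w ≠ b := by
    rintro w h rfl
    simp at h
    linarith
  have hFR : CHom F R (F '' R) := by
    refine ⟨hF.mono inter_subset_left, ?_, rfl⟩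
    intro z hz z' hz' e
    exact hinj z hz.1 z' hz'.1 e hz.2.1 (hne _ hz.2.2)
  obtain ⟨g, hg, hg1, hg2⟩ := hFR.exists_inv hR
  have hmem : ∀ z ∈ Q, ε / 2 ≤ ‖F z - b‖ → rad ε b (F z) ∈ F '' R := by
    intro z hz h
    have h1 : rad ε b (F z) ∈ closedBall b ε := by
      rw [mem_closedBall_iff_norm]
      exact (norm_rad_lt hε _).le
    obtain ⟨y, hy, hye⟩ := hb h1
    refine ⟨y, ⟨hUQ hy, ?_⟩, hye⟩
    rw [mem_preimage, hye]
    exact ⟨h1, half_le_norm_rad hε h⟩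
  classical
  let ψ : X → X := fun z => if ‖F z - b‖ ≤ ε / 2 then z else g (rad ε b (F z))
  have hψ1 : ∀ z, ‖F z - b‖ ≤ ε / 2 → ψ z = z := fun z hz => if_pos hz
  have hψ2 : ∀ z ∈ Q, ε / 2 ≤ ‖F z - b‖ → ψ z = g (rad ε b (F z)) := by
    intro z hz h
    by_cases h' : ‖F z - b‖ ≤ ε / 2
    · rw [hψ1 z h', rad_of_le hε h', hg1 z ⟨hz, ?_, h⟩]
      rw [mem_closedBall_iff_norm]
      linarith
    · exact if_neg h'
  have hψF : ∀ z ∈ Q, ψ z ∈ U ∧ F (ψ z) = rad ε b (F z) := by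
    intro z hz
    rcases le_total ‖F z - b‖ (ε / 2) with h | h
    · rw [hψ1 z h, rad_of_le hε h]
      refine ⟨hin z hz ?_, rfl⟩
      rw [mem_closedBall_iff_norm]
      linarith
    · rw [hψ2 z hz h]
      have h1 := hmem z hz h
      have h2 := hg2 _ h1
      have h3 := hg.mem h1
      exact ⟨hin _ h3.1 h3.2.1, h2⟩
  have hψb : ∀ z ∈ Q, F z = b → ψ z = z := fun z _ h => hψ1 z (by rw [h]; simp; positivity)
  have hradb : ∀ w : E, rad ε b w = b ↔ w = b := fun w =>
    ⟨fun h => rad_injective hε (h.trans (rad_self hε).symm), fun h => h ▸ rad_self hε⟩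
  have hradc : ∀ w : E, rad ε b w ∈ closedBall b ε := fun w => by
    rw [mem_closedBall_iff_norm]
    exact (norm_rad_lt hε _).le
  refine ⟨ψ, ?_, hψF, hψb, ?_, ?_⟩
  · have h1 : IsClosed (Q ∩ F ⁻¹' {w | ‖w - b‖ ≤ ε / 2}) :=
      hF.preimage_isClosed_of_isClosed hQ.isClosed (isClosed_le (by fun_prop) (by fun_prop))
    have h2 : IsClosed (Q ∩ F ⁻¹' {w | ε / 2 ≤ ‖w - b‖}) :=
      hF.preimage_isClosed_of_isClosed hQ.isClosed (isClosed_le (by fun_prop) (by fun_prop))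
    have c1 : ContinuousOn ψ (Q ∩ F ⁻¹' {w | ‖w - b‖ ≤ ε / 2}) :=
      continuousOn_id.congr fun z hz => hψ1 z hz.2
    have c2 : ContinuousOn ψ (Q ∩ F ⁻¹' {w | ε / 2 ≤ ‖w - b‖}) := by
      refine ContinuousOn.congr (f := g ∘ (rad ε b ∘ F)) ?_ fun z hz => hψ2 z hz.1 hz.2
      exact hg.cont.comp ((continuous_rad hε).comp_continuousOn (hF.mono inter_subset_left))
        fun z hz => hmem z hz.1 hz.2
    refine (c1.union_of_isClosed c2 h1 h2).mono fun z hz => ?_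
    rcases le_total ‖F z - b‖ (ε / 2) with h | h
    exacts [Or.inl ⟨hz, h⟩, Or.inr ⟨hz, h⟩]
  · intro z hz z' hz'
    constructor
    · intro e
      have h1 : F z = F z' := rad_injective hε (by rw [← (hψF z hz).2, ← (hψF z' hz').2, e])
      by_cases h : F z = b
      · left
        rw [← hψb z hz h, e, hψb z' hz' (h1 ▸ h)]
      · exact Or.inr ⟨h1, h⟩
    · rintro (rfl | ⟨h1, h2⟩)
      · rfl
      · refine hinj _ (hUQ (hψF z hz).1) _ (hUQ (hψF z' hz').1) ?_ ?_ ?_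
        · rw [(hψF z hz).2, (hψF z' hz').2, h1]
        · rw [(hψF z hz).2]
          exact hradc _
        · rw [(hψF z hz).2]
          exact fun h => h2 ((hradb _).1 h)
  · have : ψ '' U = U ∩ F ⁻¹' (rad ε b '' (F '' U)) := by
      ext w
      constructor
      · rintro ⟨z, hz, rfl⟩
        have := hψF z (hUQ hz)
        exact ⟨this.1, _, ⟨z, hz, rfl⟩, this.2.symm⟩
      · rintro ⟨hw, _, ⟨z, hz, rfl⟩, h⟩
        by_cases hb' : F w = b
        · exact ⟨w, hw, hψb w (hUQ hw) hb'⟩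
        · have := hψF z (hUQ hz)
          refine ⟨z, hz, hinj _ (hUQ this.1) _ (hUQ hw) (this.2.trans h) ?_ ?_⟩
          · rw [this.2]
            exact hradc _
          · rw [this.2, h]
            exact hb'
    rw [this]
    exact (hF.mono hUQ).isOpen_inter_preimage hU (isOpen_image_rad hε hFU)

theorem exists_closedBall_preimage {X : Type*} [TopologicalSpace X] [T2Space X] {Q U : Set X}
    (hQ : IsCompact Q) (hU : IsOpen U) {F : X → E} (hF : ContinuousOn F Q)
    (h : ∀ z ∈ Q, F z = b → z ∈ U) {V : Set E} (hV : IsOpen V) (hb : b ∈ V) :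
    ∃ ε > 0, closedBall b ε ⊆ V ∧ ∀ z ∈ Q, F z ∈ closedBall b ε → z ∈ U := by
  have h1 : IsCompact (F '' (Q \ U)) := (hQ.diff hU).image_of_continuousOn (hF.mono sdiff_subset)
  have h2 : IsOpen (V ∩ (F '' (Q \ U))ᶜ) := hV.inter h1.isClosed.isOpen_compl
  have h3 : b ∈ V ∩ (F '' (Q \ U))ᶜ := ⟨hb, by
    rintro ⟨z, hz, e⟩
    exact hz.2 (h z hz.1 e)⟩
  obtain ⟨ε, hε, hs⟩ := nhds_basis_closedBall.mem_iff.1 (h2.mem_nhds h3)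
  refine ⟨ε, hε, hs.trans inter_subset_left, fun z hz hz' => ?_⟩
  by_contra hc
  exact (hs hz').2 ⟨z, ⟨hz, hc⟩, rfl⟩

end

section

/-- Collapsing the complement of a collar of a sphere to the centre of a ball. -/
theorem exists_collapse {V E : Type*} [NormedAddCommGroup V] [NormedSpace ℝ V]
    [NormedAddCommGroup E] [NormedSpace ℝ E] [Nontrivial E] {P S : Set V} {f : V → ℝ}
    (hP : IsCompact P) (hSP : S ⊆ P) (hSc : IsCompact S) (hf : Continuous f) (hf0 : ∀ x, 0 ≤ f x)
    (hfS : ∀ x ∈ S, 0 < f x) {G : V × ℝ → V} (hG : CHom G (collared P S f) P)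
    (hGS : ∀ x ∈ S, G (x, f x) = x) {j : E → V} (hj : CHom j (sphere 0 1) S)
    (hsph : IsCompact (sphere (0 : E) 1)) :
    ∃ g : V → E, ContinuousOn g P ∧ g '' P = closedBall 0 1 ∧
      (∀ x ∈ P, ∀ y ∈ P, g x = g y → g x ≠ 0 → x = y) ∧ ∀ x ∈ P, ‖g x‖ = 1 ↔ x ∈ S := by
  have hM := isCompact_collared hP hSc hSP hf hf0
  obtain ⟨i, hi, hi1, hi2⟩ := hj.exists_inv hsph
  obtain ⟨Gi, hGi, hGi1, hGi2⟩ := hG.exists_inv hM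
  let p : V × ℝ → E := fun q => (q.2 / f q.1) • i q.1
  have hin : ∀ x ∈ S, ‖i x‖ = 1 := fun x hx => by simpa using hi.mem hx
  have hpn : ∀ x ∈ S, ∀ t, 0 ≤ t → ‖p (x, t)‖ = t / f x := fun x hx t ht => by
    simp only [p]
    rw [norm_smul, hin x hx, mul_one, Real.norm_eq_abs, abs_of_nonneg (div_nonneg ht (hf0 x))]
  have hp0 : ∀ x, p (x, 0) = 0 := fun x => by simp [p]
  have hpS : ∀ q ∈ collared P S f, p q ≠ 0 → q.1 ∈ S := by
    rintro ⟨x, t⟩ ⟨-, -, h | h⟩ h0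
    · exact absurd (by rw [show t = 0 from h]; exact hp0 x) h0
    · exact h.1
  have hpM : ContinuousOn p (collared P S f) := by
    have c1 : ContinuousOn p (P ×ˢ {0}) := by
      refine ContinuousOn.congr (f := fun _ => 0) continuousOn_const ?_
      rintro ⟨x, t⟩ ⟨-, h⟩
      rw [show t = 0 from h]
      exact hp0 x
    have c2 : ContinuousOn p (S ×ˢ univ) := by
      refine ContinuousOn.smul (ContinuousOn.div (by fun_prop) (by fun_prop) ?_)
        (hi.cont.comp continuousOn_fst fun q hq => hq.1)
      exact fun q hq => (hfS _ hq.1).ne'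
    refine (c1.union_of_isClosed c2 (hP.isClosed.prod isClosed_singleton)
      (hSc.isClosed.prod isClosed_univ)).mono ?_
    rintro ⟨x, t⟩ ⟨hx, -, h | h⟩
    exacts [Or.inl ⟨hx, h⟩, Or.inr ⟨h.1, trivial⟩]
  have hinj : ∀ q ∈ collared P S f, ∀ q' ∈ collared P S f, p q = p q' → p q ≠ 0 → q = q' := by
    rintro ⟨x, t⟩ hq ⟨x', t'⟩ hq' e h0
    have hx := hpS _ hq h0
    have hx' := hpS _ hq' (e ▸ h0)
    have e1 := congrArg norm e
    simp only at hx hx'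
    rw [hpn x hx t hq.2.1, hpn x' hx' t' hq'.2.1] at e1
    have ht : t / f x ≠ 0 := by
      intro h
      apply h0
      simp only [p]
      rw [h, zero_smul]
    simp only [p] at e
    rw [← e1] at e
    have e2 := hi.inj hx hx' (smul_right_injective _ ht e)
    subst e2
    have := (div_left_inj' (hfS x hx).ne').1 e1
    rw [this]
  have hle : ∀ q ∈ collared P S f, ‖p q‖ ≤ 1 := by
    rintro ⟨x, t⟩ hq
    rcases hq.2.2 with h | h
    · rw [show t = 0 from h, hp0]
      simp
    · rw [hpn x h.1 t hq.2.1, div_le_one (hfS x h.1)]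
      exact h.2
  refine ⟨p ∘ Gi, hpM.comp hGi.cont hGi.mapsTo, ?_, ?_, ?_⟩
  · ext y
    constructor
    · rintro ⟨x, hx, rfl⟩
      simpa using hle _ (hGi.mem hx)
    · intro hy
      obtain ⟨u, hu, e⟩ : ∃ u ∈ sphere (0 : E) 1, ‖y‖ • u = y := by
        by_cases h0 : y = 0
        · obtain ⟨u, hu⟩ := exists_norm_eq E zero_le_one
          exact ⟨u, by simpa using hu, by simp [h0]⟩
        · refine ⟨‖y‖⁻¹ • y, by simp [norm_smul, h0], ?_⟩
          rw [smul_smul, mul_inv_cancel₀ (norm_ne_zero_iff.2 h0), one_smul]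
      have hx := hj.mem hu
      have hq : (j u, ‖y‖ * f (j u)) ∈ collared P S f := by
        refine ⟨hSP hx, mul_nonneg (norm_nonneg _) (hf0 _), Or.inr ⟨hx, ?_⟩⟩
        have : ‖y‖ ≤ 1 := by simpa using hy
        exact mul_le_of_le_one_left (hf0 _) this
      refine ⟨G (j u, ‖y‖ * f (j u)), hG.mem hq, ?_⟩
      rw [Function.comp_apply, hGi1 _ hq]
      simp only [p]
      rw [mul_div_cancel_right₀ _ (hfS _ hx).ne', hi1 u hu, e]
  · intro x hx y hy e h0
    exact hGi.inj hx hy (hinj _ (hGi.mem hx) _ (hGi.mem hy) e h0)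
  · intro x hx
    have hq := hGi.mem hx
    have e := hGi2 x hx
    constructor
    · intro h
      have hS := hpS _ hq (by rintro h'; rw [Function.comp_apply, h'] at h; simp at h)
      have := hpn _ hS (Gi x).2 hq.2.1
      rw [Prod.mk.eta] at this
      rw [Function.comp_apply, this, div_eq_one_iff_eq (hfS _ hS).ne'] at h
      have e3 := hGS _ hS
      rw [← h, Prod.mk.eta, e] at e3
      rwa [← e3] at hS
    · intro hS
      have hm : (x, f x) ∈ collared P S f := ⟨hx, hf0 x, Or.inr ⟨hS, le_rfl⟩⟩
      have : Gi x = (x, f x) := by rw [← hGi1 _ hm, hGS x hS]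
      rw [Function.comp_apply, this, hpn x hS _ (hf0 x), div_self (hfS x hS).ne']

end

section

variable {E : Type*} [NormedAddCommGroup E] [InnerProductSpace ℝ E]

/-- Inversion in the unit sphere centred at `c`. -/
def uinv (c : E) : E → E := EuclideanGeometry.inversion c 1

theorem uinv_uinv (c x : E) : uinv c (uinv c x) = x :=
  EuclideanGeometry.inversion_inversion c one_ne_zero x

theorem uinv_self (c : E) : uinv c c = c := EuclideanGeometry.inversion_self c 1

theorem uinv_injective (c : E) : Function.Injective (uinv c) :=
  EuclideanGeometry.inversion_injective c one_ne_zero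

theorem uinv_eq_center {c x : E} : uinv c x = c ↔ x = c :=
  EuclideanGeometry.inversion_eq_center one_ne_zero

theorem dist_uinv (c x : E) : dist (uinv c x) c = (dist x c)⁻¹ := by
  rw [uinv, EuclideanGeometry.dist_inversion_center, one_pow, one_div]

theorem continuousAt_uinv {c x : E} (h : x ≠ c) : ContinuousAt (uinv c) x :=
  ContinuousAt.inversion continuousAt_const continuousAt_const continuousAt_id h

theorem continuousOn_uinv (c : E) : ContinuousOn (uinv c) {c}ᶜ := fun _ h =>
  (continuousAt_uinv h).continuousWithinAt

theorem isOpen_uinv_preimage (c : E) {V : Set E} (hV : IsOpen V) :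
    IsOpen ({c}ᶜ ∩ uinv c ⁻¹' V) :=
  (continuousOn_uinv c).isOpen_inter_preimage isOpen_compl_singleton hV

theorem image_uinv (c : E) (V : Set E) : uinv c '' V = uinv c ⁻¹' V := by
  ext x
  exact ⟨by rintro ⟨y, hy, rfl⟩; rwa [mem_preimage, uinv_uinv], fun h => ⟨_, h, uinv_uinv c x⟩⟩

theorem isOpen_image_uinv {c : E} {V : Set E} (hV : IsOpen V) (hc : c ∉ V) :
    IsOpen (uinv c '' V) := by
  have : uinv c '' V = {c}ᶜ ∩ uinv c ⁻¹' V := by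
    rw [image_uinv, inter_eq_right.2]
    intro x hx h
    rw [mem_singleton_iff.1 h, mem_preimage, uinv_self] at hx
    exact hc hx
  rw [this]
  exact isOpen_uinv_preimage c hV

/-- A proper surjection of an open set onto the whole space, injective away from one fibre, can be
turned inside out into a map defined on a ball. -/
theorem exists_inside_out [ProperSpace E] [Nontrivial E] {W A : Set E} {h : E → E} (hW : IsOpen W)
    (hA : IsCompact A) (hAW : A ⊆ W) (hhA : ∀ x ∈ W, h x = 0 ↔ x ∈ A) (hh : ContinuousOn h W)
    (hsurj : ∀ y, ∃ x ∈ W, h x = y) (hinj : ∀ x ∈ W, ∀ y ∈ W, h x = h y → h x ≠ 0 → x = y)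
    (hprop : ∀ R, IsCompact {x | x ∈ W ∧ ‖h x‖ ≤ R}) :
    ∃ (o b a : E) (r : ℝ) (F : E → E), 0 < r ∧ a ≠ b ∧ ContinuousOn F (closedBall o r) ∧
      IsOpen (F '' ball o r) ∧ b ∈ F '' ball o r ∧
      (∀ z ∈ closedBall o r, F z = b → z ∈ ball o r) ∧
      (∀ z ∈ closedBall o r, F z = a ↔ uinv o z ∈ A) ∧ o ∉ A ∧
      (∀ x ∈ A, uinv o x ∈ ball o r) ∧
      (∀ z ∈ closedBall o r, ∀ z' ∈ closedBall o r, F z = F z' → F z ≠ b → F z ≠ a →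
        z = z') := by
  classical
  obtain ⟨b, hb0⟩ := exists_ne (0 : E)
  obtain ⟨o, hoW, hob⟩ := hsurj b
  have hoA : o ∉ A := fun h' => hb0 (by rw [← hob, (hhA o hoW).2 h'])
  obtain ⟨ε, hε, hD⟩ := nhds_basis_closedBall.mem_iff.1
    ((hW.inter hA.isClosed.isOpen_compl).mem_nhds ⟨hoW, hoA⟩)
  let F : E → E := fun z => if uinv o z ∈ W then uinv b (h (uinv o z)) else b
  have F1 : ∀ z, uinv o z ∈ W → F z = uinv b (h (uinv o z)) := fun z hz => if_pos hz
  have F2 : ∀ z, uinv o z ∉ W → F z = b := fun z hz => if_neg hz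
  have key : ∀ x ∈ W, h x = b → x = o := fun x hx e =>
    hinj x hx o hoW (e.trans hob.symm) (e ▸ hb0)
  have Fb : ∀ z, F z = b → uinv o z ∈ W → z = o := fun z e hz => by
    rw [F1 z hz, uinv_eq_center] at e
    exact uinv_eq_center.1 (key _ hz e)
  have Fo : F o = b := by rw [F1 o (by rwa [uinv_self]), uinv_self, hob, uinv_self]
  have hr : 0 < ε⁻¹ := inv_pos.2 hε
  have hQ : ∀ z, z ≠ o → (z ∈ closedBall o ε⁻¹ ↔ ε ≤ dist (uinv o z) o) := fun z hz => by
    rw [dist_uinv, mem_closedBall, le_inv_comm₀ hε (dist_pos.2 hz)]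
  have hU : ∀ z, z ≠ o → (z ∈ ball o ε⁻¹ ↔ uinv o z ∉ closedBall o ε) := fun z hz => by
    rw [mem_closedBall, dist_uinv, mem_ball, not_le,
      lt_inv_comm₀ hε (dist_pos.2 hz)]
  have hDW : ∀ x ∈ closedBall o ε, x ∈ W := fun x hx => (hD hx).1
  have hDA : ∀ x ∈ closedBall o ε, h x ≠ 0 := fun x hx e =>
    (hD hx).2 ((hhA x (hDW x hx)).1 e)
  let Y := h '' closedBall o ε
  have hY : IsCompact Y := (isCompact_closedBall o ε).image_of_continuousOn (hh.mono hDW)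
  have hbY : b ∈ Y := ⟨o, mem_closedBall_self hε.le, hob⟩
  have ha : uinv b 0 ≠ b := fun e => hb0 (uinv_eq_center.1 e).symm
  have hFU : F '' ball o ε⁻¹ = {w | w = b ∨ uinv b w ∉ Y} := by
    ext w
    constructor
    · rintro ⟨z, hz, rfl⟩
      by_cases hzW : uinv o z ∈ W
      · by_cases hzo : z = o
        · left
          rw [hzo, Fo]
        · right
          rw [F1 z hzW, uinv_uinv]
          rintro ⟨d, hd, e⟩
          have := hinj d (hDW d hd) _ hzW e (hDA d hd)
          rw [this] at hd
          exact (hU z hzo).1 hz hd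
      · exact Or.inl (F2 z hzW)
    · rintro (rfl | hw)
      · exact ⟨o, mem_ball_self hr, Fo⟩
      · obtain ⟨x, hx, e⟩ := hsurj (uinv b w)
        have hxD : x ∉ closedBall o ε := fun h' => hw (e ▸ mem_image_of_mem h h')
        have hxo : x ≠ o := by
          rintro rfl
          exact hxD (mem_closedBall_self hε.le)
        refine ⟨uinv o x, (hU _ (fun e' => hxo (uinv_eq_center.1 e'))).2 (by rwa [uinv_uinv]), ?_⟩
        rw [F1 _ (by rwa [uinv_uinv]), uinv_uinv, e, uinv_uinv]
  refine ⟨o, b, uinv b 0, ε⁻¹, F, hr, ha, ?_, ?_, ⟨o, mem_ball_self hr, Fo⟩, ?_, ?_, hoA, ?_,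
    ?_⟩
  · intro z hz
    by_cases hc : z ≠ o ∧ uinv o z ∈ W
    · obtain ⟨hzo, hzW⟩ := hc
      have hev : ∀ᶠ z' in nhds z, F z' = uinv b (h (uinv o z')) :=
        Filter.Eventually.mono ((continuousAt_uinv hzo).eventually (hW.mem_nhds hzW)) F1
      have hne : h (uinv o z) ≠ b := fun e => hzo (uinv_eq_center.1 (key _ hzW e))
      have : ContinuousAt (fun z' => uinv b (h (uinv o z'))) z :=
        ContinuousAt.comp (g := uinv b) (continuousAt_uinv hne)
          (ContinuousAt.comp (g := h) (hh.continuousAt (hW.mem_nhds hzW)) (continuousAt_uinv hzo))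
      exact (this.congr (hev.mono fun _ e => e.symm)).continuousWithinAt
    · have hFz : F z = b := by
        by_cases hzo : z = o
        · rw [hzo, Fo]
        · exact F2 z fun h' => hc ⟨hzo, h'⟩
      rw [continuousWithinAt_iff']
      intro δ hδ
      let C := {x | x ∈ W ∧ ‖h x‖ ≤ ‖b‖ + δ⁻¹} \ ball o ε
      have hCo : ∀ x ∈ C, x ≠ o := by
        rintro x hx rfl
        exact hx.2 (mem_ball_self hε)
      have hC : IsCompact (uinv o '' C) := ((hprop _).diff isOpen_ball).image_of_continuousOn
        ((continuousOn_uinv o).mono hCo)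
      have hzC : z ∉ uinv o '' C := by
        rintro ⟨x, hx, rfl⟩
        exact hc ⟨fun e => hCo x hx (uinv_eq_center.1 e), by rw [uinv_uinv]; exact hx.1.1⟩
      filter_upwards [self_mem_nhdsWithin,
        mem_nhdsWithin_of_mem_nhds (hC.isClosed.isOpen_compl.mem_nhds hzC)] with y hy hyC
      rw [hFz]
      by_contra hd
      apply hyC
      have hyW : uinv o y ∈ W := by
        by_contra h'
        rw [F2 y h', dist_self] at hd
        exact hd hδ
      have hyo : y ≠ o := by
        rintro rfl
        rw [Fo, dist_self] at hd
        exact hd hδ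
      refine ⟨uinv o y, ⟨⟨hyW, ?_⟩, ?_⟩, uinv_uinv o y⟩
      · rw [F1 y hyW, dist_uinv, not_lt] at hd
        have hp : 0 < dist (h (uinv o y)) b := by
          refine dist_pos.2 fun e => hyo (uinv_eq_center.1 (key _ hyW e))
        have h3 := (le_inv_comm₀ hδ hp).1 hd
        rw [dist_eq_norm] at h3
        calc ‖h (uinv o y)‖ = ‖b + (h (uinv o y) - b)‖ := by rw [add_sub_cancel]
          _ ≤ _ := (norm_add_le _ _).trans (by gcongr)
      · rw [mem_ball, not_lt]
        exact (hQ y hyo).1 hy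
  · rw [hFU, isOpen_iff_mem_nhds]
    rintro w hw
    by_cases hwb : w = b
    · subst hwb
      obtain ⟨R, hR0, hR⟩ := hY.isBounded.subset_closedBall_lt 0 w
      refine Filter.mem_of_superset (ball_mem_nhds w (inv_pos.2 hR0)) fun x hx => ?_
      by_cases hxw : x = w
      · exact Or.inl hxw
      · right
        intro hxY
        have := hR hxY
        rw [mem_closedBall, dist_uinv, inv_le_comm₀ (dist_pos.2 hxw) hR0] at this
        rw [mem_ball] at hx
        linarith
    · have h2 : uinv b w ∉ Y := hw.resolve_left hwb
      exact Filter.mem_of_superset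
        ((continuousAt_uinv hwb).eventually (hY.isClosed.isOpen_compl.mem_nhds h2))
        fun x hx => Or.inr hx
  · intro z hz e
    by_contra hzU
    have hzo : z ≠ o := by
      rintro rfl
      exact hzU (mem_ball_self hr)
    have := not_not.1 ((hU z hzo).not.1 hzU)
    exact hzo (Fb z e (hDW _ this))
  · intro z hz
    constructor
    · intro e
      have hzW : uinv o z ∈ W := by
        by_contra h'
        rw [F2 z h'] at e
        exact ha e.symm
      rw [F1 z hzW] at e
      exact (hhA _ hzW).1 (uinv_injective b e)
    · intro hz
      rw [F1 z (hAW hz), (hhA _ (hAW hz)).2 hz]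
  · intro x hx
    have hxo : x ≠ o := by
      rintro rfl
      exact hoA hx
    refine (hU _ fun e => hxo (uinv_eq_center.1 e)).2 ?_
    rw [uinv_uinv]
    exact fun h' => (hD h').2 hx
  · intro z hz z' hz' e hzb hza
    have hzW : uinv o z ∈ W := by
      by_contra h'
      exact hzb (F2 z h')
    have hzW' : uinv o z' ∈ W := by
      by_contra h'
      exact hzb (e.trans (F2 z' h'))
    rw [F1 z hzW] at e hza
    rw [F1 z' hzW'] at e
    exact uinv_injective o (hinj _ hzW _ hzW' (uinv_injective b e) fun h' => hza (by rw [h']))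

/-- The exceptional fibre of a collapse onto a cell is cellular. -/
theorem exists_cell [ProperSpace E] [Nontrivial E] {W A : Set E} {h : E → E} (hW : IsOpen W)
    (hA : IsCompact A) (hAW : A ⊆ W) (hhA : ∀ x ∈ W, h x = 0 ↔ x ∈ A) (hh : ContinuousOn h W)
    (hsurj : ∀ y, ∃ x ∈ W, h x = y) (hinj : ∀ x ∈ W, ∀ y ∈ W, h x = h y → h x ≠ 0 → x = y)
    (hprop : ∀ R, IsCompact {x | x ∈ W ∧ ‖h x‖ ≤ R}) {O : Set E} (hO : IsOpen O) (hAO : A ⊆ O) :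
    ∃ (κ : E → E) (D : Set E), CHom κ (closedBall 0 1) D ∧ D ⊆ O ∧
      IsOpen (κ '' ball 0 1) ∧ A ⊆ κ '' ball 0 1 := by
  obtain ⟨o, b, a, r, F, hr, hab, hF, hFo, hbF, hFb, hFa, hoA, hAU, hFi⟩ :=
    exists_inside_out hW hA hAW hhA hh hsurj hinj hprop
  have hQ := isCompact_closedBall o r
  have hUQ : ball o r ⊆ closedBall o r := ball_subset_closedBall
  obtain ⟨ε, hε, hε1, hε2⟩ := exists_closedBall_preimage hQ isOpen_ball hF hFb
    (hFo.inter isOpen_compl_singleton) ⟨hbF, fun e => hab (mem_singleton_iff.1 e).symm⟩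
  have hεa : a ∉ closedBall b ε := fun h' => (hε1 h').2 rfl
  obtain ⟨ψ, hψ, hψF, hψb, hψi, hψo⟩ := exists_pullback_rad hQ isOpen_ball hUQ hF hε hFo
    (hε1.trans inter_subset_left) hε2 fun z hz z' hz' e h1 h2 =>
      hFi z hz z' hz' e h2 fun h' => hεa (h' ▸ h1)
  obtain ⟨x0, hx0W, hx00⟩ := hsurj 0
  have hx0 := (hhA x0 hx0W).1 hx00
  have hz0 := hAU x0 hx0
  have hF0 : F (uinv o x0) = a := (hFa _ (hUQ hz0)).2 (by rwa [uinv_uinv])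
  obtain ⟨c, hc⟩ : ∃ c, c = ψ (uinv o x0) := ⟨_, rfl⟩
  have hψc : ∀ z ∈ closedBall o r, ψ z = c ↔ uinv o z ∈ A := by
    intro z hz
    rw [← hFa z hz, hc, hψi z hz _ (hUQ hz0), hF0]
    constructor
    · rintro (h' | h')
      · rw [h', hF0]
      · exact h'.1
    · exact fun h' => Or.inr ⟨h', h' ▸ hab⟩
  have hψinj : ∀ z ∈ closedBall o r, ∀ z' ∈ closedBall o r, ψ z = ψ z' → ψ z ≠ c →
      z = z' := by
    intro z hz z' hz' e hne
    rcases (hψi z hz z' hz').1 e with h' | ⟨h1, h2⟩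
    · exact h'
    · exact hFi z hz z' hz' h1 h2 fun h3 => hne ((hψc z hz).2 ((hFa z hz).1 h3))
  have hcU : c ∈ ψ '' ball o r := ⟨_, hz0, hc.symm⟩
  let O' := ball o r ∩ ({o}ᶜ ∩ uinv o ⁻¹' O)
  have hO' : IsOpen O' := isOpen_ball.inter (isOpen_uinv_preimage o hO)
  have hcO' : ∀ z ∈ closedBall o r, ψ z = c → z ∈ O' := by
    intro z hz e
    have h1 := (hψc z hz).1 e
    refine ⟨?_, ?_, hAO h1⟩
    · have := hAU _ h1
      rwa [uinv_uinv] at this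
    · intro h2
      rw [mem_singleton_iff.1 h2, uinv_self] at h1
      exact hoA h1
  obtain ⟨ε', hε', hε1', hε2'⟩ := exists_closedBall_preimage hQ hO' hψ hcO' hψo hcU
  obtain ⟨g, hg, hgψ, hgc, hgi, hgo⟩ := exists_pullback_rad hQ isOpen_ball hUQ hψ hε' hψo
    hε1' (fun z hz h' => (hε2' z hz h').1) fun z hz z' hz' e _ h2 => hψinj z hz z' hz' e h2
  have hgO' : ∀ z ∈ closedBall o r, g z ∈ O' := by
    intro z hz
    refine hε2' _ (hUQ (hgψ z hz).1) ?_
    rw [(hgψ z hz).2, mem_closedBall_iff_norm]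
    exact (norm_rad_lt hε' _).le
  have hginj : InjOn g (closedBall o r) := by
    intro z hz z' hz' e
    rcases (hgi z hz z' hz').1 e with h' | ⟨h1, h2⟩
    · exact h'
    · exact hψinj z hz z' hz' h1 h2
  let s : E → E := fun z => o + r • z
  have hs : Continuous s := by fun_prop
  have hs1 : ∀ z, dist (s z) o = r * ‖z‖ := fun z => by
    simp [s, norm_smul, abs_of_pos hr]
  have hsi : Function.Injective s := fun z z' e => smul_right_injective _ hr.ne' (add_left_cancel e)
  have hsQ : ∀ z ∈ closedBall (0 : E) 1, s z ∈ closedBall o r := fun z hz => by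
    rw [mem_closedBall, hs1]
    exact mul_le_of_le_one_right hr.le (by simpa using hz)
  have hsU : s '' ball 0 1 = ball o r := by
    ext y
    constructor
    · rintro ⟨z, hz, rfl⟩
      rw [mem_ball, hs1]
      exact mul_lt_of_lt_one_right hr (by simpa using hz)
    · intro hy
      have e : s (r⁻¹ • (y - o)) = y := by
        simp only [s]
        rw [smul_smul, mul_inv_cancel₀ hr.ne', one_smul, add_sub_cancel]
      refine ⟨r⁻¹ • (y - o), ?_, e⟩
      rw [mem_ball, ← e, hs1] at hy
      simpa using (mul_lt_iff_lt_one_right hr).1 hy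
  refine ⟨uinv o ∘ g ∘ s, _, ⟨?_, ?_, rfl⟩, ?_, ?_, ?_⟩
  · exact (continuousOn_uinv o).comp (hg.comp hs.continuousOn hsQ)
      fun z hz => (hgO' _ (hsQ z hz)).2.1
  · exact fun z hz z' hz' e => hsi (hginj (hsQ z hz) (hsQ z' hz') (uinv_injective o e))
  · rintro _ ⟨z, hz, rfl⟩
    exact (hgO' _ (hsQ z hz)).2.2
  · rw [image_comp, image_comp, hsU]
    refine isOpen_image_uinv hgo ?_
    rintro ⟨z, hz, e⟩
    exact (hgO' z (hUQ hz)).2.1 e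
  · rw [image_comp, image_comp, hsU]
    intro x hx
    refine ⟨uinv o x, ⟨_, hAU x hx, hgc _ (hUQ (hAU x hx)) ?_⟩, uinv_uinv o x⟩
    exact (hψc _ (hUQ (hAU x hx))).2 (by rwa [uinv_uinv])

end

section

variable {E : Type*} [NormedAddCommGroup E] [NormedSpace ℝ E]

/-- A radial self-homeomorphism of the unit ball squeezing towards the centre. -/
theorem chom_squeeze (k : ℕ) : CHom (fun z : E => ‖z‖ ^ k • z) (closedBall 0 1)
    (closedBall 0 1) := by
  have hn : ∀ z : E, ‖‖z‖ ^ k • z‖ = ‖z‖ ^ (k + 1) := fun z => by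
    rw [norm_smul, norm_pow, norm_norm, pow_succ]
  refine ⟨by fun_prop, ?_, ?_⟩
  · intro z _ w _ e
    have e1 := congrArg norm e
    simp only [hn] at e1
    have e2 : ‖z‖ = ‖w‖ := (pow_left_inj₀ (norm_nonneg _) (norm_nonneg _) (by omega)).1 e1
    simp only [e2] at e
    by_cases h : w = 0
    · rw [h, norm_zero, norm_eq_zero] at e2
      rw [e2, h]
    · exact smul_right_injective _ (pow_ne_zero k (norm_ne_zero_iff.2 h)) e
  · ext y
    constructor
    · rintro ⟨z, hz, rfl⟩
      rw [mem_closedBall_zero_iff] at hz ⊢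
      simp only [hn]
      exact pow_le_one₀ (norm_nonneg _) hz
    · intro hy
      rw [mem_closedBall_zero_iff] at hy
      by_cases h : y = 0
      · exact ⟨0, by simp, by simp [h]⟩
      · have h0 : 0 < ‖y‖ := norm_pos_iff.2 h
        obtain ⟨c, hc0, hc⟩ : ∃ c : ℝ, 0 ≤ c ∧ c ^ (k + 1) = ‖y‖ :=
          ⟨‖y‖ ^ ((k + 1 : ℕ) : ℝ)⁻¹, by positivity,
            Real.rpow_inv_natCast_pow h0.le (by omega)⟩
        have e : ‖(c / ‖y‖) • y‖ = c := by
          rw [norm_smul, Real.norm_eq_abs, abs_of_nonneg (by positivity), div_mul_cancel₀ _ h0.ne']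
        refine ⟨(c / ‖y‖) • y, ?_, ?_⟩
        · rw [mem_closedBall_zero_iff, e]
          exact (pow_le_one_iff_of_nonneg hc0 (by omega : k + 1 ≠ 0)).1 (hc ▸ hy)
        · simp only [e]
          rw [smul_smul, ← mul_div_assoc, ← pow_succ, hc, div_self h0.ne', one_smul]

variable {N W A : Set E}

theorem exists_shrink (hN : IsCompact N) (hWN : W ⊆ N)
    (hW : IsOpen W) (hAW : A ⊆ W) (hA : IsCompact A) (hne : A.Nonempty)
    (hcell : ∀ O : Set E, IsOpen O → A ⊆ O → ∃ (κ : E → E) (D : Set E),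
      CHom κ (closedBall 0 1) D ∧ D ⊆ O ∧ IsOpen (κ '' ball 0 1) ∧
        A ⊆ κ '' ball 0 1)
    [ProperSpace E] {Φ : E → E} (hΦ : CHom Φ N N) {V : Set E} (hV : IsOpen V) (hAV : A ⊆ V) {δ ε : ℝ}
    (hδ : 0 < δ) (hε : 0 < ε) :
    ∃ (Φ' : E → E) (V' : Set E), CHom Φ' N N ∧ IsOpen V' ∧ A ⊆ V' ∧ V' ⊆ V ∧
      V' ⊆ thickening δ A ∧ (∀ x ∈ N ∩ V', ∀ y ∈ N ∩ V', dist (Φ' x) (Φ' y) ≤ ε) ∧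
      (∀ x ∈ N, x ∉ V → Φ' x = Φ x) ∧ ∀ x ∈ N ∩ V, ∃ y ∈ N ∩ V, Φ' x = Φ y := by
  obtain ⟨κ, D, hκ, hDO, hκo, hAκ⟩ := hcell (V ∩ W) (hV.inter hW) (subset_inter hAV hAW)
  have hB := isCompact_closedBall (0 : E) 1
  obtain ⟨i, hi, hi1, hi2⟩ := hκ.exists_inv hB
  have hD := hκ.compact hB
  have hDN : D ⊆ N := fun x hx => hWN (hDO hx).2
  have hbD : κ '' ball 0 1 ⊆ D := by
    rw [← hκ.img]
    exact image_mono ball_subset_closedBall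
  have hiA : IsCompact (i '' A) := hA.image_of_continuousOn (hi.cont.mono (hAκ.trans hbD))
  have hiA1 : ∀ z ∈ i '' A, ‖z‖ < 1 := by
    rintro _ ⟨x, hx, rfl⟩
    obtain ⟨z, hz, rfl⟩ := hAκ hx
    rw [hi1 z (ball_subset_closedBall hz)]
    simpa using hz
  obtain ⟨z0, hz0, hmax⟩ := hiA.exists_isMaxOn (hne.image i) continuous_norm.continuousOn
  obtain ⟨ρ, hρ0, hρ1⟩ := exists_between (hiA1 z0 hz0)
  have hρ : 0 < ρ := (norm_nonneg _).trans_lt hρ0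
  have hcΦ : ContinuousWithinAt (Φ ∘ κ) (closedBall 0 1) 0 :=
    (hΦ.cont.comp hκ.cont fun z hz => hDN (hκ.mem hz)) 0 (mem_closedBall_self zero_le_one)
  obtain ⟨η, hη, hηΦ⟩ := continuousWithinAt_iff.1 hcΦ (ε / 2) (half_pos hε)
  obtain ⟨k, hk⟩ := exists_pow_lt_of_lt_one hη hρ1
  have hθ1 := (hκ.comp (chom_squeeze k)).comp hi
  have hbs : ∀ x ∈ D, x ∉ κ '' ball 0 1 → ‖i x‖ = 1 := by
    intro x hx hx'
    have h1 : ‖i x‖ ≤ 1 := by simpa using hi.mem hx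
    refine h1.antisymm (not_lt.1 fun h => hx' ⟨i x, by simpa using h, hi2 x hx⟩)
  have hfix : ∀ x ∈ D, x ∉ κ '' ball 0 1 →
      ((κ ∘ fun z : E => ‖z‖ ^ k • z) ∘ i) x = x := by
    intro x hx hx'
    simp [hbs x hx hx', hi2 x hx]
  have hid : CHom (id : E → E) (N \ κ '' ball 0 1) (N \ κ '' ball 0 1) :=
    ⟨continuousOn_id, injOn_id _, image_id _⟩
  obtain ⟨θ, hθ, hθD, hθN⟩ := hθ1.union hid hD.isClosed (hN.diff hκo).isClosed
    (fun x hx => hfix x hx.1 hx.2.2) fun x hx => ⟨x, hx, hfix x hx.1 hx.2.2⟩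
  have hun : D ∪ N \ κ '' ball 0 1 = N := by
    ext x
    constructor
    · rintro (h | h)
      exacts [hDN h, h.1]
    · intro h
      by_cases h' : x ∈ κ '' ball 0 1
      exacts [Or.inl (hbD h'), Or.inr ⟨h, h'⟩]
  rw [hun] at hθ
  have hθD' : ∀ x ∈ D, θ x ∈ D := fun x hx => by rw [hθD hx]; exact hθ1.mem hx
  have hθout : ∀ x ∈ N, x ∉ D → θ x = x := fun x hx hx' => hθN ⟨hx, fun h => hx' (hbD h)⟩
  have hV' : κ '' ball 0 ρ = κ '' ball 0 1 \
      κ '' (closedBall 0 1 \ ball 0 ρ) := by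
    ext x
    constructor
    · rintro ⟨z, hz, rfl⟩
      have hz1 := ball_subset_ball hρ1.le hz
      refine ⟨⟨z, hz1, rfl⟩, ?_⟩
      rintro ⟨w, hw, e⟩
      rw [hκ.inj hw.1 (ball_subset_closedBall hz1) e] at hw
      exact hw.2 hz
    · rintro ⟨⟨z, hz, rfl⟩, h⟩
      by_contra hc
      exact h ⟨z, ⟨ball_subset_closedBall hz, fun h' => hc ⟨z, h', rfl⟩⟩, rfl⟩
  have hV'o : IsOpen (κ '' ball 0 ρ) := by
    rw [hV']
    exact hκo.sdiff ((hB.diff isOpen_ball).image_of_continuousOn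
      (hκ.cont.mono sdiff_subset)).isClosed
  have hsmall : ∀ x ∈ κ '' ball 0 ρ, dist ((Φ ∘ θ) x) (Φ (κ 0)) < ε / 2 := by
    rintro _ ⟨z, hz, rfl⟩
    have hz1 := ball_subset_closedBall (ball_subset_ball hρ1.le hz)
    have hs := (chom_squeeze (E := E) k).mem hz1
    rw [Function.comp_apply, hθD (hκ.mem hz1), Function.comp_apply, Function.comp_apply, hi1 z hz1]
    refine hηΦ hs ?_
    rw [mem_ball_zero_iff] at hz
    rw [dist_zero_right, norm_smul, norm_pow, norm_norm]
    calc ‖z‖ ^ k * ‖z‖ ≤ ρ ^ k * 1 := by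
          gcongr
          linarith
      _ < η := by rwa [mul_one]
  refine ⟨Φ ∘ θ, κ '' ball 0 ρ ∩ (V ∩ thickening δ A), hΦ.comp hθ,
    hV'o.inter (hV.inter isOpen_thickening), ?_, fun x hx => hx.2.1, fun x hx => hx.2.2, ?_,
    ?_, ?_⟩
  · intro x hx
    refine ⟨⟨i x, ?_, hi2 x (hbD (hAκ hx))⟩, hAV hx, self_subset_thickening hδ A hx⟩
    rw [mem_ball_zero_iff]
    have h : ‖i x‖ ≤ ‖z0‖ := hmax (mem_image_of_mem i hx)
    linarith
  · intro x hx y hy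
    have h1 := hsmall x hx.2.1
    have h2 := hsmall y hy.2.1
    have h3 := dist_triangle_right ((Φ ∘ θ) x) ((Φ ∘ θ) y) (Φ (κ 0))
    linarith
  · intro x hx hxV
    rw [Function.comp_apply, hθout x hx fun h => hxV (hDO h).1]
  · intro x hx
    by_cases h : x ∈ D
    · exact ⟨θ x, ⟨hDN (hθD' x h), (hDO (hθD' x h)).1⟩, rfl⟩
    · exact ⟨x, hx, by rw [Function.comp_apply, hθout x hx.1 h]⟩

/-- A cellular set in the interior can be shrunk to a point. -/
theorem exists_quotient_self [ProperSpace E] (hN : IsCompact N) (hWN : W ⊆ N)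
    (hW : IsOpen W) (hAW : A ⊆ W) (hA : IsCompact A) (hne : A.Nonempty)
    (hcell : ∀ O : Set E, IsOpen O → A ⊆ O → ∃ (κ : E → E) (D : Set E),
      CHom κ (closedBall 0 1) D ∧ D ⊆ O ∧ IsOpen (κ '' ball 0 1) ∧
        A ⊆ κ '' ball 0 1) :
    ∃ Φ : E → E, ContinuousOn Φ N ∧ Φ '' N = N ∧
      ∀ x ∈ N, ∀ y ∈ N, Φ x = Φ y ↔ x = y ∨ (x ∈ A ∧ y ∈ A) := by
  let T := {p : (E → E) × Set E // CHom p.1 N N ∧ IsOpen p.2 ∧ A ⊆ p.2}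
  have step : ∀ (n : ℕ) (p : T), ∃ q : T, q.1.2 ⊆ p.1.2 ∧
      q.1.2 ⊆ thickening (1 / ((n : ℝ) + 1)) A ∧
      (∀ x ∈ N ∩ q.1.2, ∀ y ∈ N ∩ q.1.2, dist (q.1.1 x) (q.1.1 y) ≤ (1 / 2) ^ n) ∧
      (∀ x ∈ N, x ∉ p.1.2 → q.1.1 x = p.1.1 x) ∧
      ∀ x ∈ N ∩ p.1.2, ∃ y ∈ N ∩ p.1.2, q.1.1 x = p.1.1 y := by
    rintro n ⟨⟨Φ, V⟩, hΦ, hV, hAV⟩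
    obtain ⟨Φ', V', h1, h2, h3, h4⟩ := exists_shrink hN hWN hW hAW hA hne hcell hΦ hV hAV
      (δ := 1 / ((n : ℝ) + 1)) (ε := (1 / 2) ^ n) (by positivity) (by positivity)
    exact ⟨⟨(Φ', V'), h1, h2, h3⟩, h4⟩
  choose nx hnx using step
  let q0 : T := ⟨(id, univ), ⟨continuousOn_id, injOn_id _, image_id _⟩, isOpen_univ, subset_univ _⟩
  let q : ℕ → T := fun n => Nat.rec (nx 0 q0) (fun n p => nx (n + 1) p) n
  have hq : ∀ n, q (n + 1) = nx (n + 1) (q n) := fun n => rfl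
  let f : ℕ → E → E := fun n => (q n).1.1
  let V : ℕ → Set E := fun n => (q n).1.2
  have hf : ∀ n, CHom (f n) N N := fun n => (q n).2.1
  have hAV : ∀ n, A ⊆ V n := fun n => (q n).2.2.2
  have hth : ∀ n, V n ⊆ thickening (1 / ((n : ℝ) + 1)) A := fun n => by
    cases n with
    | zero => exact (hnx 0 q0).2.1
    | succ n => exact (hnx (n + 1) (q n)).2.1
  have hsm : ∀ n, ∀ x ∈ N ∩ V n, ∀ y ∈ N ∩ V n, dist (f n x) (f n y) ≤ (1 / 2) ^ n := fun n => by
    cases n with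
    | zero => exact (hnx 0 q0).2.2.1
    | succ n => exact (hnx (n + 1) (q n)).2.2.1
  have hout : ∀ n, ∀ x ∈ N, x ∉ V n → f (n + 1) x = f n x := fun n =>
    (hnx (n + 1) (q n)).2.2.2.1
  have hins : ∀ n, ∀ x ∈ N ∩ V n, ∃ y ∈ N ∩ V n, f (n + 1) x = f n y := fun n =>
    (hnx (n + 1) (q n)).2.2.2.2
  have hVsub : ∀ n, V (n + 1) ⊆ V n := fun n => (hnx (n + 1) (q n)).1
  have hVanti : Antitone V := antitone_nat_of_succ_le hVsub
  have hd : ∀ n, ∀ x ∈ N, dist (f n x) (f (n + 1) x) ≤ 2 / 2 / 2 ^ n := by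
    intro n x hx
    by_cases h : x ∈ V n
    · obtain ⟨y, hy, e⟩ := hins n x ⟨hx, h⟩
      rw [e]
      refine (hsm n x ⟨hx, h⟩ y hy).trans (le_of_eq ?_)
      rw [one_div, inv_pow]
      ring
    · rw [hout n x hx h, dist_self]
      positivity
  choose! Φ hΦ using fun x (hx : x ∈ N) =>
    cauchySeq_tendsto_of_complete (cauchySeq_of_le_geometric_two (f := fun n => f n x)
      fun n => hd n x hx)
  have hdl : ∀ n, ∀ x ∈ N, dist (f n x) (Φ x) ≤ 2 / 2 ^ n := fun n x hx =>
    dist_le_of_le_geometric_two_of_tendsto (fun n => hd n x hx) (hΦ x hx) n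
  have hlim : Filter.Tendsto (fun n : ℕ => (2 : ℝ) / 2 ^ n) Filter.atTop (nhds 0) := by
    have := (tendsto_pow_atTop_nhds_zero_of_lt_one (r := (1 / 2 : ℝ)) (by norm_num)
      (by norm_num)).const_mul 2
    rw [mul_zero] at this
    refine this.congr fun n => ?_
    rw [one_div, inv_pow]
    ring
  have hunif : TendstoUniformlyOn f Φ Filter.atTop N := by
    rw [tendstoUniformlyOn_iff]
    intro ε hε
    filter_upwards [hlim.eventually (gt_mem_nhds hε)] with n hn x hx
    rw [dist_comm]
    exact (hdl n x hx).trans_lt hn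
  have hΦc : ContinuousOn Φ N :=
    hunif.continuousOn (Filter.Frequently.of_forall fun n => (hf n).cont)
  have hΦN : ∀ x ∈ N, Φ x ∈ N := fun x hx => hN.isClosed.mem_of_tendsto (hΦ x hx)
    (Filter.Eventually.of_forall fun n => (hf n).mem hx)
  have hstab : ∀ m, ∀ x ∈ N, x ∉ V m → Φ x = f m x := by
    intro m x hx hm
    have : ∀ k, f (m + k) x = f m x := by
      intro k
      induction k with
      | zero => rfl
      | succ k ih =>
        rw [← ih]
        exact hout (m + k) x hx fun h => hm (hVanti (Nat.le_add_right m k) h)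
    refine tendsto_nhds_unique (hΦ x hx) (tendsto_const_nhds.congr' ?_)
    filter_upwards [Filter.eventually_ge_atTop m] with n hn
    obtain ⟨k, rfl⟩ := Nat.exists_eq_add_of_le hn
    exact (this k).symm
  have hins' : ∀ m, ∀ x ∈ N ∩ V m, ∀ k, ∃ y ∈ N ∩ V m, f (m + k) x = f m y := by
    intro m x hx k
    induction k generalizing x with
    | zero => exact ⟨x, hx, rfl⟩
    | succ k ih =>
      by_cases h : x ∈ V (m + k)
      · obtain ⟨y, hy, e⟩ := hins (m + k) x ⟨hx.1, h⟩
        obtain ⟨z, hz, e'⟩ := ih y ⟨hy.1, hVanti (Nat.le_add_right m k) hy.2⟩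
        exact ⟨z, hz, e.trans e'⟩
      · obtain ⟨z, hz, e'⟩ := ih x hx
        exact ⟨z, hz, (hout (m + k) x hx.1 h).trans e'⟩
  have hfar : ∀ x, x ∉ A → ∃ m : ℕ, x ∉ cthickening (1 / ((m : ℝ) + 1)) A := by
    intro x hx
    have h0 : 0 < infDist x A := (hA.isClosed.notMem_iff_infDist_pos hne).1 hx
    obtain ⟨m, hm⟩ := exists_nat_one_div_lt h0
    refine ⟨m, fun h => ?_⟩
    rw [hA.cthickening_eq_biUnion_closedBall (by positivity)] at h
    simp only [mem_iUnion, mem_closedBall] at h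
    obtain ⟨a, ha, hd⟩ := h
    have := infDist_le_dist_of_mem (x := x) ha
    linarith
  have hVc : ∀ m, V m ⊆ cthickening (1 / ((m : ℝ) + 1)) A := fun m =>
    (hth m).trans (thickening_subset_cthickening _ _)
  have hAne : ∀ x ∈ N, ∀ y ∈ N, x ∈ A → y ∉ A → Φ x ≠ Φ y := by
    intro x hx y hy hxA hyA e
    obtain ⟨m, hm⟩ := hfar y hyA
    have hc : IsCompact (f m '' (N ∩ cthickening (1 / ((m : ℝ) + 1)) A)) :=
      (hN.inter_right isClosed_cthickening).image_of_continuousOn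
        ((hf m).cont.mono inter_subset_left)
    have h1 : Φ x ∈ f m '' (N ∩ cthickening (1 / ((m : ℝ) + 1)) A) := by
      refine hc.isClosed.mem_of_tendsto (hΦ x hx) ?_
      filter_upwards [Filter.eventually_ge_atTop m] with n hn
      obtain ⟨k, rfl⟩ := Nat.exists_eq_add_of_le hn
      obtain ⟨z, hz, e'⟩ := hins' m x ⟨hx, hAV m hxA⟩ k
      exact ⟨z, ⟨hz.1, hVc m hz.2⟩, e'.symm⟩
    rw [e, hstab m y hy fun h => hm (hVc m h)] at h1
    obtain ⟨z, hz, e'⟩ := h1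
    rw [(hf m).inj hz.1 hy e'] at hz
    exact hm hz.2
  refine ⟨Φ, hΦc, ?_, fun x hx y hy => ⟨fun e => ?_, ?_⟩⟩
  · refine Subset.antisymm (by rintro _ ⟨x, hx, rfl⟩; exact hΦN x hx) fun y hy => ?_
    have hc := (hN.image_of_continuousOn hΦc).isClosed
    have : ∀ n, ∃ x ∈ N, f n x = y := fun n => by
      have := (hf n).img
      rw [← this] at hy
      exact hy
    choose x hx hxy using this
    refine hc.mem_of_tendsto (f := fun n => Φ (x n)) (b := Filter.atTop) ?_
      (Filter.Eventually.of_forall fun n => ⟨x n, hx n, rfl⟩)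
    rw [tendsto_iff_dist_tendsto_zero]
    refine squeeze_zero (fun _ => dist_nonneg) (fun n => ?_) hlim
    have := hdl n (x n) (hx n)
    rwa [hxy, dist_comm] at this
  · by_cases hxA : x ∈ A
    · by_cases hyA : y ∈ A
      · exact Or.inr ⟨hxA, hyA⟩
      · exact absurd e (hAne x hx y hy hxA hyA)
    · by_cases hyA : y ∈ A
      · exact absurd e.symm (hAne y hy x hx hyA hxA)
      · left
        obtain ⟨m, hm⟩ := hfar x hxA
        obtain ⟨m', hm'⟩ := hfar y hyA
        have h1 : x ∉ V (max m m') := fun h => hm (hVc m (hVanti (le_max_left _ _) h))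
        have h2 : y ∉ V (max m m') := fun h => hm' (hVc m' (hVanti (le_max_right _ _) h))
        rw [hstab _ x hx h1, hstab _ y hy h2] at e
        exact (hf _).inj hx hy e
  · rintro (rfl | ⟨hxA, hyA⟩)
    · rfl
    · refine tendsto_nhds_unique (hΦ x hx) ((hΦ y hy).congr_dist ?_)
      refine squeeze_zero (fun _ => dist_nonneg)
        (fun n => hsm n y ⟨hy, hAV n hyA⟩ x ⟨hx, hAV n hxA⟩) ?_
      exact tendsto_pow_atTop_nhds_zero_of_lt_one (by norm_num) (by norm_num)

end

section

/-- A compact set with open interior part that collapses onto a ball is a ball. -/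
theorem exists_chom_ball {E : Type*} [NormedAddCommGroup E] [InnerProductSpace ℝ E] [ProperSpace E]
    [Nontrivial E] {N S : Set E} (hN : IsCompact N) (hW : IsOpen (N \ S)) {f : E → E}
    (hf : ContinuousOn f N) (hfN : f '' N = closedBall 0 1)
    (hfi : ∀ x ∈ N, ∀ y ∈ N, f x = f y → f x ≠ 0 → x = y) (hfS : ∀ x ∈ N, ‖f x‖ = 1 ↔ x ∈ S) :
    ∃ g : E → E, CHom g (closedBall 0 1) N := by
  have hfl : ∀ x ∈ N, ‖f x‖ ≤ 1 := fun x hx => by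
    have := mem_image_of_mem f hx
    rw [hfN] at this
    simpa using this
  have hlt : ∀ x ∈ N \ S, ‖f x‖ < 1 := fun x hx =>
    (hfl x hx.1).lt_of_ne fun h => hx.2 ((hfS x hx.1).1 h)
  let A := N ∩ f ⁻¹' {0}
  have hA : IsCompact A := hN.of_isClosed_subset
    (hf.preimage_isClosed_of_isClosed hN.isClosed isClosed_singleton) inter_subset_left
  have hAW : A ⊆ N \ S := fun x hx => ⟨hx.1, fun h => by
    have := (hfS x hx.1).2 h
    rw [show f x = 0 from hx.2] at this
    simp at this⟩
  have hne : A.Nonempty := by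
    obtain ⟨x, hx, e⟩ := hfN.symm ▸ mem_closedBall_self (x := (0 : E)) zero_le_one
    exact ⟨x, hx, e⟩
  let h : E → E := fun x => (1 - ‖f x‖)⁻¹ • f x
  have hpos : ∀ x ∈ N \ S, 0 < 1 - ‖f x‖ := fun x hx => by linarith [hlt x hx]
  have hh : ContinuousOn h (N \ S) := by
    have hf' := hf.mono (sdiff_subset : N \ S ⊆ N)
    exact ((continuousOn_const.sub hf'.norm).inv₀ fun x hx => (hpos x hx).ne').smul hf'
  have hn : ∀ x ∈ N \ S, ‖h x‖ = ‖f x‖ / (1 - ‖f x‖) := fun x hx => by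
    simp only [h]
    rw [norm_smul, norm_inv, Real.norm_eq_abs, abs_of_pos (hpos x hx), div_eq_inv_mul]
  have hfh : ∀ x ∈ N \ S, f x = (1 + ‖h x‖)⁻¹ • h x := fun x hx => by
    have := hpos x hx
    rw [hn x hx]
    simp only [h]
    rw [smul_smul]
    have : (1 + ‖f x‖ / (1 - ‖f x‖))⁻¹ * (1 - ‖f x‖)⁻¹ = 1 := by
      field_simp
      ring
    rw [this, one_smul]
  have hh0 : ∀ x ∈ N \ S, h x = 0 ↔ f x = 0 := fun x hx => by
    simp only [h]
    rw [smul_eq_zero, inv_eq_zero, or_iff_right (hpos x hx).ne']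
  obtain ⟨Φ, hΦ, hΦN, hΦi⟩ := exists_quotient_self hN sdiff_subset hW hAW hA hne
    fun O hO hAO => exists_cell hW hA hAW
      (fun x hx => (hh0 x hx).trans ⟨fun e => ⟨hx.1, e⟩, fun e => e.2⟩) hh
      (fun y => by
        have hy : (1 + ‖y‖)⁻¹ • y ∈ closedBall (0 : E) 1 := by
          rw [mem_closedBall_zero_iff, norm_smul, norm_inv, Real.norm_eq_abs,
            abs_of_pos (by positivity), inv_mul_le_one₀ (by positivity)]
          linarith
        obtain ⟨x, hx, e⟩ := hfN.symm ▸ hy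
        have e1 : ‖f x‖ = ‖y‖ / (1 + ‖y‖) := by
          rw [e, norm_smul, norm_inv, Real.norm_eq_abs, abs_of_pos (by positivity), div_eq_inv_mul]
        have e2 : 1 - ‖f x‖ = (1 + ‖y‖)⁻¹ := by
          rw [e1]
          field_simp
          ring
        refine ⟨x, ⟨hx, fun hS => ?_⟩, ?_⟩
        · rw [(hfS x hx).2 hS, sub_self] at e2
          have : 0 < (1 + ‖y‖)⁻¹ := by positivity
          linarith
        · simp only [h]
          rw [e2, e, smul_smul, inv_inv, mul_inv_cancel₀ (by positivity), one_smul])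
      (fun x hx y hy e h0 => hfi x hx.1 y hy.1 (by rw [hfh x hx, hfh y hy, e])
        fun h' => h0 ((hh0 x hx).2 h'))
      (fun R => by
        have : {x | x ∈ N \ S ∧ ‖h x‖ ≤ R} = N ∩ f ⁻¹' {y | ‖y‖ * (1 + max R 0) ≤ max R 0 ∧
            ‖y‖ ≤ R * (1 - ‖y‖)} := by
          ext x
          constructor
          · rintro ⟨hx, hR⟩
            have hp := hpos x hx
            rw [hn x hx, div_le_iff₀ hp] at hR
            have := mul_le_mul_of_nonneg_right (le_max_left R 0) hp.le
            exact ⟨hx.1, by linarith, hR⟩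
          · rintro ⟨hx, h1, h2⟩
            have hxS : x ∈ N \ S := by
              refine ⟨hx, fun hS => ?_⟩
              rw [(hfS x hx).2 hS] at h1
              linarith
            refine ⟨hxS, ?_⟩
            rw [hn x hxS, div_le_iff₀ (hpos x hxS)]
            exact h2
        rw [this]
        have hc1 : IsClosed {y : E | ‖y‖ * (1 + max R 0) ≤ max R 0} :=
          isClosed_le (by fun_prop) (by fun_prop)
        have hc2 : IsClosed {y : E | ‖y‖ ≤ R * (1 - ‖y‖)} :=
          isClosed_le (by fun_prop) (by fun_prop)
        have hc := hc1.inter hc2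
        exact hN.of_isClosed_subset (hf.preimage_isClosed_of_isClosed hN.isClosed hc)
          inter_subset_left) hO hAO
  have key : ∀ x ∈ N, ∀ y ∈ N, f x = f y ↔ x = y ∨ (x ∈ A ∧ y ∈ A) := by
    intro x hx y hy
    constructor
    · intro e
      by_cases h0 : f x = 0
      · exact Or.inr ⟨⟨hx, h0⟩, hy, e.symm.trans h0⟩
      · exact Or.inl (hfi x hx y hy e h0)
    · rintro (rfl | ⟨h1, h2⟩)
      · rfl
      · exact h1.2.trans h2.2.symm
  obtain ⟨g, hg, hgf⟩ := hN.exists_factor hf hΦ fun x hx y hy e =>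
    (hΦi x hx y hy).2 ((key x hx y hy).1 e)
  rw [hfN] at hg
  refine ⟨g, hg, ?_, ?_⟩
  · rw [← hfN]
    rintro _ ⟨x, hx, rfl⟩ _ ⟨y, hy, rfl⟩ e
    rw [hgf x hx, hgf y hy] at e
    exact (key x hx y hy).2 ((hΦi x hx y hy).1 e)
  · rw [← hfN, image_image, image_congr hgf, hΦN]

/-- A good complex realized in space, with interior equal to the complement of the boundary
complex, is a ball. -/
theorem Good.ball {n : ℕ} {K : Fam n} (h : Good K) {φ : (Fin n → ℝ) → R3}
    {N : Set R3} (hφ : CHom φ (rl K) N) (hW : IsOpen (N \ φ '' rl (bT K))) :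
    ∃ g : R3 → R3, CHom g (closedBall 0 1) N := by
  obtain ⟨F, hF, hF0, hFS, G, hG, hGS⟩ := h.collar
  obtain ⟨j, hj⟩ := h.sphere
  have hP := isCompact_rl K
  have hSP : rl (bT K) ⊆ rl K := fun x hx => by
    obtain ⟨t, ht, hwt⟩ := mem_rl.1 hx
    exact mem_rl.2 ⟨t, (mem_bT.1 ht).1.1, hwt⟩
  obtain ⟨f, hf, hfN, hfi, hfS⟩ := exists_collapse hP hSP (isCompact_rl _) hF hF0 hFS hG hGS hj
    (isCompact_sphere _ _)
  obtain ⟨i, hi, hi1, hi2⟩ := hφ.exists_inv hP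
  refine exists_chom_ball (f := f ∘ i) (hφ.compact hP) hW (hf.comp hi.cont hi.mapsTo) ?_ ?_ ?_
  · rw [image_comp, hi.img, hfN]
  · exact fun x hx y hy e h0 => hi.inj hx hy (hfi _ (hi.mem hx) _ (hi.mem hy) e h0)
  · intro x hx
    rw [Function.comp_apply, hfS _ (hi.mem hx)]
    constructor
    · exact fun h' => ⟨_, h', hi2 x hx⟩
    · rintro ⟨y, hy, rfl⟩
      rwa [hi1 y (hSP hy)]

end

section

/-- One sign vector is obtained from another by replacing entries by zero. -/
def SgLe {ι : Type*} (s t : ι → SignType) : Prop := ∀ i, s i = 0 ∨ s i = t i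

theorem SgLe.refl {ι : Type*} (s : ι → SignType) : SgLe s s := fun _ => Or.inr rfl

theorem SgLe.trans {ι : Type*} {s t u : ι → SignType} (h : SgLe s t) (h' : SgLe t u) : SgLe s u :=
  fun i => by
    rcases h i with e | e
    · exact Or.inl e
    · rw [e]
      exact h' i

/-- Number of nonzero entries. -/
def nz {ι : Type*} [Fintype ι] (s : ι → SignType) : ℕ := (Finset.univ.filter fun i => s i ≠ 0).card

theorem SgLe.eq_of_nz {ι : Type*} [Fintype ι] {s t : ι → SignType} (h : SgLe s t)
    (h' : nz t ≤ nz s) : s = t := by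
  have hsub : (Finset.univ.filter fun i => s i ≠ 0) ⊆ Finset.univ.filter fun i => t i ≠ 0 := by
    intro i hi
    rw [mem_filter] at hi ⊢
    rw [← (h i).resolve_left hi.2]
    exact hi
  have e := Finset.eq_of_subset_of_card_le hsub h'
  funext i
  rcases h i with h0 | h0
  · by_contra hne
    have : i ∈ Finset.univ.filter fun i => t i ≠ 0 := by
      rw [mem_filter]
      refine ⟨Finset.mem_univ i, fun ht => hne (h0.trans ht.symm)⟩
    rw [← e, mem_filter] at this
    exact this.2 h0
  · exact h0

theorem SgLe.nz_lt {ι : Type*} [Fintype ι] {s t : ι → SignType} (h : SgLe s t) (hne : s ≠ t) :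
    nz s < nz t := lt_of_not_ge fun h' => hne (h.eq_of_nz h')

variable {E : Type*} [NormedAddCommGroup E] [NormedSpace ℝ E] {ι : Type*}

/-- The vector of signs of affine functionals. -/
def sgv (l : ι → E →ᵃ[ℝ] ℝ) (x : E) : ι → SignType := fun i => SignType.sign (l i x)

theorem sgv_combo {l : ι → E →ᵃ[ℝ] ℝ} {b y : E} {α β : ℝ} (hα : 0 < α) (hβ : 0 ≤ β)
    (hs : α + β = 1) (h : SgLe (sgv l y) (sgv l b)) : sgv l (α • b + β • y) = sgv l b := by
  funext i
  have e : l i (α • b + β • y) = α * l i b + β * l i y := Convex.combo_affine_apply hs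
  simp only [sgv, e]
  have hi := h i
  simp only [sgv] at hi
  rcases hi with hi | hi
  · rw [sign_eq_zero_iff] at hi
    rw [hi, mul_zero, add_zero, sign_mul, sign_pos hα, one_mul]
  · rcases lt_trichotomy (l i b) 0 with h0 | h0 | h0
    · rw [sign_neg h0, sign_eq_neg_one_iff] at hi
      rw [sign_neg h0, sign_neg]
      nlinarith
    · rw [h0, sign_zero, sign_eq_zero_iff] at hi
      rw [h0, hi, mul_zero, mul_zero, add_zero]
    · rw [sign_pos h0, sign_eq_one_iff] at hi
      rw [sign_pos h0, sign_pos]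
      nlinarith

theorem sgv_of_combo_eq {l : ι → E →ᵃ[ℝ] ℝ} {b y y' : E} {α α' : ℝ} (h : α < α') (h1 : α' ≤ 1)
    (e : α • b + (1 - α) • y = α' • b + (1 - α') • y') (hle : SgLe (sgv l y') (sgv l b)) :
    sgv l y = sgv l b := by
  have h0 : 0 < 1 - α := by linarith
  have : y = ((α' - α) / (1 - α)) • b + ((1 - α') / (1 - α)) • y' := by
    have e2 : (1 - α) • y = (α' - α) • b + (1 - α') • y' := by
      rw [sub_smul α', sub_add_eq_add_sub, ← e]
      abel
    rw [div_eq_inv_mul, div_eq_inv_mul, ← smul_smul, ← smul_smul, ← smul_add, ← e2, smul_smul,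
      inv_mul_cancel₀ h0.ne', one_smul]
  rw [this]
  refine sgv_combo (div_pos (by linarith) h0) (div_nonneg (by linarith) h0.le) ?_ hle
  rw [← add_div, div_eq_one_iff_eq h0.ne']
  ring

/-- A ray in a bounded union of sign cells leaves its cell through a smaller cell. -/
theorem exists_exit [FiniteDimensional ℝ E] [Fintype ι] {l : ι → E →ᵃ[ℝ] ℝ} {N : Set E}
    (hN : IsCompact N)
    (hl : ∀ x y, sgv l x = sgv l y → x ∈ N → y ∈ N) {b x : E} (hb : b ∈ N)
    (e : sgv l b = sgv l x) (hne : x ≠ b) :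
    ∃ t : ℝ, 1 < t ∧ b + t • (x - b) ∈ N ∧ SgLe (sgv l (b + t • (x - b))) (sgv l x) ∧
      sgv l (b + t • (x - b)) ≠ sgv l x := by
  let y : ℝ → E := fun t => b + t • (x - b)
  have hy : Continuous y := by fun_prop
  have hly : ∀ i t, l i (y t) = l i b + t * (l i x - l i b) := by
    intro i t
    have : y t = (1 - t) • b + t • x := by
      simp only [y]
      module
    rw [this, Convex.combo_affine_apply (by ring)]
    simp only [smul_eq_mul]
    ring
  let T := {t | sgv l (y t) = sgv l x}
  have h1T : (1 : ℝ) ∈ T := by simp [T, y]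
  have hTN : ∀ t ∈ T, y t ∈ N := fun t ht => hl b _ (e.trans (Eq.symm ht)) hb
  have hnx : 0 < ‖x - b‖ := norm_pos_iff.2 (sub_ne_zero.2 hne)
  obtain ⟨R, hR⟩ := hN.isBounded.subset_closedBall b
  have hbd : BddAbove T := by
    refine ⟨R / ‖x - b‖, fun t ht => ?_⟩
    have := hR (hTN t ht)
    rw [mem_closedBall_iff_norm] at this
    simp only [y, add_sub_cancel_left, norm_smul, Real.norm_eq_abs] at this
    rw [le_div_iff₀ hnx]
    nlinarith [le_abs_self t]
  obtain ⟨m, hm⟩ : ∃ m, m = sSup T := ⟨_, rfl⟩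
  have hmT : m ∈ closure T := hm ▸ csSup_mem_closure ⟨1, h1T⟩ hbd
  have hmN : y m ∈ N := by
    have := hy.continuousAt.continuousWithinAt.mem_closure (x := m) hmT hTN
    rwa [hN.isClosed.closure_eq] at this
  have hzero : ∀ i, sgv l x i = 0 → ∀ t, l i (y t) = 0 := by
    intro i hi t
    have h2 : sgv l b i = 0 := e ▸ hi
    simp only [sgv, sign_eq_zero_iff] at hi h2
    rw [hly, hi, h2]
    ring
  have hle : SgLe (sgv l (y m)) (sgv l x) := by
    intro i
    have hc : Continuous fun t => l i (y t) := by
      simp only [hly]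
      fun_prop
    rcases lt_trichotomy (l i x) 0 with h0 | h0 | h0
    · have : l i (y m) ≤ 0 := by
        have h3 := (hc.continuousAt (x := m)).continuousWithinAt.mem_closure (t := Iic 0) hmT
          fun t ht => by
            show l i (y t) ≤ 0
            have := congrFun (show sgv l (y t) = sgv l x from ht) i
            simp only [sgv, sign_neg h0, sign_eq_neg_one_iff] at this
            exact this.le
        rwa [isClosed_Iic.closure_eq] at h3
      rcases this.lt_or_eq with h4 | h4
      · right
        simp only [sgv, sign_neg h0, sign_neg h4]
      · left
        simp only [sgv, h4, sign_zero]
    · left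
      simp only [sgv, sign_eq_zero_iff]
      exact hzero i (by simp only [sgv, h0, sign_zero]) m
    · have : 0 ≤ l i (y m) := by
        have h3 := (hc.continuousAt (x := m)).continuousWithinAt.mem_closure (t := Ici 0) hmT
          fun t ht => by
            show 0 ≤ l i (y t)
            have := congrFun (show sgv l (y t) = sgv l x from ht) i
            simp only [sgv, sign_pos h0, sign_eq_one_iff] at this
            exact this.le
        rwa [isClosed_Ici.closure_eq] at h3
      rcases this.lt_or_eq with h4 | h4
      · right
        simp only [sgv, sign_pos h0, sign_pos h4]
      · left
        simp only [sgv, ← h4, sign_zero]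
  have hneq : sgv l (y m) ≠ sgv l x := by
    intro h
    have hev : ∀ᶠ t in nhds m, ∀ i, sgv l (y t) i = sgv l x i := by
      rw [Filter.eventually_all]
      intro i
      have hc : Continuous fun t => l i (y t) := by
        simp only [hly]
        fun_prop
      have hmi := congrFun h i
      rcases lt_trichotomy (l i x) 0 with h0 | h0 | h0
      · simp only [sgv, sign_neg h0, sign_eq_neg_one_iff] at hmi ⊢
        exact hc.continuousAt.eventually (gt_mem_nhds hmi)
      · exact Filter.Eventually.of_forall fun t => by
          simp only [sgv, h0, sign_zero, sign_eq_zero_iff]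
          exact hzero i (by simp only [sgv, h0, sign_zero]) t
      · simp only [sgv, sign_pos h0, sign_eq_one_iff] at hmi ⊢
        exact hc.continuousAt.eventually (lt_mem_nhds hmi)
    obtain ⟨ε, hε, hb⟩ := Metric.eventually_nhds_iff.1 hev
    have : m + ε / 2 ∈ T := funext (hb (by
      rw [dist_self_add_left, Real.norm_eq_abs, abs_of_pos (half_pos hε)]
      linarith))
    have := le_csSup hbd this
    rw [← hm] at this
    linarith
  refine ⟨m, ?_, hmN, hle, hneq⟩
  have h1 : 1 ≤ m := hm ▸ le_csSup hbd h1T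
  refine h1.lt_of_ne fun h => hneq ?_
  rw [← h]
  exact h1T

/-- The linear map determined by the images of the vertices. -/
def lin {n : ℕ} (b : Fin n → E) : (Fin n → ℝ) →ₗ[ℝ] E := Fintype.linearCombination ℝ b

theorem lin_apply {n : ℕ} (b : Fin n → E) (w : Fin n → ℝ) : lin b w = ∑ v, w v • b v := rfl

theorem lin_single {n : ℕ} (b : Fin n → E) (u : Fin n) : lin b (Pi.single u 1) = b u := by
  rw [lin, Fintype.linearCombination_apply_single, one_smul]

/-- Splitting off a vertex of a point of a simplex. -/
theorem exists_fcs_split {n : ℕ} {c : Face n} {w : Fin n → ℝ} (hw : w ∈ fcs c) {u : Fin n}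
    (hu : w u < 1) : ∃ w' ∈ fcs c, w = w u • Pi.single u 1 + (1 - w u) • w' ∧ w' u = 0 ∧
      ∀ v, v ≠ u → (w' v = 0 ↔ w v = 0) := by
  obtain ⟨h0, h1, h2⟩ := hw
  have hp : 0 < 1 - w u := by linarith
  let w' : Fin n → ℝ := fun v => if v = u then 0 else w v / (1 - w u)
  have hw' : ∀ v, v ≠ u → w' v = w v / (1 - w u) := fun v hv => if_neg hv
  have e : w = w u • Pi.single u 1 + (1 - w u) • w' := by
    funext v
    by_cases h : v = u
    · subst h
      simp [w']
    · simp only [Pi.add_apply, Pi.smul_apply, smul_eq_mul, hw' v h, Pi.single_eq_of_ne h, mul_zero,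
        zero_add]
      field_simp
  refine ⟨w', ⟨?_, ?_, ?_⟩, e, if_pos rfl, ?_⟩
  · intro v
    by_cases h : v = u
    · simp [w', h]
    · rw [hw' v h]
      exact div_nonneg (h0 v) hp.le
  · have h3 := h1
    rw [e] at h3
    simp only [Pi.add_apply, Pi.smul_apply, smul_eq_mul, sum_add_distrib,
      ← mul_sum, Finset.sum_pi_single', Finset.mem_univ, if_true] at h3
    have h4 : (1 - w u) * (∑ v, w' v - 1) = 0 := by linarith
    have := (mul_eq_zero.1 h4).resolve_left hp.ne'
    linarith
  · intro v hv
    by_cases h : v = u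
    · simp [w', h]
    · rw [hw' v h, h2 v hv, zero_div]
  · intro v hv
    rw [hw' v hv, div_eq_zero_iff, or_iff_left hp.ne']

variable [Fintype ι] {n : ℕ}

open Classical in
/-- The chains of a family of sign vectors. -/
def sgChains (S : Fin n → ι → SignType) : Fam n :=
  Finset.univ.filter fun c => ∀ u ∈ c, ∀ v ∈ c, SgLe (S u) (S v) ∨ SgLe (S v) (S u)

theorem mem_sgChains {S : Fin n → ι → SignType} {c : Face n} :
    c ∈ sgChains S ↔ ∀ u ∈ c, ∀ v ∈ c, SgLe (S u) (S v) ∨ SgLe (S v) (S u) := by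
  simp [sgChains]

theorem exists_top {l : ι → E →ᵃ[ℝ] ℝ} {b : Fin n → E}
    (hinj : Function.Injective fun v => sgv l (b v)) {c : Face n}
    (hc : c ∈ sgChains fun v => sgv l (b v)) (k : ℕ) :
    ∀ w ∈ fcs c, (Finset.univ.filter fun v => w v ≠ 0).card ≤ k →
      ∃ u w', w u ≠ 0 ∧ w u ≤ 1 ∧ sgv l (lin b w) = sgv l (b u) ∧
        w = w u • Pi.single u 1 + (1 - w u) • w' ∧ SgLe (sgv l (lin b w')) (sgv l (b u)) ∧
        (w u < 1 → w' ∈ fcs c ∧ sgv l (lin b w') ≠ sgv l (b u)) := by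
  induction k with
  | zero =>
    intro w hw h
    exfalso
    rw [Nat.le_zero, card_eq_zero, filter_eq_empty_iff] at h
    have := hw.2.1
    rw [sum_eq_zero fun v hv => not_not.1 (h hv)] at this
    exact zero_ne_one this
  | succ k ih =>
    intro w hw h
    have hne : (Finset.univ.filter fun v => w v ≠ 0).Nonempty := by
      rw [Finset.nonempty_iff_ne_empty]
      intro he
      rw [filter_eq_empty_iff] at he
      have := hw.2.1
      rw [sum_eq_zero fun v hv => not_not.1 (he hv)] at this
      exact zero_ne_one this
    obtain ⟨u, hu, hmax⟩ := Finset.exists_max_image _ (fun v => nz (sgv l (b v))) hne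
    rw [mem_filter] at hu
    have hle1 : w u ≤ 1 := by
      rw [← hw.2.1]
      exact single_le_sum (fun v _ => hw.1 v) (Finset.mem_univ u)
    have huc : u ∈ c := by
      by_contra h'
      exact hu.2 (hw.2.2 u h')
    rcases hle1.lt_or_eq with h1 | h1
    · obtain ⟨w', hw', e, hu0, hsupp⟩ := exists_fcs_split hw h1
      obtain ⟨v, -, hv0, -, hv, -⟩ := ih w' hw' (by
        have : (Finset.univ.filter fun v => w' v ≠ 0) ⊂ Finset.univ.filter fun v => w v ≠ 0 := by
          refine (Finset.ssubset_iff_of_subset fun v hv => ?_).2 ⟨u, by simp [hu.2], by simp [hu0]⟩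
          simp only [mem_filter, Finset.mem_univ, true_and] at hv ⊢
          have hvu : v ≠ u := by
            rintro rfl
            exact hv hu0
          exact fun h' => hv ((hsupp v hvu).2 h')
        have := Finset.card_lt_card this
        omega)
      have hvu : v ≠ u := by
        rintro rfl
        exact hv0 hu0
      have hvc : v ∈ c := by
        by_contra h'
        exact hv0 (hw'.2.2 v h')
      have hvw : nz (sgv l (b v)) ≤ nz (sgv l (b u)) :=
        hmax v (by simpa using fun h' => hv0 ((hsupp v hvu).2 h'))
      have hle : SgLe (sgv l (b v)) (sgv l (b u)) := by
        rcases mem_sgChains.1 hc v hvc u huc with h' | h'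
        · exact h'
        · rw [h'.eq_of_nz hvw]
          exact SgLe.refl _
      refine ⟨u, w', hu.2, hle1, ?_, e, hv ▸ hle, fun _ => ⟨hw', ?_⟩⟩
      · rw [e, map_add, map_smul, map_smul, lin_single]
        exact sgv_combo ((hw.1 u).lt_of_ne' hu.2) (by linarith) (by ring) (hv ▸ hle)
      · rw [hv]
        exact fun h' => hvu (hinj h')
    · have hws : w = Pi.single u 1 := by
        funext v
        by_cases hv : v = u
        · rw [hv, Pi.single_eq_same, h1]
        · rw [Pi.single_eq_of_ne hv]
          have h3 := hw.2.1
          rw [← add_sum_erase _ _ (Finset.mem_univ u), h1, add_eq_left] at h3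
          exact (Finset.sum_eq_zero_iff_of_nonneg fun v _ => hw.1 v).1 h3 v (by simp [hv])
      refine ⟨u, w, hu.2, hle1, ?_, ?_, ?_, fun h' => absurd h1 h'.ne⟩
      · rw [hws, lin_single]
      · rw [h1, sub_self, zero_smul, add_zero, one_smul]
        exact hws
      · rw [hws, lin_single]
        exact SgLe.refl _

theorem injOn_sgChains {l : ι → E →ᵃ[ℝ] ℝ} {b : Fin n → E}
    (hinj : Function.Injective fun v => sgv l (b v)) (k : ℕ) :
    ∀ w ∈ rl (sgChains fun v => sgv l (b v)), ∀ w' ∈ rl (sgChains fun v => sgv l (b v)),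
      nz (sgv l (lin b w)) < k → lin b w = lin b w' → w = w' := by
  induction k with
  | zero => exact fun _ _ _ _ h => absurd h (Nat.not_lt_zero _)
  | succ k ih =>
    intro w hw w' hw' hk e
    obtain ⟨c, hc, hwc⟩ := mem_rl.1 hw
    obtain ⟨c', hc', hwc'⟩ := mem_rl.1 hw'
    obtain ⟨u, y, hu0, hu1, hus, hue, hul, hul'⟩ := exists_top hinj hc _ w hwc le_rfl
    obtain ⟨u', y', hu0', hu1', hus', hue', hul2, hul2'⟩ := exists_top hinj hc' _ w' hwc' le_rfl
    have huu : u = u' := hinj (by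
      simp only
      rw [← hus, ← hus', e])
    subst huu
    have e1 : w u • b u + (1 - w u) • lin b y = w' u • b u + (1 - w' u) • lin b y' := by
      rw [hue, hue'] at e
      simp only [map_add, map_smul, lin_single] at e
      exact e
    rcases lt_trichotomy (w u) (w' u) with h | h | h
    · exact absurd (sgv_of_combo_eq h hu1' e1 hul2) (hul' (by linarith)).2
    · rw [h] at e1
      rcases hu1'.lt_or_eq with h1 | h1
      · have e2 : lin b y = lin b y' :=
          smul_right_injective _ (by linarith : (1 - w' u) ≠ 0) (add_left_cancel e1)
        have h3 := hul' (h ▸ h1)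
        have := ih y (mem_rl.2 ⟨c, hc, h3.1⟩) y' (mem_rl.2 ⟨c', hc', (hul2' h1).1⟩)
          (by have := hul.nz_lt h3.2; rw [← hus] at this; omega) e2
        rw [hue, hue', this, h]
      · rw [hue, hue', h, h1, sub_self, zero_smul, zero_smul]
    · exact absurd (sgv_of_combo_eq h hu1 e1.symm hul) (hul2' (by linarith)).2

theorem surjOn_sgChains [FiniteDimensional ℝ E] {l : ι → E →ᵃ[ℝ] ℝ} {b : Fin n → E} {N : Set E}
    (hN : IsCompact N) (hl : ∀ x y, sgv l x = sgv l y → x ∈ N → y ∈ N) (hb : ∀ v, b v ∈ N)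
    (hs : ∀ x ∈ N, ∃ v, sgv l (b v) = sgv l x) (k : ℕ) :
    ∀ x ∈ N, nz (sgv l x) < k → ∃ c ∈ sgChains fun v => sgv l (b v), ∃ w ∈ fcs c, lin b w = x ∧
      ∀ v ∈ c, SgLe (sgv l (b v)) (sgv l x) := by
  classical
  induction k with
  | zero => exact fun _ _ h => absurd h (Nat.not_lt_zero _)
  | succ k ih =>
    intro x hx hk
    obtain ⟨u, hu⟩ := hs x hx
    by_cases hxb : x = b u
    · refine ⟨{u}, mem_sgChains.2 ?_, Pi.single u 1, single_mem_fcs (mem_singleton_self u),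
        (lin_single b u).trans hxb.symm, ?_⟩
      · intro v hv v' hv'
        rw [Finset.mem_singleton] at hv hv'
        rw [hv, hv']
        exact Or.inl (SgLe.refl _)
      · intro v hv
        rw [Finset.mem_singleton] at hv
        rw [hv, hu]
        exact SgLe.refl _
    · obtain ⟨t, ht, hyN, hle, hne⟩ := exists_exit hN hl (hb u) hu hxb
      obtain ⟨c, hc, w, hw, e, hcl⟩ := ih _ hyN (by have := hle.nz_lt hne; omega)
      have hcl' : ∀ v ∈ c, SgLe (sgv l (b v)) (sgv l x) := fun v hv => (hcl v hv).trans hle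
      have ht0 : 0 < t := by linarith
      have hti : t⁻¹ ≤ 1 := inv_le_one_of_one_le₀ ht.le
      refine ⟨insert u c, mem_sgChains.2 ?_, t⁻¹ • w + (1 - t⁻¹) • Pi.single u 1, ?_, ?_, ?_⟩
      · intro v hv v' hv'
        rw [Finset.mem_insert] at hv hv'
        rcases hv with rfl | hv <;> rcases hv' with rfl | hv'
        · exact Or.inl (SgLe.refl _)
        · exact Or.inr (hu ▸ hcl' v' hv')
        · exact Or.inl (hu ▸ hcl' v hv)
        · exact mem_sgChains.1 hc v hv v' hv'
      · have h1 := fcs_mono (Finset.subset_insert u c) hw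
        have h2 := single_mem_fcs (mem_insert_self u c)
        refine ⟨fun v => ?_, ?_, fun v hv => ?_⟩
        · have := h1.1 v
          have := h2.1 v
          have : 0 ≤ 1 - t⁻¹ := by linarith
          simp only [Pi.add_apply, Pi.smul_apply, smul_eq_mul]
          positivity
        · simp only [Pi.add_apply, Pi.smul_apply, smul_eq_mul, sum_add_distrib,
            ← mul_sum]
          rw [h1.2.1, h2.2.1]
          ring
        · simp only [Pi.add_apply, Pi.smul_apply, smul_eq_mul]
          rw [h1.2.2 v hv, h2.2.2 v hv]
          ring
      · rw [map_add, map_smul, map_smul, lin_single, e, smul_add, smul_smul, inv_mul_cancel₀ ht0.ne',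
          one_smul]
        module
      · intro v hv
        rw [Finset.mem_insert] at hv
        rcases hv with rfl | hv
        · rw [hu]
          exact SgLe.refl _
        · exact hcl' v hv

/-- A compact union of sign cells has a finite triangulation. -/
theorem exists_triangulation_of_sgv [FiniteDimensional ℝ E] {l : ι → E →ᵃ[ℝ] ℝ} {N : Set E}
    (hN : IsCompact N) (hl : ∀ x y, sgv l x = sgv l y → x ∈ N → y ∈ N) :
    ∃ (n : ℕ) (b : Fin n → E) (K : Fam n), IsCx K ∧ CHom (lin b) (rl K) N := by
  classical
  have hfin : (sgv l '' N).Finite := toFinite _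
  obtain ⟨n, ⟨f⟩⟩ := Finite.exists_equiv_fin ↥(sgv l '' N)
  choose b hbN hbs using fun v : Fin n => (f.symm v).2
  have hinj : Function.Injective fun v => sgv l (b v) := by
    intro v v' e
    simp only [hbs] at e
    exact f.symm.injective (Subtype.ext e)
  refine ⟨n, b, sgChains fun v => sgv l (b v), ⟨mem_sgChains.2 (by simp), ?_⟩, ?_, ?_, ?_⟩
  · intro s hs t hts
    exact mem_sgChains.2 fun u hu v hv => mem_sgChains.1 hs u (hts hu) v (hts hv)
  · exact (continuous_of_finiteDimensional _).continuousOn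
  · exact fun w hw w' hw' e => injOn_sgChains hinj _ w hw w' hw' (Nat.lt_succ_self _) e
  · ext x
    constructor
    · rintro ⟨w, hw, rfl⟩
      obtain ⟨c, hc, hwc⟩ := mem_rl.1 hw
      obtain ⟨u, -, -, -, hus, -⟩ := exists_top hinj hc _ w hwc le_rfl
      exact hl _ _ hus.symm (hbN u)
    · intro hx
      obtain ⟨c, hc, w, hw, e, -⟩ := surjOn_sgChains hN hl hbN
        (fun x hx => ⟨f ⟨_, mem_image_of_mem _ hx⟩, by rw [hbs, Equiv.symm_apply_apply]⟩) _ x hx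
        (Nat.lt_succ_self _)
      exact ⟨w, mem_rl.2 ⟨c, hc, hw⟩, e⟩

theorem IsSimplexSet.exists_sgv {s : Set R3} (h : IsSimplexSet s) :
    ∃ L : Finset (R3 →ᵃ[ℝ] ℝ), ∀ x y, (∀ i ∈ L, SignType.sign (i x) = SignType.sign (i y)) →
      x ∈ s → y ∈ s := by
  classical
  obtain ⟨t, ht, rfl⟩ := h
  obtain ⟨t', htt, hai, htop⟩ := exists_subset_affineIndependent_affineSpan_eq_top ht
  have : Finite t' := finite_set_of_fin_dim_affineIndependent ℝ hai
  have := Fintype.ofFinite t'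
  let B : AffineBasis t' ℝ R3 := ⟨fun p => p, hai, by rwa [Subtype.range_coe]⟩
  have hB : ∀ i, B i = (i : R3) := fun _ => rfl
  have key : ∀ x, x ∈ convexHull ℝ (t : Set R3) ↔
      ∀ i, 0 ≤ B.coord i x ∧ ((i : R3) ∉ t → B.coord i x = 0) := by
    intro x
    constructor
    · have hconv : Convex ℝ {x | ∀ i, 0 ≤ B.coord i x ∧ ((i : R3) ∉ t → B.coord i x = 0)} := by
        intro x hx y hy α β hα hβ hs i
        rw [Convex.combo_affine_apply hs, smul_eq_mul, smul_eq_mul]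
        refine ⟨add_nonneg (mul_nonneg hα (hx i).1) (mul_nonneg hβ (hy i).1), fun hi => ?_⟩
        rw [(hx i).2 hi, (hy i).2 hi, mul_zero, mul_zero, add_zero]
      refine fun hx => convexHull_min (fun p hp => ?_) hconv hx
      intro i
      have hp' := htt hp
      have e : p = B ⟨p, hp'⟩ := rfl
      rw [e, B.coord_apply]
      split_ifs with h
      · refine ⟨zero_le_one, fun h' => ?_⟩
        rw [h] at h'
        exact absurd hp h'
      · exact ⟨le_rfl, fun _ => rfl⟩
    · intro hx
      rw [← B.linear_combination_coord_eq_self x, ← Finset.sum_filter_add_sum_filter_not _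
        fun i : t' => (i : R3) ∈ t, sum_eq_zero
        (s := Finset.univ.filter fun i : t' => (i : R3) ∉ t), add_zero]
      · refine (convex_convexHull ℝ _).sum_mem (fun i _ => (hx i).1) ?_ fun i hi =>
          subset_convexHull ℝ _ (mem_filter.1 hi).2
        rw [← B.sum_coord_apply_eq_one x, sum_filter]
        refine sum_congr rfl fun i _ => ?_
        split_ifs with h
        · rfl
        · exact ((hx i).2 h).symm
      · intro i hi
        rw [(hx i).2 (mem_filter.1 hi).2, zero_smul]
  refine ⟨Finset.univ.image B.coord, fun x y hxy hx => ?_⟩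
  rw [key] at hx ⊢
  intro i
  have := hxy (B.coord i) (by simp)
  refine ⟨?_, fun h => ?_⟩
  · rw [← sign_nonneg_iff, ← this, sign_nonneg_iff]
    exact (hx i).1
  · rw [(hx i).2 h, sign_zero] at this
    exact sign_eq_zero_iff.1 this.symm

theorem IsPolyhedron.exists_triangulation {N : Set R3} (h : IsPolyhedron N) (hN : IsCompact N) :
    ∃ (n : ℕ) (b : Fin n → R3) (K : Fam n), IsCx K ∧ CHom (lin b) (rl K) N := by
  classical
  obtain ⟨F, hF, rfl⟩ := h
  choose! L hL using fun s (hs : s ∈ F) => (hF s hs).exists_sgv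
  refine exists_triangulation_of_sgv (ι := ↥(F.biUnion L)) (l := fun i => i) hN fun x y e hx => ?_
  simp only [mem_iUnion] at hx ⊢
  obtain ⟨s, hs, hx⟩ := hx
  exact ⟨s, hs, hL s hs x y (fun i hi =>
    congrFun e ⟨i, Finset.mem_biUnion.2 ⟨s, hs, hi⟩⟩) hx⟩

end

section

/-- Mod 2 singular chains, indexed by the number of vertices (so `SC X 0` is the augmentation). -/
abbrev SC (X : Type) [TopologicalSpace X] (k : ℕ) := C(stdSimplex ℝ (Fin k), X) →₀ ZMod 2

/-- The inclusion of the `i`-th face of the standard simplex. -/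
def faceMap {k : ℕ} (i : Fin (k + 1)) :
    C(stdSimplex ℝ (Fin k), stdSimplex ℝ (Fin (k + 1))) :=
  ⟨stdSimplex.map i.succAbove, stdSimplex.continuous_map _⟩

/-- The singular boundary. -/
def SC.d {X : Type} [TopologicalSpace X] {k : ℕ} : SC X (k + 1) →ₗ[ZMod 2] SC X k :=
  ∑ i : Fin (k + 1), lmapDomain _ _ fun σ => σ.comp (faceMap i)

theorem SC.d_single {X : Type} [TopologicalSpace X] {k : ℕ}
    (σ : C(stdSimplex ℝ (Fin (k + 1)), X)) (a : ZMod 2) :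
    SC.d (single σ a) = ∑ i, single (σ.comp (faceMap i)) a := by
  simp [SC.d, LinearMap.sum_apply, Finsupp.lmapDomain_apply, mapDomain_single]

/-- Singular cycles with `k` vertices bound. -/
def SAcyc (X : Type) [TopologicalSpace X] (k : ℕ) : Prop :=
  ∀ z : SC X (k + 1), SC.d z = 0 → ∃ D : SC X (k + 2), SC.d D = z

/-- Singular simplices as elements of the simplicial set `TopCat.toSSet`. -/
def scEquiv (X : Type) [TopologicalSpace X] (k : ℕ) :
    C(stdSimplex ℝ (Fin (k + 1)), X) ≃
      (TopCat.toSSet.obj (TopCat.of X)).obj (Opposite.op (SimplexCategory.mk k)) :=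
  ((TopCat.toSSetObjEquiv (TopCat.of X) (Opposite.op (SimplexCategory.mk k)))).symm

theorem scEquiv_face {X : Type} [TopologicalSpace X] {k : ℕ} (i : Fin (k + 2))
    (σ : C(stdSimplex ℝ (Fin (k + 2)), X)) :
    (TopCat.toSSet.obj (TopCat.of X)).map (SimplexCategory.δ i).op (scEquiv X (k + 1) σ)
      = scEquiv X k (σ.comp (faceMap i)) := by
  apply (scEquiv X k).symm.injective
  rw [Equiv.symm_apply_apply]
  rfl

/-- Singular chains as elements of the chain complex. -/
def scLin (X : Type) [TopologicalSpace X] (k : ℕ) :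
    SC X (k + 1) ≃ₗ[ZMod 2] (singularChainComplexZ2.obj (TopCat.of X)).X k :=
  Finsupp.domLCongr (scEquiv X k)

theorem scLin_single {X : Type} [TopologicalSpace X] {k : ℕ}
    (σ : C(stdSimplex ℝ (Fin (k + 1)), X)) :
    scLin X k (single σ 1) = ModuleCat.freeMk (scEquiv X k σ) :=
  Finsupp.domLCongr_single _ _ _

theorem objD_apply (M : SimplicialObject (ModuleCat.{0} (ZMod 2))) (k : ℕ)
    (v : M.obj (Opposite.op (SimplexCategory.mk (k + 1)))) :
    (AlgebraicTopology.AlternatingFaceMapComplex.objD M k).hom v = ∑ i, (M.δ i).hom v := by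
  simp only [AlgebraicTopology.AlternatingFaceMapComplex.objD]
  rw [ModuleCat.hom_sum, LinearMap.sum_apply]
  refine sum_congr rfl fun i _ => ?_
  rcases neg_one_pow_eq_or ℤ (i : ℕ) with h | h
  · rw [h, one_smul]
  · rw [h, neg_one_smul, ModuleCat.hom_neg, LinearMap.neg_apply, neg_eq_iff_add_eq_zero,
      ← two_smul (ZMod 2), show (2 : ZMod 2) = 0 from rfl, zero_smul]

theorem scLin_d {X : Type} [TopologicalSpace X] {k : ℕ} (c : SC X (k + 2)) :
    ((singularChainComplexZ2.obj (TopCat.of X)).d (k + 1) k).hom (scLin X (k + 1) c)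
      = scLin X k (SC.d c) := by
  have : ((singularChainComplexZ2.obj (TopCat.of X)).d (k + 1) k).hom ∘ₗ
      (scLin X (k + 1)).toLinearMap = (scLin X k).toLinearMap ∘ₗ SC.d := by
    refine Finsupp.lhom_ext' fun σ => ext_ring ?_
    simp only [LinearMap.comp_apply, lsingle_apply, LinearEquiv.coe_coe]
    rw [scLin_single, SC.d_single, map_sum]
    simp only [scLin_single, ← scEquiv_face]
    have e : (singularChainComplexZ2.obj (TopCat.of X)).d (k + 1) k
        = AlgebraicTopology.AlternatingFaceMapComplex.objD
          (((SimplicialObject.whiskering Type (ModuleCat (ZMod 2))).obj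
            (ModuleCat.free (ZMod 2))).obj (TopCat.toSSet.obj (TopCat.of X))) k :=
      AlgebraicTopology.alternatingFaceMapComplex_obj_d _ _
    rw [e]
    refine (objD_apply _ _ _).trans (sum_congr rfl fun i _ => ?_)
    exact ModuleCat.free_map_apply _ _
  exact LinearMap.congr_fun this c

theorem sAcyc_of_H {X : Type} [TopologicalSpace X] {k : ℕ} (h : Subsingleton (H (k + 1) X)) :
    SAcyc X (k + 1) := by
  intro z hz
  have h0 : Limits.IsZero ((singularChainComplexZ2.obj (TopCat.of X)).homology (k + 1)) :=
    ModuleCat.isZero_of_subsingleton (H (k + 1) X)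
  have h1 := (HomologicalComplex.exactAt_iff_isZero_homology _ _).2 h0
  rw [HomologicalComplex.exactAt_iff' _ (k + 2) (k + 1) k (by simp) (by simp),
    ShortComplex.moduleCat_exact_iff] at h1
  obtain ⟨D, hD⟩ := h1 (scLin X (k + 1) z) (by
    refine (scLin_d z).trans ?_
    rw [hz, map_zero]
    rfl)
  refine ⟨(scLin X (k + 2)).symm D, (scLin X (k + 1)).injective ?_⟩
  refine (scLin_d _).symm.trans ?_
  exact (congrArg _ (LinearEquiv.apply_symm_apply (scLin X (k + 2)) D)).trans hD

end

section

/-- Ordered mod 2 chains of `k`-tuples. -/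
abbrev Tup (P : Type) (k : ℕ) := (Fin k → P) →₀ ZMod 2

namespace Tup

variable {P Q : Type} {k : ℕ}

/-- Pushforward of tuples. -/
def map (f : P → Q) : Tup P k →ₗ[ZMod 2] Tup Q k := lmapDomain _ _ fun x => f ∘ x

/-- The boundary of tuples. -/
def d : Tup P (k + 1) →ₗ[ZMod 2] Tup P k :=
  ∑ i : Fin (k + 1), lmapDomain _ _ fun x => x ∘ i.succAbove

/-- The cone with a given apex. -/
def cone (b : P) : Tup P k →ₗ[ZMod 2] Tup P (k + 1) :=
  lmapDomain _ _ fun x => (Fin.cons b x : Fin (k + 1) → P)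

/-- The generator of a tuple. -/
def of (x : Fin k → P) : Tup P k := single x 1

theorem map_of (f : P → Q) (x : Fin k → P) : map f (of x) = of (f ∘ x) :=
  mapDomain_single

theorem cone_of (b : P) (x : Fin k → P) : cone b (of x) = of (Fin.cons b x) :=
  mapDomain_single

theorem d_of (x : Fin (k + 1) → P) : d (of x) = ∑ i, of (x ∘ Fin.succAbove i) := by
  simp [d, of, LinearMap.sum_apply, Finsupp.lmapDomain_apply, mapDomain_single]

theorem hom_ext {M : Type} [AddCommGroup M] [Module (ZMod 2) M] {f g : Tup P k →ₗ[ZMod 2] M}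
    (h : ∀ x, f (of x) = g (of x)) : f = g :=
  Finsupp.lhom_ext' fun x => ext_ring (h x)

theorem add_self (c : Tup P k) : c + c = 0 := by
  rw [← two_smul (ZMod 2), show (2 : ZMod 2) = 0 from rfl, zero_smul]

theorem d_map (f : P → Q) (c : Tup P (k + 1)) : d (map f c) = map f (d c) := by
  have : d ∘ₗ map f = map f ∘ₗ d (k := k) := hom_ext fun x => by
    simp only [LinearMap.comp_apply, map_of, d_of, map_sum]
    rfl
  exact LinearMap.congr_fun this c

theorem d_cone_of (b : P) (x : Fin (k + 1) → P) :
    d (cone b (of x)) = of x + cone b (d (of x)) := by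
  simp only [cone_of, d_of, map_sum]
  rw [Fin.sum_univ_succ]
  congr 1
  refine sum_congr rfl fun i _ => congrArg of (funext fun j => ?_)
  refine Fin.cases ?_ (fun j => ?_) j
  · simp
  · simp

theorem d_cone (b : P) (c : Tup P (k + 1)) : d (cone b c) = c + cone b (d c) := by
  have : d ∘ₗ cone b = LinearMap.id + cone b ∘ₗ d (k := k) := hom_ext fun x => d_cone_of b x
  exact LinearMap.congr_fun this c

theorem d_cone_zero (b : P) (c : Tup P 0) : d (cone b c) = c := by
  have : d ∘ₗ cone b = LinearMap.id := hom_ext fun x => by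
    simp only [LinearMap.comp_apply, cone_of, d_of, LinearMap.id_apply]
    rw [Fin.sum_univ_one]
    exact congrArg of (Subsingleton.elim _ _)
  exact LinearMap.congr_fun this c

theorem d_d (c : Tup P (k + 2)) : d (d c) = 0 := by
  induction k with
  | zero =>
    have : d ∘ₗ d = (0 : Tup P 2 →ₗ[ZMod 2] Tup P 0) := hom_ext fun x => by
      rw [← Fin.cons_self_tail x, ← cone_of]
      simp only [LinearMap.comp_apply, d_cone, map_add, d_cone_zero, LinearMap.zero_apply]
      exact add_self _
    exact LinearMap.congr_fun this c
  | succ k ih =>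
    have : d ∘ₗ d = (0 : Tup P (k + 3) →ₗ[ZMod 2] Tup P (k + 1)) := hom_ext fun x => by
      rw [← Fin.cons_self_tail x, ← cone_of]
      simp only [LinearMap.comp_apply, d_cone, map_add, LinearMap.zero_apply, ih, map_zero,
        add_zero]
      exact add_self _
    exact LinearMap.congr_fun this c

/-- Barycentric subdivision, for a given choice of barycenters. -/
def sd (β : ∀ j : ℕ, (Fin (j + 1) → P) → P) : ∀ k : ℕ, Tup P k →ₗ[ZMod 2] Tup P k
  | 0 => LinearMap.id
  | k + 1 => linearCombination (ZMod 2) fun x => cone (β k x) (sd β k (d (of x)))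

variable (β : ∀ j : ℕ, (Fin (j + 1) → P) → P)

theorem sd_of (x : Fin (k + 1) → P) : sd β (k + 1) (of x) = cone (β k x) (sd β k (d (of x))) := by
  rw [sd, of, linearCombination_single, one_smul]
  rfl

theorem d_sd (c : Tup P (k + 1)) : d (sd β (k + 1) c) = sd β k (d c) := by
  induction k with
  | zero =>
    have : d ∘ₗ sd β 1 = sd β 0 ∘ₗ d := hom_ext fun x => by
      simp only [LinearMap.comp_apply, sd_of]
      exact d_cone_zero _ _
    exact LinearMap.congr_fun this c
  | succ k ih =>
    have : d ∘ₗ sd β (k + 2) = sd β (k + 1) ∘ₗ d := hom_ext fun x => by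
      simp only [LinearMap.comp_apply, sd_of]
      rw [d_cone, ih, d_d, map_zero, map_zero, add_zero]
    exact LinearMap.congr_fun this c

theorem map_sd {β' : ∀ j : ℕ, (Fin (j + 1) → Q) → Q} {f : P → Q}
    (hf : ∀ j x, f (β j x) = β' j (f ∘ x)) (c : Tup P k) :
    map f (sd β k c) = sd β' k (map f c) := by
  induction k with
  | zero => rfl
  | succ k ih =>
    have : map f ∘ₗ sd β (k + 1) = sd β' (k + 1) ∘ₗ map f := hom_ext fun x => by
      simp only [LinearMap.comp_apply, sd_of, map_of]
      have h : ∀ (b : P) (c : Tup P k), map f (cone b c) = cone (f b) (map f c) := by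
        intro b c
        have : map f ∘ₗ cone b = cone (f b) ∘ₗ map f (k := k) := hom_ext fun x => by
          simp only [LinearMap.comp_apply, cone_of, map_of]
          refine congrArg of (funext fun j => ?_)
          refine Fin.cases rfl (fun j => rfl) j
        exact LinearMap.congr_fun this c
      rw [h, ih, ← d_map, map_of, hf]
    exact LinearMap.congr_fun this c

theorem d_sd_iterate (m : ℕ) (c : Tup P (k + 1)) :
    d ((sd β (k + 1))^[m] c) = (sd β k)^[m] (d c) := by
  induction m with
  | zero => rfl
  | succ m ih => rw [Function.iterate_succ_apply', Function.iterate_succ_apply', d_sd, ih]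

theorem map_sd_iterate {β' : ∀ j : ℕ, (Fin (j + 1) → Q) → Q} {f : P → Q}
    (hf : ∀ j x, f (β j x) = β' j (f ∘ x)) (m : ℕ) (c : Tup P k) :
    map f ((sd β k)^[m] c) = (sd β' k)^[m] (map f c) := by
  induction m with
  | zero => rfl
  | succ m ih => rw [Function.iterate_succ_apply', Function.iterate_succ_apply', map_sd β hf, ih]

/-- Tuples occurring in a boundary. -/
theorem exists_of_mem_d {c : Tup P (k + 1)} {y : Fin k → P} (hy : y ∈ (d c).support) :
    ∃ x ∈ c.support, ∃ i : Fin (k + 1), y = x ∘ i.succAbove := by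
  classical
  rw [d, LinearMap.sum_apply] at hy
  obtain ⟨i, -, hi⟩ := Finset.mem_biUnion.1 (Finsupp.support_finsetSum hy)
  obtain ⟨x, hx, e⟩ := Finset.mem_image.1 (mapDomain_support hi)
  exact ⟨x, hx, i, e.symm⟩

theorem exists_of_mem_cone {b : P} {c : Tup P k} {y : Fin (k + 1) → P}
    (hy : y ∈ (cone b c).support) : ∃ x ∈ c.support, y = Fin.cons b x := by
  classical
  obtain ⟨x, hx, e⟩ := Finset.mem_image.1 (mapDomain_support hy)
  exact ⟨x, hx, e.symm⟩

theorem exists_of_mem_map {f : P → Q} {c : Tup P k} {y : Fin k → Q}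
    (hy : y ∈ (map f c).support) : ∃ x ∈ c.support, y = f ∘ x := by
  classical
  obtain ⟨x, hx, e⟩ := Finset.mem_image.1 (mapDomain_support hy)
  exact ⟨x, hx, e.symm⟩

theorem exists_of_mem_sd {c : Tup P k} {y : Fin k → P} (hy : y ∈ (sd β k c).support) :
    ∃ x ∈ c.support, y ∈ (sd β k (of x)).support := by
  classical
  have h : c = ∑ x ∈ c.support, of x := by
    conv_lhs => rw [← Finsupp.sum_single c]
    refine sum_congr rfl fun x hx => ?_
    rw [zmod2_eq_one_of_ne_zero (mem_support_iff.1 hx)]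
    rfl
  rw [h, map_sum] at hy
  obtain ⟨x, hx, hi⟩ := Finset.mem_biUnion.1 (Finsupp.support_finsetSum hy)
  exact ⟨x, hx, hi⟩

/-- Tuples in the subdivision of `x` stay in every `S` closed under barycenters. -/
theorem mem_of_mem_sd {S : Set P} (hS : ∀ j x, (∀ i, x i ∈ S) → β j x ∈ S) {x y : Fin k → P}
    (hx : ∀ i, x i ∈ S) (hy : y ∈ (sd β k (of x)).support) : ∀ i, y i ∈ S := by
  induction k with
  | zero => exact fun i => i.elim0
  | succ k ih =>
    rw [sd_of] at hy
    obtain ⟨z, hz, rfl⟩ := exists_of_mem_cone hy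
    obtain ⟨u, hu, hzu⟩ := exists_of_mem_sd β hz
    obtain ⟨v, hv, i, rfl⟩ := exists_of_mem_d hu
    have : v = x := by
      by_contra hne
      exact (mem_support_iff.1 hv) (single_eq_of_ne hne)
    subst this
    exact Fin.cases (hS _ _ hx) (ih (fun j => hx _) hzu)

end Tup

/-- Averages of points of the standard simplex. -/
def avg (ι : Type) [Fintype ι] (j : ℕ) (x : Fin (j + 1) → stdSimplex ℝ ι) : stdSimplex ℝ ι :=
  ⟨∑ i, (1 / ((j : ℝ) + 1)) • (x i).1, (convex_stdSimplex ℝ ι).sum_mem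
    (fun _ _ => by positivity) (by
      rw [sum_const, card_univ, Fintype.card_fin, nsmul_eq_mul]
      push_cast
      field_simp) fun i _ => (x i).2⟩

theorem dist_avg_le {ι : Type} [Fintype ι] {j : ℕ} {x : Fin (j + 1) → stdSimplex ℝ ι} {D : ℝ}
    (hx : ∀ a b, dist (x a) (x b) ≤ D) (a : Fin (j + 1)) :
    dist (avg ι j x) (x a) ≤ j / (j + 1) * D := by
  have h1 : (avg ι j x).1 - (x a).1
      = ∑ i ∈ Finset.univ.erase a, (1 / ((j : ℝ) + 1)) • ((x i).1 - (x a).1) := by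
    have h2 : ∑ i, (1 / ((j : ℝ) + 1)) • ((x i).1 - (x a).1)
        = (avg ι j x).1 - (x a).1 := by
      simp only [smul_sub, sum_sub_distrib, avg]
      rw [sum_const, card_univ, Fintype.card_fin, ← Nat.cast_smul_eq_nsmul ℝ,
        smul_smul]
      push_cast
      rw [mul_one_div_cancel (by positivity), one_smul]
    rw [← h2, ← add_sum_erase _ _ (Finset.mem_univ a), sub_self, smul_zero, zero_add]
  have hD : 0 ≤ D := dist_nonneg.trans (hx a a)
  rw [Subtype.dist_eq, dist_eq_norm, h1]
  refine (norm_sum_le _ _).trans ?_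
  have : ∀ i ∈ Finset.univ.erase a, ‖(1 / ((j : ℝ) + 1)) • ((x i).1 - (x a).1)‖
      ≤ 1 / ((j : ℝ) + 1) * D := by
    intro i _
    rw [norm_smul, Real.norm_of_nonneg (by positivity), ← dist_eq_norm]
    exact mul_le_mul_of_nonneg_left (hx i a) (by positivity)
  refine (sum_le_sum this).trans (le_of_eq ?_)
  rw [sum_const, card_erase_of_mem (Finset.mem_univ _), card_univ,
    Fintype.card_fin, nsmul_eq_mul]
  simp only [Nat.add_sub_cancel]
  ring

theorem avg_mem_of_convex {ι : Type} [Fintype ι] {S : Set (ι → ℝ)} (hS : Convex ℝ S) (j : ℕ)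
    (x : Fin (j + 1) → stdSimplex ℝ ι) (hx : ∀ i, (x i).1 ∈ S) :
    (avg ι j x).1 ∈ S := by
  have h : ∑ i, (1 / ((j : ℝ) + 1)) • (x i).1 ∈ S := by
    refine hS.sum_mem (fun _ _ => by positivity) ?_ fun i _ => hx i
    rw [sum_const, card_univ, Fintype.card_fin, nsmul_eq_mul]
    push_cast
    field_simp
  exact h

theorem dist_of_mem_sd {ι : Type} [Fintype ι] {k K : ℕ} (hk : k ≤ K + 1) {D : ℝ}
    {x y : Fin k → stdSimplex ℝ ι} (hx : ∀ a b, dist (x a) (x b) ≤ D)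
    (hy : y ∈ (Tup.sd (avg ι) k (Tup.of x)).support) (a b : Fin k) :
    dist (y a) (y b) ≤ K / (K + 1) * D := by
  induction k with
  | zero => exact a.elim0
  | succ k ih =>
    have hD : 0 ≤ D := dist_nonneg.trans (hx a a)
    rw [Tup.sd_of] at hy
    obtain ⟨z, hz, rfl⟩ := Tup.exists_of_mem_cone hy
    obtain ⟨u, hu, hzu⟩ := Tup.exists_of_mem_sd _ hz
    obtain ⟨v, hv, i, rfl⟩ := Tup.exists_of_mem_d hu
    have : v = x := by
      by_contra hne
      exact (mem_support_iff.1 hv) (single_eq_of_ne hne)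
    subst this
    have hkK : (k : ℝ) / (k + 1) ≤ K / (K + 1) := by
      rw [div_le_div_iff₀ (by positivity) (by positivity)]
      have : (k : ℝ) ≤ K := by exact_mod_cast Nat.le_of_succ_le_succ hk
      nlinarith
    have key : ∀ l, dist (avg ι k v) (z l) ≤ K / (K + 1) * D := by
      intro l
      have := Tup.mem_of_mem_sd (avg ι)
        (S := {p | p.1 ∈ closedBall (avg ι k v).1 (K / (K + 1) * D)})
        (fun j x hx => avg_mem_of_convex (convex_closedBall _ _) j x hx)
        (fun j => ?_) hzu l
      · rw [dist_comm]
        exact this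
      · show dist _ _ ≤ _
        rw [dist_comm]
        exact (dist_avg_le hx _).trans (mul_le_mul_of_nonneg_right hkK hD)
    refine Fin.cases (Fin.cases ?_ (fun b => ?_) b) (fun a => Fin.cases ?_ (fun b => ?_) b) a
    · simp only [Fin.cons_zero, dist_self]
      positivity
    · exact key b
    · rw [dist_comm]
      exact key a
    · exact ih (Nat.le_of_succ_le hk) (fun a b => hx _ _) hzu a b

theorem dist_of_mem_sd_iterate {ι : Type} [Fintype ι] {k K : ℕ} (hk : k ≤ K + 1) {D : ℝ}
    {x y : Fin k → stdSimplex ℝ ι} (hx : ∀ a b, dist (x a) (x b) ≤ D) (m : ℕ)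
    (hy : y ∈ ((Tup.sd (avg ι) k)^[m] (Tup.of x)).support) (a b : Fin k) :
    dist (y a) (y b) ≤ (K / (K + 1)) ^ m * D := by
  induction m generalizing y a b with
  | zero =>
    have : y = x := by
      by_contra hne
      exact (mem_support_iff.1 hy) (single_eq_of_ne hne)
    rw [this, pow_zero, one_mul]
    exact hx a b
  | succ m ih =>
    rw [Function.iterate_succ_apply'] at hy
    obtain ⟨z, hz, hyz⟩ := Tup.exists_of_mem_sd _ hy
    rw [pow_succ', mul_assoc]
    exact dist_of_mem_sd hk (fun a b => ih hz a b) hyz a b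

end

section

theorem faceMap_self {k : ℕ} (i : Fin (k + 1)) (p : stdSimplex ℝ (Fin k)) :
    (faceMap i p).1 i = 0 := by
  show FunOnFinite.linearMap ℝ ℝ i.succAbove p.1 i = 0
  rw [FunOnFinite.linearMap_apply_apply]
  exact sum_eq_zero fun j hj => absurd (mem_filter.1 hj).2 (Fin.succAbove_ne i j)

theorem faceMap_succAbove {k : ℕ} (i : Fin (k + 1)) (p : stdSimplex ℝ (Fin k)) (j : Fin k) :
    (faceMap i p).1 (i.succAbove j) = p.1 j := by
  show FunOnFinite.linearMap ℝ ℝ i.succAbove p.1 (i.succAbove j) = p.1 j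
  rw [FunOnFinite.linearMap_apply_apply, sum_eq_single j]
  · exact fun b hb hne => absurd (Fin.succAbove_right_injective (mem_filter.1 hb).2) hne
  · exact fun h => absurd (by simp) h

theorem lin_faceMap {E : Type*} [NormedAddCommGroup E] [NormedSpace ℝ E] {k : ℕ} (b : Fin (k + 1) → E)
    (i : Fin (k + 1)) (p : stdSimplex ℝ (Fin k)) :
    lin b (faceMap i p).1 = lin (b ∘ i.succAbove) p.1 := by
  rw [lin_apply, lin_apply, Fin.sum_univ_succAbove _ i, faceMap_self, zero_smul, zero_add]
  exact sum_congr rfl fun j _ => by rw [faceMap_succAbove]; rfl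

theorem faceMap_vertex {k : ℕ} (i : Fin (k + 1)) :
    faceMap i ∘ stdSimplex.vertex = stdSimplex.vertex ∘ i.succAbove :=
  funext fun _ => stdSimplex.map_vertex _ _

theorem faceMap_avg {k : ℕ} (i : Fin (k + 1)) (j : ℕ)
    (x : Fin (j + 1) → stdSimplex ℝ (Fin k)) :
    faceMap i (avg (Fin k) j x) = avg (Fin (k + 1)) j (faceMap i ∘ x) := by
  apply Subtype.ext
  show FunOnFinite.linearMap ℝ ℝ i.succAbove (∑ l, (1 / ((j : ℝ) + 1)) • (x l).1)
    = ∑ l, (1 / ((j : ℝ) + 1)) • FunOnFinite.linearMap ℝ ℝ i.succAbove (x l).1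
  rw [map_sum]
  exact sum_congr rfl fun l _ => by rw [map_smul]

/-- A singular simplex from a globally defined function (constant if not continuous). -/
def toC {X : Type} [TopologicalSpace X] {k : ℕ} (f : (Fin k → ℝ) → X) :
    C(stdSimplex ℝ (Fin k), X) :=
  open Classical in
  if h : Continuous fun p : stdSimplex ℝ (Fin k) => f p.1 then ⟨_, h⟩ else .const _ (f 0)

theorem toC_apply {X : Type} [TopologicalSpace X] {k : ℕ} {f : (Fin k → ℝ) → X}
    (h : Continuous fun p : stdSimplex ℝ (Fin k) => f p.1) (p : stdSimplex ℝ (Fin k)) :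
    toC f p = f p.1 := by
  rw [toC, dif_pos h]
  rfl

section Project

variable {n k : ℕ}

/-- The (unordered) simplex spanned by a tuple of vertices. -/
def spanned (x : Fin k → Fin n) : Chn n :=
  if (Finset.univ.image x).card = k then dl (Finset.univ.image x) else 0

theorem spanned_eq_zero {x : Fin k → Fin n} (h : ¬Function.Injective x) : spanned x = 0 := by
  refine if_neg fun h' => h ?_
  rw [← Set.injOn_univ, ← Finset.coe_univ]
  exact Finset.card_image_iff.1 (h'.trans (card_fin k).symm)

theorem spanned_of_injective {x : Fin k → Fin n} (h : Function.Injective x) :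
    spanned x = dl (Finset.univ.image x) :=
  if_pos ((Finset.card_image_of_injective _ h).trans (card_fin k))

theorem image_comp_succAbove {x : Fin (k + 1) → Fin n} {a b : Fin (k + 1)} (hab : a ≠ b)
    (h : x a = x b) : Finset.univ.image (x ∘ a.succAbove) = Finset.univ.image x := by
  ext v
  simp only [Finset.mem_image, Finset.mem_univ, true_and, Function.comp_apply]
  constructor
  · rintro ⟨j, rfl⟩
    exact ⟨_, rfl⟩
  · rintro ⟨j, rfl⟩
    by_cases hj : j = a
    · obtain ⟨l, hl⟩ := Fin.exists_succAbove_eq hab.symm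
      exact ⟨l, by rw [hl, hj, h]⟩
    · obtain ⟨l, hl⟩ := Fin.exists_succAbove_eq hj
      exact ⟨l, by rw [hl]⟩

theorem bd_spanned (x : Fin (k + 1) → Fin n) :
    bd (spanned x) = ∑ i : Fin (k + 1), spanned (x ∘ i.succAbove) := by
  by_cases h : Function.Injective x
  · rw [spanned_of_injective h, bd_dl, sum_image fun _ _ _ _ e => h e]
    refine sum_congr rfl fun i _ => ?_
    rw [spanned_of_injective (h.comp Fin.succAbove_right_injective)]
    congr 1
    ext v
    simp only [mem_erase, Finset.mem_image, Finset.mem_univ, true_and, Function.comp_apply]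
    constructor
    · rintro ⟨hv, j, rfl⟩
      obtain ⟨l, hl⟩ := Fin.exists_succAbove_eq (y := i) (x := j) fun e => hv (by rw [e])
      exact ⟨l, by rw [hl]⟩
    · rintro ⟨l, rfl⟩
      exact ⟨fun e => Fin.succAbove_ne i l (h e), _, rfl⟩
  · rw [spanned_eq_zero h, map_zero]
    simp only [Function.Injective, not_forall] at h
    obtain ⟨a, b, e, hab⟩ := h
    rw [Fintype.sum_eq_add a b hab]
    · rw [spanned, spanned, image_comp_succAbove hab e, image_comp_succAbove (Ne.symm hab) e.symm,
        chn_add_self]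
    · rintro i ⟨hia, hib⟩
      refine spanned_eq_zero fun hi => ?_
      obtain ⟨a', ha'⟩ := Fin.exists_succAbove_eq (Ne.symm hia)
      obtain ⟨b', hb'⟩ := Fin.exists_succAbove_eq (Ne.symm hib)
      have := hi (a₁ := a') (a₂ := b') (by simp only [Function.comp_apply, ha', hb', e])
      exact hab (by rw [← ha', ← hb', this])

/-- From ordered chains to simplicial chains. -/
def proj : Tup (Fin n) k →ₗ[ZMod 2] Chn n := linearCombination (ZMod 2) spanned

theorem proj_of (x : Fin k → Fin n) : proj (Tup.of x) = spanned x := by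
  rw [proj, Tup.of, linearCombination_single, one_smul]

theorem bd_proj (c : Tup (Fin n) (k + 1)) : bd (proj c) = proj (Tup.d c) := by
  have : bd ∘ₗ proj = proj ∘ₗ Tup.d (P := Fin n) (k := k) := Tup.hom_ext fun x => by
    simp only [LinearMap.comp_apply, proj_of, Tup.d_of, map_sum, bd_spanned]
  exact LinearMap.congr_fun this c

theorem proj_mem {F : Fam n} {c : Tup (Fin n) k}
    (h : ∀ x ∈ c.support, (Finset.univ.image x).card = k → Finset.univ.image x ∈ F) :
    proj c ∈ ChS F := by
  rw [proj, Finsupp.linearCombination_apply]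
  refine Submodule.sum_mem _ fun x hx => Submodule.smul_mem _ _ ?_
  rw [spanned]
  split_ifs with h1
  · exact dl_mem_ChS (h x hx h1)
  · exact zero_mem _

end Project

section Approx

variable {X : Type} [TopologicalSpace X] {n k : ℕ}

/-- Simplicial approximation of singular chains by `m`-fold subdivision and a vertex map. -/
def approx (f : X → Fin n) (m : ℕ) : SC X k →ₗ[ZMod 2] Chn n :=
  linearCombination (ZMod 2) fun σ =>
    proj (Tup.map (f ∘ σ) ((Tup.sd (avg (Fin k)) k)^[m] (Tup.of stdSimplex.vertex)))

theorem approx_single (f : X → Fin n) (m : ℕ) (σ : C(stdSimplex ℝ (Fin k), X)) :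
    approx f m (single σ 1) =
      proj (Tup.map (f ∘ σ) ((Tup.sd (avg (Fin k)) k)^[m] (Tup.of stdSimplex.vertex))) := by
  rw [approx, linearCombination_single, one_smul]

theorem bd_approx (f : X → Fin n) (m : ℕ) (c : SC X (k + 1)) :
    bd (approx f m c) = approx f m (SC.d c) := by
  have : bd ∘ₗ approx f m = approx f m ∘ₗ SC.d (X := X) (k := k) := by
    refine Finsupp.lhom_ext' fun σ => ext_ring ?_
    simp only [LinearMap.comp_apply, lsingle_apply]
    rw [approx_single, SC.d_single, bd_proj, Tup.d_map, Tup.d_sd_iterate, Tup.d_of, map_sum]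
    simp only [approx_single, ← Module.End.pow_apply]
    rw [map_sum, map_sum, map_sum]
    refine sum_congr rfl fun i _ => ?_
    rw [← faceMap_vertex, ← Tup.map_of]
    simp only [Module.End.pow_apply]
    rw [← Tup.map_sd_iterate (avg (Fin k)) (faceMap_avg i)]
    congr 1
    have h2 : Tup.map (f ∘ σ) ∘ₗ Tup.map (faceMap i) = Tup.map (k := k) (f ∘ σ.comp (faceMap i)) :=
      Tup.hom_ext fun x => by
        simp only [LinearMap.comp_apply, Tup.map_of]
        rfl
    exact LinearMap.congr_fun h2 _
  exact LinearMap.congr_fun this c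

end Approx

end

section

variable {n : ℕ} {K : Fam n}

/-- A vertex of maximal weight. -/
def topVertex [NeZero n] (w : Fin n → ℝ) : Fin n := Classical.choose (Finite.exists_max w)

theorem le_topVertex [NeZero n] (w : Fin n → ℝ) (v : Fin n) : w v ≤ w (topVertex w) :=
  Classical.choose_spec (Finite.exists_max w) v

theorem one_le_topVertex [NeZero n] {s : Face n} {w : Fin n → ℝ} (hw : w ∈ fcs s) :
    1 / (n : ℝ) ≤ w (topVertex w) := by
  have h : ∑ v, w v ≤ ∑ _v : Fin n, w (topVertex w) :=
    sum_le_sum fun v _ => le_topVertex w v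
  rw [hw.2.1, sum_const, card_univ, Fintype.card_fin, nsmul_eq_mul] at h
  have hn : (0 : ℝ) < n := by exact_mod_cast NeZero.pos n
  rw [div_le_iff₀ hn]
  linarith

theorem topVertex_mem [NeZero n] {s : Face n} {w : Fin n → ℝ} (hw : w ∈ fcs s) :
    topVertex w ∈ s := by
  by_contra h
  have h1 := one_le_topVertex hw
  rw [hw.2.2 _ h] at h1
  have hn : (0 : ℝ) < n := by exact_mod_cast NeZero.pos n
  have : 0 < 1 / (n : ℝ) := by positivity
  linarith

theorem convex_fcs' (s : Face n) : Convex ℝ (fcs s) := by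
  intro x hx y hy a b ha hb hab
  refine ⟨fun v => add_nonneg (mul_nonneg ha (hx.1 v)) (mul_nonneg hb (hy.1 v)), ?_, fun v hv => ?_⟩
  · simp only [Pi.add_apply, Pi.smul_apply, smul_eq_mul, sum_add_distrib, ← mul_sum,
      hx.2.1, hy.2.1, mul_one, hab]
  · simp only [Pi.add_apply, Pi.smul_apply, smul_eq_mul, hx.2.2 v hv, hy.2.2 v hv]
    ring

/-- The increasing enumeration of a face. -/
def enum [NeZero n] (k : ℕ) (s : Face n) : Fin k → Fin n :=
  if h : s.card = k then s.orderEmbOfFin h else fun _ => 0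

theorem enum_eq [NeZero n] {k : ℕ} {s : Face n} (h : s.card = k) :
    enum k s = s.orderEmbOfFin h := dif_pos h

theorem image_enum [NeZero n] {k : ℕ} {s : Face n} (h : s.card = k) :
    Finset.univ.image (enum k s) = s := by
  rw [enum_eq h]
  exact Finset.image_orderEmbOfFin_univ s h

theorem enum_injective [NeZero n] {k : ℕ} {s : Face n} (h : s.card = k) :
    Function.Injective (enum k s) := by
  rw [enum_eq h]
  exact (s.orderEmbOfFin h).injective

theorem enum_mem [NeZero n] {k : ℕ} {s : Face n} (h : s.card = k) (i : Fin k) :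
    enum k s i ∈ s := by
  rw [enum_eq h]
  exact Finset.orderEmbOfFin_mem s h i

theorem enum_comp [NeZero n] {k : ℕ} {s : Face n} (h : s.card = k + 1) (i : Fin (k + 1)) :
    enum (k + 1) s ∘ i.succAbove = enum k (s.erase (enum (k + 1) s i)) := by
  have hc : (s.erase (enum (k + 1) s i)).card = k := by
    rw [card_erase_of_mem (enum_mem h i), h, Nat.add_sub_cancel]
  rw [enum_eq hc]
  refine Finset.orderEmbOfFin_unique hc (fun j => mem_erase.2 ⟨fun e => ?_, enum_mem h _⟩) ?_
  · exact Fin.succAbove_ne i j (enum_injective h e)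
  · rw [enum_eq h]
    exact (s.orderEmbOfFin h).strictMono.comp (Fin.strictMono_succAbove i)

theorem lin_single_mem_fcs {k : ℕ} {x : Fin k → Fin n} {s : Face n} (hx : ∀ i, x i ∈ s)
    (p : stdSimplex ℝ (Fin k)) :
    lin (fun i => (Pi.single (x i) 1 : Fin n → ℝ)) p.1 ∈ fcs s :=
  (convex_fcs' s).sum_mem (fun i _ => p.2.1 i) p.2.2 fun i _ => single_mem_fcs (hx i)

theorem exists_small (k : ℕ) {δ : ℝ} (hδ : 0 < δ) : ∀ᶠ m : ℕ in Filter.atTop,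
    ∀ y ∈ ((Tup.sd (avg (Fin k)) k)^[m] (Tup.of stdSimplex.vertex)).support, ∀ a b,
      dist (y a) (y b) < δ := by
  obtain ⟨D, hD⟩ := isBounded_iff.1 (bounded_stdSimplex (ι := Fin k))
  have h1 : Filter.Tendsto (fun m : ℕ => ((k : ℝ) / (k + 1)) ^ m * D) Filter.atTop (nhds 0) := by
    rw [← zero_mul D]
    refine (tendsto_pow_atTop_nhds_zero_of_lt_one (by positivity) ?_).mul_const D
    rw [div_lt_one (by positivity)]
    linarith
  filter_upwards [h1.eventually (gt_mem_nhds hδ)] with m hm y hy a b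
  exact (dist_of_mem_sd_iterate (Nat.le_succ k) (fun a b => hD (Subtype.prop _) (Subtype.prop _))
    m hy a b).trans_lt hm

section

variable {X : Type} [TopologicalSpace X] {w : X → Fin n → ℝ}

theorem approx_mem_eventually [NeZero n] (hw : Continuous w) (hwK : ∀ x, w x ∈ rl K) (hK : IsCx K)
    {k : ℕ} (D : SC X (k + 1)) : ∀ᶠ m : ℕ in Filter.atTop,
      approx (topVertex ∘ w) m D ∈ ChS (fc K (k + 1)) := by
  have hn : (0 : ℝ) < 1 / n := by
    have : (0 : ℝ) < n := by exact_mod_cast NeZero.pos n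
    positivity
  have h1 : ∀ σ ∈ D.support, ∀ᶠ m : ℕ in Filter.atTop,
      proj (Tup.map ((topVertex ∘ w) ∘ σ) ((Tup.sd (avg (Fin (k + 1))) (k + 1))^[m]
        (Tup.of stdSimplex.vertex))) ∈ ChS (fc K (k + 1)) := by
    intro σ _
    have hu := CompactSpace.uniformContinuous_of_continuous (hw.comp σ.continuous)
    obtain ⟨δ, hδ, hδ'⟩ := uniformContinuous_iff.1 hu _ hn
    filter_upwards [exists_small (k + 1) hδ] with m hm
    refine proj_mem fun x hx hc => mem_fc.2 ⟨?_, hc⟩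
    obtain ⟨y, hy, rfl⟩ := Tup.exists_of_mem_map hx
    obtain ⟨s, hs, hws⟩ := mem_rl.1 (hwK (σ (y 0)))
    refine hK.down s hs _ fun v hv => ?_
    obtain ⟨a, -, rfl⟩ := Finset.mem_image.1 hv
    by_contra hvs
    have h2 := hws.2.2 _ hvs
    obtain ⟨s', -, hws'⟩ := mem_rl.1 (hwK (σ (y a)))
    have h3 := one_le_topVertex hws'
    have h4 := (dist_le_pi_dist _ _ (topVertex (w (σ (y a))))).trans_lt (hδ' (hm y hy a 0))
    simp only [Function.comp_apply] at h2 h4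
    rw [h2, Real.dist_eq, sub_zero] at h4
    exact absurd (h4.trans_le' (le_abs_self _)) (not_lt.2 h3)
  filter_upwards [(Filter.eventually_all_finset D.support).2 h1] with m hm
  rw [approx, Finsupp.linearCombination_apply]
  exact Submodule.sum_mem _ fun σ hσ => Submodule.smul_mem _ _ (hm σ hσ)

variable {s : (Fin n → ℝ) → X}

/-- The singular simplex of `X` associated with a tuple of vertices. -/
def affSing (s : (Fin n → ℝ) → X) {k : ℕ} (x : Fin k → Fin n) : C(stdSimplex ℝ (Fin k), X) :=
  toC fun p => s (lin (fun i => (Pi.single (x i) 1 : Fin n → ℝ)) p)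

theorem affSing_apply (hs : ContinuousOn s (rl K)) {k : ℕ} {x : Fin k → Fin n}
    {t : Face n} (ht : t ∈ K) (hx : ∀ i, x i ∈ t) (p : stdSimplex ℝ (Fin k)) :
    affSing s x p = s (lin (fun i => (Pi.single (x i) 1 : Fin n → ℝ)) p.1) := by
  refine toC_apply (f := fun p => s (lin (fun i => (Pi.single (x i) 1 : Fin n → ℝ)) p))
    (hs.comp_continuous ?_ fun p => mem_rl.2 ⟨t, ht, lin_single_mem_fcs hx p⟩) p
  exact (continuous_of_finiteDimensional _).comp continuous_subtype_val

theorem affSing_face (hs : ContinuousOn s (rl K)) {k : ℕ} {x : Fin (k + 1) → Fin n}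
    {t : Face n} (ht : t ∈ K) (hx : ∀ i, x i ∈ t) (i : Fin (k + 1)) :
    (affSing s x).comp (faceMap i) = affSing s (x ∘ i.succAbove) := by
  ext p
  rw [ContinuousMap.comp_apply, affSing_apply hs ht hx,
    affSing_apply (x := x ∘ i.succAbove) hs ht (fun _ => hx _), lin_faceMap]
  rfl

theorem d_affSing [NeZero n] (hs : ContinuousOn s (rl K)) {k : ℕ} {t : Face n}
    (ht : t ∈ K) (hc : t.card = k + 1) :
    SC.d (single (affSing s (enum (k + 1) t)) 1)
      = ∑ v ∈ t, single (affSing s (enum k (t.erase v))) (1 : ZMod 2) := by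
  rw [SC.d_single]
  conv_rhs => rw [← image_enum hc, sum_image fun _ _ _ _ e => enum_injective hc e]
  refine sum_congr rfl fun i _ => ?_
  rw [affSing_face hs ht (enum_mem hc), enum_comp hc, image_enum hc]

theorem approx_affSing [NeZero n] (hK : IsCx K) (hs : ContinuousOn s (rl K))
    (hws : ∀ y ∈ rl K, w (s y) = y) (m : ℕ) {k : ℕ} {t : Face n} (ht : t ∈ K)
    (hc : t.card = k) :
    approx (topVertex ∘ w) m (single (affSing s (enum k t)) 1) = dl t := by
  induction k generalizing t with
  | zero =>
    have : ((Tup.sd (avg (Fin 0)) 0)^[m] (Tup.of stdSimplex.vertex)) = Tup.of stdSimplex.vertex :=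
      Function.iterate_fixed rfl m
    rw [approx_single, this, Tup.map_of, proj_of, card_eq_zero.1 hc,
      spanned_of_injective (Function.injective_of_subsingleton _)]
    rfl
  | succ k ih =>
    set Φ := approx (topVertex ∘ w) m (single (affSing s (enum (k + 1) t)) 1) with hΦ
    have h1 : Φ ∈ ChS {t} := by
      rw [hΦ, approx_single]
      refine proj_mem fun x hx hxc => Finset.mem_singleton.2 ?_
      obtain ⟨y, hy, rfl⟩ := Tup.exists_of_mem_map hx
      refine Finset.eq_of_subset_of_card_le (fun v hv => ?_) (by rw [hxc, hc])
      obtain ⟨a, -, rfl⟩ := Finset.mem_image.1 hv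
      simp only [Function.comp_apply]
      have h2 := lin_single_mem_fcs (enum_mem hc) (y a)
      rw [affSing_apply hs ht (enum_mem hc), hws _ (mem_rl.2 ⟨t, ht, h2⟩)]
      exact topVertex_mem h2
    have h2 : bd Φ = bd (dl t) := by
      rw [hΦ, bd_approx, d_affSing hs ht hc, map_sum, bd_dl]
      refine sum_congr rfl fun v hv => ih (hK.down t ht _ (erase_subset _ _)) ?_
      rw [card_erase_of_mem hv, hc, Nat.add_sub_cancel]
    have h3 : Φ = Φ t • dl t := by
      funext u
      by_cases hu : u = t
      · subst hu
        simp [dl]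
      · rw [h1 u (by simpa using hu), Pi.smul_apply, dl_apply, if_neg hu, smul_zero]
    by_cases h4 : Φ t = 0
    · exfalso
      rw [h3, h4, zero_smul, map_zero] at h2
      obtain ⟨v, hv⟩ : t.Nonempty := card_pos.1 (by omega)
      have h5 := congrFun h2 (t.erase v)
      rw [bd_dl, Finset.sum_apply, sum_eq_single v] at h5
      · simp [dl_apply] at h5
      · intro u hu huv
        rw [dl_apply, if_neg]
        intro e
        have : v ∈ t.erase u := mem_erase.2 ⟨huv.symm, hv⟩
        rw [← e] at this
        exact absurd this (notMem_erase v t)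
      · exact fun h => absurd hv h
    · rw [h3, zmod2_eq_one_of_ne_zero h4, one_smul]

/-- If a complex is a retract (up to an embedding) of a space whose singular cycles bound, its
simplicial cycles bound. -/
theorem acyc_of_sAcyc [NeZero n] (hK : IsCx K) (hw : Continuous w) (hwK : ∀ x, w x ∈ rl K)
    (hs : ContinuousOn s (rl K)) (hws : ∀ y ∈ rl K, w (s y) = y) {k : ℕ} (hX : SAcyc X k) :
    Acyc K (k + 1) := by
  intro c hc hbc
  let J : ∀ j, Chn n →ₗ[ZMod 2] SC X j := fun j =>
    ∑ t ∈ Finset.univ.filter (fun t : Face n => t.card = j),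
      (LinearMap.toSpanSingleton (ZMod 2) (SC X j) (single (affSing s (enum j t)) 1)) ∘ₗ
        LinearMap.proj t
  have hJ : ∀ {j t}, t.card = j → J j (dl t) = single (affSing s (enum j t)) 1 := by
    intro j t ht
    simp only [J, LinearMap.sum_apply, LinearMap.comp_apply, LinearMap.proj_apply,
      LinearMap.toSpanSingleton_apply]
    rw [sum_eq_single t]
    · rw [dl_apply, if_pos rfl, one_smul]
    · intro u _ hu
      rw [dl_apply, if_neg hu, zero_smul]
    · exact fun h => absurd (by simpa using ht) h
  have hcs : c = ∑ t ∈ fc K (k + 1), c t • dl t := by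
    funext u
    rw [Finset.sum_apply]
    by_cases hu : u ∈ fc K (k + 1)
    · rw [Finset.sum_eq_single_of_mem u hu]
      · simp [dl]
      · intro v _ hv
        rw [Pi.smul_apply, dl_apply, if_neg hv.symm, smul_zero]
    · rw [hc u hu, sum_eq_zero]
      intro v hv
      rw [Pi.smul_apply, dl_apply, if_neg, smul_zero]
      rintro rfl
      exact hu hv
  have hdJ : ∀ t ∈ fc K (k + 1), SC.d (J (k + 1) (dl t)) = J k (bd (dl t)) := by
    intro t ht
    obtain ⟨ht, htc⟩ := mem_fc.1 ht
    rw [hJ htc, d_affSing hs ht htc, bd_dl, map_sum]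
    refine sum_congr rfl fun v hv => (hJ ?_).symm
    rw [card_erase_of_mem hv, htc, Nat.add_sub_cancel]
  have hz : SC.d (J (k + 1) c) = 0 := by
    have : SC.d (J (k + 1) c) = J k (bd c) := by
      conv_lhs => rw [hcs]
      conv_rhs => rw [hcs]
      simp only [map_sum, map_smul]
      exact sum_congr rfl fun t ht => by rw [hdJ t ht]
    rw [this, hbc, map_zero]
  obtain ⟨D, hD⟩ := hX _ hz
  obtain ⟨m, hm⟩ := (approx_mem_eventually hw hwK hK D).exists
  refine ⟨_, hm, ?_⟩
  rw [bd_approx, hD]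
  conv_lhs => rw [hcs]
  conv_rhs => rw [hcs]
  simp only [map_sum, map_smul]
  refine sum_congr rfl fun t ht => ?_
  obtain ⟨ht, htc⟩ := mem_fc.1 ht
  rw [hJ htc, approx_affSing hK hs hws m ht htc]

end

end

section

theorem sAcyc_of_functional {X : Type} [TopologicalSpace X] {k : ℕ}
    (h : ∀ f : SC X (k + 1) →ₗ[ZMod 2] ZMod 2, (∀ D : SC X (k + 2), f (SC.d D) = 0) →
      ∃ g : C(stdSimplex ℝ (Fin k), X) → ZMod 2, ∀ σ, f (single σ 1)
        = ∑ i, g (σ.comp (faceMap i))) : SAcyc X k := by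
  intro z hz
  by_contra hD
  have hzr : z ∉ LinearMap.range (SC.d (X := X) (k := k + 1)) := hD
  obtain ⟨f, hfz, hf⟩ := Submodule.exists_le_ker_of_notMem hzr
  obtain ⟨g, hg⟩ := h f fun D => hf ⟨D, rfl⟩
  have : f = linearCombination (ZMod 2) g ∘ₗ SC.d := by
    refine Finsupp.lhom_ext' fun σ => ext_ring ?_
    simp only [LinearMap.comp_apply, lsingle_apply]
    rw [hg, SC.d_single, map_sum]
    simp [linearCombination_single]
  exact hfz (by rw [this, LinearMap.comp_apply, hz, map_zero])

/-- The singular 1-simplex traced by a path on `[0, 1]`. -/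
def edgeOf {X : Type} [TopologicalSpace X] (c : C(ℝ, X)) : C(stdSimplex ℝ (Fin 2), X) :=
  ⟨fun p => c (p.1 1), c.continuous.comp ((continuous_apply 1).comp continuous_subtype_val)⟩

theorem edgeOf_congr {X : Type} [TopologicalSpace X] {c c' : C(ℝ, X)}
    (h : ∀ t, 0 ≤ t → t ≤ 1 → c t = c' t) : edgeOf c = edgeOf c' :=
  ContinuousMap.ext fun p => h _ (p.2.1 1) (stdSimplex.le_one p 1)

theorem edgeOf_comp_face_zero {X : Type} [TopologicalSpace X] (c : C(ℝ, X)) :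
    (edgeOf c).comp (faceMap 0) = .const _ (c 1) := by
  ext p
  show c ((faceMap 0 p).1 1) = c 1
  rw [show (1 : Fin 2) = Fin.succAbove 0 0 from rfl, faceMap_succAbove]
  exact congrArg c (stdSimplex.eq_one_of_unique p 0)

theorem edgeOf_comp_face_one {X : Type} [TopologicalSpace X] (c : C(ℝ, X)) :
    (edgeOf c).comp (faceMap 1) = .const _ (c 0) := by
  ext p
  exact congrArg c (faceMap_self 1 p)

/-- Clamping to the unit interval. -/
def clamp : C(ℝ, ℝ) := ⟨fun x => max 0 (min 1 x), by fun_prop⟩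

theorem clamp_of_mem {t : ℝ} (h0 : 0 ≤ t) (h1 : t ≤ 1) : clamp t = t := by
  show max 0 (min 1 t) = t
  rw [min_eq_right h1, max_eq_right h0]

theorem clamp_mem (t : ℝ) : 0 ≤ clamp t ∧ clamp t ≤ 1 :=
  ⟨le_max_left _ _, max_le zero_le_one (min_le_left _ _)⟩

theorem exists_edgeOf {X : Type} [TopologicalSpace X] (σ : C(stdSimplex ℝ (Fin 2), X)) :
    ∃ c : C(ℝ, X), edgeOf c = σ := by
  have hc : ∀ t : ℝ, ![1 - clamp t, clamp t] ∈ stdSimplex ℝ (Fin 2) := by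
    intro t
    refine ⟨fun i => ?_, by simp⟩
    fin_cases i
    · exact sub_nonneg.2 (clamp_mem t).2
    · exact (clamp_mem t).1
  refine ⟨⟨fun t => σ ⟨_, hc t⟩, σ.continuous.comp (Continuous.subtype_mk (by fun_prop) _)⟩, ?_⟩
  ext p
  refine congrArg σ (Subtype.ext (funext fun i => ?_))
  have h1 := clamp_of_mem (p.2.1 1) (stdSimplex.le_one p 1)
  have h2 := stdSimplex.add_eq_one p
  fin_cases i
  · show 1 - clamp (p.1 1) = p.1 0
    rw [h1, sub_eq_iff_eq_add]
    exact h2.symm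
  · exact h1

section Cochain

variable {X : Type} [TopologicalSpace X] {f : SC X 2 →ₗ[ZMod 2] ZMod 2}

theorem cochain_triangle (hf : ∀ D : SC X 3, f (SC.d D) = 0) (G : C(ℝ × ℝ, X)) :
    f (single (edgeOf (G.comp ⟨fun t => (1, t), by fun_prop⟩)) 1)
      + f (single (edgeOf (G.comp ⟨fun t => (t, t), by fun_prop⟩)) 1)
      + f (single (edgeOf (G.comp ⟨fun t => (t, 0), by fun_prop⟩)) 1) = 0 := by
  have h0 : Continuous fun p : stdSimplex ℝ (Fin 3) => ((p.1 1 + p.1 2, p.1 2) : ℝ × ℝ) := by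
    have h : ∀ i, Continuous fun p : stdSimplex ℝ (Fin 3) => p.1 i := fun i =>
      (continuous_apply i).comp continuous_subtype_val
    exact ((h 1).add (h 2)).prodMk (h 2)
  have h := hf (single (G.comp ⟨_, h0⟩) 1)
  rw [SC.d_single, Fin.sum_univ_three, map_add, map_add] at h
  convert h using 7
  · ext p
    refine congrArg G (Prod.ext ?_ ?_)
    · show 1 = (faceMap 0 p).1 (Fin.succAbove 0 0) + (faceMap 0 p).1 (Fin.succAbove 0 1)
      rw [faceMap_succAbove, faceMap_succAbove]
      exact (stdSimplex.add_eq_one p).symm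
    · exact (faceMap_succAbove 0 p 1).symm
  · ext p
    have h2 : (faceMap 1 p).1 2 = p.1 1 := faceMap_succAbove 1 p 1
    refine congrArg G (Prod.ext ?_ ?_)
    · show p.1 1 = (faceMap 1 p).1 1 + (faceMap 1 p).1 2
      rw [faceMap_self, h2, zero_add]
    · exact h2.symm
  · ext p
    have h2 : (faceMap 2 p).1 1 = p.1 1 := faceMap_succAbove 2 p 1
    refine congrArg G (Prod.ext ?_ ?_)
    · show p.1 1 = (faceMap 2 p).1 1 + (faceMap 2 p).1 2
      rw [faceMap_self, h2, add_zero]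
    · exact (faceMap_self 2 p).symm

theorem cochain_const (hf : ∀ D : SC X 3, f (SC.d D) = 0) (x : X) :
    f (single (edgeOf (.const _ x)) 1) = 0 := by
  have h := cochain_triangle hf (.const _ x)
  rwa [ContinuousMap.const_comp, ContinuousMap.const_comp, ContinuousMap.const_comp,
    CharTwo.add_self_eq_zero, zero_add] at h

theorem cochain_square (hf : ∀ D : SC X 3, f (SC.d D) = 0) (G : C(ℝ × ℝ, X)) :
    f (single (edgeOf (G.comp ⟨fun t => (1, t), by fun_prop⟩)) 1)
      + f (single (edgeOf (G.comp ⟨fun t => (t, 0), by fun_prop⟩)) 1)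
      = f (single (edgeOf (G.comp ⟨fun t => (t, 1), by fun_prop⟩)) 1)
      + f (single (edgeOf (G.comp ⟨fun t => (0, t), by fun_prop⟩)) 1) := by
  have h1 := cochain_triangle hf G
  have h2 := cochain_triangle hf (G.comp ⟨Prod.swap, continuous_swap⟩)
  rw [ContinuousMap.comp_assoc, ContinuousMap.comp_assoc, ContinuousMap.comp_assoc] at h2
  have h3 := h1.trans h2.symm
  rw [add_right_comm, add_right_comm _ _ (f (single (edgeOf (G.comp
    (ContinuousMap.comp ⟨Prod.swap, _⟩ _))) 1))] at h3
  exact add_right_cancel h3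

/-- A path of `X` restricted to `[a, b]`. -/
def subPath (c : C(ℝ, X)) (a b : ℝ) : C(ℝ, X) := c.comp ⟨fun t => a + t * (b - a), by fun_prop⟩

theorem cochain_subPath (hf : ∀ D : SC X 3, f (SC.d D) = 0) (c : C(ℝ, X)) (a b : ℝ) :
    f (single (edgeOf (subPath c 0 b)) 1) = f (single (edgeOf (subPath c 0 a)) 1)
      + f (single (edgeOf (subPath c a b)) 1) := by
  have h := cochain_triangle hf (c.comp ⟨fun p => p.1 * a + p.2 * (b - a), by fun_prop⟩)
  simp only [ContinuousMap.comp_assoc] at h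
  rw [add_right_comm, CharTwo.add_eq_zero] at h
  rw [add_comm, ← sub_eq_zero, CharTwo.sub_eq_add, CharTwo.add_eq_zero]
  convert h.symm using 7
  all_goals
    ext t
    refine congrArg c ?_
    simp only [ContinuousMap.comp_apply, ContinuousMap.coe_mk]
    ring

/-- If `f` is locally the coboundary of a function, it is so globally. -/
theorem cochain_glue (hf : ∀ D : SC X 3, f (SC.d D) = 0) {A B : Set X} (hA : IsOpen A)
    (hB : IsOpen B) (hAB : ∀ x, x ∈ A ∨ x ∈ B) {g : X → ZMod 2}
    (hgA : ∀ c : C(ℝ, X), (∀ t, 0 ≤ t → t ≤ 1 → c t ∈ A) →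
      f (single (edgeOf c) 1) = g (c 0) + g (c 1))
    (hgB : ∀ c : C(ℝ, X), (∀ t, 0 ≤ t → t ≤ 1 → c t ∈ B) →
      f (single (edgeOf c) 1) = g (c 0) + g (c 1)) (c : C(ℝ, X)) :
    f (single (edgeOf c) 1) = g (c 0) + g (c 1) := by
  let F : ℝ → ZMod 2 := fun t => f (single (edgeOf (subPath c 0 t)) 1) + g (c t)
  have hloc : ∀ {W : Set X}, IsOpen W → (∀ c : C(ℝ, X), (∀ t, 0 ≤ t → t ≤ 1 → c t ∈ W) →
      f (single (edgeOf c) 1) = g (c 0) + g (c 1)) → ∀ a, c a ∈ W →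
      ∀ᶠ b in nhds a, F b = F a := by
    intro W hW hg a ha
    obtain ⟨δ, hδ, hb⟩ := isOpen_iff.1 (hW.preimage c.continuous) a ha
    filter_upwards [ball_mem_nhds a hδ] with b hbb
    have h := hg (subPath c a b) fun t h0 h1 => hb (by
      rw [mem_ball, Real.dist_eq] at hbb ⊢
      show |a + t * (b - a) - a| < δ
      rw [add_sub_cancel_left, abs_mul, abs_of_nonneg h0]
      nlinarith [abs_nonneg (b - a)])
    have e0 : subPath c a b 0 = c a := by simp [subPath]
    have e1 : subPath c a b 1 = c b := by simp [subPath]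
    rw [e0, e1] at h
    show f _ + g (c b) = f _ + g (c a)
    rw [cochain_subPath hf c a b, h, add_assoc, add_assoc, CharTwo.add_self_eq_zero, add_zero]
  have hF : IsLocallyConstant F := (IsLocallyConstant.iff_eventually_eq F).2 fun a =>
    (hAB (c a)).elim (hloc hA hgA a) (hloc hB hgB a)
  have h := hF.apply_eq_of_preconnectedSpace 1 0
  have e1 : subPath c 0 1 = c := by ext; simp [subPath]
  have e0 : subPath c 0 0 = .const _ (c 0) := by ext; simp [subPath]
  simp only [F] at h
  rw [e1, e0, cochain_const hf, zero_add] at h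
  rw [← h, add_assoc, CharTwo.add_self_eq_zero, add_zero]

end Cochain

theorem sAcyc_zero_of_joined {X : Type} [TopologicalSpace X] (h : ∀ x y : X, Joined x y) :
    SAcyc X 0 := by
  refine sAcyc_of_functional fun f hf => ?_
  by_cases hX : Nonempty X
  · obtain ⟨x⟩ := hX
    refine ⟨fun _ => f (single (.const _ x) 1), fun σ => ?_⟩
    have p := (h x (σ (stdSimplex.vertex 0))).somePath
    have := hf (single (edgeOf ⟨p.extend, p.continuous_extend⟩) 1)
    rw [SC.d_single, Fin.sum_univ_two, edgeOf_comp_face_zero, edgeOf_comp_face_one, map_add,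
      CharTwo.add_eq_zero] at this
    simp only [ContinuousMap.coe_mk, Path.extend_zero, Path.extend_one] at this
    rw [Fin.sum_univ_one, ← this]
    congr 2
    ext y
    exact congrArg σ (Subsingleton.elim _ _)
  · exact ⟨0, fun σ => absurd ⟨σ (stdSimplex.vertex 0)⟩ hX⟩

section Star

variable {E : Type} [NormedAddCommGroup E] [NormedSpace ℝ E] {Y A B : Set E}

theorem cochain_star {f : SC Y 2 →ₗ[ZMod 2] ZMod 2} (hf : ∀ D : SC Y 3, f (SC.d D) = 0) {a : E}
    (ha : a ∈ Y) (hAY : A ⊆ Y) (hA : StarConvex ℝ a A) : ∃ g : Y → ZMod 2, ∀ c : C(ℝ, Y),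
    (∀ t, 0 ≤ t → t ≤ 1 → (c t : E) ∈ A) → f (single (edgeOf c) 1) = g (c 0) + g (c 1) := by
  have hm : ∀ (s : ℝ) {y : E}, y ∈ A → (1 - clamp s) • a + clamp s • y ∈ Y := fun s y hy =>
    hAY (hA hy (sub_nonneg.2 (clamp_mem s).2) (clamp_mem s).1 (sub_add_cancel _ _))
  have hseg : ∀ y : Y, ∃ p : C(ℝ, Y), (y : E) ∈ A →
      ∀ t, (p t : E) = (1 - clamp t) • a + clamp t • (y : E) := by
    intro y
    by_cases hy : (y : E) ∈ A
    · exact ⟨⟨fun t => ⟨_, hm t hy⟩, Continuous.subtype_mk (by fun_prop) _⟩, fun _ _ => rfl⟩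
    · exact ⟨.const _ y, fun h => absurd h hy⟩
  choose p hp using hseg
  refine ⟨fun y => f (single (edgeOf (p y)) 1), fun c hc => ?_⟩
  have hc' : ∀ t, (c (clamp t) : E) ∈ A := fun t => hc _ (clamp_mem t).1 (clamp_mem t).2
  have c0 : clamp 0 = 0 := clamp_of_mem le_rfl zero_le_one
  have c1 : clamp 1 = 1 := clamp_of_mem zero_le_one le_rfl
  let G : C(ℝ × ℝ, Y) := ⟨fun q => ⟨_, hm q.1 (hc' q.2)⟩, Continuous.subtype_mk (by fun_prop) _⟩
  have hG : ∀ q, (G q : E) = (1 - clamp q.1) • a + clamp q.1 • (c (clamp q.2) : E) := fun _ => rfl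
  have h := cochain_square hf G
  have i1 : edgeOf (G.comp ⟨fun t => (1, t), by fun_prop⟩) = edgeOf c := by
    refine edgeOf_congr fun t h0 h1 => Subtype.ext ((hG _).trans ?_)
    simp [c1, clamp_of_mem h0 h1]
  have i2 : edgeOf (G.comp ⟨fun t => (t, 0), by fun_prop⟩) = edgeOf (p (c 0)) := by
    refine edgeOf_congr fun t _ _ => Subtype.ext ((hG _).trans ?_)
    rw [hp _ (hc 0 le_rfl zero_le_one)]
    simp [c0]
  have i3 : edgeOf (G.comp ⟨fun t => (t, 1), by fun_prop⟩) = edgeOf (p (c 1)) := by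
    refine edgeOf_congr fun t _ _ => Subtype.ext ((hG _).trans ?_)
    rw [hp _ (hc 1 zero_le_one le_rfl)]
    simp [c1]
  have i4 : edgeOf (G.comp ⟨fun t => (0, t), by fun_prop⟩) = edgeOf (.const _ (⟨a, ha⟩ : Y)) := by
    refine edgeOf_congr fun t _ _ => Subtype.ext ((hG _).trans ?_)
    simp [c0]
  rw [i1, i2, i3, i4, cochain_const hf, add_zero] at h
  show _ = f _ + f _
  rw [← h, add_comm, add_assoc, CharTwo.add_self_eq_zero, add_zero]

/-- A union of two star-shaped open sets with path connected intersection has no first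
homology. -/
theorem sAcyc_one_of_cover {a b : E} (hA : StarConvex ℝ a A) (hB : StarConvex ℝ b B) (ha : a ∈ A)
    (hb : b ∈ B) (hAo : IsOpen ((↑) ⁻¹' A : Set Y)) (hBo : IsOpen ((↑) ⁻¹' B : Set Y))
    (hY : A ∪ B = Y) (hj : ∀ x ∈ A ∩ B, ∀ y ∈ A ∩ B, JoinedIn (A ∩ B) x y) : SAcyc Y 1 := by
  classical
  refine sAcyc_of_functional fun f hf => ?_
  have hAY : A ⊆ Y := hY ▸ subset_union_left
  have hBY : B ⊆ Y := hY ▸ subset_union_right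
  obtain ⟨gA, hgA⟩ := cochain_star hf (hAY ha) hAY hA
  obtain ⟨gB, hgB⟩ := cochain_star hf (hBY hb) hBY hB
  have hAB : ∃ κ, ∀ x : Y, (x : E) ∈ A ∩ B → gA x = gB x + κ := by
    by_cases h : (A ∩ B).Nonempty
    · obtain ⟨x₀, h₀⟩ := h
      refine ⟨gB ⟨x₀, hAY h₀.1⟩ + gA ⟨x₀, hAY h₀.1⟩, fun x hx => ?_⟩
      obtain ⟨γ, hγ⟩ := hj x hx x₀ h₀
      have hγ' : ∀ t, γ.extend t ∈ A ∩ B := fun t => hγ _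
      let c : C(ℝ, Y) := ⟨fun t => ⟨γ.extend t, hAY (hγ' t).1⟩,
        Continuous.subtype_mk γ.continuous_extend _⟩
      have e0 : c 0 = x := Subtype.ext γ.extend_zero
      have e1 : c 1 = ⟨x₀, hAY h₀.1⟩ := Subtype.ext γ.extend_one
      have h := (hgA c fun t _ _ => (hγ' t).1).symm.trans (hgB c fun t _ _ => (hγ' t).2)
      rw [e0, e1] at h
      rw [← add_assoc, ← h, add_assoc, CharTwo.add_self_eq_zero, add_zero]
    · exact ⟨0, fun x hx => absurd ⟨_, hx⟩ h⟩
  obtain ⟨κ, hκ⟩ := hAB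
  let g : Y → ZMod 2 := fun x => if (x : E) ∈ A then gA x else gB x + κ
  have gA' : ∀ x : Y, (x : E) ∈ A → g x = gA x := fun x hx => if_pos hx
  have gB' : ∀ x : Y, (x : E) ∈ B → g x = gB x + κ := by
    intro x hx
    by_cases hxA : (x : E) ∈ A
    · rw [gA' x hxA, hκ x ⟨hxA, hx⟩]
    · exact if_neg hxA
  have hg := cochain_glue hf hAo hBo (fun x => by simpa [← hY] using x.2) (g := g)
    (fun c hc => by
      rw [hgA c hc, gA' _ (hc 0 le_rfl zero_le_one), gA' _ (hc 1 zero_le_one le_rfl)])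
    (fun c hc => by
      rw [hgB c hc, gB' _ (hc 0 le_rfl zero_le_one), gB' _ (hc 1 zero_le_one le_rfl),
        add_add_add_comm, CharTwo.add_self_eq_zero, add_zero])
  refine ⟨fun τ => g (τ (stdSimplex.vertex 0)), fun σ => ?_⟩
  obtain ⟨c, rfl⟩ := exists_edgeOf σ
  rw [hg, Fin.sum_univ_two, edgeOf_comp_face_zero, edgeOf_comp_face_one, add_comm]
  rfl

end Star

theorem joinedIn_of_segment {E : Type} [NormedAddCommGroup E] [NormedSpace ℝ E] {S : Set E} {x y : E}
    (h : ∀ t : ℝ, 0 ≤ t → t ≤ 1 → (1 - t) • x + t • y ∈ S) : JoinedIn S x y :=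
  JoinedIn.ofLine (f := fun t : ℝ => (1 - t) • x + t • y) (by fun_prop) (by simp) (by simp) (by
    rintro _ ⟨t, ht, rfl⟩
    exact h t ht.1 ht.2)

/-- The pointed half ball around `q`. -/
def pHalf (q : R3) (r : ℝ) : Set R3 := (ball q r ∩ {x | 0 ≤ x 2}) \ {q}

section HalfBall

variable {q : R3} {r : ℝ}

theorem convex_halfBall : Convex ℝ (ball q r ∩ {x : R3 | 0 ≤ x 2}) :=
  (convex_ball q r).inter
    (convex_halfSpace_ge (f := fun x : R3 => x 2) ⟨fun _ _ => rfl, fun _ _ => rfl⟩ 0)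

theorem add_single_mem_halfBall (hq : 0 ≤ q 2) {i : Fin 3} {ε : ℝ} (hε : |ε| < r)
    (hi : i ≠ 2 ∨ 0 ≤ ε) :
    q + EuclideanSpace.single i ε ∈ ball q r ∩ {x : R3 | 0 ≤ x 2} := by
  refine ⟨by simpa [mem_ball] using hε, ?_⟩
  show 0 ≤ (q + EuclideanSpace.single i ε) 2
  rw [PiLp.add_apply, PiLp.single_apply]
  split_ifs with h
  · exact add_nonneg hq (hi.resolve_left fun h' => h' h.symm)
  · rwa [add_zero]

theorem sAcyc_pHalf (hq : 0 ≤ q 2) (hr : 0 < r) :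
    (pHalf q r).Nonempty ∧ SAcyc (pHalf q r) 0 ∧ SAcyc (pHalf q r) 1 := by
  set U : Set R3 := ball q r ∩ {x | 0 ≤ x 2} with hU
  have hUc : Convex ℝ U := convex_halfBall
  let A : ℝ → Set R3 := fun s => {y ∈ U | ¬(y 1 = q 1 ∧ y 2 = q 2 ∧ 0 ≤ s * (y 0 - q 0))}
  let e : ℝ → R3 := fun s => q + EuclideanSpace.single 0 (-s * (r / 2))
  have he : ∀ s, |s| = 1 → e s ∈ A s := by
    intro s hs
    have hss : s * s = 1 := by rw [← abs_mul_abs_self, hs, one_mul]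
    refine ⟨add_single_mem_halfBall hq ?_ (Or.inl (by decide)), fun h => ?_⟩
    · rw [abs_mul, abs_neg, hs, one_mul, abs_of_pos] <;> linarith
    · have := h.2.2
      simp only [e, PiLp.add_apply, PiLp.single_apply, if_true, add_sub_cancel_left] at this
      nlinarith
  have hstar : ∀ s, |s| = 1 → StarConvex ℝ (e s) (A s) := by
    intro s hs y hy a b ha hb hab
    have hss : s * s = 1 := by rw [← abs_mul_abs_self, hs, one_mul]
    refine ⟨hUc (he s hs).1 hy.1 ha hb hab, fun h => ?_⟩
    obtain ⟨h1, h2, h0⟩ := h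
    obtain rfl : a = 1 - b := by linarith
    simp only [e, PiLp.add_apply, PiLp.smul_apply, PiLp.single_apply, smul_eq_mul,
      if_true, if_neg (show (1 : Fin 3) ≠ 0 by decide), if_neg (show (2 : Fin 3) ≠ 0 by decide)]
      at h0 h1 h2
    have hb0 : 0 < b := by
      rcases hb.lt_or_eq with h | rfl
      · exact h
      · nlinarith
    have h1' : b * (y 1 - q 1) = 0 := by linear_combination h1
    have h2' : b * (y 2 - q 2) = 0 := by linear_combination h2
    have h0' : 0 ≤ b * (s * (y 0 - q 0)) := by
      have : b * (s * (y 0 - q 0))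
          = s * ((1 - b) * (q 0 + -s * (r / 2)) + b * y 0 - q 0) + (1 - b) * (r / 2) := by
        linear_combination (1 - b) * (r / 2) * hss
      rw [this]
      positivity
    exact hy.2 ⟨by nlinarith, by nlinarith, (mul_nonneg_iff_of_pos_left hb0).1 h0'⟩
  have ho : ∀ s, IsOpen ((↑) ⁻¹' A s : Set (pHalf q r)) := by
    intro s
    have hcl : IsClosed {y : R3 | y 1 = q 1 ∧ y 2 = q 2 ∧ 0 ≤ s * (y 0 - q 0)} :=
      (isClosed_eq (f := fun y : R3 => y 1) (by fun_prop) continuous_const).inter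
        ((isClosed_eq (f := fun y : R3 => y 2) (by fun_prop) continuous_const).inter
          (isClosed_le (g := fun y : R3 => s * (y 0 - q 0)) continuous_const (by fun_prop)))
    convert hcl.isOpen_compl.preimage (continuous_subtype_val (p := (· ∈ pHalf q r))) using 1
    ext y
    exact and_iff_right y.2.1
  have hY : A 1 ∪ A (-1) = pHalf q r := by
    ext y
    constructor
    · rintro (h | h) <;> exact ⟨h.1, fun h' => h.2 (by simp [mem_singleton_iff.1 h'])⟩
    · rintro ⟨hyU, hyq⟩
      by_contra! hn
      rw [mem_union, not_or] at hn
      have h1 := not_not.1 fun h => hn.1 ⟨hyU, h⟩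
      have h2 := not_not.1 fun h => hn.2 ⟨hyU, h⟩
      refine hyq (PiLp.ext fun i => ?_)
      fin_cases i
      · show y 0 = q 0
        linarith [h1.2.2, h2.2.2]
      · exact h1.1
      · exact h1.2.1
  have hAB : ∀ {y}, y ∈ A 1 ∩ A (-1) ↔ y ∈ U ∧ ¬(y 1 = q 1 ∧ y 2 = q 2) := by
    intro y
    constructor
    · rintro ⟨h, h'⟩
      refine ⟨h.1, fun hy => ?_⟩
      rcases le_total 0 (y 0 - q 0) with h0 | h0
      · exact h.2 ⟨hy.1, hy.2, by linarith⟩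
      · exact h'.2 ⟨hy.1, hy.2, by linarith⟩
    · rintro ⟨h, h'⟩
      exact ⟨⟨h, fun hy => h' ⟨hy.1, hy.2.1⟩⟩, ⟨h, fun hy => h' ⟨hy.1, hy.2.1⟩⟩⟩
  have hj : ∀ y ∈ A 1 ∩ A (-1), JoinedIn (A 1 ∩ A (-1)) y (q + EuclideanSpace.single 2 (r / 2)) := by
    have hr2 : |r / 2| < r := by rw [abs_of_pos] <;> linarith
    have hc : q + EuclideanSpace.single 2 (r / 2) ∈ U :=
      add_single_mem_halfBall hq hr2 (Or.inr (by linarith))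
    have hd : q + EuclideanSpace.single 1 (r / 2) ∈ U :=
      add_single_mem_halfBall hq hr2 (Or.inl (by decide))
    have step : ∀ y ∈ U, (y 1 ≠ q 1 ∨ q 2 < y 2) →
        JoinedIn (A 1 ∩ A (-1)) y (q + EuclideanSpace.single 2 (r / 2)) := by
      intro y hy h
      refine joinedIn_of_segment fun t h0 h1 => hAB.2 ⟨hUc hy hc (by linarith) h0 (by ring), ?_⟩
      rintro ⟨e1, e2⟩
      simp [PiLp.add_apply, PiLp.smul_apply] at e1 e2
      have e1' : (1 - t) * (y 1 - q 1) = 0 := by linear_combination e1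
      have e2' : (1 - t) * (y 2 - q 2) + t * (r / 2) = 0 := by linear_combination e2
      rcases h with h | h
      · rcases mul_eq_zero.1 e1' with h' | h'
        · rw [h'] at e2'
          nlinarith
        · exact h (by linarith)
      · rcases h0.lt_or_eq with h0 | rfl
        · nlinarith [mul_nonneg (sub_nonneg.2 h1) (sub_nonneg.2 h.le)]
        · nlinarith
    intro y hy
    obtain ⟨hyU, hy'⟩ := hAB.1 hy
    by_cases h : y 1 ≠ q 1 ∨ q 2 < y 2
    · exact step y hyU h
    · push Not at h
      have h2 : y 2 < q 2 := h.2.lt_of_ne fun h' => hy' ⟨h.1, h'⟩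
      refine JoinedIn.trans (joinedIn_of_segment fun t h0 h1 => hAB.2
        ⟨hUc hyU hd (by linarith) h0 (by ring), ?_⟩) (step _ hd (Or.inl ?_))
      · rintro ⟨e1, e2⟩
        simp [PiLp.add_apply, PiLp.smul_apply] at e1 e2
        rw [h.1] at e1
        have e1' : t * (r / 2) = 0 := by linear_combination e1
        have e2' : (1 - t) * (y 2 - q 2) = 0 := by linear_combination e2
        rcases mul_eq_zero.1 e1' with h' | h'
        · rw [h'] at e2'
          linarith
        · linarith
      · simp [hr.ne']
  have hc : q + EuclideanSpace.single 2 (r / 2) ∈ pHalf q r := by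
    refine ⟨add_single_mem_halfBall hq ?_ (Or.inr (by linarith)), fun h => ?_⟩
    · rw [abs_of_pos] <;> linarith
    · have := congrArg (fun y : R3 => y 2) (mem_singleton_iff.1 h)
      simp [hr.ne'] at this
  have hjY : ∀ y ∈ pHalf q r, JoinedIn (pHalf q r) y (q + EuclideanSpace.single 2 (r / 2)) := by
    intro y hy
    by_cases h : y 1 = q 1 ∧ y 2 = q 2
    · refine joinedIn_of_segment fun t h0 h1 => ⟨hUc hy.1 hc.1 (by linarith) h0 (by ring), ?_⟩
      intro h'
      have e2 := congrArg (fun y : R3 => y 2) (mem_singleton_iff.1 h')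
      have e0 := congrArg (fun y : R3 => y 0) (mem_singleton_iff.1 h')
      simp [PiLp.add_apply, PiLp.smul_apply] at e0 e2
      have e2' : t * (r / 2) = 0 := by linear_combination e2 - (1 - t) * h.2
      have ht : t = 0 := (mul_eq_zero.1 e2').resolve_right (by linarith)
      refine hy.2 (PiLp.ext fun i => ?_)
      fin_cases i
      · show y 0 = q 0
        linear_combination e0 + (y 0 - q 0) * ht
      · exact h.1
      · exact h.2
    · exact (hj y (hAB.2 ⟨hy.1, h⟩)).mono fun z hz => hY ▸ Or.inl hz.1
  refine ⟨⟨_, hc⟩, sAcyc_zero_of_joined fun x y => ?_, sAcyc_one_of_cover (hstar 1 (by simp))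
    (hstar (-1) (by simp)) (he 1 (by simp)) (he (-1) (by simp)) (ho 1) (ho (-1)) hY
    fun x hx y hy => (hj x hx).trans (hj y hy).symm⟩
  exact ((hjY x x.2).trans (hjY y y.2).symm).joined_subtype

end HalfBall

end

section

variable {n : ℕ} {K : Fam n} {σ : Face n}

/-- The join of the boundary of a simplex with its link. -/
def bdStar (K : Fam n) (σ : Face n) : Fam n :=
  K.filter fun t => t ∪ σ ∈ K ∧ ¬σ ⊆ t

theorem mem_bdStar {t : Face n} :
    t ∈ bdStar K σ ↔ t ∈ K ∧ t ∪ σ ∈ K ∧ ¬σ ⊆ t := mem_filter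

theorem IsCx.bdStar (hK : IsCx K) (hσ : σ ∈ K) (h0 : σ.Nonempty) : IsCx (bdStar K σ) where
  empty_mem := mem_bdStar.2 ⟨hK.empty_mem, by rwa [Finset.empty_union], fun h =>
    h0.ne_empty (Finset.subset_empty.1 h)⟩
  down s hs t hts := by
    obtain ⟨h1, h2, h3⟩ := mem_bdStar.1 hs
    exact mem_bdStar.2 ⟨hK.down s h1 t hts, hK.down _ h2 _ (Finset.union_subset_union_left hts),
      fun h => h3 (h.trans hts)⟩

theorem acyc_lk_of_bdStar (hK : IsCx K) (h0 : σ.Nonempty) {j : ℕ}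
    (h : Acyc (bdStar K σ) (σ.card - 1 + j)) : Acyc (lk K σ) j := by
  classical
  intro c hc hbc
  have hcd : ∀ {t}, c t ≠ 0 → Disjoint σ t ∧ σ ∪ t ∈ K ∧ t.card = j := fun ht =>
    have h1 := mem_fc.1 (mem_of_ChS hc ht)
    ⟨(hK.mem_lk_iff.1 h1.1).1, (hK.mem_lk_iff.1 h1.1).2, h1.2⟩
  have hσ1 := card_pos.2 h0
  let e : Chn n := fun t => if σ ⊆ t then c (t \ σ) else 0
  have he : bd e ∈ ChS (fc (bdStar K σ) (σ.card - 1 + j)) := by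
    intro t ht
    rw [bd_apply]
    by_cases hs : σ ⊆ t
    · have h1 := congrFun hbc (t \ σ)
      rw [bd_apply] at h1
      refine Eq.trans ?_ h1
      refine Finset.sum_subset_zero_on_sdiff (fun v hv => ?_) (fun v hv => ?_) fun v hv => ?_
      · simp only [Finset.mem_compl, Finset.mem_sdiff] at hv ⊢
        tauto
      · by_contra hne
        have hd := (hcd hne).1
        simp only [Finset.mem_compl, Finset.mem_sdiff, not_and, not_not] at hv
        exact Finset.disjoint_left.1 hd (hv.1 hv.2) (mem_insert_self _ _)
      · have hvt : v ∉ t := by simpa using hv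
        show (if σ ⊆ insert v t then c (insert v t \ σ) else 0) = _
        rw [if_pos (hs.trans (Finset.subset_insert _ _)),
          Finset.insert_sdiff_of_notMem _ fun h => hvt (hs h)]
    · refine sum_eq_zero fun v hv => ?_
      by_contra hne
      have hvt : v ∉ t := by simpa using hv
      by_cases hs' : σ ⊆ insert v t
      · have hne' : c (insert v t \ σ) ≠ 0 := by simpa [e, hs'] using hne
        obtain ⟨h1, h2, h3⟩ := hcd hne'
        rw [union_sdiff_of_subset hs'] at h2
        have h4 := Finset.card_sdiff_add_card_eq_card hs'
        rw [h3, Finset.card_insert_of_notMem hvt] at h4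
        exact ht (mem_fc.2 ⟨mem_bdStar.2 ⟨hK.down _ h2 _ (Finset.subset_insert _ _),
          hK.down _ h2 _ (Finset.union_subset (Finset.subset_insert _ _) hs'), hs⟩, by omega⟩)
      · exact hne (if_neg hs')
  obtain ⟨d', hd', hbd'⟩ := h _ he (bd_bd _)
  obtain ⟨v₀, hv₀⟩ := h0
  let d : Chn n := fun t => if Disjoint σ t then d' (σ.erase v₀ ∪ t) else 0
  refine ⟨d, fun t ht => ?_, funext fun t => ?_⟩
  · by_contra hne
    by_cases hd : Disjoint σ t
    · have h1 := mem_fc.1 (mem_of_ChS hd' (show d' (σ.erase v₀ ∪ t) ≠ 0 by simpa [d, hd] using hne))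
      refine ht (mem_fc.2 ⟨hK.mem_lk_iff.2 ⟨hd, ?_⟩, ?_⟩)
      · refine hK.down _ (mem_bdStar.1 h1.1).2.1 _ fun x hx => ?_
        simp only [Finset.mem_union] at hx ⊢
        tauto
      · rw [card_union_of_disjoint (hd.mono_left (erase_subset _ _)),
          card_erase_of_mem hv₀] at h1
        omega
    · exact hne (if_neg hd)
  · by_cases hd : Disjoint σ t
    · have hv₀t : v₀ ∉ t := Finset.disjoint_left.1 hd hv₀
      have hins : insert v₀ (σ.erase v₀ ∪ t) = σ ∪ t := by
        rw [← Finset.insert_union, insert_erase hv₀]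
      have hv₀m : v₀ ∈ (σ.erase v₀ ∪ t)ᶜ := by simp [hv₀t]
      have h1 := congrFun hbd' (σ.erase v₀ ∪ t)
      have h2 : bd e (σ.erase v₀ ∪ t) = c t := by
        rw [bd_apply, Finset.sum_eq_single_of_mem v₀ hv₀m]
        · show (if _ then _ else _) = _
          rw [hins, if_pos Finset.subset_union_left, Finset.union_sdiff_cancel_left hd]
        · intro v hv hne
          refine if_neg fun hs => ?_
          have := hs hv₀
          simp [hne.symm, hv₀t] at this
      rw [h2, bd_apply, ← add_sum_erase _ _ hv₀m, hins] at h1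
      have h3 : d' (σ ∪ t) = 0 := hd' _ fun h' =>
        (mem_bdStar.1 (mem_fc.1 h').1).2.2 Finset.subset_union_left
      rw [h3, zero_add] at h1
      rw [← h1, bd_apply]
      refine (Finset.sum_subset_zero_on_sdiff (fun v hv => ?_) (fun v hv => ?_) fun v hv => ?_).symm
      · simp at hv ⊢
        tauto
      · simp only [Finset.mem_sdiff, Finset.mem_compl, mem_erase, Finset.mem_union,
          not_and, not_not, not_or] at hv
        refine if_neg fun hd' => ?_
        by_cases hvσ : v ∈ σ
        · exact Finset.disjoint_left.1 hd' hvσ (mem_insert_self _ _)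
        · have := hv.2 (fun h => hvσ (h ▸ hv₀))
          simp_all
      · simp only [mem_erase, Finset.mem_compl, Finset.mem_union, not_or, not_and] at hv
        have hvσ : v ∉ σ := hv.2.1 hv.1
        show _ = if _ then _ else _
        rw [if_pos (Finset.disjoint_insert_right.2 ⟨hvσ, hd⟩), Finset.union_insert]
    · have h1 : c t = 0 := by
        by_contra hne
        exact hd (hcd hne).1
      rw [h1, bd_apply]
      exact sum_eq_zero fun v _ => if_neg fun h' =>
        hd (h'.mono_right (Finset.subset_insert _ _))

/-- The barycenter of a face. -/
def bary (σ : Face n) (v : Fin n) : ℝ := if v ∈ σ then (σ.card : ℝ)⁻¹ else 0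

theorem bary_mem (h0 : σ.Nonempty) : bary σ ∈ fcs σ := by
  refine ⟨fun v => ?_, ?_, fun v hv => if_neg hv⟩
  · unfold bary
    split_ifs <;> positivity
  · have : (σ.card : ℝ) ≠ 0 := by simpa using h0.ne_empty
    simp [bary, this]

/-- The part of `w` left after removing its component at the barycenter of `σ`. -/
def awayPart (h0 : σ.Nonempty) (w : Fin n → ℝ) (v : Fin n) : ℝ :=
  if v ∈ σ then w v - σ.inf' h0 w else w v

theorem continuous_awayPart (h0 : σ.Nonempty) : Continuous (awayPart h0) := by
  have h1 : Continuous fun w : Fin n → ℝ => σ.inf' h0 w := by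
    have := Continuous.finset_inf' (f := fun (v : Fin n) (w : Fin n → ℝ) => w v) h0
      fun v _ => continuous_apply v
    convert this using 1
    ext w
    simp [Finset.inf'_apply]
  refine continuous_pi fun v => ?_
  unfold awayPart
  split_ifs
  · exact (continuous_apply v).sub h1
  · exact continuous_apply v

theorem awayPart_spec (hK : IsCx K) (h0 : σ.Nonempty) {w : Fin n → ℝ} (hw : w ∈ rl K)
    (hσ : ∀ v ∈ σ, 0 < w v) (hne : w ≠ bary σ) :
    0 < ∑ v, awayPart h0 w v ∧
      (∑ v, awayPart h0 w v)⁻¹ • awayPart h0 w ∈ rl (bdStar K σ) := by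
  obtain ⟨t, ht, hwt⟩ := mem_rl.1 hw
  have hst : σ ⊆ t := fun v hv => by
    by_contra h
    exact (hσ v hv).ne' (hwt.2.2 v h)
  obtain ⟨v₀, hv₀, hm⟩ := Finset.exists_mem_eq_inf' h0 w
  have hnn : ∀ v, 0 ≤ awayPart h0 w v := by
    intro v
    unfold awayPart
    split_ifs with h
    · exact sub_nonneg.2 (Finset.inf'_le _ h)
    · exact hwt.1 v
  have hpos : 0 < ∑ v, awayPart h0 w v := by
    refine (sum_nonneg fun v _ => hnn v).lt_of_ne fun h => hne ?_
    have h1 := fun v => (Finset.sum_eq_zero_iff_of_nonneg fun v _ => hnn v).1 h.symm v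
      (Finset.mem_univ v)
    have hin : ∀ v ∈ σ, w v = w v₀ := fun v hv => by
      have := h1 v
      rw [awayPart, if_pos hv, hm] at this
      linarith
    have hout : ∀ v ∉ σ, w v = 0 := fun v hv => by
      have := h1 v
      rwa [awayPart, if_neg hv] at this
    have hs := sum_fcs (s := σ) ⟨hwt.1, hwt.2.1, hout⟩
    rw [sum_congr rfl hin, sum_const, nsmul_eq_mul] at hs
    funext v
    unfold bary
    split_ifs with hv
    · rw [hin v hv]
      exact eq_inv_of_mul_eq_one_right hs
    · exact hout v hv
  refine ⟨hpos, mem_rl.2 ⟨t.erase v₀, mem_bdStar.2 ⟨hK.down t ht _ (erase_subset _ _),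
    hK.down t ht _ (Finset.union_subset (erase_subset _ _) hst), fun h =>
      absurd (h hv₀) (notMem_erase _ _)⟩, fun v => ?_, ?_, fun v hv => ?_⟩⟩
  · exact mul_nonneg (inv_nonneg.2 hpos.le) (hnn v)
  · simp only [Pi.smul_apply, smul_eq_mul]
    rw [← mul_sum, inv_mul_cancel₀ hpos.ne']
  · rw [Pi.smul_apply, smul_eq_mul, awayPart]
    by_cases hv0 : v = v₀
    · rw [hv0, if_pos hv₀, hm, sub_self, mul_zero]
    · have hvt : v ∉ t := fun h => hv (mem_erase.2 ⟨hv0, h⟩)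
      rw [if_neg fun h => hvt (hst h), hwt.2.2 v hvt, mul_zero]

theorem ne_bary_of_mem (h0 : σ.Nonempty) {y : Fin n → ℝ} (hy : y ∈ rl (bdStar K σ)) :
    y ≠ bary σ := by
  rintro rfl
  obtain ⟨t, ht, hyt⟩ := mem_rl.1 hy
  refine (mem_bdStar.1 ht).2.2 fun v hv => ?_
  by_contra h
  have h1 := hyt.2.2 v h
  rw [bary, if_pos hv] at h1
  have : (σ.card : ℝ) ≠ 0 := by simpa using h0.ne_empty
  exact inv_ne_zero this h1

theorem toward_mem (h0 : σ.Nonempty) {y : Fin n → ℝ} (hy : y ∈ rl (bdStar K σ)) {ε : ℝ} (hε : 0 ≤ ε)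
    (h1 : ε ≤ 1) : (1 - ε) • bary σ + ε • y ∈ rl K := by
  obtain ⟨t, ht, hyt⟩ := mem_rl.1 hy
  exact mem_rl.2 ⟨t ∪ σ, (mem_bdStar.1 ht).2.1,
    convex_fcs' _ (fcs_mono Finset.subset_union_right (bary_mem h0))
    (fcs_mono Finset.subset_union_left hyt) (sub_nonneg.2 h1) hε (sub_add_cancel _ _)⟩

theorem awayPart_toward (h0 : σ.Nonempty) {y : Fin n → ℝ} (hy : y ∈ rl (bdStar K σ)) {ε : ℝ}
    (hε : 0 < ε) : (∑ v, awayPart h0 ((1 - ε) • bary σ + ε • y) v)⁻¹ •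
      awayPart h0 ((1 - ε) • bary σ + ε • y) = y := by
  obtain ⟨t, ht, hyt⟩ := mem_rl.1 hy
  obtain ⟨v₀, hv₀, hv₀t⟩ := Finset.not_subset.1 (mem_bdStar.1 ht).2.2
  have hσv : ∀ v ∈ σ, ((1 - ε) • bary σ + ε • y) v = (1 - ε) * (σ.card : ℝ)⁻¹ + ε * y v :=
    fun v hv => by simp [bary, hv]
  have hm : σ.inf' h0 ((1 - ε) • bary σ + ε • y) = (1 - ε) * (σ.card : ℝ)⁻¹ := by
    refine le_antisymm ((Finset.inf'_le _ hv₀).trans_eq ?_) ?_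
    · rw [hσv v₀ hv₀, hyt.2.2 v₀ hv₀t, mul_zero, add_zero]
    · refine Finset.le_inf' _ _ fun v hv => ?_
      rw [hσv v hv]
      exact le_add_of_nonneg_right (mul_nonneg hε.le (hyt.1 v))
  have ha : awayPart h0 ((1 - ε) • bary σ + ε • y) = ε • y := by
    funext v
    unfold awayPart
    split_ifs with hv
    · rw [hm, hσv v hv, add_sub_cancel_left]
      rfl
    · simp [bary, hv]
  rw [ha]
  simp only [Pi.smul_apply, smul_eq_mul]
  rw [← mul_sum, hyt.2.1, mul_one, inv_smul_smul₀ hε.ne']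

end

section

variable {n : ℕ} {K : Fam n} {σ : Face n} {b : Fin n → R3} {N : Set R3}

/-- Half-space charts of a triangulated manifold around a point `p`, restricted to small pointed
half balls. -/
theorem exists_chart (hφ : CHom (lin b) (rl K) N) (hm : IsManifold3WithBoundary N)
    {p : Fin n → ℝ} (hp : p ∈ rl K) {O : Set (Fin n → ℝ)} (hO : IsOpen O) (hpO : p ∈ O) :
    ∃ (q : R3) (r : ℝ), 0 ≤ q 2 ∧ 0 < r ∧ ∃ f : pHalf q r → Fin n → ℝ, Continuous f ∧
      (∀ x, f x ∈ rl K ∧ f x ∈ O ∧ f x ≠ p) ∧ ∃ (g : (Fin n → ℝ) → R3) (O' : Set (Fin n → ℝ)),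
        IsOpen O' ∧ p ∈ O' ∧ ContinuousOn g (O' ∩ rl K) ∧
          ∀ w ∈ O' ∩ rl K, w ≠ p → ∃ h : g w ∈ pHalf q r, f ⟨g w, h⟩ = w := by
  classical
  obtain ⟨ψ, hψ, hψl, hψr⟩ := hφ.exists_inv (isCompact_rl K)
  obtain ⟨V, hV, hpV, W, hW, ⟨h⟩⟩ := hm ⟨lin b p, hφ.mem hp⟩
  obtain ⟨V', hV', rfl⟩ := isOpen_induced_iff.1 hV
  obtain ⟨W', hW', rfl⟩ := isOpen_induced_iff.1 hW
  have hψc : Continuous fun x : N => ψ x := continuousOn_iff_continuous_domRestrict.1 hψ.cont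
  let f₀ : ↥(Subtype.val ⁻¹' W' : Set HalfSpace3) → Fin n → ℝ := fun y => ψ (h.symm y : N)
  have hf₀ : Continuous f₀ :=
    hψc.comp (continuous_subtype_val.comp h.symm.continuous)
  set y₀ := h ⟨_, hpV⟩ with hy₀
  have hf₀p : f₀ y₀ = p := by
    show ψ (h.symm (h ⟨_, hpV⟩) : N) = p
    rw [h.symm_apply_apply]
    exact hψl p hp
  set q : R3 := y₀.1.1 with hq
  obtain ⟨U, hU, hUeq⟩ : ∃ U : Set R3, IsOpen U ∧ ∀ y : ↥(Subtype.val ⁻¹' W' : Set HalfSpace3),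
      (y.1.1 ∈ U ↔ f₀ y ∈ O) := by
    obtain ⟨U₁, hU₁, e₁⟩ := isOpen_induced_iff.1 (hO.preimage hf₀)
    obtain ⟨U₂, hU₂, rfl⟩ := isOpen_induced_iff.1 hU₁
    exact ⟨U₂, hU₂, fun y => by rw [← mem_preimage (f := f₀), ← e₁]; rfl⟩
  obtain ⟨r, hr, hb⟩ := isOpen_iff.1 (hU.inter hW') q
    ⟨(hUeq y₀).2 (hf₀p ▸ hpO), y₀.2⟩
  let ι : pHalf q r → ↥(Subtype.val ⁻¹' W' : Set HalfSpace3) := fun x =>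
    ⟨⟨x.1, x.2.1.2⟩, (hb x.2.1.1).2⟩
  have hι : Continuous ι := by fun_prop
  have hVs : ∀ w ∈ rl K, lin b w ∈ V' → ∃ y : ↥(Subtype.val ⁻¹' W' : Set HalfSpace3), f₀ y = w :=
    fun w hw hwV => ⟨h ⟨⟨lin b w, hφ.mem hw⟩, hwV⟩, by
      show ψ (h.symm (h _) : N) = w
      rw [h.symm_apply_apply]
      exact hψl w hw⟩
  let g : (Fin n → ℝ) → R3 := fun w =>
    if hw : w ∈ rl K ∧ lin b w ∈ V' then (h ⟨⟨lin b w, hφ.mem hw.1⟩, hw.2⟩).1.1 else q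
  have hlc : Continuous (lin b) := continuous_of_finiteDimensional _
  have hg : ContinuousOn g (lin b ⁻¹' V' ∩ rl K) := by
    rw [continuousOn_iff_continuous_domRestrict]
    have : (lin b ⁻¹' V' ∩ rl K).domRestrict g
        = fun w : ↥(lin b ⁻¹' V' ∩ rl K) => (h ⟨⟨lin b w, hφ.mem w.2.2⟩, w.2.1⟩).1.1 := by
      funext w
      exact dif_pos ⟨w.2.2, w.2.1⟩
    rw [this]
    refine continuous_subtype_val.comp (continuous_subtype_val.comp (h.continuous.comp ?_))
    exact Continuous.subtype_mk (Continuous.subtype_mk (hlc.comp continuous_subtype_val) _) _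
  have hgp : g p = q := dif_pos ⟨hp, hpV⟩
  obtain ⟨u, hu, hue⟩ := continuousOn_iff'.1 hg _ (isOpen_ball (x := q) (ε := r))
  have hpu : p ∈ u ∩ (lin b ⁻¹' V' ∩ rl K) := by
    rw [← hue]
    refine ⟨?_, hpV, hp⟩
    rw [mem_preimage, hgp]
    exact mem_ball_self hr
  refine ⟨q, r, y₀.1.2, hr, f₀ ∘ ι, hf₀.comp hι, fun x => ⟨hψ.mem (h.symm (ι x)).1.2,
    (hUeq (ι x)).1 (hb x.2.1.1).1, fun e => ?_⟩, g, u ∩ lin b ⁻¹' V',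
    hu.inter (hV'.preimage hlc), ⟨hpu.1, hpV⟩, hg.mono fun w hw => ⟨hw.1.2, hw.2⟩, ?_⟩
  · have h1 : ((h.symm (ι x)).1 : R3) = lin b p := by
      rw [← hψr _ (h.symm (ι x)).1.2]
      exact congrArg _ e
    have h2 : h.symm (ι x) = ⟨_, hpV⟩ := Subtype.ext (Subtype.ext h1)
    have h3 : ι x = y₀ := by rw [hy₀, ← h2, h.apply_symm_apply]
    exact x.2.2 (congrArg (fun y : ↥(Subtype.val ⁻¹' W' : Set HalfSpace3) => y.1.1) h3)
  · rintro w ⟨⟨hwu, hwV⟩, hw⟩ hwp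
    have hgw : g w = (h ⟨⟨lin b w, hφ.mem hw⟩, hwV⟩).1.1 := dif_pos ⟨hw, hwV⟩
    have hwb : w ∈ g ⁻¹' ball q r ∩ (lin b ⁻¹' V' ∩ rl K) := by
      rw [hue]
      exact ⟨hwu, hwV, hw⟩
    have hf : f₀ (h ⟨⟨lin b w, hφ.mem hw⟩, hwV⟩) = w := by
      show ψ (h.symm (h _) : N) = w
      rw [h.symm_apply_apply]
      exact hψl w hw
    have hmem : g w ∈ pHalf q r := by
      refine ⟨⟨hwb.1, ?_⟩, fun e => hwp ?_⟩
      · rw [hgw]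
        exact (h _).1.2
      · rw [← hf, ← hf₀p]
        refine congrArg f₀ (Subtype.ext (Subtype.ext ?_))
        rw [← hgw]
        exact e
    refine ⟨hmem, ?_⟩
    refine Eq.trans (congrArg f₀ (Subtype.ext (Subtype.ext ?_))) hf
    exact hgw

theorem acyc_bdStar (hK : IsCx K) (hφ : CHom (lin b) (rl K) N) (hm : IsManifold3WithBoundary N)
    (hσ : σ ∈ K) (h0 : σ.Nonempty) {j : ℕ} (hj : j ≤ 2) : Acyc (bdStar K σ) j := by
  classical
  obtain ⟨v₀, hv₀⟩ := id h0
  have : NeZero n := ⟨fun h => by subst h; exact v₀.elim0⟩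
  have hp : bary σ ∈ rl K := mem_rl.2 ⟨σ, hσ, bary_mem h0⟩
  have hO : IsOpen {w : Fin n → ℝ | ∀ v ∈ σ, 0 < w v} := by
    have : {w : Fin n → ℝ | ∀ v ∈ σ, 0 < w v} = ⋂ v ∈ σ, {w | 0 < w v} := by
      ext w
      simp
    rw [this]
    exact isOpen_biInter_finset fun v _ => isOpen_lt continuous_const (continuous_apply v)
  obtain ⟨q, r, hq, hr, f, hf, hfm, g, O', hO', hpO', hg, hgm⟩ := exists_chart hφ hm hp hO
    (fun v hv => by
      have := card_pos.2 h0
      rw [bary, if_pos hv]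
      positivity)
  obtain ⟨⟨x₀, hx₀⟩, hA0, hA1⟩ := sAcyc_pHalf hq hr
  have hcx := hK.bdStar hσ h0
  let w : pHalf q r → Fin n → ℝ := fun x => (∑ v, awayPart h0 (f x) v)⁻¹ • awayPart h0 (f x)
  have hspec := fun x => awayPart_spec hK h0 (hfm x).1 (hfm x).2.1 (hfm x).2.2
  have hac : Continuous fun x => awayPart h0 (f x) := (continuous_awayPart h0).comp hf
  have hw : Continuous w := by
    refine Continuous.smul (Continuous.inv₀ ?_ fun x => (hspec x).1.ne') hac
    exact continuous_finsetSum _ fun v _ => (continuous_apply v).comp hac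
  obtain ⟨ε, hε, hε1, hεO⟩ : ∃ ε : ℝ, 0 < ε ∧ ε ≤ 1 ∧ ∀ y ∈ rl (bdStar K σ),
      (1 - ε) • bary σ + ε • y ∈ O' := by
    obtain ⟨δ, hδ, hb⟩ := isOpen_iff.1 hO' _ hpO'
    obtain ⟨C, hC, hCb⟩ := (isCompact_rl (bdStar K σ)).isBounded.exists_pos_norm_le
    have hC' : 0 < C + ‖bary σ‖ := add_pos_of_pos_of_nonneg hC (norm_nonneg _)
    refine ⟨min 1 (δ / 2 / (C + ‖bary σ‖)), by positivity, min_le_left _ _, fun y hy => hb ?_⟩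
    set ε := min 1 (δ / 2 / (C + ‖bary σ‖))
    have hε0 : 0 ≤ ε := by positivity
    rw [mem_ball_iff_norm, show (1 - ε) • bary σ + ε • y - bary σ = ε • (y - bary σ) by module,
      norm_smul, Real.norm_of_nonneg hε0]
    calc ε * ‖y - bary σ‖ ≤ δ / 2 / (C + ‖bary σ‖) * (C + ‖bary σ‖) :=
          mul_le_mul (min_le_right _ _) ((norm_sub_le _ _).trans
            (add_le_add_left (hCb y hy) _)) (norm_nonneg _) (by positivity)
      _ = δ / 2 := div_mul_cancel₀ _ hC'.ne'
      _ < δ := half_lt_self hδ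
  have hεp : ∀ y ∈ rl (bdStar K σ), (1 - ε) • bary σ + ε • y ≠ bary σ := fun y hy e =>
    ne_bary_of_mem h0 hy (by
      have : ε • (y - bary σ) = 0 := by
        rw [← sub_eq_zero.2 e]
        module
      exact sub_eq_zero.1 ((smul_eq_zero.1 this).resolve_left hε.ne'))
  have hgs := fun y hy => hgm _ ⟨hεO y hy, toward_mem h0 hy hε.le hε1⟩ (hεp y hy)
  let s : (Fin n → ℝ) → pHalf q r := fun y =>
    if hy : y ∈ rl (bdStar K σ) then ⟨_, (hgs y hy).choose⟩ else ⟨x₀, hx₀⟩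
  have hs : ContinuousOn s (rl (bdStar K σ)) := by
    rw [continuousOn_iff_continuous_domRestrict, continuous_induced_rng]
    have : Subtype.val ∘ (rl (bdStar K σ)).domRestrict s
        = fun y : rl (bdStar K σ) => g ((1 - ε) • bary σ + ε • (y : Fin n → ℝ)) := by
      funext y
      exact congrArg Subtype.val (dif_pos y.2)
    rw [this]
    exact hg.comp_continuous (by fun_prop) fun y =>
      ⟨hεO y y.2, toward_mem h0 y.2 hε.le hε1⟩
  have hws : ∀ y ∈ rl (bdStar K σ), w (s y) = y := by
    intro y hy
    have h1 : f (s y) = (1 - ε) • bary σ + ε • y := by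
      rw [show s y = ⟨_, (hgs y hy).choose⟩ from dif_pos hy]
      exact (hgs y hy).choose_spec
    show (∑ v, awayPart h0 (f (s y)) v)⁻¹ • awayPart h0 (f (s y)) = y
    rw [h1]
    exact awayPart_toward h0 hy hε
  interval_cases j
  · obtain ⟨t, ht, hwt⟩ := mem_rl.1 (hspec ⟨x₀, hx₀⟩).2
    obtain ⟨v, hv⟩ : t.Nonempty := nonempty_of_mem_fcs hwt
    exact acyc_zero_of_vertex hcx (hcx.down t ht _ (Finset.singleton_subset_iff.2 hv))
  · exact acyc_of_sAcyc hcx hw (fun x => (hspec x).2) hs hws hA0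
  · exact acyc_of_sAcyc hcx hw (fun x => (hspec x).2) hs hws hA1

/-- Links of nonempty simplices in a triangulated 3-manifold. -/
theorem acyc_lk_of_manifold (hK : IsCx K) (hφ : CHom (lin b) (rl K) N)
    (hm : IsManifold3WithBoundary N) (hσ : σ ∈ K) (h0 : σ.Nonempty) {j : ℕ}
    (hj : σ.card + j ≤ 3) : Acyc (lk K σ) j :=
  acyc_lk_of_bdStar hK h0 (acyc_bdStar hK hφ hm hσ h0 (by
    have := card_pos.2 h0
    omega))

end

section

variable {n : ℕ} {K : Fam n} {b : Fin n → R3} {N : Set R3}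

theorem exists_pos_add_mul_nonneg (s : Face n) {m : Fin n → ℝ} (hm : ∀ v ∈ s, 0 < m v)
    (u : Fin n → ℝ) : ∃ ε : ℝ, 0 < ε ∧ ε < 1 ∧ ∀ v ∈ s, 0 < m v + ε * u v := by
  have h : ∀ᶠ ε : ℝ in nhdsWithin 0 (Ioi 0), ∀ v ∈ s, 0 < m v + ε * u v := by
    refine nhdsWithin_le_nhds ((Finset.eventually_all s).2 fun v hv => ?_)
    have : ContinuousAt (fun ε : ℝ => m v + ε * u v) 0 := by fun_prop
    exact this.eventually (lt_mem_nhds (by simpa using hm v hv))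
  obtain ⟨ε, h1, h2, h3⟩ := (h.and ((eventually_mem_nhdsWithin).and
    (nhdsWithin_le_nhds (gt_mem_nhds (zero_lt_one' ℝ))))).exists
  exact ⟨ε, h2, h3, h1⟩

theorem bary_pos {s : Face n} {v : Fin n} (hv : v ∈ s) : 0 < bary s v := by
  have := card_pos.2 ⟨v, hv⟩
  rw [bary, if_pos hv]
  positivity

theorem lin_unique (hφ : CHom (lin b) (rl K) N) {s : Face n} (hs : s ∈ K)
    {x y : Fin n → ℝ} (hx : ∀ v ∉ s, x v = 0) (hy : ∀ v ∉ s, y v = 0)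
    (h1 : ∑ v, x v = ∑ v, y v) (h2 : lin b x = lin b y) : x = y := by
  rcases s.eq_empty_or_nonempty with rfl | h0
  · ext v
    rw [hx v (by simp), hy v (by simp)]
  obtain ⟨ε, hε, -, hp⟩ := exists_pos_add_mul_nonneg s (fun v hv => bary_pos hv) (x - y)
  obtain ⟨hb0, hb1, hb2⟩ := bary_mem h0
  have hmem : bary s + ε • (x - y) ∈ fcs s := by
    refine ⟨fun v => ?_, ?_, fun v hv => ?_⟩
    · by_cases hv : v ∈ s
      · exact (hp v hv).le
      · simp [hb2 v hv, hx v hv, hy v hv]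
    · simp [sum_add_distrib, ← mul_sum, sum_sub_distrib, h1, hb1]
    · simp [hb2 v hv, hx v hv, hy v hv]
  have := hφ.inj (mem_rl.2 ⟨s, hs, hmem⟩) (mem_rl.2 ⟨s, hs, bary_mem h0⟩) (by simp [h2])
  exact sub_eq_zero.1 ((smul_eq_zero.1 (left_eq_add.1 this.symm)).resolve_left hε.ne')

/-- Extension by zero. -/
def extZ (s : Face n) : (s → ℝ) →ₗ[ℝ] Fin n → ℝ where
  toFun u v := if h : v ∈ s then u ⟨v, h⟩ else 0
  map_add' u u' := by
    ext v
    by_cases h : v ∈ s <;> simp [h]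
  map_smul' c u := by
    ext v
    by_cases h : v ∈ s <;> simp [h]

theorem extZ_injective (hφ : CHom (lin b) (rl K) N) {s : Face n} (hs : s ∈ K) :
    Function.Injective (((lin b).prod (∑ v, LinearMap.proj v)) ∘ₗ extZ s) := by
  intro u u' h
  have h' := Prod.ext_iff.1 h
  have := lin_unique hφ hs (x := extZ s u) (y := extZ s u') (fun v hv => dif_neg hv)
    (fun v hv => dif_neg hv) (by simpa using h'.2) h'.1
  ext v
  simpa [extZ] using congrFun this v

theorem card_le_four (hφ : CHom (lin b) (rl K) N) {s : Face n} (hs : s ∈ K) :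
    s.card ≤ 4 := by
  simpa using LinearMap.finrank_le_finrank_of_injective (extZ_injective hφ hs)

/-- Affine coordinates in a tetrahedron. -/
theorem exists_coords (hφ : CHom (lin b) (rl K) N) {T : Face n} (hT : T ∈ fc K 4) :
    ∃ c : R3 → Fin n → ℝ, Continuous c ∧
      ∀ y, (∀ v ∉ T, c y v = 0) ∧ ∑ v, c y v = 1 ∧ lin b (c y) = y := by
  rw [mem_fc] at hT
  let e := LinearMap.linearEquivOfInjective _ (extZ_injective hφ hT.1) (by simp [hT.2])
  refine ⟨fun y => extZ T (e.symm (y, 1)), ?_, fun y => ?_⟩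
  · exact (continuous_of_finiteDimensional (extZ T)).comp
      ((continuous_of_finiteDimensional e.symm.toLinearMap).comp (by fun_prop))
  · have h := Prod.ext_iff.1 (e.apply_symm_apply (y, 1))
    have h2 : (∑ v, LinearMap.proj v : (Fin n → ℝ) →ₗ[ℝ] ℝ) (extZ T (e.symm (y, 1))) = 1 := h.2
    exact ⟨fun v hv => dif_neg hv, by simpa using h2, h.1⟩

theorem coords_eq (hφ : CHom (lin b) (rl K) N) {T : Face n} (hT : T ∈ fc K 4)
    {c : R3 → Fin n → ℝ} (hc : ∀ y, (∀ v ∉ T, c y v = 0) ∧ ∑ v, c y v = 1 ∧ lin b (c y) = y)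
    {w : Fin n → ℝ} (hw : ∀ v ∉ T, w v = 0) (h1 : ∑ v, w v = 1) : c (lin b w) = w :=
  lin_unique hφ (mem_fc.1 hT).1 (hc _).1 hw ((hc _).2.1.trans h1.symm) (hc _).2.2

theorem mem_of_coords (hφ : CHom (lin b) (rl K) N) {T : Face n} (hT : T ∈ fc K 4)
    {c : R3 → Fin n → ℝ} (hc : ∀ y, (∀ v ∉ T, c y v = 0) ∧ ∑ v, c y v = 1 ∧ lin b (c y) = y)
    {y : R3} (hy : ∀ v ∈ T, 0 ≤ c y v) : y ∈ N := by
  rw [← (hc y).2.2]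
  refine hφ.mem (mem_rl.2 ⟨T, (mem_fc.1 hT).1, fun v => ?_, (hc y).2.1, (hc y).1⟩)
  by_cases hv : v ∈ T
  · exact hy v hv
  · rw [(hc y).1 v hv]

/-- Two tetrahedra sharing a triangle lie on opposite sides. -/
theorem coords_neg (hφ : CHom (lin b) (rl K) N) {t : Face n}
    (h0 : t.Nonempty) {v v' : Fin n} (hv : v ∉ t) (hv' : v' ∉ t) (hne : v ≠ v')
    (hT : insert v t ∈ K) (hT' : insert v' t ∈ K) {c : Fin n → ℝ} (hc : ∀ u ∉ insert v t, c u = 0)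
    (h1 : ∑ u, c u = 1) (hl : lin b c = b v') : c v < 0 := by
  by_contra! h
  obtain ⟨ε, hε, hε1, hp⟩ := exists_pos_add_mul_nonneg t (fun u hu => bary_pos hu) (c - bary t)
  obtain ⟨hb0, hb1, hb2⟩ := bary_mem h0
  have hm : bary t + ε • (c - bary t) ∈ fcs (insert v t) := by
    refine ⟨fun u => ?_, ?_, fun u hu => ?_⟩
    · by_cases hu : u ∈ t
      · exact (hp u hu).le
      · rcases eq_or_ne u v with rfl | huv
        · simpa [hb2 u hu] using mul_nonneg hε.le h
        · simp [hb2 u hu, hc u (by simp [huv, hu])]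
    · simp [sum_add_distrib, ← mul_sum, sum_sub_distrib, h1, hb1]
    · simp [hb2 u fun h => hu (Finset.mem_insert_of_mem h), hc u hu]
  have hm' : bary t + ε • (Pi.single v' 1 - bary t) ∈ fcs (insert v' t) :=
    (convex_fcs' _).add_smul_sub_mem (fcs_mono (Finset.subset_insert _ _) (bary_mem h0))
      (single_mem_fcs (mem_insert_self _ _)) ⟨hε.le, hε1.le⟩
  have := congrFun (hφ.inj (mem_rl.2 ⟨_, hT, hm⟩) (mem_rl.2 ⟨_, hT', hm'⟩)
    (by simp [hl, lin_single])) v'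
  have hcv : c v' = 0 := hc v' (by simp [hne.symm, hv'])
  simp [hb2 v' hv', hcv] at this
  exact hε.ne this

theorem coords_replace (hφ : CHom (lin b) (rl K) N) {t : Face n} {v v' : Fin n}
    (hv' : v' ∉ t) (hT : insert v t ∈ fc K 4)
    {c : R3 → Fin n → ℝ}
    (hc : ∀ y, (∀ u ∉ insert v t, c y u = 0) ∧ ∑ u, c y u = 1 ∧ lin b (c y) = y)
    {w : Fin n → ℝ} (hw : ∀ u ∉ insert v' t, w u = 0) (h1 : ∑ u, w u = 1) (hv : v ∉ t)
    (hne : v ≠ v') : c (lin b w) v = w v' * c (b v') v := by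
  have h := coords_eq hφ hT hc (w := w + w v' • (c (b v') - Pi.single v' 1)) (fun u hu => by
      rcases eq_or_ne u v' with rfl | huv
      · simp [(hc (b u)).1 u hu]
      · have : u ∉ insert v' t := by
          simp only [Finset.mem_insert, not_or] at hu ⊢
          exact ⟨huv, hu.2⟩
        simp [hw u this, (hc (b v')).1 u hu, huv])
    (by simp [sum_add_distrib, ← mul_sum, sum_sub_distrib, h1, (hc (b v')).2.1])
  have h2 : lin b (w + w v' • (c (b v') - Pi.single v' 1)) = lin b w := by
    simp [(hc (b v')).2.2, lin_single]
  rw [h2] at h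
  have := hw v (by simp [hne, hv])
  simp [h, this, hne]

theorem exists_insert_of_subset {t T : Face n} (ht : t.card = 3) (hT : T.card = 4)
    (h : t ⊆ T) : ∃ v ∉ t, T = insert v t := by
  have hc : (T \ t).card = 1 := by
    rw [card_sdiff_of_subset h]
    omega
  obtain ⟨v, hv⟩ := card_eq_one.1 hc
  refine ⟨v, (Finset.mem_sdiff.1 (hv ▸ mem_singleton_self v)).2, ?_⟩
  rw [Finset.insert_eq, ← hv, Finset.sdiff_union_of_subset h]

theorem deg_le_two (hφ : CHom (lin b) (rl K) N) {t : Face n} (ht : t ∈ fc K 3) :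
    deg (fc K 4) t ≤ 2 := by
  by_contra! h
  have ht3 := (mem_fc.1 ht).2
  have h0 : t.Nonempty := card_pos.1 (by omega)
  obtain ⟨T₁, h₁, T₂, h₂, T₃, h₃, h12, h13, h23⟩ := Finset.two_lt_card.1 h
  rw [mem_filter] at h₁ h₂ h₃
  obtain ⟨v₁, hv₁, rfl⟩ := exists_insert_of_subset ht3 (mem_fc.1 h₁.1).2 h₁.2
  obtain ⟨v₂, hv₂, rfl⟩ := exists_insert_of_subset ht3 (mem_fc.1 h₂.1).2 h₂.2
  obtain ⟨v₃, hv₃, rfl⟩ := exists_insert_of_subset ht3 (mem_fc.1 h₃.1).2 h₃.2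
  have n12 : v₁ ≠ v₂ := fun e => h12 (by rw [e])
  have n13 : v₁ ≠ v₃ := fun e => h13 (by rw [e])
  have n23 : v₂ ≠ v₃ := fun e => h23 (by rw [e])
  obtain ⟨c₁, -, hc₁⟩ := exists_coords hφ h₁.1
  obtain ⟨c₂, -, hc₂⟩ := exists_coords hφ h₂.1
  have m₁ := (mem_fc.1 h₁.1).1
  have m₂ := (mem_fc.1 h₂.1).1
  have m₃ := (mem_fc.1 h₃.1).1
  have l12 := coords_neg hφ h0 hv₁ hv₂ n12 m₁ m₂ (hc₁ (b v₂)).1 (hc₁ (b v₂)).2.1 (hc₁ (b v₂)).2.2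
  have l13 := coords_neg hφ h0 hv₁ hv₃ n13 m₁ m₃ (hc₁ (b v₃)).1 (hc₁ (b v₃)).2.1 (hc₁ (b v₃)).2.2
  have l23 := coords_neg hφ h0 hv₂ hv₃ n23 m₂ m₃ (hc₂ (b v₃)).1 (hc₂ (b v₃)).2.1 (hc₂ (b v₃)).2.2
  have := coords_replace hφ hv₂ h₁.1 hc₁ (hc₂ (b v₃)).1 (hc₂ (b v₃)).2.1 hv₁ n12
  rw [(hc₂ (b v₃)).2.2] at this
  nlinarith [mul_pos_of_neg_of_neg l23 l12]

/-- Points in open triangles off the boundary and in open tetrahedra are interior. -/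
theorem lin_mem_interior (hφ : CHom (lin b) (rl K) N) {s T : Face n} (hT : T ∈ fc K 4)
    (hsT : s ⊆ T) (h3 : 3 ≤ s.card) (hs : s ∈ K) (hsb : s ∉ bT K) {w : Fin n → ℝ}
    (hw : w ∈ fcs s) (hp : ∀ v ∈ s, 0 < w v) : lin b w ∈ interior N := by
  obtain ⟨c, hcc, hc⟩ := exists_coords hφ hT
  have hcw := coords_eq hφ hT hc (fun v hv => hw.2.2 v fun h => hv (hsT h)) hw.2.1
  have hev : ∀ (U : Face n) (d : R3 → Fin n → ℝ), Continuous d → (∀ v ∈ U, 0 < d (lin b w) v) →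
      ∀ᶠ y in nhds (lin b w), ∀ v ∈ U, 0 < d y v := fun U d hd h =>
    (Finset.eventually_all U).2 fun v hv =>
      (((continuous_apply v).comp hd).continuousAt).eventually (lt_mem_nhds (h v hv))
  have hes := hev s c hcc (by rwa [hcw])
  rw [mem_interior_iff_mem_nhds]
  by_cases hc4 : s = T
  · subst hc4
    filter_upwards [hes] with y hy
    exact mem_of_coords hφ hT hc fun v hv => (hy v hv).le
  have hs3 : s.card = 3 := by
    have := Finset.card_lt_card (Finset.ssubset_iff_subset_ne.2 ⟨hsT, hc4⟩)
    have := (mem_fc.1 hT).2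
    omega
  obtain ⟨v, hv, rfl⟩ := exists_insert_of_subset hs3 (mem_fc.1 hT).2 hsT
  obtain ⟨T', hT', hne⟩ : ∃ T' ∈ (fc K 4).filter (s ⊆ ·), T' ≠ insert v s := by
    by_contra! h
    exact hsb (mem_bT.2 ⟨⟨hs, hs3⟩, card_eq_one.2 ⟨insert v s, Finset.eq_singleton_iff_unique_mem.2
      ⟨mem_filter.2 ⟨hT, hsT⟩, h⟩⟩⟩)
  rw [mem_filter] at hT'
  obtain ⟨v', hv', rfl⟩ := exists_insert_of_subset hs3 (mem_fc.1 hT'.1).2 hT'.2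
  have hvv : v ≠ v' := fun e => hne (by rw [e])
  obtain ⟨c', hcc', hc'⟩ := exists_coords hφ hT'.1
  have hcw' := coords_eq hφ hT'.1 hc' (fun v hv => hw.2.2 v fun h => hv (hT'.2 h)) hw.2.1
  filter_upwards [hes, hev s c' hcc' (by rwa [hcw'])] with y hy hy'
  rcases le_or_gt 0 (c' y v') with h | h
  · refine mem_of_coords hφ hT'.1 hc' fun u hu => ?_
    rcases Finset.mem_insert.1 hu with rfl | hu
    exacts [h, (hy' u hu).le]
  · refine mem_of_coords hφ hT hc fun u hu => ?_
    rcases Finset.mem_insert.1 hu with rfl | hu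
    · have l := coords_neg hφ (card_pos.1 (by omega)) hv hv' hvv (mem_fc.1 hT).1
        (mem_fc.1 hT'.1).1 (hc (b v')).1 (hc (b v')).2.1 (hc (b v')).2.2
      have := coords_replace hφ hv' hT hc (hc' y).1 (hc' y).2.1 hv hvv
      rw [(hc' y).2.2] at this
      rw [this]
      exact (mul_pos_of_neg_of_neg h l).le
    · exact (hy u hu).le

/-- Segments from a point of an open tetrahedron can be perturbed off the 1-skeleton. -/
theorem exists_segment_avoiding (a : R3) (F : Fam n) (hF : ∀ s ∈ F, s.card ≤ 2)
    (ha : a ∉ lin b '' rl F) {C : Set R3} (hC : IsOpen C) (hne : C.Nonempty) :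
    ∃ c ∈ C, Disjoint (segment ℝ a c) (lin b '' rl F) := by
  have key : ∀ s ∈ F, MeasureTheory.volume
      (AffineSubspace.mk' a (Submodule.span ℝ ((s.image fun v => b v - a : Finset R3) : Set R3)) :
        Set R3) = 0 := by
    intro s hs
    refine MeasureTheory.Measure.addHaar_affineSubspace _ _ fun h => ?_
    have h2 := congrArg AffineSubspace.direction h
    rw [AffineSubspace.direction_mk', AffineSubspace.direction_top] at h2
    have h3 := finrank_span_finset_le_card (R := ℝ) (s.image fun v => b v - a)
    rw [Set.finrank, h2, finrank_top] at h3
    have := h3.trans (Finset.card_image_le.trans (hF s hs))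
    simp at this
  have h0 : MeasureTheory.volume (⋃ s ∈ F,
      (AffineSubspace.mk' a (Submodule.span ℝ ((s.image fun v => b v - a : Finset R3) : Set R3)) :
        Set R3)) = 0 := (MeasureTheory.measure_biUnion_null_iff F.countable_toSet).2 key
  obtain ⟨c, hcC, hc⟩ : ∃ c ∈ C, c ∉ ⋃ s ∈ F,
      (AffineSubspace.mk' a (Submodule.span ℝ ((s.image fun v => b v - a : Finset R3) : Set R3)) :
        Set R3) := by
    by_contra! h
    exact (hC.measure_pos MeasureTheory.volume hne).ne' (MeasureTheory.measure_mono_null h h0)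
  refine ⟨c, hcC, Set.disjoint_left.2 ?_⟩
  rintro z hz ⟨w, hw, rfl⟩
  obtain ⟨s, hs, hws⟩ := mem_rl.1 hw
  rw [segment_eq_image'] at hz
  obtain ⟨τ, -, hτ⟩ := hz
  have hτ0 : τ ≠ 0 := by
    rintro rfl
    exact ha ⟨w, hw, by simpa using hτ.symm⟩
  refine hc (mem_biUnion hs ?_)
  rw [SetLike.mem_coe, AffineSubspace.mem_mk', vsub_eq_sub]
  have e : c - a = τ⁻¹ • (lin b w - a) := by
    rw [← hτ, add_sub_cancel_left, smul_smul, inv_mul_cancel₀ hτ0, one_smul]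
  have e2 : lin b w - a = ∑ v, w v • (b v - a) := by
    simp [smul_sub, sum_sub_distrib, ← sum_smul, hws.2.1, lin_apply]
  rw [e, e2]
  refine Submodule.smul_mem _ _ (Submodule.sum_mem _ fun v _ => ?_)
  by_cases hv : v ∈ s
  · exact Submodule.smul_mem _ _ (Submodule.subset_span (by
      simpa using ⟨v, hv, rfl⟩))
  · rw [hws.2.2 v hv, zero_smul]
    exact Submodule.zero_mem _

theorem exists_tet_point (hp : ∀ s ∈ K, ∃ T ∈ fc K 4, s ⊆ T) {w : Fin n → ℝ}
    (hw : w ∈ rl K) {O : Set R3} (hO : IsOpen O) (hwO : lin b w ∈ O) :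
    ∃ T ∈ fc K 4, ∃ y ∈ fcs T, (∀ v ∈ T, 0 < y v) ∧ lin b y ∈ O := by
  obtain ⟨s, hs, hws⟩ := mem_rl.1 hw
  obtain ⟨T, hT, hsT⟩ := hp s hs
  have hT0 : T.Nonempty := card_pos.1 (by rw [(mem_fc.1 hT).2]; norm_num)
  have hc : Continuous fun ε : ℝ => lin b (w + ε • (bary T - w)) :=
    (continuous_of_finiteDimensional (lin b)).comp (by fun_prop)
  have h : ∀ᶠ ε : ℝ in nhdsWithin 0 (Ioi 0), lin b (w + ε • (bary T - w)) ∈ O :=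
    nhdsWithin_le_nhds (hc.continuousAt.eventually (hO.mem_nhds (by simpa using hwO)))
  obtain ⟨ε, h1, h2, h3⟩ := (h.and ((eventually_mem_nhdsWithin).and
    (nhdsWithin_le_nhds (gt_mem_nhds (zero_lt_one' ℝ))))).exists
  have hwT := fcs_mono hsT hws
  refine ⟨T, hT, _, (convex_fcs' T).add_smul_sub_mem hwT (bary_mem hT0) ⟨le_of_lt h2, le_of_lt h3⟩,
    fun v hv => ?_, h1⟩
  have e : (w + ε • (bary T - w)) v = (1 - ε) * w v + ε * bary T v := by
    simp
    ring
  rw [e]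
  exact add_pos_of_nonneg_of_pos (mul_nonneg (by linarith) (hwT.1 v)) (mul_pos h2 (bary_pos hv))

theorem isOpen_diff_bT (hK : IsCx K) (hφ : CHom (lin b) (rl K) N)
    (hp : ∀ s ∈ K, ∃ T ∈ fc K 4, s ⊆ T) : IsOpen (N \ lin b '' rl (bT K)) := by
  have hlc : Continuous (lin b) := continuous_of_finiteDimensional _
  have hB := ((isCompact_rl (bT K)).image hlc).isClosed
  have hN : IsClosed N := by
    rw [← hφ.img]
    exact ((isCompact_rl K).image hlc).isClosed
  rw [isOpen_iff]
  rintro x ⟨hx, hxB⟩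
  obtain ⟨r, hr, hb⟩ := isOpen_iff.1 hB.isOpen_compl x hxB
  suffices h : ball x r ⊆ N from ⟨r, hr, fun y hy => ⟨h hy, hb hy⟩⟩
  by_contra h
  obtain ⟨y, hy, hyN⟩ := not_subset.1 h
  obtain ⟨w, hw, rfl⟩ := hφ.img.symm ▸ hx
  obtain ⟨T, hT, m, hm, hmp, hmO⟩ := exists_tet_point hp hw isOpen_ball
    (mem_ball_self hr)
  have hT4 := mem_fc.1 hT
  have hmi : lin b m ∈ interior N := lin_mem_interior hφ hT subset_rfl (by omega) hT4.1
    (fun h => by have := (mem_bT.1 h).1.2; omega) hm hmp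
  set F := K.filter fun s => s.card ≤ 2
  have hmF : lin b m ∉ lin b '' rl F := by
    rintro ⟨z, hz, e⟩
    obtain ⟨s, hs, hzs⟩ := mem_rl.1 hz
    rw [mem_filter] at hs
    have := hφ.inj (mem_rl.2 ⟨s, hs.1, hzs⟩) (mem_rl.2 ⟨T, hT4.1, hm⟩) e
    subst this
    obtain ⟨v, hv, hvs⟩ := Finset.exists_mem_notMem_of_card_lt_card (s := s) (t := T) (by omega)
    exact (hmp v hv).ne' (hzs.2.2 v hvs)
  obtain ⟨c, ⟨hcb, hcN⟩, hd⟩ := exists_segment_avoiding (lin b m) F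
    (fun s hs => (mem_filter.1 hs).2) hmF (isOpen_ball.inter hN.isOpen_compl) ⟨y, hy, hyN⟩
  suffices hS : segment ℝ (lin b m) c ⊆ interior N ∪ Nᶜ by
    obtain ⟨z, -, hz1, hz2⟩ := (convex_segment (𝕜 := ℝ) (lin b m) c).isPreconnected (interior N) Nᶜ
      isOpen_interior hN.isOpen_compl hS ⟨_, left_mem_segment _ _ _, hmi⟩
      ⟨_, right_mem_segment _ _ _, hcN⟩
    exact hz2 (interior_subset hz1)
  intro z hz
  by_cases hzN : z ∈ N
  swap
  · exact Or.inr hzN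
  refine Or.inl ?_
  have hzb : z ∈ ball (lin b w) r := (convex_ball _ _).segment_subset hmO hcb hz
  rw [← hφ.img] at hzN
  obtain ⟨u, hu, rfl⟩ := hzN
  obtain ⟨s, hs, hus⟩ := mem_rl.1 hu
  set s' := s.filter fun v => 0 < u v with hs'
  have hs'K : s' ∈ K := hK.down s hs _ (filter_subset _ _)
  have hus' : u ∈ fcs s' := ⟨hus.1, hus.2.1, fun v hv => by
    by_cases h : v ∈ s
    · rw [hs', mem_filter] at hv
      exact le_antisymm (not_lt.1 fun h' => hv ⟨h, h'⟩) (hus.1 v)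
    · exact hus.2.2 v h⟩
  obtain ⟨T', hT', hsT'⟩ := hp s' hs'K
  refine lin_mem_interior hφ hT' hsT' ?_ hs'K (fun h => hb hzb ⟨u, mem_rl.2 ⟨s', h, hus'⟩, rfl⟩) hus'
    fun v hv => (mem_filter.1 hv).2
  by_contra! h
  exact disjoint_left.1 hd hz ⟨u, mem_rl.2 ⟨s', mem_filter.2 ⟨hs'K, by omega⟩, hus'⟩, rfl⟩

theorem bT_nonempty (hK : IsCx K) (hφ : CHom (lin b) (rl K) N)
    (hp : ∀ s ∈ K, ∃ T ∈ fc K 4, s ⊆ T) (hc : IsCompact N) (hne : N.Nonempty) :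
    (bT K).Nonempty := by
  by_contra! h
  have ho := isOpen_diff_bT hK hφ hp
  simp only [h, rl, Finset.notMem_empty, iUnion_of_empty, iUnion_empty, image_empty, sdiff_empty] at ho
  have := IsClopen.eq_univ ⟨hc.isClosed, ho⟩ hne
  exact noncompact_univ R3 (this ▸ hc)

end

section

variable {n : ℕ} {K : Fam n} {b : Fin n → R3} {N : Set R3}

theorem acyc_one_of_isPreconnected (hK : IsCx K) (hφ : CHom (lin b) (rl K) N)
    (hN : IsPreconnected N) : Acyc K 1 := by
  refine acyc_one_of_conn fun g hg a c ha hc => ?_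
  by_contra hac
  have hcl : ∀ F, IsClosed (lin b '' rl F) := fun F =>
    ((isCompact_rl F).image (continuous_of_finiteDimensional (lin b))).isClosed
  have hsub : N ⊆ lin b '' rl (K.filter fun s => ∀ v ∈ s, g v = g a) ∪
      lin b '' rl (K.filter fun s => ∀ v ∈ s, g v ≠ g a) := by
    rw [← hφ.img, ← image_union]
    refine image_mono fun w hw => ?_
    obtain ⟨s, hs, hws⟩ := mem_rl.1 hw
    have hsg : ∀ u ∈ s, ∀ v ∈ s, g u = g v := fun u hu v hv => by
      rcases eq_or_ne u v with rfl | huv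
      · rfl
      · exact hg u v huv (hK.down s hs _ (Finset.insert_subset hu (Finset.singleton_subset_iff.2 hv)))
    by_cases h : ∀ v ∈ s, g v = g a
    · exact Or.inl (mem_rl.2 ⟨s, mem_filter.2 ⟨hs, h⟩, hws⟩)
    · push Not at h
      obtain ⟨u, hu, hua⟩ := h
      exact Or.inr (mem_rl.2 ⟨s, mem_filter.2 ⟨hs, fun v hv => hsg u hu v hv ▸ hua⟩, hws⟩)
  have hmem : ∀ v (F : Fam n), {v} ∈ F → lin b (Pi.single v 1) ∈ lin b '' rl F :=
    fun v F hv => ⟨_, mem_rl.2 ⟨_, hv, single_mem_fcs (mem_singleton_self v)⟩, rfl⟩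
  obtain ⟨z, -, ⟨w, hw, rfl⟩, ⟨w', hw', e⟩⟩ := isPreconnected_closed_iff.1 hN _ _ (hcl _) (hcl _) hsub
    ⟨_, hφ.mem (mem_rl.2 ⟨_, ha, single_mem_fcs (mem_singleton_self a)⟩),
      hmem a _ (by simpa using ha)⟩
    ⟨_, hφ.mem (mem_rl.2 ⟨_, hc, single_mem_fcs (mem_singleton_self c)⟩),
      hmem c _ (by simpa [Ne.symm hac] using hc)⟩
  obtain ⟨s, hs, hws⟩ := mem_rl.1 hw
  obtain ⟨t, ht, hwt⟩ := mem_rl.1 hw'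
  rw [mem_filter] at hs ht
  obtain rfl := hφ.inj (mem_rl.2 ⟨t, ht.1, hwt⟩) (mem_rl.2 ⟨s, hs.1, hws⟩) e
  have hst : w' ∈ fcs (s ∩ t) := fcs_inter ▸ ⟨hws, hwt⟩
  obtain ⟨v, hv⟩ : (s ∩ t).Nonempty := nonempty_of_mem_fcs hst
  rw [Finset.mem_inter] at hv
  exact ht.2 v hv.2 (hs.2 v hv.1)

theorem acyc_of_sAcyc_image [NeZero n] (hK : IsCx K) (hφ : CHom (lin b) (rl K) N)
    (hne : N.Nonempty) {k : ℕ} (h : SAcyc N k) : Acyc K (k + 1) := by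
  classical
  obtain ⟨ψ, hψ, hψl, -⟩ := hφ.exists_inv (isCompact_rl K)
  obtain ⟨x₀, hx₀⟩ := hne
  let s : (Fin n → ℝ) → N := fun w =>
    if hw : w ∈ rl K then ⟨lin b w, hφ.mem hw⟩ else ⟨x₀, hx₀⟩
  have hsv : ∀ w ∈ rl K, (s w : R3) = lin b w := fun w hw => congrArg Subtype.val (dif_pos hw)
  refine acyc_of_sAcyc (w := fun x : N => ψ x) (s := s) hK
    (continuousOn_iff_continuous_domRestrict.1 hψ.cont) (fun x => hψ.mem x.2) ?_
    (fun y hy => by rw [hsv y hy, hψl y hy]) h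
  rw [continuousOn_iff_continuous_domRestrict, continuous_induced_rng]
  exact (continuousOn_iff_continuous_domRestrict.1 hφ.cont).congr fun w => (hsv w w.2).symm

theorem good_of_manifold (hK : IsCx K) (hφ : CHom (lin b) (rl K) N) (hne : N.Nonempty)
    (hc : IsCompact N) (hconn : IsConnected N) (hm : IsManifold3WithBoundary N)
    (h1 : Subsingleton (H 1 N)) (h2 : Subsingleton (H 2 N)) :
    Good K ∧ IsOpen (N \ lin b '' rl (bT K)) := by
  obtain ⟨x, hx⟩ := id hne
  obtain ⟨w, hw, -⟩ := hφ.img.symm ▸ hx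
  obtain ⟨s₀, hs₀, hws₀⟩ := mem_rl.1 hw
  obtain ⟨v₀, hv₀⟩ : s₀.Nonempty := nonempty_of_mem_fcs hws₀
  have : NeZero n := ⟨fun h => by subst h; exact v₀.elim0⟩
  have hd := fun s (hs : s ∈ K) => card_le_four hφ hs
  have hl : ∀ s ∈ K, ∀ j, s.card + j ≤ 3 → Acyc (lk K s) j := by
    intro s hs j hj
    rcases s.eq_empty_or_nonempty with rfl | h0
    · rw [lk_empty]
      rw [Finset.card_empty, zero_add] at hj
      interval_cases j
      · exact acyc_zero_of_vertex hK (hK.down _ hs₀ _ (Finset.singleton_subset_iff.2 hv₀))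
      · exact acyc_one_of_isPreconnected hK hφ hconn.isPreconnected
      · exact acyc_of_sAcyc_image hK hφ hne (sAcyc_of_H h1)
      · exact acyc_of_sAcyc_image hK hφ hne (sAcyc_of_H h2)
    · exact acyc_lk_of_manifold hK hφ hm hs h0 hj
  have hp := fun s (hs : s ∈ K) => exists_tet_of_links hK hd hl hs
  obtain ⟨t, ht⟩ := bT_nonempty hK hφ hp hc hne
  rw [mem_bT, ← mem_fc] at ht
  exact ⟨⟨hK, hd, hl, fun t ht => deg_le_two hφ ht, t, ht.1, ht.2⟩, isOpen_diff_bT hK hφ hp⟩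

end

/-- A nonempty compact connected polyhedral 3-manifold with boundary in `ℝ³` with trivial
`H₁(·; ℤ/2)` and `H₂(·; ℤ/2)` is homeomorphic to the closed unit ball of `ℝ³`. -/
theorem ball_of_trivial_H1_H2 (N : Set R3) (hne : N.Nonempty) (hc : IsCompact N)
    (hconn : IsConnected N) (hpoly : IsPolyhedron N) (hm : IsManifold3WithBoundary N)
    (h1 : Subsingleton (H 1 ↥N)) (h2 : Subsingleton (H 2 ↥N)) :
    Nonempty (↥N ≃ₜ ↥(Metric.closedBall (0 : R3) 1)) := by
  obtain ⟨n, b, K, hK, hφ⟩ := hpoly.exists_triangulation hc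
  obtain ⟨hg, hW⟩ := good_of_manifold hK hφ hne hc hconn hm h1 h2
  obtain ⟨g, hg⟩ := hg.ball hφ hW
  have : CompactSpace (closedBall (0 : R3) 1) :=
    isCompact_iff_compactSpace.1 (isCompact_closedBall _ _)
  let e : closedBall (0 : R3) 1 ≃ N :=
    BijOn.equiv g ⟨hg.mapsTo, hg.inj, hg.img.ge⟩
  have he : Continuous e := Continuous.subtype_mk
    (continuousOn_iff_continuous_domRestrict.1 hg.cont) _
  exact ⟨(he.homeoOfEquivCompactToT2).symm⟩
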